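/- For every fixed strictly 2-balanced graph H, max over p ∈ [0,1] of P(G_{n,p} ∈ Q_H ∖ T_H) tends to 0 as n → ∞; equivalently, for every sequence p = p(n) ∈ [0,1], P(G_{n,p(n)} ∈ Q_H ∖ T_H) → 0 as n → ∞. -/

import Mathlib

open Finset SimpleGraph Filter Topology

noncomputable section
open scoped Classical

namespace RG

variable {α β V : Type*}

def eCount (H : SimpleGraph α) : ℕ := Nat.card ↥H.edgeSet

def autCount (H : SimpleGraph α) : ℕ := Nat.card (H ≃g H)

def IsEulerianGraph (H : SimpleGraph α) : Prop :=
  ∀ v, Even (Nat.card ↥(H.neighborSet v))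

abbrev EdgeVec (V : Type*) := Sym2 V → ZMod 2

def setVec (s : Set (Sym2 V)) : EdgeVec V := fun e => if e ∈ s then 1 else 0

def suppSet (f : EdgeVec V) : Set (Sym2 V) := {e | f e ≠ 0}

def wt (f : EdgeVec V) : ℕ := Nat.card ↥(suppSet f)

def edgeSpace (G : SimpleGraph V) : Submodule (ZMod 2) (EdgeVec V) :=
  Submodule.span (ZMod 2) {f | ∃ e ∈ G.edgeSet, f = setVec {e}}

def parityMap [Fintype V] [DecidableEq V] (v : V) : EdgeVec V →ₗ[ZMod 2] ZMod 2 where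
  toFun f := ∑ w ∈ Finset.univ.erase v, f s(v, w)
  map_add' f g := by simp [Finset.sum_add_distrib]
  map_smul' c f := by simp [Finset.mul_sum, mul_sub]

def cycleSpace [Fintype V] [DecidableEq V] (G : SimpleGraph V) :
    Submodule (ZMod 2) (EdgeVec V) :=
  edgeSpace G ⊓ ⨅ v : V, LinearMap.ker (parityMap v)

def totalMap [Fintype V] [DecidableEq V] : EdgeVec V →ₗ[ZMod 2] ZMod 2 where
  toFun f := ∑ e, f e
  map_add' f g := by simp [Finset.sum_add_distrib]
  map_smul' c f := by simp [Finset.mul_sum, mul_sub]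

def dSpace [Fintype V] [DecidableEq V] (G : SimpleGraph V) :
    Submodule (ZMod 2) (EdgeVec V) :=
  edgeSpace G ⊓ LinearMap.ker (totalMap (V := V))

def hSpace (H : SimpleGraph α) (G : SimpleGraph V) : Submodule (ZMod 2) (EdgeVec V) :=
  Submodule.span (ZMod 2)
    {f | ∃ K : G.Subgraph, Nonempty (H ≃g K.coe) ∧ f = setVec K.edgeSet}

def wSpace [Fintype V] [DecidableEq V] (H : SimpleGraph α) (G : SimpleGraph V) :
    Submodule (ZMod 2) (EdgeVec V) :=
  if IsEulerianGraph H then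
    if Odd (eCount H) then cycleSpace G else cycleSpace G ⊓ dSpace G
  else
    if Odd (eCount H) then edgeSpace G else dSpace G

def memT [Fintype V] [DecidableEq V] (H : SimpleGraph α) (G : SimpleGraph V) : Prop :=
  hSpace H G = wSpace H G

def memQ (H : SimpleGraph α) (G : SimpleGraph V) : Prop :=
  ∀ e ∈ G.edgeSet, ∃ K : G.Subgraph, Nonempty (H ≃g K.coe) ∧ e ∈ K.edgeSet

def ip [Fintype V] [DecidableEq V] (f g : EdgeVec V) : ZMod 2 := ∑ e, f e * g e

def perpIn [Fintype V] [DecidableEq V] (G : SimpleGraph V)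
    (S : Submodule (ZMod 2) (EdgeVec V)) : Set (EdgeVec V) :=
  {f | f ∈ edgeSpace G ∧ ∀ g ∈ S, ip f g = 0}

def erProb (n : ℕ) (p : ℝ) (A : Set (SimpleGraph (Fin n))) : ℝ :=
  ∑ s ∈ (⊤ : SimpleGraph (Fin n)).edgeFinset.powerset,
    if SimpleGraph.fromEdgeSet (↑s) ∈ A then
      p ^ s.card * (1 - p) ^ ((⊤ : SimpleGraph (Fin n)).edgeFinset.card - s.card)
    else 0

def density2 (v e : ℕ) : ℝ := if 3 ≤ v then ((e : ℝ) - 1) / ((v : ℝ) - 2) else 0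

def d2 (H : SimpleGraph α) : ℝ := density2 (Nat.card α) (eCount H)

def subDensity2 {H : SimpleGraph α} (K : H.Subgraph) : ℝ :=
  density2 (Nat.card ↥K.verts) (Nat.card ↥K.edgeSet)

def m2 (H : SimpleGraph α) : ℝ := sSup {x : ℝ | ∃ K : H.Subgraph, x = subDensity2 K}

def Strictly2Balanced (H : SimpleGraph α) : Prop :=
  3 ≤ Nat.card α ∧ ∀ K : H.Subgraph, K ≠ ⊤ → subDensity2 K < d2 H

def rho (H : SimpleGraph α) : ℝ := 2 * (eCount H : ℝ) / (autCount H : ℝ)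

def pStar (H : SimpleGraph α) (n : ℕ) : ℝ :=
  (n : ℝ) ^ (-(1 / m2 H)) *
    ((2 - 1 / m2 H) * (rho H)⁻¹ * Real.log n) ^ (1 / ((eCount H : ℝ) - 1))

def Lambda (H : SimpleGraph α) (n : ℕ) (p : ℝ) : ℝ :=
  rho H * ((n - 2).descFactorial (Nat.card α - 2) : ℝ) * p ^ (eCount H - 1)

def NotPathOrTriangle (H : SimpleGraph α) : Prop :=
  ¬ Nonempty (H ≃g SimpleGraph.pathGraph 3) ∧ ¬ Nonempty (H ≃g (⊤ : SimpleGraph (Fin 3)))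

/-! ### Bridges -/

def bridgeHost (G : SimpleGraph V) (x y : V) : SimpleGraph V :=
  G ⊔ SimpleGraph.fromEdgeSet {s(x, y)}

def IsBridgeCopy (H : SimpleGraph α) (G : SimpleGraph V) (x y : V)
    (K : (bridgeHost G x y).Subgraph) : Prop :=
  Nonempty (H ≃g K.coe) ∧ s(x, y) ∈ K.edgeSet

def tauB (H : SimpleGraph α) (G : SimpleGraph V) (x y : V) : ℕ :=
  Nat.card {K : (bridgeHost G x y).Subgraph // IsBridgeCopy H G x y K}

def sigmaB (H : SimpleGraph α) (G : SimpleGraph V) (x y : V) : ℕ :=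
  sSup {m | ∃ T : Finset ((bridgeHost G x y).Subgraph),
    (∀ K ∈ T, IsBridgeCopy H G x y K) ∧
    (∀ K ∈ T, ∀ K' ∈ T, K ≠ K' → (K.verts ∩ K'.verts : Set V) ⊆ {x, y}) ∧ T.card = m}

def IsCentralBridge (H : SimpleGraph α) (G : SimpleGraph V) (S : Set (Sym2 V)) (x y : V)
    (K : (bridgeHost G x y).Subgraph) : Prop :=
  IsBridgeCopy H G x y K ∧
  Odd (Nat.card {e : Sym2 V // e ∈ K.edgeSet ∧ e ≠ s(x, y) ∧ e ∈ S}) ∧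
  ∃ e ∈ K.edgeSet, e ∈ S ∧ x ∉ e ∧ y ∉ e

def sigmaCentral (H : SimpleGraph α) (G : SimpleGraph V) (S : Set (Sym2 V)) (x y : V) : ℕ :=
  sSup {m | ∃ T : Finset ((bridgeHost G x y).Subgraph),
    (∀ K ∈ T, IsCentralBridge H G S x y K) ∧
    (∀ K ∈ T, ∀ K' ∈ T, K ≠ K' → (K.verts ∩ K'.verts : Set V) ⊆ {x, y}) ∧ T.card = m}

/-! ### Extensions `[W,Z]` -/

def PairAdj (F : SimpleGraph β) (W Z : Set β) (a b : ↥Z) : Prop :=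
  F.Adj (a : β) (b : β) ∧ ¬((a : β) ∈ W ∧ (b : β) ∈ W)

def vWZ (W Z : Set β) : ℕ := Nat.card ↥(Z \ W)

def eWZ (F : SimpleGraph β) (W Z : Set β) : ℕ :=
  Nat.card {q : Sym2 β // q ∈ F.edgeSet ∧ (∀ a ∈ q, a ∈ Z) ∧ ¬(∀ a ∈ q, a ∈ W)}

def dWZ (F : SimpleGraph β) (W Z : Set β) : ℝ := (eWZ F W Z : ℝ) / (vWZ W Z : ℝ)

def StrictlyBalancedWZ (F : SimpleGraph β) (W Z : Set β) : Prop :=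
  ∀ Y : Set β, W ⊂ Y → Y ⊂ Z → dWZ F W Y < dWZ F W Z

def mWZ (F : SimpleGraph β) (W Z : Set β) : ℝ :=
  sSup {x : ℝ | ∃ Y : Set β, W ⊂ Y ∧ Y ⊆ Z ∧ x = dWZ F W Y}

def autWZ (F : SimpleGraph β) (W Z : Set β) : ℕ :=
  Nat.card {γ : ↥Z ≃ ↥Z // (∀ w : ↥Z, (w : β) ∈ W → γ w = w) ∧
    ∀ a b : ↥Z, PairAdj F W Z a b ↔ PairAdj F W Z (γ a) (γ b)}

def muWZ (F : SimpleGraph β) (W Z : Set β) (n : ℕ) (p : ℝ) : ℝ :=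
  (n : ℝ) ^ (vWZ W Z) * p ^ (eWZ F W Z) / (autWZ F W Z : ℝ)

def IsExt (F : SimpleGraph β) (W Z : Set β) (G : SimpleGraph V) (x : ↥W → V)
    (ψ : ↥Z → V) : Prop :=
  Function.Injective ψ ∧
  (∀ (w : ↥Z) (hw : (w : β) ∈ W), ψ w = x ⟨(w : β), hw⟩) ∧
  ∀ a b : ↥Z, PairAdj F W Z a b → G.Adj (ψ a) (ψ b)

def extData (F : SimpleGraph β) (W Z : Set β) (ψ : ↥Z → V) : Set V × Set (Sym2 V) :=
  (ψ '' {z : ↥Z | (z : β) ∉ W},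
   {q | ∃ a b : ↥Z, PairAdj F W Z a b ∧ q = s(ψ a, ψ b)})

def copySet (F : SimpleGraph β) (W Z : Set β) (G : SimpleGraph V) (x : ↥W → V) :
    Set (Set V × Set (Sym2 V)) :=
  {d | ∃ ψ : ↥Z → V, IsExt F W Z G x ψ ∧ extData F W Z ψ = d}

def tauExt (F : SimpleGraph β) (W Z : Set β) (G : SimpleGraph V) (x : ↥W → V) : ℕ :=
  Nat.card ↥(copySet F W Z G x)

def sigmaExt (F : SimpleGraph β) (W Z : Set β) (G : SimpleGraph V) (x : ↥W → V) : ℕ :=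
  sSup {m | ∃ T : Finset (Set V × Set (Sym2 V)),
    (↑T : Set (Set V × Set (Sym2 V))) ⊆ copySet F W Z G x ∧
    (∀ d ∈ T, ∀ d' ∈ T, d ≠ d' → d.1 ∩ d'.1 = ∅) ∧ T.card = m}

def phiFn (x : ℝ) : ℝ := if x = -1 then 1 else (1 + x) * Real.log (1 + x) - x

set_option linter.unusedSectionVars false
open Real (add_one_le_exp exp exp_add exp_le_exp exp_log exp_nat_mul exp_neg exp_one_lt_d9 exp_pos exp_sub log log_nonneg log_pos log_pow rpow_add rpow_mul rpow_natCast rpow_neg rpow_one rpow_two tendsto_log_atTop)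

notation "ES(" n ")" => Finset (Sym2 (Fin n))
notation "E2(" n ")" => Sym2 (Fin n)
notation "ν(" a ")" => Fintype.card a

/-! ### Probability layer: a random subset of a finite set -/

/-- Expectation over a `p`-random subset of `E`. -/
def ex {ι : Type*} (E : Finset ι) (p : ℝ) (f : Finset ι → ℝ) : ℝ :=
  ∑ s ∈ E.powerset, p ^ s.card * (1 - p) ^ (E.card - s.card) * f s

/-- Indicator of a proposition. -/
def ind (P : Prop) : ℝ := if P then 1 else 0

/-- Probability of an event for a `p`-random subset of `E`. -/
def pr {ι : Type*} (E : Finset ι) (p : ℝ) (P : Finset ι → Prop) : ℝ :=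
  ex E p (fun s => ind (P s))

lemma ind_true {P : Prop} (h : P) : ind P = 1 := if_pos h
lemma ind_false {P : Prop} (h : ¬ P) : ind P = 0 := if_neg h
lemma ind_nonneg (P : Prop) : 0 ≤ ind P := by unfold ind; split_ifs <;> norm_num
lemma ind_le_one (P : Prop) : ind P ≤ 1 := by unfold ind; split_ifs <;> norm_num
lemma ind_mono {P Q : Prop} (h : P → Q) : ind P ≤ ind Q := by
  by_cases hP : P
  · rw [ind_true hP, ind_true (h hP)]
  · rw [ind_false hP]; exact ind_nonneg _
lemma ind_and (P Q : Prop) : ind (P ∧ Q) = ind P * ind Q := by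
  by_cases hP : P <;> by_cases hQ : Q <;> simp [ind, hP, hQ]
lemma ind_or_le (P Q : Prop) : ind (P ∨ Q) ≤ ind P + ind Q := by
  by_cases hP : P <;> by_cases hQ : Q <;> simp [ind, hP, hQ]
lemma ind_congr {P Q : Prop} (h : P ↔ Q) : ind P = ind Q := by rw [propext h]

section
variable {ι : Type*} {E : Finset ι} {p : ℝ}

lemma ex_congr {f g : Finset ι → ℝ} (h : ∀ s ⊆ E, f s = g s) : ex E p f = ex E p g :=
  sum_congr rfl fun s hs => by rw [h s (mem_powerset.1 hs)]

lemma ex_mono (hp : 0 ≤ p) (hp1 : p ≤ 1) {f g : Finset ι → ℝ} (h : ∀ s ⊆ E, f s ≤ g s) :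
    ex E p f ≤ ex E p g :=
  sum_le_sum fun s hs => mul_le_mul_of_nonneg_left (h s (mem_powerset.1 hs))
    (mul_nonneg (pow_nonneg hp _) (pow_nonneg (by linarith) _))

lemma ex_add (f g : Finset ι → ℝ) : ex E p (fun s => f s + g s) = ex E p f + ex E p g := by
  simp only [ex, mul_add, sum_add_distrib]

lemma ex_sub (f g : Finset ι → ℝ) : ex E p (fun s => f s - g s) = ex E p f - ex E p g := by
  simp only [ex, mul_sub, sum_sub_distrib]

lemma ex_mul_left (c : ℝ) (f : Finset ι → ℝ) : ex E p (fun s => c * f s) = c * ex E p f := by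
  simp only [ex, mul_sum]
  exact sum_congr rfl fun s _ => by ring

lemma ex_mul_right (c : ℝ) (f : Finset ι → ℝ) : ex E p (fun s => f s * c) = ex E p f * c := by
  simp only [mul_comm _ c, ex_mul_left]

lemma ex_sum {κ : Type*} (I : Finset κ) (f : κ → Finset ι → ℝ) :
    ex E p (fun s => ∑ i ∈ I, f i s) = ∑ i ∈ I, ex E p (f i) := by
  simp only [ex, mul_sum]
  exact sum_comm

lemma ex_empty (f : Finset ι → ℝ) : ex ∅ p f = f ∅ := by simp [ex]

lemma ex_insert [DecidableEq ι] {a : ι} (ha : a ∉ E) (f : Finset ι → ℝ) :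
    ex (insert a E) p f = p * ex E p (fun s => f (insert a s)) + (1 - p) * ex E p f := by
  unfold ex
  rw [sum_powerset_insert ha, add_comm]
  congr 1
  · rw [mul_sum]
    refine sum_congr rfl fun s hs => ?_
    have hs' := mem_powerset.1 hs
    have : a ∉ s := fun h => ha (hs' h)
    rw [card_insert_of_notMem this, card_insert_of_notMem ha,
      Nat.add_sub_add_right]
    ring
  · rw [mul_sum]
    refine sum_congr rfl fun s hs => ?_
    have hs' := card_le_card (mem_powerset.1 hs)
    rw [card_insert_of_notMem ha, Nat.succ_sub hs', pow_succ]
    ring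

lemma ex_const (c : ℝ) : ex E p (fun _ => c) = c := by
  classical
  induction E using Finset.induction_on with
  | empty => simp [ex_empty]
  | insert a E ha ih => rw [ex_insert ha, ih]; ring

lemma ex_nonneg (hp : 0 ≤ p) (hp1 : p ≤ 1) {f : Finset ι → ℝ} (h : ∀ s ⊆ E, 0 ≤ f s) :
    0 ≤ ex E p f := by
  have := ex_mono (E := E) hp hp1 (f := fun _ => 0) (g := f) h
  rwa [ex_const] at this

lemma ex_union [DecidableEq ι] {A B : Finset ι} (h : Disjoint A B) (f : Finset ι → ℝ) :
    ex (A ∪ B) p f = ex A p (fun s => ex B p (fun t => f (s ∪ t))) := by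
  induction A using Finset.induction_on generalizing f with
  | empty => simp [ex_empty]
  | insert a A ha ih =>
    rw [disjoint_insert_left] at h
    rw [insert_union, ex_insert (by simp [ha, h.1]), ex_insert ha, ih h.2, ih h.2]
    simp only [insert_union]

lemma ex_comm {κ : Type*} {E' : Finset κ} {q : ℝ} (f : Finset ι → Finset κ → ℝ) :
    ex E p (fun s => ex E' q (fun t => f s t)) = ex E' q (fun t => ex E p (fun s => f s t)) := by
  simp only [ex, mul_sum]
  rw [sum_comm]
  exact sum_congr rfl fun _ _ => sum_congr rfl fun _ _ => by ring

/-- The expectation of a function that vanishes unless `A ⊆ s`. -/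
lemma ex_subset [DecidableEq ι] {A : Finset ι} (h : A ⊆ E) (f : Finset ι → ℝ) :
    ex E p (fun s => ind (A ⊆ s) * f s) = p ^ A.card * ex (E \ A) p (fun t => f (A ∪ t)) := by
  rw [← union_sdiff_of_subset h, ex_union disjoint_sdiff,
    union_sdiff_of_subset h]
  unfold ex
  rw [sum_eq_single_of_mem A (mem_powerset_self A)]
  · simp [ind]
  · intro s hs hne
    have hs' := mem_powerset.1 hs
    refine mul_eq_zero_of_right _ (sum_eq_zero fun t ht => ?_)
    have ht' := mem_powerset.1 ht
    beta_reduce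
    rw [ind_false, zero_mul, mul_zero]
    intro hA
    apply hne
    refine Finset.Subset.antisymm hs' fun x hx => ?_
    rcases mem_union.1 (hA hx) with h1 | h1
    · exact h1
    · exact absurd hx (Finset.mem_sdiff.1 (ht' h1)).2

lemma pr_subset [DecidableEq ι] {A : Finset ι} (h : A ⊆ E) :
    pr E p (fun s => A ⊆ s) = p ^ A.card := by
  have := ex_subset (p := p) h (fun _ => 1)
  rw [ex_const] at this
  simpa [pr] using this

/-- A function not depending on the coordinates in `A`. -/
lemma ex_sdiff [DecidableEq ι] {A : Finset ι} (h : A ⊆ E) (f : Finset ι → ℝ) :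
    ex E p (fun s => f (s \ A)) = ex (E \ A) p f := by
  rw [← union_sdiff_of_subset h, ex_union disjoint_sdiff,
    union_sdiff_of_subset h]
  rw [show (fun s => ex (E \ A) p (fun t => f ((s ∪ t) \ A)))
    = fun s => ex (E \ A) p (fun t => f ((s ∪ t) \ A)) from rfl]
  rw [ex_congr (g := fun _ => ex (E \ A) p f), ex_const]
  intro s hs
  refine ex_congr fun t ht => ?_
  congr 1
  ext x
  simp only [Finset.mem_sdiff, mem_union]
  constructor
  · rintro ⟨h1 | h1, h2⟩
    · exact absurd (hs h1) h2
    · exact h1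
  · intro h1
    exact ⟨Or.inr h1, (Finset.mem_sdiff.1 (ht h1)).2⟩

lemma ex_indep [DecidableEq ι] {A : Finset ι} (h : A ⊆ E) (f : Finset ι → ℝ)
    (hf : ∀ s, f s = f (s \ A)) :
    ex E p (fun s => ind (A ⊆ s) * f s) = p ^ A.card * ex E p f := by
  rw [ex_subset h]
  congr 1
  rw [ex_congr (E := E) (f := f) (g := fun s => f (s \ A)) fun s _ => hf s, ex_sdiff h]
  refine ex_congr fun t ht => ?_
  rw [hf]
  congr 1
  ext x
  simp only [Finset.mem_sdiff, mem_union]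
  constructor
  · rintro ⟨h1 | h1, h2⟩
    · exact absurd h1 h2
    · exact h1
  · intro h1
    exact ⟨Or.inr h1, (Finset.mem_sdiff.1 (ht h1)).2⟩

lemma harris (hp : 0 ≤ p) (hp1 : p ≤ 1) {f g : Finset ι → ℝ}
    (hf : ∀ s t, s ⊆ t → f s ≤ f t) (hg : ∀ s t, s ⊆ t → g t ≤ g s) :
    ex E p (fun s => f s * g s) ≤ ex E p f * ex E p g := by
  classical
  induction E using Finset.induction_on generalizing f g with
  | empty => simp [ex_empty]
  | insert a E ha ih =>
    rw [ex_insert ha, ex_insert ha, ex_insert ha]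
    have h1 := ih (f := fun s => f (insert a s)) (g := fun s => g (insert a s))
      (fun s t h => hf _ _ (insert_subset_insert a h))
      (fun s t h => hg _ _ (insert_subset_insert a h))
    have h0 := ih hf hg
    have hF : ex E p f ≤ ex E p (fun s => f (insert a s)) :=
      ex_mono hp hp1 fun s _ => hf _ _ (subset_insert a s)
    have hG : ex E p (fun s => g (insert a s)) ≤ ex E p g :=
      ex_mono hp hp1 fun s _ => hg _ _ (subset_insert a s)
    have h2 := mul_le_mul_of_nonneg_left h1 hp
    have h3 := mul_le_mul_of_nonneg_left h0 (sub_nonneg.2 hp1)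
    have h4 : 0 ≤ p * (1 - p) * ((ex E p (fun s => f (insert a s)) - ex E p f) *
        (ex E p g - ex E p (fun s => g (insert a s)))) :=
      mul_nonneg (mul_nonneg hp (by linarith)) (mul_nonneg (by linarith) (by linarith))
    nlinarith [h2, h3, h4]

lemma harris_dec (hp : 0 ≤ p) (hp1 : p ≤ 1) {f g : Finset ι → ℝ}
    (hf : ∀ s t, s ⊆ t → f t ≤ f s) (hg : ∀ s t, s ⊆ t → g t ≤ g s) :
    ex E p f * ex E p g ≤ ex E p (fun s => f s * g s) := by
  have := harris (E := E) hp hp1 (f := fun s => -1 * f s) (g := g)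
    (fun s t h => by simpa using hf s t h) hg
  rw [ex_mul_left] at this
  have h2 : ex E p (fun s => -1 * f s * g s) = -1 * ex E p (fun s => f s * g s) := by
    rw [← ex_mul_left]; exact ex_congr fun s _ => by ring
  rw [h2] at this
  linarith

lemma thinning (q : ℝ) (f : Finset ι → ℝ) :
    ex E p (fun s => ex s q f) = ex E (p * q) f := by
  classical
  induction E using Finset.induction_on generalizing f with
  | empty => simp [ex_empty]
  | insert a E ha ih =>
    rw [ex_insert ha, ex_insert ha, ← ih, ← ih]
    rw [ex_congr (g := fun s => q * ex s q (fun s => f (insert a s)) + (1 - q) * ex s q f)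
      (fun s hs => ex_insert (fun h => ha (hs h)) f)]
    rw [ex_add, ex_mul_left, ex_mul_left]
    ring

/-! basic facts about `pr` -/

lemma pr_nonneg (hp : 0 ≤ p) (hp1 : p ≤ 1) (P : Finset ι → Prop) : 0 ≤ pr E p P :=
  ex_nonneg hp hp1 fun _ _ => ind_nonneg _

lemma pr_le_one (hp : 0 ≤ p) (hp1 : p ≤ 1) (P : Finset ι → Prop) : pr E p P ≤ 1 := by
  have := ex_mono (E := E) hp hp1 (f := fun s => ind (P s)) (g := fun _ => 1)
    fun s _ => ind_le_one _
  rwa [ex_const] at this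

lemma pr_mono (hp : 0 ≤ p) (hp1 : p ≤ 1) {P Q : Finset ι → Prop} (h : ∀ s ⊆ E, P s → Q s) :
    pr E p P ≤ pr E p Q :=
  ex_mono hp hp1 fun s hs => ind_mono (h s hs)

lemma pr_or (hp : 0 ≤ p) (hp1 : p ≤ 1) (P Q : Finset ι → Prop) :
    pr E p (fun s => P s ∨ Q s) ≤ pr E p P + pr E p Q := by
  unfold pr
  rw [← ex_add]
  exact ex_mono hp hp1 fun s _ => ind_or_le _ _

lemma pr_exists {κ : Type*} (hp : 0 ≤ p) (hp1 : p ≤ 1) (I : Finset κ)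
    (P : κ → Finset ι → Prop) :
    pr E p (fun s => ∃ i ∈ I, P i s) ≤ ∑ i ∈ I, pr E p (P i) := by
  unfold pr
  rw [← ex_sum]
  refine ex_mono hp hp1 fun s _ => ?_
  by_cases h : ∃ i ∈ I, P i s
  · obtain ⟨i, hi, hP⟩ := h
    rw [ind_true ⟨i, hi, hP⟩, ← ind_true hP]
    exact single_le_sum (f := fun i => ind (P i s)) (fun j _ => ind_nonneg _) hi
  · rw [ind_false h]
    exact sum_nonneg fun j _ => ind_nonneg _

lemma markov (hp : 0 ≤ p) (hp1 : p ≤ 1) {f : Finset ι → ℝ} (hf : ∀ s ⊆ E, 0 ≤ f s)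
    {t : ℝ} (ht : 0 < t) (P : Finset ι → Prop) (hP : ∀ s ⊆ E, P s → t ≤ f s) :
    pr E p P ≤ ex E p f / t := by
  rw [le_div_iff₀ ht, mul_comm]
  unfold pr
  rw [← ex_mul_left]
  refine ex_mono hp hp1 fun s hs => ?_
  by_cases h : P s
  · rw [ind_true h, mul_one]; exact hP s hs h
  · rw [ind_false h, mul_zero]; exact hf s hs

/-- Exponential moment of the size of a random set. -/
lemma ex_pow_card (c : ℝ) : ex E p (fun s => c ^ s.card) = (1 + p * (c - 1)) ^ E.card := by
  classical
  induction E using Finset.induction_on with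
  | empty => simp [ex_empty]
  | insert a E ha ih =>
    rw [ex_insert ha, ih, card_insert_of_notMem ha, pow_succ]
    rw [ex_congr (g := fun s => c * c ^ s.card) fun s hs => by
      rw [card_insert_of_notMem (fun h => ha (hs h)), pow_succ, mul_comm]]
    rw [ex_mul_left, ih]
    ring

/-- Restriction of the random set to a subset of the ground set. -/
lemma ex_inter [DecidableEq ι] {A : Finset ι} (h : A ⊆ E) (f : Finset ι → ℝ) :
    ex E p (fun s => f (s ∩ A)) = ex A p f := by
  have := ex_sdiff (p := p) (E := E) (A := E \ A) sdiff_subset f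
  rw [Finset.sdiff_sdiff_eq_self h] at this
  rw [← this]
  refine ex_congr fun s hs => ?_
  congr 1
  ext x
  simp only [mem_inter, Finset.mem_sdiff, not_and, not_not]
  exact ⟨fun h => ⟨h.1, fun _ => h.2⟩, fun h => ⟨h.1, h.2 (hs h.1)⟩⟩

end

/-! ### Janson's inequality and the disjoint tuples bound -/

section
variable {ι κ : Type*} [DecidableEq ι] [DecidableEq κ] {E : Finset ι} {p : ℝ}

lemma prod_one_sub_ge {J : Finset κ} {x : κ → ℝ} (h0 : ∀ i ∈ J, 0 ≤ x i)
    (h1 : ∀ i ∈ J, x i ≤ 1) : 1 - ∑ i ∈ J, x i ≤ ∏ i ∈ J, (1 - x i) := by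
  induction J using Finset.induction_on with
  | empty => simp
  | insert a J ha ih =>
    rw [sum_insert ha, prod_insert ha]
    have h0' : ∀ i ∈ J, 0 ≤ x i := fun i hi => h0 i (mem_insert_of_mem hi)
    have h1' : ∀ i ∈ J, x i ≤ 1 := fun i hi => h1 i (mem_insert_of_mem hi)
    have := ih h0' h1'
    have ha0 := h0 a (mem_insert_self a J)
    have ha1 := h1 a (mem_insert_self a J)
    have hs : 0 ≤ ∑ i ∈ J, x i := sum_nonneg h0'
    nlinarith [mul_le_mul_of_nonneg_left this (sub_nonneg.2 ha1), mul_nonneg ha0 hs]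

/-- The correction term in Janson's inequality. -/
def jDelta {ι κ : Type*} [DecidableEq ι] [DecidableEq κ]
    (p : ℝ) (I : Finset κ) (A : κ → Finset ι) : ℝ :=
  ∑ i ∈ I, ∑ j ∈ I with j ≠ i ∧ ¬ Disjoint (A i) (A j), p ^ (A i ∪ A j).card

lemma janson (hp : 0 ≤ p) (hp1 : p ≤ 1) (I : Finset κ) (A : κ → Finset ι)
    (hA : ∀ i ∈ I, A i ⊆ E) {q : ℝ} (hq : 0 ≤ q) (hq1 : q ≤ 1) :
    ex E p (fun s => ∏ i ∈ I, (1 - q * ind (A i ⊆ s))) ≤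
      exp (-(q * ∑ i ∈ I, p ^ (A i).card) + q ^ 2 * jDelta p I A) := by
  induction I using Finset.induction_on with
  | empty => simp [ex_const, jDelta]
  | insert i I hi ih =>
    have hA' : ∀ i ∈ I, A i ⊆ E := fun j hj => hA j (mem_insert_of_mem hj)
    have hAi : A i ⊆ E := hA i (mem_insert_self i I)
    have ih := ih hA'
    set N := I.filter fun j => ¬ Disjoint (A i) (A j) with hN
    set M := I.filter fun j => Disjoint (A i) (A j) with hM
    set g : Finset ι → ℝ := fun s => ∏ j ∈ I, (1 - q * ind (A j ⊆ s)) with hg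
    set g' : Finset ι → ℝ := fun s => ∏ j ∈ M, (1 - q * ind (A j ⊆ s)) with hg'
    have fac0 : ∀ j s, 0 ≤ 1 - q * ind (A j ⊆ s) := fun j s => by
      have := ind_le_one (A j ⊆ s); have := ind_nonneg (A j ⊆ s); nlinarith
    have fac1 : ∀ j s, 1 - q * ind (A j ⊆ s) ≤ 1 := fun j s => by
      have := ind_nonneg (A j ⊆ s); nlinarith
    have gsplit : ∀ s, g s = g' s * ∏ j ∈ N, (1 - q * ind (A j ⊆ s)) := fun s =>
      (prod_filter_mul_prod_filter_not I _ _).symm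
    have g'0 : ∀ s, 0 ≤ g' s := fun s => prod_nonneg fun j _ => fac0 j s
    have g0 : ∀ s, 0 ≤ g s := fun s => prod_nonneg fun j _ => fac0 j s
    have gle : ∀ s, g s ≤ g' s := fun s => by
      rw [gsplit]
      exact mul_le_of_le_one_right (g'0 s) (prod_le_one (fun j _ => fac0 j s)
        fun j _ => fac1 j s)
    have g'anti : ∀ s t, s ⊆ t → g' t ≤ g' s := fun s t h =>
      Finset.prod_le_prod (fun j _ => fac0 j t) fun j _ => by
        have := ind_mono (fun h' : A j ⊆ s => h'.trans h)
        nlinarith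
    set D := ∑ j ∈ N, p ^ (A i ∪ A j).card with hD
    -- lower bound for the correlation
    have key : (p ^ (A i).card - q * D) * ex E p g' ≤ ex E p (fun s => ind (A i ⊆ s) * g s) := by
      have h1 : ex E p (fun s => ind (A i ⊆ s) * g' s) = p ^ (A i).card * ex E p g' := by
        apply ex_indep hAi
        intro s
        refine prod_congr rfl fun j hj => ?_
        congr 2
        apply ind_congr
        have hd := (mem_filter.1 hj).2
        exact ⟨fun h x hx => Finset.mem_sdiff.2 ⟨h hx, fun h' =>
          (Finset.disjoint_left.1 hd h' hx)⟩, fun h => h.trans sdiff_subset⟩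
      have h2 : ∀ j ∈ N, ex E p (fun s => ind (A i ∪ A j ⊆ s) * g' s)
          ≤ p ^ (A i ∪ A j).card * ex E p g' := by
        intro j hj
        have hj' : j ∈ I := (mem_filter.1 hj).1
        have := harris (E := E) hp hp1 (f := fun s => ind (A i ∪ A j ⊆ s)) (g := g')
          (fun s t h => ind_mono fun h' => h'.trans h) g'anti
        refine this.trans_eq ?_
        congr 1
        exact pr_subset (union_subset hAi (hA' j hj'))
      have h3 : ex E p (fun s => ind (A i ⊆ s) * g' s
          - q * ∑ j ∈ N, ind (A i ∪ A j ⊆ s) * g' s) ≤ ex E p (fun s => ind (A i ⊆ s) * g s) := by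
        refine ex_mono hp hp1 fun s _ => ?_
        rw [gsplit s]
        have h4 := prod_one_sub_ge (J := N) (x := fun j => q * ind (A j ⊆ s))
          (fun j _ => mul_nonneg hq (ind_nonneg _))
          (fun j _ => by have := fac0 j s; linarith)
        have h5 : ∑ j ∈ N, ind (A i ∪ A j ⊆ s) * g' s
            = ind (A i ⊆ s) * g' s * ∑ j ∈ N, ind (A j ⊆ s) := by
          rw [mul_sum]
          refine sum_congr rfl fun j _ => ?_
          rw [ind_congr union_subset_iff, ind_and]; ring
        rw [h5]
        rw [← mul_sum] at h4
        have h6 := mul_le_mul_of_nonneg_left h4 (mul_nonneg (ind_nonneg (A i ⊆ s)) (g'0 s))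
        linarith
      rw [ex_sub, ex_mul_left, ex_sum, h1] at h3
      have h7 := mul_le_mul_of_nonneg_left (sum_le_sum h2) hq
      rw [← sum_mul] at h7
      rw [hD, sub_mul]
      linarith
    have Eg0 : 0 ≤ ex E p g := ex_nonneg hp hp1 fun s _ => g0 s
    have Egg' : ex E p g ≤ ex E p g' := ex_mono hp hp1 fun s _ => gle s
    have step : ex E p (fun s => ∏ j ∈ insert i I, (1 - q * ind (A j ⊆ s)))
        = ex E p g - q * ex E p (fun s => ind (A i ⊆ s) * g s) := by
      rw [← ex_mul_left, ← ex_sub]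
      refine ex_congr fun s _ => ?_
      rw [prod_insert hi, hg]
      ring
    have hbd : ex E p (fun s => ∏ j ∈ insert i I, (1 - q * ind (A j ⊆ s)))
        ≤ exp (-(q * p ^ (A i).card) + q ^ 2 * D) * ex E p g := by
      rw [step]
      have hexp := add_one_le_exp (-(q * p ^ (A i).card) + q ^ 2 * D)
      by_cases hc : 0 ≤ p ^ (A i).card - q * D
      · have h8 := (mul_le_mul_of_nonneg_left Egg' hc).trans key
        have h9 := mul_le_mul_of_nonneg_left h8 hq
        have h10 := mul_le_mul_of_nonneg_right hexp Eg0
        nlinarith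
      · have h8 : 0 ≤ ex E p (fun s => ind (A i ⊆ s) * g s) :=
          ex_nonneg hp hp1 fun s _ => mul_nonneg (ind_nonneg _) (g0 s)
        have h9 : 0 ≤ -(q * p ^ (A i).card) + q ^ 2 * D := by
          push Not at hc
          nlinarith
        have h10 : (1:ℝ) ≤ exp (-(q * p ^ (A i).card) + q ^ 2 * D) :=
          Real.one_le_exp h9
        nlinarith [mul_le_mul_of_nonneg_right h10 Eg0, mul_nonneg hq h8]
    refine hbd.trans ((mul_le_mul_of_nonneg_left ih (exp_pos _).le).trans ?_)
    rw [← exp_add, exp_le_exp, sum_insert hi]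
    have hJ : D + jDelta p I A ≤ jDelta p (insert i I) A := by
      unfold jDelta
      rw [sum_insert hi]
      refine add_le_add ?_ (sum_le_sum fun j hj => ?_)
      · refine sum_le_sum_of_subset_of_nonneg ?_ fun _ _ _ => pow_nonneg hp _
        intro j hj
        have hj' := mem_filter.1 hj
        refine mem_filter.2 ⟨mem_insert_of_mem hj'.1, ?_, hj'.2⟩
        rintro rfl
        exact hi hj'.1
      · refine sum_le_sum_of_subset_of_nonneg ?_ fun _ _ _ => pow_nonneg hp _
        exact filter_subset_filter _ (subset_insert _ _)
    have := mul_le_mul_of_nonneg_left hJ (sq_nonneg q)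
    linarith

/-- Number of members of the family contained in `s`. -/
def cnt {ι κ : Type*} (I : Finset κ) (A : κ → Finset ι) (s : Finset ι) : ℕ :=
  (I.filter fun i => A i ⊆ s).card

lemma prod_eq_pow_cnt (I : Finset κ) (A : κ → Finset ι) (q : ℝ) (s : Finset ι) :
    ∏ i ∈ I, (1 - q * ind (A i ⊆ s)) = (1 - q) ^ cnt I A s := by
  unfold cnt
  rw [← prod_const, prod_filter]
  refine prod_congr rfl fun i _ => ?_
  by_cases h : A i ⊆ s <;> simp [ind, h]

lemma janson_zero (hp : 0 ≤ p) (hp1 : p ≤ 1) (I : Finset κ) (A : κ → Finset ι)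
    (hA : ∀ i ∈ I, A i ⊆ E) :
    pr E p (fun s => ∀ i ∈ I, ¬ A i ⊆ s) ≤
      exp (-(∑ i ∈ I, p ^ (A i).card) + jDelta p I A) := by
  have := janson hp hp1 I A hA (q := 1) zero_le_one le_rfl
  simp only [one_mul, one_pow] at this
  refine le_trans (ex_mono hp hp1 fun s _ => ?_) this
  by_cases h : ∀ i ∈ I, ¬ A i ⊆ s
  · rw [ind_true h]
    exact le_of_eq (prod_eq_one fun i hi => by rw [ind_false (h i hi), sub_zero]).symm
  · rw [ind_false h]
    exact prod_nonneg fun i _ => sub_nonneg.2 (ind_le_one _)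

lemma janson_lower (hp : 0 ≤ p) (hp1 : p ≤ 1) (I : Finset κ) (A : κ → Finset ι)
    (hA : ∀ i ∈ I, A i ⊆ E) {q : ℝ} (hq : 0 ≤ q) (hq1 : q < 1) (m : ℝ) :
    pr E p (fun s => (cnt I A s : ℝ) ≤ m) ≤
      exp (-(q * ∑ i ∈ I, p ^ (A i).card) + q ^ 2 * jDelta p I A - m * log (1 - q)) := by
  have h := janson hp hp1 I A hA hq hq1.le
  have hq' : 0 < 1 - q := by linarith
  have h2 := markov (E := E) hp hp1 (f := fun s => ∏ i ∈ I, (1 - q * ind (A i ⊆ s)))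
    (fun s _ => by rw [prod_eq_pow_cnt]; positivity) (exp_pos (m * log (1 - q)))
    (fun s => (cnt I A s : ℝ) ≤ m) (fun s _ hs => by
      rw [prod_eq_pow_cnt, ← rpow_natCast, Real.rpow_def_of_pos hq', exp_le_exp, mul_comm]
      exact mul_le_mul_of_nonpos_left hs (Real.log_nonpos hq'.le (by linarith)))
  refine h2.trans ?_
  rw [exp_sub]
  gcongr

/-- Convenient form of the lower tail. -/
lemma janson_quarter (hp : 0 ≤ p) (hp1 : p ≤ 1) (I : Finset κ) (A : κ → Finset ι)
    (hA : ∀ i ∈ I, A i ⊆ E) {mu D : ℝ} (hmu : 0 < mu) (hm : mu ≤ ∑ i ∈ I, p ^ (A i).card)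
    (hD : jDelta p I A ≤ D) (hmD : mu ≤ D) :
    pr E p (fun s => (cnt I A s : ℝ) ≤ mu / 4) ≤ exp (-(mu ^ 2 / (16 * D))) := by
  have hD0 : 0 < D := hmu.trans_le hmD
  set q := mu / (4 * D) with hq
  have hq0 : 0 < q := by positivity
  have hq1 : q ≤ 1 / 4 := by
    rw [hq, div_le_iff₀ (by positivity)]; linarith
  have h := janson_lower hp hp1 I A hA hq0.le (by linarith : q < 1) (mu / 4)
  refine h.trans (exp_le_exp.2 ?_)
  have hlog : -log (1 - q) ≤ 2 * q := by
    have h1 := Real.one_sub_inv_le_log_of_pos (by linarith : 0 < 1 - q)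
    have h2 : (1 - q)⁻¹ ≤ 1 + 2 * q := by
      rw [inv_le_iff_one_le_mul₀ (by linarith)]; nlinarith
    linarith
  have h3 : q * mu ≤ q * ∑ i ∈ I, p ^ (A i).card := mul_le_mul_of_nonneg_left hm hq0.le
  have h4 : q ^ 2 * jDelta p I A ≤ q ^ 2 * D := mul_le_mul_of_nonneg_left hD (sq_nonneg q)
  have h5 : q ^ 2 * D = q * mu / 4 := by rw [hq]; field_simp
  have h6 : mu / 4 * -log (1 - q) ≤ mu / 4 * (2 * q) :=
    mul_le_mul_of_nonneg_left hlog (by positivity)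
  have h7 : mu ^ 2 / (16 * D) = q * mu / 4 := by rw [hq]; field_simp; norm_num
  rw [h7]
  linarith

/-- The event of the disjoint tuples bound. -/
def dtEv {ι κ : Type*} [DecidableEq ι] (I : Finset κ) (A : κ → Finset ι) (D t : ℝ)
    (s : Finset ι) : Prop :=
  ∃ I' ⊆ I, t ≤ (I'.card : ℝ) ∧ (∀ i ∈ I', A i ⊆ s) ∧
    ∀ i ∈ I', ((I'.filter fun j => ¬ Disjoint (A i) (A j)).card : ℝ) ≤ D

lemma dt_step (hp : 0 ≤ p) (hp1 : p ≤ 1) (I : Finset κ) (A : κ → Finset ι)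
    (hA : ∀ i ∈ I, A i ⊆ E) {D t : ℝ} (ht : 0 < t) :
    pr E p (dtEv I A D t) ≤ (∑ i ∈ I, p ^ (A i).card) / t * pr E p (dtEv I A D (t - D)) := by
  have h1 : pr E p (dtEv I A D t) ≤
      ex E p (fun s => ∑ i ∈ I, ind (A i ⊆ s) * ind (dtEv I A D (t - D) (s \ A i))) / t := by
    refine markov hp hp1 (fun s _ => sum_nonneg fun i _ =>
      mul_nonneg (ind_nonneg _) (ind_nonneg _)) ht _ ?_
    rintro s - ⟨I', hI', ht', hs, hD⟩
    refine ht'.trans ?_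
    rw [card_eq_sum_ones, Nat.cast_sum]
    refine (sum_le_sum fun i hi => ?_).trans
      (sum_le_sum_of_subset_of_nonneg hI' fun i _ _ =>
        mul_nonneg (ind_nonneg _) (ind_nonneg _))
    rw [ind_true (hs i hi), ind_true, one_mul, Nat.cast_one]
    refine ⟨I'.filter fun j => Disjoint (A i) (A j), (filter_subset _ _).trans hI', ?_, ?_, ?_⟩
    · have h2 := card_filter_add_card_filter_not (s := I')
        (p := fun j => Disjoint (A i) (A j))
      have h3 := hD i hi
      have h4 : ((I'.filter fun j => Disjoint (A i) (A j)).card : ℝ)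
        + ((I'.filter fun j => ¬ Disjoint (A i) (A j)).card : ℝ) = I'.card := by exact_mod_cast h2
      linarith
    · intro j hj
      have hj' := mem_filter.1 hj
      exact fun x hx => Finset.mem_sdiff.2 ⟨hs j hj'.1 hx, fun h => Finset.disjoint_left.1 hj'.2 h hx⟩
    · intro j hj
      refine le_trans ?_ (hD j (mem_filter.1 hj).1)
      exact_mod_cast card_le_card (filter_subset_filter _ (filter_subset _ _))
  refine h1.trans ?_
  rw [ex_sum, div_mul_eq_mul_div]
  refine div_le_div_of_nonneg_right ?_ ht.le
  rw [sum_mul]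
  refine sum_le_sum fun i hi => ?_
  rw [ex_indep (hA i hi) (fun s => ind (dtEv I A D (t - D) (s \ A i))) (fun s => by simp)]
  refine mul_le_mul_of_nonneg_left (ex_mono hp hp1 fun s _ => ind_mono ?_) (pow_nonneg hp _)
  rintro ⟨I', hI', ht', hs, hD⟩
  exact ⟨I', hI', ht', fun j hj => (hs j hj).trans sdiff_subset, hD⟩

lemma dt_bound (hp : 0 ≤ p) (hp1 : p ≤ 1) (I : Finset κ) (A : κ → Finset ι)
    (hA : ∀ i ∈ I, A i ⊆ E) {D t : ℝ} (hD : 0 ≤ D) (ht : 0 < t) (k : ℕ) (hk : k * D ≤ t / 2) :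
    pr E p (dtEv I A D t) ≤ (2 * (∑ i ∈ I, p ^ (A i).card) / t) ^ k := by
  have hmu : 0 ≤ ∑ i ∈ I, p ^ (A i).card := sum_nonneg fun _ _ => pow_nonneg hp _
  suffices H : ∀ k : ℕ, ∀ t' : ℝ, t / 2 + k * D ≤ t' →
      pr E p (dtEv I A D t') ≤ (2 * (∑ i ∈ I, p ^ (A i).card) / t) ^ k from
    H k t (by linarith)
  intro k
  induction k with
  | zero => intro t' _; simpa using pr_le_one hp hp1 _
  | succ k ih =>
    intro t' ht'
    push_cast at ht'
    have hkD : 0 ≤ (k : ℝ) * D := by positivity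
    have ht0 : 0 < t' := by linarith
    refine (dt_step hp hp1 I A hA ht0).trans ?_
    rw [pow_succ']
    refine mul_le_mul ?_ (ih _ (by linarith)) (pr_nonneg hp hp1 _) (by positivity)
    rw [div_le_div_iff₀ ht0 ht]
    nlinarith
end

/-! ### The fixed graph `H` -/

/-- The finite edge set of `H`. -/
def HE [Fintype α] (H : SimpleGraph α) : Finset (Sym2 α) := (Set.toFinite H.edgeSet).toFinset

/-- Vertices covered by an edge set. -/
def VJ [Fintype α] (J : Finset (Sym2 α)) : Finset α := univ.filter fun w => ∃ f ∈ J, w ∈ f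

section
variable [Fintype α] {H : SimpleGraph α}

lemma mem_HE {f : Sym2 α} : f ∈ HE H ↔ f ∈ H.edgeSet := by simp [HE]

lemma mem_VJ {J : Finset (Sym2 α)} {w : α} : w ∈ VJ J ↔ ∃ f ∈ J, w ∈ f := by simp [VJ]

lemma eCount_eq : eCount H = (HE H).card := by
  unfold eCount
  rw [Nat.card_coe_set_eq, Set.ncard_eq_toFinset_card _ (Set.toFinite _)]; rfl

/-- The subgraph with edge set `J`. -/
def subJ (H : SimpleGraph α) (J : Finset (Sym2 α)) (hJ : J ⊆ HE H) : H.Subgraph where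
  verts := ↑(VJ J)
  Adj a b := s(a, b) ∈ J
  adj_sub {a b} h := by
    have := mem_HE.1 (hJ h)
    simpa using this
  edge_vert {a b} h := by
    simp only [mem_coe, mem_VJ]
    exact ⟨_, h, Sym2.mem_mk_left a b⟩
  symm := ⟨fun a b h => by rw [Sym2.eq_swap]; exact h⟩

lemma subJ_edgeSet (J : Finset (Sym2 α)) (hJ : J ⊆ HE H) : (subJ H J hJ).edgeSet = ↑J := by
  ext f
  induction f with
  | _ a b => simp [subJ]

lemma subJ_dens (J : Finset (Sym2 α)) (hJ : J ⊆ HE H) :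
    subDensity2 (subJ H J hJ) = density2 (VJ J).card J.card := by
  unfold subDensity2
  rw [subJ_edgeSet]
  congr 1
  · simp [subJ]
  · simp

lemma VJ_card_two {J : Finset (Sym2 α)} (hJ : J ⊆ HE H) (h : J.Nonempty) : 2 ≤ (VJ J).card := by
  obtain ⟨f, hf⟩ := h
  have hd := H.not_isDiag_of_mem_edgeSet (mem_HE.1 (hJ hf))
  induction f with
  | _ a b =>
    rw [Sym2.mk_isDiag_iff] at hd
    rw [← card_pair hd]
    apply card_le_card
    intro x hx
    rw [mem_VJ]
    refine ⟨_, hf, ?_⟩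
    simpa using hx

lemma VJ_card_three {J : Finset (Sym2 α)} (hJ : J ⊆ HE H) (h : 2 ≤ J.card) :
    3 ≤ (VJ J).card := by
  obtain ⟨f, hf, g, hg, hne⟩ := one_lt_card.1 h
  by_contra hlt
  have h2 : (VJ J).card = 2 := by
    have := VJ_card_two hJ ⟨f, hf⟩; omega
  apply hne
  have key : ∀ x ∈ J, x = s((card_eq_two.1 h2).choose,
      (card_eq_two.1 h2).choose_spec.choose) := by
    have hs := (card_eq_two.1 h2).choose_spec.choose_spec
    generalize (card_eq_two.1 h2).choose_spec.choose = b at hs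
    generalize (card_eq_two.1 h2).choose = a at hs
    intro x hx
    have hd := H.not_isDiag_of_mem_edgeSet (mem_HE.1 (hJ hx))
    induction x with
    | _ c d =>
      rw [Sym2.mk_isDiag_iff] at hd
      have hc : c ∈ VJ J := mem_VJ.2 ⟨_, hx, Sym2.mem_mk_left c d⟩
      have hd' : d ∈ VJ J := mem_VJ.2 ⟨_, hx, Sym2.mem_mk_right c d⟩
      rw [hs.2] at hc hd'
      simp only [mem_insert, mem_singleton] at hc hd'
      rw [Sym2.eq_iff]
      grind
  rw [key f hf, key g hg]

lemma sb_card (hH : Strictly2Balanced H) : 3 ≤ ν(α) := by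
  have := hH.1; rwa [Nat.card_eq_fintype_card] at this

lemma sb_d2 (hH : Strictly2Balanced H) : d2 H = ((HE H).card - 1 : ℝ) / ((ν(α) : ℝ) - 2) := by
  unfold d2 density2
  rw [if_pos hH.1, eCount_eq, Nat.card_eq_fintype_card]

lemma sb_e2 (hH : Strictly2Balanced H) : 2 ≤ (HE H).card := by
  have h3 := sb_card hH
  have h1 := hH.2 (subJ H ∅ (empty_subset _)) (by
    intro h
    have : (subJ H ∅ (empty_subset _)).verts = Set.univ := by rw [h]; rfl
    have h0 : (subJ H ∅ (empty_subset _)).verts = ∅ := by simp [subJ, VJ]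
    rw [h0] at this
    have hne : Nonempty α := Fintype.card_pos_iff.1 (by omega)
    exact Set.empty_ne_univ this)
  rw [subJ_dens, sb_d2 hH] at h1
  simp only [VJ, density2] at h1
  simp at h1
  have h3' : (3:ℝ) ≤ ν(α) := by exact_mod_cast h3
  rw [lt_div_iff₀ (by linarith)] at h1
  have : (1:ℝ) < (HE H).card := by linarith
  exact_mod_cast this

lemma sb_cover (hH : Strictly2Balanced H) : VJ (HE H) = univ := by
  by_contra hne
  have h3 := sb_card hH
  have he := sb_e2 hH
  have h1 := hH.2 (subJ H _ (Finset.Subset.refl _)) (by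
    intro h
    apply hne
    have : (subJ H _ (Finset.Subset.refl _)).verts = Set.univ := by rw [h]; rfl
    have h4 : ((VJ (HE H) : Finset α) : Set α) = Set.univ := this
    exact_mod_cast h4)
  rw [subJ_dens, sb_d2 hH] at h1
  have hv3 := VJ_card_three (Finset.Subset.refl (HE H)) he
  have hlt : (VJ (HE H)).card < ν(α) := by
    rw [← card_univ]
    exact card_lt_card (ssubset_univ_iff.2 hne)
  rw [density2, if_pos hv3] at h1
  have e2 : (2:ℝ) ≤ (HE H).card := by exact_mod_cast he
  have v3 : (3:ℝ) ≤ (VJ (HE H)).card := by exact_mod_cast hv3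
  have vlt : ((VJ (HE H)).card : ℝ) < ν(α) := by exact_mod_cast hlt
  rw [div_lt_div_iff₀ (by linarith) (by linarith)] at h1
  nlinarith

/-- The strict balancedness inequality in integer form. -/
lemma sb_main (hH : Strictly2Balanced H) {J : Finset (Sym2 α)} (hJ : J ⊆ HE H) (hne : J ≠ HE H) (h2 : 2 ≤ J.card) :
    (J.card - 1) * (ν(α) - 2) < ((HE H).card - 1) * ((VJ J).card - 2) := by
  have h3 := sb_card hH
  have he := sb_e2 hH
  have hv3 := VJ_card_three hJ h2
  have h1 := hH.2 (subJ H J hJ) (by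
    intro h
    apply hne
    have h4 : (subJ H J hJ).edgeSet = H.edgeSet := by rw [h]; simp
    rw [subJ_edgeSet] at h4
    ext f
    rw [mem_HE, ← h4]; simp)
  rw [subJ_dens, sb_d2 hH, density2, if_pos hv3] at h1
  have v3 : (3:ℝ) ≤ (VJ J).card := by exact_mod_cast hv3
  have v3' : (3:ℝ) ≤ ν(α) := by exact_mod_cast h3
  rw [div_lt_div_iff₀ (by linarith) (by linarith)] at h1
  have : (((J.card - 1) * (ν(α) - 2) : ℕ) : ℝ) <
      ((((HE H).card - 1) * ((VJ J).card - 2) : ℕ) : ℝ) := by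
    push_cast [show 1 ≤ J.card by omega, show 2 ≤ ν(α) by omega,
      show 1 ≤ (HE H).card by omega, show 2 ≤ (VJ J).card by omega]
    exact h1
  exact_mod_cast this

/-- Edges at a vertex. -/
def inc (H : SimpleGraph α) (u : α) : Finset (Sym2 α) := (HE H).filter fun f => u ∈ f

lemma mem_inc {u : α} {f : Sym2 α} : f ∈ inc H u ↔ f ∈ HE H ∧ u ∈ f := by simp [inc]

lemma inc_card (u : α) : (inc H u).card = Nat.card ↥(H.neighborSet u) := by
  rw [Nat.card_coe_set_eq]
  have : (inc H u : Set (Sym2 α)) = (fun w => s(u, w)) '' (H.neighborSet u) := by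
    ext f
    simp only [mem_coe, mem_inc, mem_HE, Set.mem_image, SimpleGraph.mem_neighborSet]
    constructor
    · rintro ⟨h1, h2⟩
      obtain ⟨w, rfl⟩ := h2
      exact ⟨w, by simpa using h1, rfl⟩
    · rintro ⟨w, h, rfl⟩
      exact ⟨by simpa using h, Sym2.mem_mk_left _ _⟩
  rw [← Set.ncard_coe_finset, this, Set.ncard_image_of_injective]
  intro a b h
  have := Sym2.eq_iff.1 h
  grind

lemma sb_inc_pos (hH : Strictly2Balanced H) (u : α) : 1 ≤ (inc H u).card := by
  have : u ∈ VJ (HE H) := by rw [sb_cover hH]; simp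
  obtain ⟨f, hf, hu⟩ := mem_VJ.1 this
  exact card_pos.2 ⟨f, mem_inc.2 ⟨hf, hu⟩⟩

lemma sum_inc : ∑ u, (inc H u).card = 2 * (HE H).card := by
  simp only [inc, card_filter]
  rw [sum_comm, mul_comm, ← smul_eq_mul, ← sum_const]
  refine sum_congr rfl fun f hf => ?_
  have hd := H.not_isDiag_of_mem_edgeSet (mem_HE.1 hf)
  induction f with
  | _ a b =>
    rw [Sym2.mk_isDiag_iff] at hd
    rw [← card_filter, ← card_pair hd]
    congr 1
    ext x
    simp

lemma sb_dense (hH : Strictly2Balanced H) (h3 : 3 ≤ (HE H).card) : ν(α) - 2 < (HE H).card - 1 := by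
  by_cases hadj : ∃ u, 2 ≤ (inc H u).card
  · obtain ⟨u, hu⟩ := hadj
    obtain ⟨J, hJ, hJ2⟩ := exists_subset_card_eq hu
    have hJH : J ⊆ HE H := hJ.trans (filter_subset _ _)
    have h1 := sb_main hH hJH (by rintro rfl; omega) (by omega)
    have hv : (VJ J).card ≤ 3 := by
      obtain ⟨f, g, hfg, rfl⟩ := card_eq_two.1 hJ2
      have hf := (mem_inc.1 (hJ (mem_insert_self f _))).2
      have hg := (mem_inc.1 (hJ (mem_insert_of_mem (mem_singleton_self g)))).2
      obtain ⟨a, rfl⟩ := hf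
      obtain ⟨b, rfl⟩ := hg
      refine (card_le_card ?_).trans (card_le_three (a := u) (b := a) (c := b))
      intro x hx
      simp [mem_VJ] at hx ⊢
      tauto
    rw [hJ2] at h1
    have : (VJ J).card - 2 ≤ 1 := by omega
    have := Nat.mul_le_mul_left ((HE H).card - 1) this
    omega
  · push Not at hadj
    have hs := sum_inc (H := H)
    have h1 : ∀ u, (inc H u).card = 1 := fun u => by
      have := hadj u; have := sb_inc_pos hH u; omega
    simp only [h1, sum_const, card_univ, smul_eq_mul, mul_one] at hs
    obtain ⟨J, hJ, hJ2⟩ := exists_subset_card_eq (show 2 ≤ (HE H).card by omega)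
    have h1 := sb_main hH hJ (by rintro rfl; omega) (by omega)
    have hv : (VJ J).card ≤ 4 := by
      obtain ⟨f, g, hfg, rfl⟩ := card_eq_two.1 hJ2
      induction f with
      | _ a b =>
        induction g with
        | _ c d =>
          refine (card_le_card ?_).trans
            (card_le_four (a := a) (b := b) (c := c) (d := d))
          intro x hx
          simp [mem_VJ] at hx ⊢
          tauto
    rw [hJ2, hs] at h1
    have : (VJ J).card - 2 ≤ 2 := by omega
    have := Nat.mul_le_mul_left ((HE H).card - 1) this
    omega

lemma sb_mindeg (hH : Strictly2Balanced H) (h3 : 3 ≤ (HE H).card) (u : α) : 2 ≤ (inc H u).card := by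
  by_contra hlt
  have h1 : (inc H u).card = 1 := by have := sb_inc_pos hH u; omega
  obtain ⟨f, hf⟩ := card_eq_one.1 h1
  have hfH : f ∈ HE H := (mem_inc.1 (hf ▸ mem_singleton_self f : f ∈ inc H u)).1
  have hc : ((HE H).erase f).card = (HE H).card - 1 := card_erase_of_mem hfH
  have hm := sb_main hH (J := (HE H).erase f) (erase_subset _ _)
    (by intro h; rw [h] at hc; omega) (by omega)
  have hv : (VJ ((HE H).erase f)).card ≤ ν(α) - 1 := by
    rw [← card_univ, ← card_erase_of_mem (mem_univ u)]
    apply card_le_card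
    intro w hw
    rw [mem_erase]
    refine ⟨?_, mem_univ _⟩
    rintro rfl
    obtain ⟨g, hg, hwg⟩ := mem_VJ.1 hw
    rw [mem_erase] at hg
    have : g ∈ inc H w := mem_inc.2 ⟨hg.2, hwg⟩
    rw [hf, mem_singleton] at this
    exact hg.1 this
  have hd := sb_dense hH h3
  have hα := sb_card hH
  rw [hc] at hm
  obtain ⟨k, hk⟩ : ∃ k, (HE H).card = k + 3 := ⟨_, (Nat.sub_add_cancel h3).symm⟩
  obtain ⟨l, hl⟩ : ∃ l, ν(α) = l + 3 := ⟨_, (Nat.sub_add_cancel hα).symm⟩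
  have h5 : (VJ ((HE H).erase f)).card - 2 ≤ l := by omega
  have h6 := Nat.mul_le_mul_left ((HE H).card - 1) h5
  rw [hk, hl] at hm hd
  rw [hk] at h6
  simp only [show k + 3 - 1 = k + 2 by omega,
    show l + 3 - 2 = l + 1 by omega, show k + 2 - 1 = k + 1 by omega] at hm hd h6
  nlinarith

end

/-! ### Copies of `H` in the complete graph -/

/-- All pairs. -/
def EE (n : ℕ) : ES(n) := univ.filter fun g => ¬ g.IsDiag

/-- Image of the edge set of `H`. -/
def im [Fintype α] (H : SimpleGraph α) (ψ : α ↪ V) : Finset (Sym2 V) := (HE H).map ψ.sym2Map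

/-- The copies of `H` in the complete graph on `Fin n` (as edge sets). -/
def cps [Fintype α] (H : SimpleGraph α) (n : ℕ) : Finset (ES(n)) :=
  (univ : Finset (α ↪ Fin n)).image (im H)

/-- Vertices covered by a finite set of pairs. -/
def VU {n : ℕ} (U : ES(n)) : Finset (Fin n) := U.biUnion Sym2.toFinset

section
variable [Fintype α] {H : SimpleGraph α} {n : ℕ}

lemma mem_EE {g : E2(n)} : g ∈ EE n ↔ ¬ g.IsDiag := by simp [EE]

lemma mem_EE_mk {x y : Fin n} : s(x, y) ∈ EE n ↔ x ≠ y := by simp [EE]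

lemma mem_im {ψ : α ↪ V} {g : Sym2 V} : g ∈ im H ψ ↔ ∃ f ∈ HE H, Sym2.map ψ f = g := by
  simp [im]

lemma im_card (ψ : α ↪ V) : (im H ψ).card = (HE H).card := by simp [im]

lemma mem_cps {K : ES(n)} : K ∈ cps H n ↔ ∃ ψ : α ↪ Fin n, im H ψ = K := by
  simp [cps]

lemma im_mem_cps (ψ : α ↪ Fin n) : im H ψ ∈ cps H n := mem_cps.2 ⟨ψ, rfl⟩

lemma cps_card {K : ES(n)} (hK : K ∈ cps H n) : K.card = (HE H).card := by
  obtain ⟨ψ, rfl⟩ := mem_cps.1 hK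
  exact im_card ψ

lemma map_not_diag {ψ : α ↪ V} {f : Sym2 α} (hf : f ∈ HE H) : ¬ (Sym2.map ψ f).IsDiag := by
  have hd := H.not_isDiag_of_mem_edgeSet (mem_HE.1 hf)
  induction f with
  | _ a b => simpa using hd

lemma im_subset_EE (ψ : α ↪ Fin n) : im H ψ ⊆ EE n := by
  intro g hg
  obtain ⟨f, hf, rfl⟩ := mem_im.1 hg
  exact mem_EE.2 (map_not_diag hf)

lemma cps_subset_EE {K : ES(n)} (hK : K ∈ cps H n) : K ⊆ EE n := by
  obtain ⟨ψ, rfl⟩ := mem_cps.1 hK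
  exact im_subset_EE ψ

lemma mem_VU {U : ES(n)} {x : Fin n} : x ∈ VU U ↔ ∃ g ∈ U, x ∈ g := by
  simp [VU]

lemma VU_card (U : ES(n)) : (VU U).card ≤ 2 * U.card := by
  unfold VU
  refine card_biUnion_le.trans ?_
  rw [mul_comm, ← smul_eq_mul, ← sum_const]
  refine sum_le_sum fun g _ => ?_
  induction g with
  | _ a b =>
    refine (card_le_card (t := {a, b}) ?_).trans card_le_two
    intro x; simp

/-- Edges of `H` mapped into `U`. -/
def Jof (H : SimpleGraph α) {n : ℕ} (ψ : α ↪ Fin n) (U : ES(n)) :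
    Finset (Sym2 α) := (HE H).filter fun f => Sym2.map ψ f ∈ U

lemma mem_Jof {ψ : α ↪ Fin n} {U : ES(n)} {f : Sym2 α} :
    f ∈ Jof H ψ U ↔ f ∈ HE H ∧ Sym2.map ψ f ∈ U := by simp [Jof]

lemma Jof_subset (ψ : α ↪ Fin n) (U : ES(n)) : Jof H ψ U ⊆ HE H :=
  filter_subset _ _

lemma Jof_map (ψ : α ↪ Fin n) (U : ES(n)) :
    (Jof H ψ U).map ψ.sym2Map = im H ψ ∩ U := by
  ext g
  simp only [Finset.mem_map, mem_Jof, mem_inter, mem_im, Function.Embedding.sym2Map_apply]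
  constructor
  · rintro ⟨f, ⟨h1, h2⟩, rfl⟩; exact ⟨⟨f, h1, rfl⟩, h2⟩
  · rintro ⟨⟨f, h1, rfl⟩, h2⟩; exact ⟨f, ⟨h1, h2⟩, rfl⟩

lemma Jof_card (ψ : α ↪ Fin n) (U : ES(n)) :
    (Jof H ψ U).card = (im H ψ ∩ U).card := by
  rw [← Jof_map, card_map]

lemma Jof_sdiff_card (ψ : α ↪ Fin n) (U : ES(n)) :
    (im H ψ \ U).card = (HE H).card - (Jof H ψ U).card := by
  rw [Jof_card, ← im_card (H := H) ψ]
  have := card_sdiff_add_card_inter (im H ψ) U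
  omega

lemma Jof_eq_iff (ψ : α ↪ Fin n) (U : ES(n)) :
    Jof H ψ U = HE H ↔ im H ψ ⊆ U := by
  constructor
  · intro h g hg
    obtain ⟨f, hf, rfl⟩ := mem_im.1 hg
    rw [← h] at hf
    exact (mem_Jof.1 hf).2
  · intro h
    refine Finset.Subset.antisymm (Jof_subset ψ U) fun f hf => ?_
    exact mem_Jof.2 ⟨hf, h (mem_im.2 ⟨f, hf, rfl⟩)⟩

/-- Counting embeddings constrained by a set for each vertex. -/
lemma emb_count_le (T : α → Finset (Fin n)) :
    (univ.filter fun ψ : α ↪ Fin n => ∀ w, ψ w ∈ T w).card ≤ ∏ w, (T w).card := by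
  rw [← Fintype.card_piFinset]
  refine card_le_card_of_injOn (fun ψ => (ψ : α → Fin n)) ?_ ?_
  · intro ψ hψ
    simpa using hψ
  · intro ψ _ ψ' _ h
    exact DFunLike.coe_injective h

lemma ext_count (J : Finset (Sym2 α)) (U : ES(n)) :
    (univ.filter fun ψ : α ↪ Fin n => ∀ f ∈ J, Sym2.map ψ f ∈ U).card ≤
      (2 * U.card) ^ (VJ J).card * n ^ (ν(α) - (VJ J).card) := by
  refine le_trans (card_le_card ?_) ((emb_count_le
    (fun w => if w ∈ VJ J then VU U else univ)).trans ?_)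
  · intro ψ hψ
    simp only [mem_filter, mem_univ, true_and] at hψ ⊢
    intro w
    split_ifs with hw
    · obtain ⟨f, hf, hwf⟩ := mem_VJ.1 hw
      exact mem_VU.2 ⟨_, hψ f hf, Sym2.mem_map.2 ⟨w, hwf, rfl⟩⟩
    · exact mem_univ _
  · rw [← prod_mul_prod_compl (VJ J)]
    refine Nat.mul_le_mul ?_ ?_
    · refine (prod_le_prod' (g := fun _ => 2 * U.card) fun w hw => ?_).trans_eq
        (prod_const _)
      rw [if_pos hw]; exact VU_card U
    · rw [prod_congr rfl (g := fun _ => n) fun w hw => by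
        rw [if_neg (mem_compl.1 hw), card_univ, Fintype.card_fin],
        prod_const, card_compl]

lemma sum_ext {p : ℝ} (hp : 0 ≤ p) (U : ES(n)) (P : Finset (Sym2 α) → Prop)
    [DecidablePred P] :
    ∑ ψ : α ↪ Fin n with P (Jof H ψ U), p ^ (im H ψ \ U).card ≤
      ∑ J ∈ (HE H).powerset with P J, (2 * U.card : ℝ) ^ (VJ J).card *
        ((n : ℝ) ^ (ν(α) - (VJ J).card) * p ^ ((HE H).card - J.card)) := by
  rw [← sum_fiberwise_of_maps_to (s := univ.filter fun ψ : α ↪ Fin n => P (Jof H ψ U))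
    (t := (HE H).powerset.filter P) (g := fun ψ => Jof H ψ U)]
  · refine sum_le_sum fun J hJ => ?_
    rw [sum_congr rfl (g := fun _ => p ^ ((HE H).card - J.card)) fun ψ hψ => by
      rw [Jof_sdiff_card, (mem_filter.1 hψ).2], sum_const, nsmul_eq_mul, ← mul_assoc]
    refine mul_le_mul_of_nonneg_right ?_ (pow_nonneg hp _)
    have h1 := ext_count (n := n) J U
    have h2 : ((univ.filter fun ψ : α ↪ Fin n => P (Jof H ψ U)).filter
        fun ψ => Jof H ψ U = J).card ≤ (univ.filter
        fun ψ : α ↪ Fin n => ∀ f ∈ J, Sym2.map ψ f ∈ U).card := by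
      refine card_le_card fun ψ hψ => ?_
      simp only [mem_filter, mem_univ, true_and] at hψ ⊢
      intro f hf
      rw [← hψ.2] at hf
      exact (mem_Jof.1 hf).2
    exact_mod_cast h2.trans h1
  · intro ψ hψ
    exact mem_filter.2 ⟨mem_powerset.2 (Jof_subset ψ U), (mem_filter.1 hψ).2⟩

/-- Passing from copies to embeddings. -/
lemma sum_cps_le (P : ES(n) → Prop) [DecidablePred P] (F : ES(n) → ℝ)
    (hF : ∀ K, 0 ≤ F K) :
    ∑ K ∈ cps H n with P K, F K ≤ ∑ ψ : α ↪ Fin n with P (im H ψ), F (im H ψ) := by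
  have : (cps H n).filter P = (univ.filter fun ψ : α ↪ Fin n => P (im H ψ)).image (im H) := by
    ext K
    simp only [mem_filter, mem_cps, mem_image, mem_univ, true_and]
    constructor
    · rintro ⟨⟨ψ, rfl⟩, h⟩; exact ⟨ψ, h, rfl⟩
    · rintro ⟨ψ, h, rfl⟩; exact ⟨⟨ψ, rfl⟩, h⟩
  rw [this]
  exact sum_image_le_of_nonneg fun K _ => hF K

/-- Every copy comes from boundedly many embeddings. -/
lemma fiber_count (hH : Strictly2Balanced H) (K : ES(n)) (hK : K ∈ cps H n) :
    (univ.filter fun ψ : α ↪ Fin n => im H ψ = K).card ≤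
      (2 * (HE H).card) ^ ν(α) := by
  have h := ext_count (n := n) (HE H) K
  rw [sb_cover hH, card_univ, Nat.sub_self, pow_zero, mul_one, cps_card hK] at h
  refine le_trans (card_le_card fun ψ hψ => ?_) h
  simp only [mem_filter, mem_univ, true_and] at hψ ⊢
  intro f hf
  rw [← hψ]
  exact mem_im.2 ⟨f, hf, rfl⟩

lemma emb_le_cps (hH : Strictly2Balanced H) (P : ES(n) → Prop)
    [DecidablePred P] :
    (univ.filter fun ψ : α ↪ Fin n => P (im H ψ)).card ≤
      (2 * (HE H).card) ^ ν(α) * ((cps H n).filter P).card := by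
  refine card_le_mul_card_image_of_maps_to (f := fun ψ : α ↪ Fin n => im H ψ) (fun ψ hψ => ?_) _ fun K hK => ?_
  · exact mem_filter.2 ⟨im_mem_cps ψ, (mem_filter.1 hψ).2⟩
  · refine le_trans (card_le_card ?_) (fiber_count hH K (mem_filter.1 hK).1)
    exact filter_subset_filter _ (filter_subset _ _)

/-- Lower bound for the number of embeddings with prescribed ranges. -/
lemma emb_count_ge (T : α → Finset (Fin n))
    (hT : ∀ w w', w ≠ w' → Disjoint (T w) (T w') ∨ ν(α) ^ 2 ≤ (T w).card ∨
      ν(α) ^ 2 ≤ (T w').card) :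
    (∏ w, ((T w).card : ℝ)) / 2 ≤
      ((univ.filter fun ψ : α ↪ Fin n => ∀ w, ψ w ∈ T w).card : ℝ) := by
  set P := Fintype.piFinset T with hP
  have hPc : (P.card : ℝ) = ∏ w, ((T w).card : ℝ) := by
    rw [hP, Fintype.card_piFinset]; push_cast; rfl
  by_cases hv : ν(α) = 0
  · have hE : IsEmpty α := Fintype.card_eq_zero_iff.1 hv
    have : (1:ℝ) ≤ ((univ.filter fun ψ : α ↪ Fin n => ∀ w, ψ w ∈ T w).card : ℝ) := by
      have : 0 < (univ.filter fun ψ : α ↪ Fin n => ∀ w, ψ w ∈ T w).card :=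
        card_pos.2 ⟨Function.Embedding.ofIsEmpty,
          mem_filter.2 ⟨mem_univ _, fun w => hE.elim w⟩⟩
      exact_mod_cast this
    simp only [univ_eq_empty, prod_empty]
    linarith
  -- non-injective functions
  set B := P.filter fun f => ¬ Function.Injective f with hB
  have hv1 : (1:ℝ) ≤ ν(α) := by exact_mod_cast Nat.one_le_iff_ne_zero.2 hv
  have hgood : (P.filter fun f => Function.Injective f).card ≤
      (univ.filter fun ψ : α ↪ Fin n => ∀ w, ψ w ∈ T w).card := by
    refine card_le_card_of_surjOn (fun ψ => (ψ : α → Fin n)) ?_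
    intro f hf
    simp only [coe_filter, Set.mem_ofPred_eq, hP, Fintype.mem_piFinset] at hf
    exact ⟨⟨f, hf.2⟩, by simpa using hf.1, rfl⟩
  have hpair : ∀ w w', w ≠ w' →
      ((P.filter fun f => f w = f w').card : ℝ) * (ν(α) : ℝ) ^ 2 ≤ P.card := by
    have aux : ∀ w w', w ≠ w' → ((P.filter fun f => f w = f w').card) * (T w).card ≤ P.card := by
      intro w w' hne
      rw [← card_product]
      refine card_le_card_of_injOn (fun q => Function.update q.1 w q.2) ?_ ?_
      · rintro ⟨f, x⟩ hq
        simp only [coe_product, coe_filter, Set.mem_prod, Set.mem_ofPred_eq,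
          mem_coe, hP, Fintype.mem_piFinset] at hq ⊢
        intro z
        by_cases hz : z = w
        · subst hz; simpa using hq.2
        · simpa [Function.update_of_ne hz] using hq.1.1 z
      · rintro ⟨f, x⟩ hq ⟨g, y⟩ hq' h
        simp only [coe_product, coe_filter, Set.mem_prod, Set.mem_ofPred_eq,
          mem_coe] at hq hq'
        have hx : x = y := by simpa using congrFun h w
        have hfg : ∀ z, z ≠ w → f z = g z := fun z hz => by
          simpa [Function.update_of_ne hz] using congrFun h z
        have : f = g := by
          funext z
          by_cases hz : z = w
          · rw [hz, hq.1.2, hq'.1.2]; exact hfg w' hne.symm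
          · exact hfg z hz
        rw [hx, this]
    intro w w' hne
    rcases hT w w' hne with h | h | h
    · have : P.filter (fun f => f w = f w') = ∅ := by
        rw [filter_eq_empty_iff]
        intro f hf heq
        rw [hP, Fintype.mem_piFinset] at hf
        exact Finset.disjoint_left.1 h (hf w) (heq ▸ hf w')
      rw [this]; simp
    · have h1 := (Nat.mul_le_mul_left _ h).trans (aux w w' hne)
      exact_mod_cast h1
    · have h1 := (Nat.mul_le_mul_left _ h).trans (aux w' w hne.symm)
      have h2 : P.filter (fun f => f w' = f w) = P.filter (fun f => f w = f w') :=
        filter_congr fun f _ => eq_comm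
      rw [h2] at h1
      exact_mod_cast h1
  have hBle : (B.card : ℝ) ≤ P.card / 2 := by
    have h2 : ∀ x ∈ B, 2 ≤ ((univ : Finset α).offDiag.filter fun q => x q.1 = x q.2).card := by
      intro f hf
      have hni := (mem_filter.1 hf).2
      simp only [Function.Injective] at hni
      push Not at hni
      obtain ⟨a, b, hab, hne⟩ := hni
      have hne2 : ((a, b) : α × α) ≠ (b, a) := fun h => hne (Prod.ext_iff.1 h).1
      rw [← card_pair hne2]
      refine card_le_card fun q hq => ?_
      simp only [mem_insert, mem_singleton] at hq
      rcases hq with rfl | rfl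
      · simp [hne, hab]
      · simp [hne.symm, hab]
    have h3 : (2:ℝ) * B.card ≤ ∑ q ∈ (univ : Finset α).offDiag,
        ((P.filter fun f => f q.1 = f q.2).card : ℝ) := by
      have h4 : B.card * 2 ≤ ∑ q ∈ (univ : Finset α).offDiag,
          (P.filter fun f => f q.1 = f q.2).card := by
        rw [← smul_eq_mul, ← sum_const]
        refine (sum_le_sum h2).trans ?_
        simp only [card_filter]
        rw [sum_comm]
        refine sum_le_sum fun q _ => ?_
        exact sum_le_sum_of_subset (filter_subset _ _)
      have : ((B.card * 2 : ℕ) : ℝ) ≤ _ := Nat.cast_le.2 h4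
      push_cast at this
      linarith
    have h5 : ∑ q ∈ (univ : Finset α).offDiag, ((P.filter fun f => f q.1 = f q.2).card : ℝ) ≤
        ∑ q ∈ (univ : Finset α).offDiag, (P.card : ℝ) / (ν(α) : ℝ) ^ 2 := by
      refine sum_le_sum fun q hq => ?_
      rw [le_div_iff₀ (by positivity)]
      exact hpair q.1 q.2 (mem_offDiag.1 hq).2.2
    rw [sum_const, nsmul_eq_mul] at h5
    have h6 : (((univ : Finset α).offDiag.card : ℝ)) ≤ (ν(α) : ℝ) ^ 2 := by
      rw [offDiag_card, card_univ, sq]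
      exact_mod_cast Nat.sub_le _ _
    have h7 : ((univ : Finset α).offDiag.card : ℝ) * ((P.card : ℝ) / (ν(α) : ℝ) ^ 2)
        ≤ P.card := by
      rw [mul_div_assoc', div_le_iff₀ (by positivity), mul_comm]
      exact mul_le_mul_of_nonneg_left h6 (Nat.cast_nonneg _)
    linarith
  have hsplit := card_filter_add_card_filter_not (s := P)
    (p := fun f => Function.Injective f)
  have hs' : ((P.filter fun f => Function.Injective f).card : ℝ) + (B.card : ℝ) = P.card := by
    exact_mod_cast hsplit
  have hg' : ((P.filter fun f => Function.Injective f).card : ℝ) ≤ _ := Nat.cast_le.2 hgood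
  rw [← hPc]
  linarith

end

/-! ### The density window -/

/-- The order of magnitude of the number of copies on an edge. -/
def lam [Fintype α] (H : SimpleGraph α) (n : ℕ) (p : ℝ) : ℝ :=
  (n : ℝ) ^ (ν(α) - 2) * p ^ ((HE H).card - 1)

/-- The exponent of the polynomial saving. -/
def gam [Fintype α] (H : SimpleGraph α) : ℝ := 1 / (2 * (((HE H).card : ℝ) - 1))

/-- The polynomial saving. -/
def tht [Fintype α] (H : SimpleGraph α) (n : ℕ) : ℝ := (n : ℝ) ^ (-gam H)

/-- Upper density range. -/
structure Up [Fintype α] (H : SimpleGraph α) (C : ℝ) (n : ℕ) (p : ℝ) : Prop where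
  hn : 3 ≤ n
  p0 : 0 ≤ p
  p1 : p ≤ 1
  lamle : lam H n p ≤ C * log n
  w2 : ∀ J ⊆ HE H, J ≠ HE H → 2 ≤ J.card →
    (n : ℝ) ^ (ν(α) - (VJ J).card) * p ^ ((HE H).card - J.card) ≤ tht H n

/-- The critical window. -/
structure Win [Fintype α] (H : SimpleGraph α) (C : ℝ) (n : ℕ) (p : ℝ) : Prop
    extends Up H C n p where
  lam1 : 1 ≤ lam H n p
  lamge : log n ≤ C * lam H n p
  w3 : (n : ℝ) ^ gam H ≤ n * p

section
variable [Fintype α] {H : SimpleGraph α} {n : ℕ} {p C : ℝ}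

lemma gam_pos (h3 : 3 ≤ (HE H).card) : 0 < gam H := by
  unfold gam
  have : (3:ℝ) ≤ (HE H).card := by exact_mod_cast h3
  apply one_div_pos.2; linarith

lemma tht_pos (hn : 1 ≤ n) : 0 < tht H n := by
  unfold tht
  exact Real.rpow_pos_of_pos (by exact_mod_cast hn) _

lemma tht_le_one (h3 : 3 ≤ (HE H).card) (hn : 1 ≤ n) : tht H n ≤ 1 := by
  unfold tht
  refine Real.rpow_le_one_of_one_le_of_nonpos (by exact_mod_cast hn) ?_
  have := gam_pos h3
  linarith

lemma tht_tendsto (h3 : 3 ≤ (HE H).card) : Tendsto (fun n : ℕ => tht H n) atTop (𝓝 0) :=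
  (tendsto_rpow_neg_atTop (gam_pos h3)).comp tendsto_natCast_atTop_atTop

lemma log_pow_mul_tht (h3 : 3 ≤ (HE H).card) (k : ℕ) :
    Tendsto (fun n : ℕ => log n ^ k * tht H n) atTop (𝓝 0) := by
  have h := (isLittleO_log_rpow_rpow_atTop (k : ℝ) (gam_pos h3)).tendsto_div_nhds_zero
  refine (h.comp tendsto_natCast_atTop_atTop).congr fun n => ?_
  simp only [Function.comp, tht, rpow_natCast]
  rw [rpow_neg (Nat.cast_nonneg n), div_eq_mul_inv]

/-- A real `x` with `x^(e-1) ≤ n^(-1/2)` is at most `n^(-γ)`. -/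
lemma le_tht (h3 : 3 ≤ (HE H).card) (hn : 1 ≤ n) {x : ℝ}
    (h : x ^ (2 * ((HE H).card - 1)) ≤ (n : ℝ)⁻¹) : x ≤ tht H n := by
  have hm : 2 * ((HE H).card - 1) ≠ 0 := by omega
  refine le_of_pow_le_pow_left₀ hm (tht_pos hn).le (h.trans_eq ?_)
  unfold tht gam
  rw [← rpow_natCast, ← rpow_mul (Nat.cast_nonneg n), ← Real.rpow_neg_one]
  congr 1
  have : (3:ℝ) ≤ (HE H).card := by exact_mod_cast h3
  push_cast [show 1 ≤ (HE H).card by omega]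
  have : ((HE H).card : ℝ) - 1 ≠ 0 := by linarith
  field_simp

lemma w2_aux (hH : Strictly2Balanced H) (hn : 1 ≤ n) (hp : 0 ≤ p)
    {L : ℝ} (hL1 : 1 ≤ L) (hL : lam H n p ≤ L) {J : Finset (Sym2 α)} (hJ : J ⊆ HE H)
    (hne : J ≠ HE H) (h2 : 2 ≤ J.card) :
    ((n : ℝ) ^ (ν(α) - (VJ J).card) * p ^ ((HE H).card - J.card)) ^ ((HE H).card - 1) ≤
      (n : ℝ)⁻¹ * L ^ (HE H).card := by
  have hm := sb_main hH hJ hne h2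
  have hv3 := sb_card hH
  have hJv := VJ_card_three hJ h2
  have hJv' : (VJ J).card ≤ ν(α) := card_le_univ _
  have hJe : J.card < (HE H).card := card_lt_card
    (Finset.ssubset_iff_subset_ne.2 ⟨hJ, hne⟩)
  have hn0 : (1:ℝ) ≤ n := by exact_mod_cast hn
  have hnn : (0:ℝ) < n := by linarith
  set e := (HE H).card
  set v := ν(α)
  set vJ := (VJ J).card
  set j := J.card
  have hkey : (v - vJ) * (e - 1) + 1 ≤ (v - 2) * (e - j) := by
    obtain ⟨a, ha⟩ : ∃ a, vJ = a + 2 := ⟨vJ - 2, by omega⟩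
    obtain ⟨b, hb⟩ : ∃ b, v = vJ + b := ⟨v - vJ, by omega⟩
    obtain ⟨c, hc⟩ : ∃ c, j = c + 1 := ⟨j - 1, by omega⟩
    obtain ⟨d, hd⟩ : ∃ d, e = j + d := ⟨e - j, by omega⟩
    have e1 : v - vJ = b := by omega
    have e2 : e - 1 = c + d := by omega
    have e3 : v - 2 = a + b := by omega
    have e4 : e - j = d := by omega
    have e5 : j - 1 = c := by omega
    have e6 : vJ - 2 = a := by omega
    rw [e1, e2, e3, e4]
    rw [e5, e3, e2, e6] at hm
    nlinarith
  have h1 : (n:ℝ) ^ ((v - vJ) * (e - 1)) ≤ (n:ℝ)⁻¹ * (n:ℝ) ^ ((v - 2) * (e - j)) := by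
    rw [le_inv_mul_iff₀ hnn, ← pow_succ']
    exact pow_le_pow_right₀ hn0 hkey
  have h4 : (lam H n p) ^ (e - j) ≤ L ^ e := by
    refine (pow_le_pow_left₀ (by unfold lam; positivity) hL _).trans ?_
    exact pow_le_pow_right₀ hL1 (Nat.sub_le _ _)
  calc ((n : ℝ) ^ (v - vJ) * p ^ (e - j)) ^ (e - 1)
      = (n:ℝ) ^ ((v - vJ) * (e - 1)) * (p ^ (e - 1)) ^ (e - j) := by
        rw [mul_pow, ← pow_mul, ← pow_mul, ← pow_mul, mul_comm (e - 1) (e - j)]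
    _ ≤ (n:ℝ)⁻¹ * (n:ℝ) ^ ((v - 2) * (e - j)) * (p ^ (e - 1)) ^ (e - j) :=
        mul_le_mul_of_nonneg_right h1 (by positivity)
    _ = (n:ℝ)⁻¹ * (lam H n p) ^ (e - j) := by
        unfold lam; rw [mul_pow, ← pow_mul (n : ℝ), mul_assoc]
    _ ≤ (n:ℝ)⁻¹ * L ^ e := mul_le_mul_of_nonneg_left h4 (by positivity)

/-- Powers of logarithms are negligible. -/
lemma log_pow_le (C : ℝ) (k : ℕ) : ∀ᶠ n : ℕ in atTop, C * log n ^ k ≤ n := by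
  have h := (isLittleO_log_rpow_rpow_atTop (k : ℝ) one_pos).tendsto_div_nhds_zero
  have h2 := (h.comp tendsto_natCast_atTop_atTop).const_mul C
  rw [mul_zero] at h2
  filter_upwards [h2.eventually (eventually_le_nhds one_pos), eventually_ge_atTop 1] with n hn h1
  simp only [Function.comp, rpow_natCast, rpow_one] at hn
  have : (0:ℝ) < n := by exact_mod_cast h1
  rwa [← mul_div_assoc, div_le_one this] at hn

lemma up_of (hH : Strictly2Balanced H) (h3 : 3 ≤ (HE H).card) (C : ℝ) :
    ∀ᶠ n : ℕ in atTop, ∀ p : ℝ, 0 ≤ p → p ≤ 1 → lam H n p ≤ C * log n → Up H C n p := by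
  have hlog : Tendsto (fun n : ℕ => log n) atTop atTop :=
    tendsto_log_atTop.comp tendsto_natCast_atTop_atTop
  filter_upwards [eventually_ge_atTop 3, log_pow_le (((|C| + 1) ^ (HE H).card) ^ 2)
    ((HE H).card * 2), hlog.eventually_ge_atTop 1] with n hn hlogn hlog1 p hp hp1 hlam
  refine ⟨hn, hp, hp1, hlam, fun J hJ hne h2 => ?_⟩
  have hL : lam H n p ≤ (|C| + 1) * log n := hlam.trans (by
    apply mul_le_mul_of_nonneg_right _ (by linarith)
    linarith [le_abs_self C])
  have hL1 : 1 ≤ (|C| + 1) * log n := by nlinarith [abs_nonneg C]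
  have := w2_aux hH (by omega : 1 ≤ n) hp hL1 hL hJ hne h2
  refine le_tht h3 (by omega) ?_
  rw [mul_comm 2, pow_mul]
  refine (pow_le_pow_left₀ (by positivity) this 2).trans ?_
  have hn0 : (0:ℝ) < n := by exact_mod_cast (by omega : 0 < n)
  rw [mul_pow, mul_pow, mul_pow, ← pow_mul (log n)]
  calc (n:ℝ)⁻¹ ^ 2 * (((|C| + 1) ^ (HE H).card) ^ 2 * log n ^ ((HE H).card * 2))
      ≤ (n:ℝ)⁻¹ ^ 2 * n := mul_le_mul_of_nonneg_left hlogn (by positivity)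
    _ = (n:ℝ)⁻¹ := by field_simp

lemma win_of (hH : Strictly2Balanced H) (h3 : 3 ≤ (HE H).card) (C : ℝ) :
    ∀ᶠ n : ℕ in atTop, ∀ p : ℝ, 0 ≤ p → p ≤ 1 → lam H n p ≤ C * log n →
      log n ≤ C * lam H n p → Win H C n p := by
  have hlog : Tendsto (fun n : ℕ => log n) atTop atTop :=
    tendsto_log_atTop.comp tendsto_natCast_atTop_atTop
  filter_upwards [up_of hH h3 C, eventually_ge_atTop 3, hlog.eventually_ge_atTop (|C| + 1)]
    with n hup hn hlog1 p hp hp1 h1 h2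
  have hl0 : 0 ≤ lam H n p := by unfold lam; positivity
  have hl1 : 1 ≤ lam H n p := by
    have : C * lam H n p ≤ |C| * lam H n p := mul_le_mul_of_nonneg_right (le_abs_self C) hl0
    by_contra hlt
    push Not at hlt
    nlinarith [abs_nonneg C]
  refine ⟨hup p hp hp1 h1, hl1, h2, ?_⟩
  have hn1 : (1:ℝ) ≤ n := by exact_mod_cast (by omega : 1 ≤ n)
  have hd := sb_dense hH h3
  have hm : 2 * ((HE H).card - 1) ≠ 0 := by omega
  refine le_of_pow_le_pow_left₀ hm (by positivity) ?_
  have e1 : ((n:ℝ) ^ gam H) ^ (2 * ((HE H).card - 1)) = n := by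
    unfold gam
    rw [← rpow_natCast, ← rpow_mul (Nat.cast_nonneg n)]
    conv_rhs => rw [← rpow_one (n:ℝ)]
    congr 1
    have : (3:ℝ) ≤ (HE H).card := by exact_mod_cast h3
    push_cast [show 1 ≤ (HE H).card by omega]
    have : ((HE H).card : ℝ) - 1 ≠ 0 := by linarith
    field_simp
  rw [e1, mul_comm 2, pow_mul]
  have h5 : (n:ℝ) ≤ ((n:ℝ) * p) ^ ((HE H).card - 1) := by
    rw [mul_pow]
    have h6 : (n:ℝ) * (n:ℝ) ^ (ν(α) - 2) ≤ (n:ℝ) ^ ((HE H).card - 1) := by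
      rw [← pow_succ']; exact pow_le_pow_right₀ hn1 hd
    have h7 := mul_le_mul_of_nonneg_right h6 (pow_nonneg hp ((HE H).card - 1))
    unfold lam at hl1
    nlinarith
  nlinarith

/-- The constant in the weighted counts. -/
def cU (H : SimpleGraph α) (u : ℕ) : ℝ :=
  2 ^ (HE H).card * (2 * u + 1) ^ ν(α)

lemma cU_ge_one (u : ℕ) : 1 ≤ cU H u := by
  unfold cU
  have h1 : (1:ℝ) ≤ 2 ^ (HE H).card := one_le_pow₀ (by norm_num)
  have h2 : (1:ℝ) ≤ (2 * u + 1) ^ ν(α) :=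
    one_le_pow₀ (by have : (0:ℝ) ≤ u := Nat.cast_nonneg u; linarith)
  nlinarith

lemma sum_bound (hp : 0 ≤ p) {u : ℕ} {U : ES(n)} (hU : U.card ≤ u)
    (P : Finset (Sym2 α) → Prop) [DecidablePred P] {B : ℝ} (hB : 0 ≤ B)
    (h : ∀ J ⊆ HE H, P J →
      (n : ℝ) ^ (ν(α) - (VJ J).card) * p ^ ((HE H).card - J.card) ≤ B) :
    ∑ ψ : α ↪ Fin n with P (Jof H ψ U), p ^ (im H ψ \ U).card ≤ cU H u * B := by
  refine (sum_ext hp U P).trans ?_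
  have h1 : ∀ J ∈ (HE H).powerset.filter P, (2 * U.card : ℝ) ^ (VJ J).card *
        ((n : ℝ) ^ (ν(α) - (VJ J).card) * p ^ ((HE H).card - J.card)) ≤
        (2 * u + 1) ^ ν(α) * B := by
    intro J hJ
    rw [mem_filter, mem_powerset] at hJ
    refine mul_le_mul ?_ (h J hJ.1 hJ.2) (by positivity) (by positivity)
    have hu : (U.card : ℝ) ≤ u := by exact_mod_cast hU
    have hu0 : (0 : ℝ) ≤ u := Nat.cast_nonneg _
    calc (2 * U.card : ℝ) ^ (VJ J).card ≤ (2 * u + 1) ^ (VJ J).card :=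
          pow_le_pow_left₀ (by positivity) (by linarith) _
      _ ≤ (2 * u + 1) ^ ν(α) :=
          pow_le_pow_right₀ (by linarith) (card_le_univ _)
  refine (sum_le_sum h1).trans ?_
  rw [sum_const, nsmul_eq_mul]
  unfold cU
  rw [mul_assoc]
  refine mul_le_mul_of_nonneg_right ?_ (by positivity)
  have := card_le_card (filter_subset P (HE H).powerset)
  rw [card_powerset] at this
  exact_mod_cast this

lemma inter_nonempty_iff (ψ : α ↪ Fin n) (U : ES(n)) :
    (im H ψ ∩ U).Nonempty ↔ (Jof H ψ U).Nonempty := by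
  rw [← card_pos, ← card_pos, Jof_card]

lemma sumA (h : Up H C n p) {u : ℕ} {U : ES(n)} (hU : U.card ≤ u) :
    ∑ K ∈ cps H n with 2 ≤ (K ∩ U).card ∧ ¬ K ⊆ U, p ^ (K \ U).card ≤ cU H u * tht H n := by
  refine (sum_cps_le (H := H) (fun K => 2 ≤ (K ∩ U).card ∧ ¬ K ⊆ U)
    (fun K => p ^ (K \ U).card) fun K => pow_nonneg h.p0 _).trans ?_
  have := sum_bound (H := H) (n := n) h.p0 hU (fun J => 2 ≤ J.card ∧ J ≠ HE H)
    (tht_pos (by have := h.hn; omega)).le (fun J hJ hP => h.w2 J hJ hP.2 hP.1)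
  refine le_trans (le_of_eq (sum_congr ?_ fun _ _ => rfl)) this
  ext ψ
  simp only [mem_filter, mem_univ, true_and, Jof_card, ne_eq, Jof_eq_iff]

lemma emb_term_le (hH : Strictly2Balanced H) (h3 : 3 ≤ (HE H).card) (h : Up H C n p)
    (J : Finset (Sym2 α)) (hJ : J ⊆ HE H) (hne : J.Nonempty) :
    (n : ℝ) ^ (ν(α) - (VJ J).card) * p ^ ((HE H).card - J.card) ≤ max (lam H n p) 1 := by
  have hn := h.hn
  have hn1 : (1:ℝ) ≤ n := by exact_mod_cast (by omega : 1 ≤ n)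
  by_cases hJ2 : 2 ≤ J.card
  · by_cases hJe : J = HE H
    · subst hJe
      rw [sb_cover hH, card_univ]
      simp
    · exact (h.w2 J hJ hJe hJ2).trans ((tht_le_one h3 (by omega)).trans (le_max_right _ _))
  · have hJ1 : J.card = 1 := by have := card_pos.2 hne; omega
    rw [hJ1]
    refine le_trans ?_ (le_max_left _ _)
    unfold lam
    refine mul_le_mul_of_nonneg_right ?_ (pow_nonneg h.p0 _)
    exact pow_le_pow_right₀ hn1 (Nat.sub_le_sub_left (VJ_card_two hJ hne) _)

lemma sumB_emb (hH : Strictly2Balanced H) (h3 : 3 ≤ (HE H).card) (h : Up H C n p) {u : ℕ}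
    {U : ES(n)} (hU : U.card ≤ u) :
    ∑ ψ : α ↪ Fin n with (im H ψ ∩ U).Nonempty, p ^ (im H ψ \ U).card ≤
      cU H u * max (lam H n p) 1 := by
  have := sum_bound (H := H) (n := n) h.p0 hU (fun J => J.Nonempty)
    (B := max (lam H n p) 1) (le_max_of_le_right zero_le_one)
    (fun J hJ hP => emb_term_le hH h3 h J hJ hP)
  refine le_trans (le_of_eq (sum_congr ?_ fun _ _ => rfl)) this
  ext ψ
  simp only [mem_filter, mem_univ, true_and, inter_nonempty_iff]

lemma sumB (hH : Strictly2Balanced H) (h3 : 3 ≤ (HE H).card) (h : Up H C n p) {u : ℕ}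
    {U : ES(n)} (hU : U.card ≤ u) :
    ∑ K ∈ cps H n with (K ∩ U).Nonempty, p ^ (K \ U).card ≤ cU H u * max (lam H n p) 1 := by
  refine (sum_cps_le (H := H) (fun K => (K ∩ U).Nonempty)
    (fun K => p ^ (K \ U).card) fun K => pow_nonneg h.p0 _).trans ?_
  refine le_trans (le_of_eq (sum_congr ?_ fun _ _ => rfl)) (sumB_emb hH h3 h hU)
  ext ψ
  simp only [mem_filter, mem_univ, true_and]

lemma Win.max_eq (h : Win H C n p) : max (lam H n p) 1 = lam H n p := max_eq_left h.lam1

lemma Win.p_pos (h : Win H C n p) (hH : Strictly2Balanced H) : 0 < p := by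
  rcases h.p0.lt_or_eq with h' | h'
  · exact h'
  · exfalso
    have h2 := h.lam1
    have he := sb_e2 hH
    unfold lam at h2
    rw [← h', zero_pow (by omega)] at h2
    norm_num at h2

lemma p_le_tht (h : Up H C n p) (h3 : 3 ≤ (HE H).card) : p ≤ tht H n := by
  obtain ⟨f, hf⟩ : (HE H).Nonempty := card_pos.1 (by omega)
  have hc : ((HE H).erase f).card = (HE H).card - 1 := card_erase_of_mem hf
  have := h.w2 ((HE H).erase f) (erase_subset _ _) (by intro h'; rw [h'] at hc; omega)
    (by omega)
  rw [hc, show (HE H).card - ((HE H).card - 1) = 1 by omega, pow_one] at this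
  have hn := h.hn
  have hn1 : (1:ℝ) ≤ n := by exact_mod_cast (by omega : 1 ≤ n)
  have h2 : (1:ℝ) ≤ (n:ℝ) ^ (ν(α) - (VJ ((HE H).erase f)).card) := one_le_pow₀ hn1
  nlinarith [h.p0]

end

/-! ### Bridge to the frozen definitions -/

/-- Admissible parameters of a trivial function. -/
def Triv (H : SimpleGraph α) (c : V → ZMod 2) (b : ZMod 2) : Prop :=
  (IsEulerianGraph H ∨ ∀ x, c x = 0) ∧ (Odd (eCount H) → b = 0)

/-- The trivial function `xy ↦ c x + c y + b`. -/
def tf (c : V → ZMod 2) (b : ZMod 2) : Sym2 V → ZMod 2 :=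
  Sym2.lift ⟨fun x y => c x + c y + b, fun x y => by ring⟩

@[simp] lemma tf_mk (c : V → ZMod 2) (b : ZMod 2) (x y : V) : tf c b s(x, y) = c x + c y + b := rfl

section
variable [Fintype α] {H : SimpleGraph α} {n : ℕ} {s : ES(n)}

lemma edgeSet_from (hs : s ⊆ EE n) : (fromEdgeSet (↑s : Set (E2(n)))).edgeSet = ↑s := by
  rw [edgeSet_fromEdgeSet]
  ext g
  simp only [Set.mem_sdiff, mem_coe, Sym2.mem_diagSet]
  exact ⟨fun h => h.1, fun h => ⟨h, mem_EE.1 (hs h)⟩⟩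

lemma copy_of_subgraph (hs : s ⊆ EE n)
    (K : (fromEdgeSet (↑s : Set (E2(n)))).Subgraph) (hK : Nonempty (H ≃g K.coe)) :
    ∃ K' ∈ cps H n, K' ⊆ s ∧ K.edgeSet = ↑K' := by
  obtain ⟨φ⟩ := hK
  let ψ : α ↪ Fin n := φ.toEquiv.toEmbedding.trans (Function.Embedding.subtype _)
  have hE : K.edgeSet = ↑(im H ψ) := by
    ext g
    simp only [mem_coe, mem_im]
    constructor
    · intro hg
      induction g with
      | _ x y =>
        have hadj : K.Adj x y := by simpa using hg
        have hx := K.edge_vert hadj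
        have hy := K.edge_vert hadj.symm
        refine ⟨s(φ.symm ⟨x, hx⟩, φ.symm ⟨y, hy⟩), ?_, ?_⟩
        · rw [mem_HE, mem_edgeSet, ← φ.map_adj_iff]
          simpa using hadj
        · simp [ψ]
    · rintro ⟨f, hf, rfl⟩
      induction f with
      | _ a b =>
        rw [mem_HE, mem_edgeSet, ← φ.map_adj_iff] at hf
        simpa [ψ] using hf
  refine ⟨im H ψ, im_mem_cps ψ, ?_, hE⟩
  have h1 : K.edgeSet ⊆ (fromEdgeSet (↑s : Set (E2(n)))).edgeSet := K.edgeSet_subset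
  rw [edgeSet_from hs, hE] at h1
  exact_mod_cast h1

lemma subgraph_of_copy (hs : s ⊆ EE n) {K : ES(n)} (hK : K ∈ cps H n)
    (hKs : K ⊆ s) :
    ∃ K' : (fromEdgeSet (↑s : Set (E2(n)))).Subgraph, Nonempty (H ≃g K'.coe) ∧
      K'.edgeSet = ↑K := by
  obtain ⟨ψ, rfl⟩ := mem_cps.1 hK
  have hadj : ∀ a b, H.Adj a b → (fromEdgeSet (↑s : Set (E2(n)))).Adj (ψ a) (ψ b) := by
    intro a b hab
    rw [fromEdgeSet_adj]
    refine ⟨?_, fun h => hab.ne (ψ.injective h)⟩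
    exact hKs (mem_im.2 ⟨s(a, b), mem_HE.2 (by simpa using hab), by simp⟩)
  refine ⟨⟨Set.range ψ, fun x y => ∃ a b, H.Adj a b ∧ ψ a = x ∧ ψ b = y, ?_, ?_, ?_⟩, ⟨?_⟩, ?_⟩
  · rintro x y ⟨a, b, hab, rfl, rfl⟩; exact hadj a b hab
  · rintro x y ⟨a, b, hab, rfl, rfl⟩; exact ⟨a, rfl⟩
  · exact ⟨fun x y ⟨a, b, hab, hx, hy⟩ => ⟨b, a, hab.symm, hy, hx⟩⟩
  · refine ⟨Equiv.ofInjective ψ ψ.injective, ?_⟩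
    intro a b
    simp only [Subgraph.coe_adj, Equiv.ofInjective_apply]
    constructor
    · rintro ⟨a', b', h, h1, h2⟩
      rwa [ψ.injective h1, ψ.injective h2] at h
    · intro h; exact ⟨a, b, h, rfl, rfl⟩
  · ext g
    induction g with
    | _ x y =>
      simp only [Subgraph.mem_edgeSet, mem_coe, mem_im]
      constructor
      · rintro ⟨a, b, hab, rfl, rfl⟩
        exact ⟨s(a, b), mem_HE.2 (by simpa using hab), by simp⟩
      · rintro ⟨f, hf, hfm⟩
        induction f with
        | _ a b =>
          have hab : H.Adj a b := by simpa using mem_HE.1 hf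
          rw [Sym2.map_mk, Sym2.eq_iff] at hfm
          rcases hfm with ⟨h1, h2⟩ | ⟨h1, h2⟩
          · exact ⟨a, b, hab, h1, h2⟩
          · exact ⟨b, a, hab.symm, h2, h1⟩

/-- The combinatorial form of `Q`. -/
def cQ (H : SimpleGraph α) (s : ES(n)) : Prop :=
  ∀ g ∈ s, ∃ K ∈ cps H n, g ∈ K ∧ K ⊆ s

/-- A function is even on all copies inside `s`. -/
def EvenOn (H : SimpleGraph α) (s : ES(n)) (F : E2(n) → ZMod 2) : Prop :=
  ∀ K ∈ cps H n, K ⊆ s → ∑ g ∈ K, F g = 0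

/-- The combinatorial (dual) form of `T`. -/
def cT (H : SimpleGraph α) (s : ES(n)) : Prop :=
  ∀ F : E2(n) → ZMod 2, EvenOn H s F →
    ∃ c b, Triv H c b ∧ ∀ g ∈ s, F g = tf c b g

lemma cQ_of_memQ (hs : s ⊆ EE n) (h : memQ H (fromEdgeSet (↑s : Set (E2(n))))) :
    cQ H s := by
  intro g hg
  obtain ⟨K, hK, hgK⟩ := h g (by rw [edgeSet_from hs]; exact hg)
  obtain ⟨K', h1, h2, h3⟩ := copy_of_subgraph hs K hK
  refine ⟨K', h1, ?_, h2⟩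
  rw [h3] at hgK; exact_mod_cast hgK

lemma parity_single {x : Fin n} {g : E2(n)} (hg : ¬ g.IsDiag) :
    parityMap x (setVec {g}) = if x ∈ g then 1 else 0 := by
  induction g with
  | _ a b =>
    rw [Sym2.mk_isDiag_iff] at hg
    simp only [parityMap, LinearMap.coe_mk, AddHom.coe_mk, setVec, Set.mem_singleton_iff]
    split_ifs with hx
    · obtain ⟨y, hy⟩ := hx
      rw [hy]
      have hxy : y ≠ x := by
        rintro rfl
        rw [Sym2.eq_iff] at hy
        grind
      rw [sum_eq_single_of_mem y (mem_erase.2 ⟨hxy, mem_univ _⟩)]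
      · simp
      · intro w hw hwy
        rw [if_neg]
        intro h
        rw [Sym2.eq_iff] at h
        grind
    · refine sum_eq_zero fun w _ => ?_
      rw [if_neg]
      intro h
      exact hx (h ▸ Sym2.mem_mk_left x w)

lemma total_single (g : E2(n)) : totalMap (setVec ({g} : Set (E2(n)))) = 1 := by
  simp only [totalMap, LinearMap.coe_mk, AddHom.coe_mk, setVec, Set.mem_singleton_iff]
  rw [sum_eq_single g] <;> simp +contextual

lemma setVec_finset (K : ES(n)) :
    setVec (↑K : Set (E2(n))) = ∑ g ∈ K, setVec {g} := by
  funext x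
  rw [Finset.sum_apply]
  simp [setVec]

lemma copy_mem_wSpace (hs : s ⊆ EE n) {K : ES(n)} (hK : K ∈ cps H n)
    (hKs : K ⊆ s) :
    setVec (↑K : Set (E2(n))) ∈ wSpace H (fromEdgeSet (↑s : Set (E2(n)))) := by
  have hedge : setVec (↑K : Set (E2(n))) ∈
      edgeSpace (fromEdgeSet (↑s : Set (E2(n)))) := by
    rw [setVec_finset]
    refine Submodule.sum_mem _ fun g hg => Submodule.subset_span ⟨g, ?_, rfl⟩
    rw [edgeSet_from hs]; exact hKs hg
  have hcyc : IsEulerianGraph H → setVec (↑K : Set (E2(n))) ∈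
      cycleSpace (fromEdgeSet (↑s : Set (E2(n)))) := by
    intro hE
    refine ⟨hedge, ?_⟩
    simp only [Submodule.coe_iInf, Set.mem_iInter, SetLike.mem_coe, LinearMap.mem_ker]
    intro x
    rw [setVec_finset, map_sum,
      sum_congr rfl fun g hg => parity_single (mem_EE.1 (hs (hKs hg)))]
    obtain ⟨ψ, rfl⟩ := mem_cps.1 hK
    unfold im
    rw [sum_map]
    by_cases hx : ∃ u, ψ u = x
    · obtain ⟨u, rfl⟩ := hx
      have h1 : ∀ f : Sym2 α, (ψ u ∈ ψ.sym2Map f) ↔ u ∈ f := by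
        intro f
        rw [Function.Embedding.sym2Map_apply, Sym2.mem_map]
        exact ⟨fun ⟨w, hw, h⟩ => ψ.injective h ▸ hw, fun h => ⟨u, h, rfl⟩⟩
      simp only [h1]
      rw [← sum_filter, sum_const, nsmul_eq_mul, mul_one]
      have h2 := hE u
      rw [← inc_card] at h2
      exact (ZMod.natCast_eq_zero_iff_even).2 h2
    · refine sum_eq_zero fun f _ => if_neg ?_
      rw [Function.Embedding.sym2Map_apply, Sym2.mem_map]
      rintro ⟨w, _, h⟩
      exact hx ⟨w, h⟩
  have hd : ¬ Odd (eCount H) → setVec (↑K : Set (E2(n))) ∈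
      dSpace (fromEdgeSet (↑s : Set (E2(n)))) := by
    intro ho
    refine ⟨hedge, ?_⟩
    simp only [SetLike.mem_coe, LinearMap.mem_ker]
    rw [setVec_finset, map_sum, sum_congr rfl fun g _ => total_single g, sum_const,
      nsmul_eq_mul, mul_one, cps_card hK, ← eCount_eq]
    exact (ZMod.natCast_eq_zero_iff_even).2 (Nat.not_odd_iff_even.1 ho)
  unfold wSpace
  split_ifs with h1 h2 h2
  · exact hcyc h1
  · exact ⟨hcyc h1, hd h2⟩
  · exact hedge
  · exact hd h2

lemma memT_of_cT (hs : s ⊆ EE n) (h : cT H s) :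
    memT H (fromEdgeSet (↑s : Set (E2(n)))) := by
  unfold memT
  apply le_antisymm
  · unfold hSpace
    rw [Submodule.span_le]
    rintro f ⟨K, hK, rfl⟩
    obtain ⟨K', h1, h2, h3⟩ := copy_of_subgraph hs K hK
    rw [h3]
    exact copy_mem_wSpace hs h1 h2
  · intro w hw
    by_contra hnot
    obtain ⟨f, hf, hker⟩ := Submodule.exists_le_ker_of_notMem hnot
    set F : E2(n) → ZMod 2 := fun g => f (setVec {g}) with hF
    have hev : EvenOn H s F := by
      intro K hK hKs
      obtain ⟨K', h1, h2⟩ := subgraph_of_copy hs hK hKs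
      have : setVec (↑K : Set (E2(n))) ∈ LinearMap.ker f :=
        hker (Submodule.subset_span ⟨K', h1, by rw [h2]⟩)
      rw [LinearMap.mem_ker, setVec_finset, map_sum] at this
      exact this
    obtain ⟨c, b, ⟨hT1, hT2⟩, hag⟩ := h F hev
    have hedge : w ∈ edgeSpace (fromEdgeSet (↑s : Set (E2(n)))) := by
      unfold wSpace at hw
      split_ifs at hw
      · exact hw.1
      · exact hw.1.1
      · exact hw
      · exact hw.1
    have hid : f w = ∑ x : Fin n, c x * parityMap (V := Fin n) x w + b * totalMap (V := Fin n) w := by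
      have key : Set.EqOn f ((∑ x : Fin n, c x • parityMap (V := Fin n) x) + b • totalMap (V := Fin n) : EdgeVec (Fin n) →ₗ[ZMod 2] ZMod 2)
          {f | ∃ e ∈ (fromEdgeSet (↑s : Set (E2(n)))).edgeSet, f = setVec {e}} := by
        rintro _ ⟨g, hg, rfl⟩
        rw [edgeSet_from hs] at hg
        have hd := mem_EE.1 (hs hg)
        have h1 := hag g hg
        simp only [hF] at h1
        rw [h1]
        simp only [LinearMap.add_apply, LinearMap.sum_apply, LinearMap.smul_apply, smul_eq_mul,
          parity_single hd, total_single, mul_one, mul_ite, mul_zero]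
        rw [← sum_filter]
        induction g with
        | _ x y =>
          rw [Sym2.mk_isDiag_iff] at hd
          have : univ.filter (fun z => z ∈ s(x, y)) = {x, y} := by ext z; simp
          rw [this, sum_pair hd, tf_mk]
      have h2 := LinearMap.eqOn_span key hedge
      rw [h2]
      simp
    have hz1 : ∑ x, c x * parityMap x w = 0 := by
      refine sum_eq_zero fun x _ => ?_
      rcases hT1 with hE | h0
      · have : w ∈ cycleSpace (fromEdgeSet (↑s : Set (E2(n)))) := by
          unfold wSpace at hw
          rw [if_pos hE] at hw
          split_ifs at hw
          · exact hw
          · exact hw.1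
        have h3 := this.2
        simp only [Submodule.coe_iInf, Set.mem_iInter, SetLike.mem_coe, LinearMap.mem_ker] at h3
        rw [h3 x, mul_zero]
      · rw [h0 x, zero_mul]
    have hz2 : b * totalMap w = 0 := by
      by_cases ho : Odd (eCount H)
      · rw [hT2 ho, zero_mul]
      · have : w ∈ dSpace (fromEdgeSet (↑s : Set (E2(n)))) := by
          unfold wSpace at hw
          simp only [if_neg ho] at hw
          split_ifs at hw
          · exact hw.2
          · exact hw
        have h3 := this.2
        simp only [SetLike.mem_coe, LinearMap.mem_ker] at h3
        rw [h3, mul_zero]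
    rw [hz1, hz2, add_zero] at hid
    exact hf hid

lemma EE_eq (n : ℕ) : (⊤ : SimpleGraph (Fin n)).edgeFinset = EE n := by
  ext g
  rw [mem_edgeFinset, mem_EE]
  simp

/-- The probability in the theorem is bounded by the combinatorial one. -/
lemma erProb_le {p : ℝ} (hp : 0 ≤ p) (hp1 : p ≤ 1) :
    erProb n p {G | memQ H G ∧ ¬ memT H G} ≤ pr (EE n) p (fun s => cQ H s ∧ ¬ cT H s) := by
  unfold erProb pr ex
  rw [EE_eq]
  refine sum_le_sum fun s hs => ?_
  have hs' := mem_powerset.1 hs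
  have hw : 0 ≤ p ^ s.card * (1 - p) ^ ((EE n).card - s.card) :=
    mul_nonneg (pow_nonneg hp _) (pow_nonneg (by linarith) _)
  split_ifs with h
  · beta_reduce
    rw [ind_true, mul_one]
    exact ⟨cQ_of_memQ hs' h.1, fun hT => h.2 (memT_of_cT hs' hT)⟩
  · exact mul_nonneg hw (ind_nonneg _)

lemma erProb_nonneg {p : ℝ} (hp : 0 ≤ p) (hp1 : p ≤ 1) (A : Set (SimpleGraph (Fin n))) :
    0 ≤ erProb n p A := by
  unfold erProb
  refine sum_nonneg fun s _ => ?_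
  split_ifs
  · exact mul_nonneg (pow_nonneg hp _) (pow_nonneg (by linarith) _)
  · exact le_rfl

end

/-! ### Dense algebra: functions even on all copies are trivial -/
section
variable [Fintype α] {H : SimpleGraph α}

lemma HE_not_diag {f : Sym2 α} (hf : f ∈ HE H) : ¬ f.IsDiag := by
  rw [mem_HE] at hf
  exact H.not_isDiag_of_mem_edgeSet hf

/-- The sum of a trivial function over a copy. -/
lemma sum_tf (c : V → ZMod 2) (b : ZMod 2) (ψ : α → V) :
    ∑ f ∈ HE H, tf c b (Sym2.map ψ f) =
      ∑ u, ((inc H u).card : ZMod 2) * c (ψ u) + ((HE H).card : ZMod 2) * b := by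
  have h1 : ∀ f ∈ HE H, tf c b (Sym2.map ψ f) = (∑ u, if u ∈ f then c (ψ u) else 0) + b := by
    intro f hf
    have hd := HE_not_diag hf
    induction f with
    | _ x y =>
      rw [Sym2.mk_isDiag_iff] at hd
      rw [← sum_filter]
      have : univ.filter (fun z => z ∈ s(x, y)) = {x, y} := by ext z; simp
      rw [this, sum_pair hd]
      rfl
  rw [sum_congr rfl h1, sum_add_distrib, sum_comm]
  congr 1
  · refine sum_congr rfl fun u _ => ?_
    rw [← sum_filter, sum_const, nsmul_eq_mul]
    rfl
  · rw [sum_const, nsmul_eq_mul]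

lemma even_cast {k : ℕ} (h : Even k) : ((k : ℕ) : ZMod 2) = 0 := (ZMod.natCast_eq_zero_iff_even).2 h
lemma odd_cast {k : ℕ} (h : Odd k) : ((k : ℕ) : ZMod 2) = 1 := (ZMod.natCast_eq_one_iff_odd).2 h

/-- Trivial functions are even on copies. -/
lemma triv_even {c : V → ZMod 2} {b : ZMod 2} (h : Triv H c b) (ψ : α → V) :
    ∑ f ∈ HE H, tf c b (Sym2.map ψ f) = 0 := by
  rw [sum_tf]
  have h1 : ∑ u, ((inc H u).card : ZMod 2) * c (ψ u) = 0 := by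
    refine sum_eq_zero fun u _ => ?_
    rcases h.1 with hE | h0
    · rw [inc_card, even_cast (hE u), zero_mul]
    · rw [h0, mul_zero]
  have h2 : ((HE H).card : ZMod 2) * b = 0 := by
    rcases Nat.even_or_odd (HE H).card with he | ho
    · rw [even_cast he, zero_mul]
    · rw [h.2 (by rw [eCount_eq]; exact ho), mul_zero]
  rw [h1, h2, add_zero]

lemma z2_add_self (x : ZMod 2) : x + x = 0 := CharTwo.add_self_eq_zero x

/-- The embedding updated at one vertex. -/
def upd1 (ρ : α ↪ V) (a : α) (x : V) (hx : ∀ w, ρ w ≠ x) : α ↪ V :=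
  ⟨Function.update ρ a x, by
    intro i j hij
    by_cases hi : i = a <;> by_cases hj : j = a
    · rw [hi, hj]
    · subst hi; simp [Function.update_of_ne hj] at hij; exact absurd hij.symm (hx j)
    · subst hj; simp [Function.update_of_ne hi] at hij; exact absurd hij (hx i)
    · rw [Function.update_of_ne hi, Function.update_of_ne hj] at hij; exact ρ.injective hij⟩

lemma upd1_apply (ρ : α ↪ V) (a : α) (x : V) (hx : ∀ w, ρ w ≠ x) (w : α) :
    upd1 ρ a x hx w = if w = a then x else ρ w := by
  show Function.update ρ a x w = _
  rw [Function.update_apply]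

lemma exists_avoid [Fintype V] (A : Finset V) (h : ν(α) + A.card ≤ Fintype.card V) :
    ∃ ρ : α ↪ V, ∀ w, ρ w ∉ A := by
  have : ν(α) ≤ Fintype.card {x : V // x ∈ Aᶜ} := by
    rw [Fintype.card_coe, card_compl]; omega
  obtain ⟨ρ⟩ := Function.Embedding.nonempty_of_card_le this
  exact ⟨ρ.trans (Function.Embedding.subtype _), fun w => mem_compl.1 (ρ w).2⟩

lemma four_cycle [Fintype V] (hcard : ν(α) + 4 ≤ Fintype.card V)
    {φ : Sym2 V → ZMod 2} (hφ : ∀ ψ : α ↪ V, ∑ f ∈ HE H, φ (Sym2.map ψ f) = 0)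
    (hne : (HE H).Nonempty)
    {u w z z' : V} (_h1 : u ≠ w) (h2 : u ≠ z) (h3 : u ≠ z') (h4 : w ≠ z) (h5 : w ≠ z') (_h6 : z ≠ z') :
    φ s(u, z) + φ s(w, z) + φ s(u, z') + φ s(w, z') = 0 := by
  obtain ⟨f0, hf0⟩ := hne
  obtain ⟨a, a', rfl⟩ : ∃ a a', f0 = s(a, a') := by
    induction f0 with
    | _ x y => exact ⟨x, y, rfl⟩
  have haa : a ≠ a' := by
    have := HE_not_diag hf0
    rwa [Sym2.mk_isDiag_iff] at this
  obtain ⟨ρ, hρ⟩ := exists_avoid (α := α) ({u, w, z, z'} : Finset V)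
    (le_trans (Nat.add_le_add_left card_le_four _) hcard)
  simp only [mem_insert, mem_singleton, not_or] at hρ
  have e1 : ∀ x y (hx : ∀ i, ρ i ≠ x) (hy : ∀ i, ρ i ≠ y) (hxy : x ≠ y),
      ∃ ψ : α ↪ V, ∀ i, ψ i = if i = a' then y else if i = a then x else ρ i := by
    intro x y hx hy hxy
    refine ⟨upd1 (upd1 ρ a x hx) a' y (fun i => ?_), fun i => ?_⟩
    · rw [upd1_apply]; split_ifs
      · exact hxy
      · exact hy i
    · rw [upd1_apply, upd1_apply]
  obtain ⟨ψ1, k1⟩ := e1 u z (fun i => (hρ i).1) (fun i => (hρ i).2.2.1) h2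
  obtain ⟨ψ2, k2⟩ := e1 w z (fun i => (hρ i).2.1) (fun i => (hρ i).2.2.1) h4
  obtain ⟨ψ3, k3⟩ := e1 u z' (fun i => (hρ i).1) (fun i => (hρ i).2.2.2) h3
  obtain ⟨ψ4, k4⟩ := e1 w z' (fun i => (hρ i).2.1) (fun i => (hρ i).2.2.2) h5
  have hs : ∑ f ∈ HE H, (φ (Sym2.map ψ1 f) + φ (Sym2.map ψ2 f) + φ (Sym2.map ψ3 f) +
      φ (Sym2.map ψ4 f)) = 0 := by
    simp only [sum_add_distrib, hφ, add_zero]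
  rw [sum_eq_single_of_mem _ hf0] at hs
  · simpa [k1, k2, k3, k4, haa] using hs
  · intro f hf hff
    induction f with
    | _ x y =>
      have hd := HE_not_diag hf
      rw [Sym2.mk_isDiag_iff] at hd
      simp only [Sym2.map_mk, k1, k2, k3, k4]
      have hne1 : ¬ (x = a ∧ y = a') := fun h => hff (by rw [h.1, h.2])
      have hne2 : ¬ (x = a' ∧ y = a) := fun h => hff (by rw [h.1, h.2, Sym2.eq_swap])
      have q : ∀ A B : ZMod 2, A + A + B + B = 0 := by decide
      have q' : ∀ A B : ZMod 2, A + B + A + B = 0 := by decide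
      by_cases xa : x = a <;> by_cases xa' : x = a' <;> by_cases ya : y = a <;>
        by_cases ya' : y = a' <;> simp_all

/-- Dense algebra lemma. -/
lemma dense_alg [Fintype V] (hcard : ν(α) + 4 ≤ Fintype.card V)
    {φ : Sym2 V → ZMod 2} (hφ : ∀ ψ : α ↪ V, ∑ f ∈ HE H, φ (Sym2.map ψ f) = 0)
    (hne : (HE H).Nonempty) :
    ∃ c b, Triv H c b ∧ ∀ x y : V, x ≠ y → φ s(x, y) = tf c b s(x, y) := by
  have fc := fun {u w z z' : V} => four_cycle hcard hφ hne (u := u) (w := w) (z := z) (z' := z')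
  have hα : Nonempty α := by
    obtain ⟨f, hf⟩ := hne
    induction f with
    | _ x y => exact ⟨x⟩
  have hα1 : 1 ≤ ν(α) := Fintype.card_pos
  obtain ⟨r0, r1, r2, h01, h02, h12⟩ := Fintype.two_lt_card_iff.1 (show 2 < Fintype.card V by omega)
  set b : ZMod 2 := φ s(r0, r1) + φ s(r1, r2) + φ s(r0, r2) with hb
  set c : V → ZMod 2 := fun x => if x = r0 then 0 else φ s(r0, x) + b with hc
  have tri : ∀ x y z z' : V, x ≠ y → x ≠ z → y ≠ z → x ≠ z' → y ≠ z' →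
      φ s(x, y) + φ s(y, z) + φ s(x, z) = φ s(x, y) + φ s(y, z') + φ s(x, z') := by
    intro x y z z' hxy hxz hyz hxz' hyz'
    by_cases hz : z = z'
    · rw [hz]
    · have := fc hxy hxz hxz' hyz hyz' hz
      have q : ∀ A B C D E : ZMod 2, A + B + C + D = 0 → E + B + A = E + D + C := by decide
      exact q _ _ _ _ _ this
  have sw : ∀ x y : V, φ s(x, y) = φ s(y, x) := fun x y => by rw [Sym2.eq_swap]
  have key : ∀ x y : V, x ≠ y → x ≠ r0 → y ≠ r0 → φ s(r0, x) + φ s(x, y) + φ s(r0, y) = b := by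
    intro x y hxy hx hy
    by_cases hx2 : x = r2
    · subst hx2
      rw [tri r0 x y r1 hx.symm hy.symm hxy h01 h12.symm, hb, sw x r1]; ring
    · rw [tri r0 x y r2 hx.symm hy.symm hxy h02 hx2]
      have := tri r0 r2 x r1 h02 hx.symm (Ne.symm hx2) h01 h12.symm
      rw [hb, sw r1 r2, sw x r2]
      have q : ∀ A B C D E : ZMod 2, A + B + C = A + D + E → C + B + A = E + D + A := by decide
      exact q _ _ _ _ _ this
  have hrep : ∀ x y : V, x ≠ y → φ s(x, y) = tf c b s(x, y) := by
    intro x y hxy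
    rw [tf_mk]
    simp only [hc]
    have q : ∀ A B : ZMod 2, A = 0 + (A + B) + B := by decide
    have q' : ∀ A B : ZMod 2, A = (A + B) + 0 + B := by decide
    have q'' : ∀ A B C D : ZMod 2, A + B + C = D → B = (A + D) + (C + D) + D := by decide
    by_cases hx : x = r0 <;> by_cases hy : y = r0
    · exact absurd (hx.trans hy.symm) hxy
    · rw [if_pos hx, if_neg hy, hx]; exact q _ _
    · rw [if_pos hy, if_neg hx, hy, sw x r0]; exact q' _ _
    · rw [if_neg hx, if_neg hy]; exact q'' _ _ _ _ (key x y hxy hx hy)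
  have hmap : ∀ ψ : α ↪ V, ∑ u, ((inc H u).card : ZMod 2) * c (ψ u) + ((HE H).card : ZMod 2) * b = 0 := by
    intro ψ
    rw [← sum_tf, ← hφ ψ]
    refine sum_congr rfl fun f hf => ?_
    have hd := map_not_diag (ψ := ψ) hf
    induction f with
    | _ x y =>
      rw [Sym2.map_mk, Sym2.mk_isDiag_iff] at hd
      rw [Sym2.map_mk, hrep _ _ hd]
  by_cases hE : IsEulerianGraph H
  · refine ⟨c, b, ⟨Or.inl hE, fun ho => ?_⟩, hrep⟩
    obtain ⟨ρ, -⟩ := exists_avoid (α := α) (V := V) ∅ (by simp; omega)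
    have := hmap ρ
    rw [sum_eq_zero, zero_add, ← eCount_eq, odd_cast ho, one_mul] at this
    · exact this
    · intro u _; rw [inc_card, even_cast (hE u), zero_mul]
  · unfold IsEulerianGraph at hE
    push Not at hE
    obtain ⟨u, hu⟩ := hE
    rw [← inc_card, Nat.not_even_iff_odd] at hu
    have hcc : ∀ x y, c x = c y := by
      intro x y
      obtain ⟨ρ, hρ⟩ := exists_avoid (α := α) ({x, y} : Finset V)
        (le_trans (Nat.add_le_add_left card_le_two _) (by omega))
      simp only [mem_insert, mem_singleton, not_or] at hρ
      have m1 := hmap (upd1 ρ u x (fun i => (hρ i).1))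
      have m2 := hmap (upd1 ρ u y (fun i => (hρ i).2))
      rw [← add_sum_erase _ _ (mem_univ u)] at m1 m2
      have e1 : ∀ (z : V) (hz : ∀ w, ρ w ≠ z), ∑ w ∈ univ.erase u, ((inc H w).card : ZMod 2) * c (upd1 ρ u z hz w)
          = ∑ w ∈ univ.erase u, ((inc H w).card : ZMod 2) * c (ρ w) := by
        intro z hz
        refine sum_congr rfl fun w hw => ?_
        rw [upd1_apply, if_neg (ne_of_mem_erase hw)]
      rw [e1, upd1_apply, if_pos rfl, odd_cast hu, one_mul] at m1 m2
      have q : ∀ A B C D : ZMod 2, A + C + D = 0 → B + C + D = 0 → A = B := by decide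
      exact q _ _ _ _ m1 m2
    have hc0 : ∀ x, c x = 0 := fun x => by rw [hcc x r0]; simp [hc]
    refine ⟨c, b, ⟨Or.inr hc0, fun ho => ?_⟩, hrep⟩
    obtain ⟨ρ, -⟩ := exists_avoid (α := α) (V := V) ∅ (by simp; omega)
    have := hmap ρ
    rw [sum_eq_zero, zero_add, ← eCount_eq, odd_cast ho, one_mul] at this
    · exact this
    · intro u _; rw [hc0, mul_zero]
end

/-! ### Upper bounds on the number of copies through one or two edges -/
section
variable [Fintype α] {H : SimpleGraph α} {n : ℕ} {p C : ℝ}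

/-- A property holding with high probability, uniformly in the window. -/
def Whp (H : SimpleGraph α) (C : ℝ) (P : ∀ n : ℕ, ℝ → ES(n) → Prop) : Prop :=
  ∀ ζ : ℝ, 0 < ζ → ∀ᶠ n in atTop, ∀ p, Win H C n p → pr (EE n) p (fun s => ¬ P n p s) ≤ ζ

lemma Whp.step {P Q : ∀ n : ℕ, ℝ → ES(n) → Prop} (hP : Whp H C P)
    (h : ∀ ζ : ℝ, 0 < ζ → ∀ᶠ n in atTop, ∀ p, Win H C n p →
      pr (EE n) p (fun s => P n p s ∧ ¬ Q n p s) ≤ ζ) : Whp H C Q := by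
  intro ζ hζ
  filter_upwards [hP (ζ / 2) (by positivity), h (ζ / 2) (by positivity)] with n h1 h2 p hw
  have : pr (EE n) p (fun s => ¬ Q n p s) ≤
      pr (EE n) p (fun s => ¬ P n p s ∨ (P n p s ∧ ¬ Q n p s)) :=
    pr_mono hw.p0 hw.p1 fun s _ hs => by tauto
  have h3 := pr_or (E := EE n) hw.p0 hw.p1 (fun s => ¬ P n p s) (fun s => P n p s ∧ ¬ Q n p s)
  linarith [h1 p hw, h2 p hw]

lemma Whp.and {P Q : ∀ n : ℕ, ℝ → ES(n) → Prop} (hP : Whp H C P) (hQ : Whp H C Q) :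
    Whp H C (fun n p s => P n p s ∧ Q n p s) := by
  refine Whp.step hP fun ζ hζ => ?_
  filter_upwards [hQ ζ hζ] with n h1 p hw
  refine le_trans (pr_mono hw.p0 hw.p1 fun s _ hs => ?_) (h1 p hw)
  tauto

/-- Copies through `g`. -/
def cpe (H : SimpleGraph α) {n : ℕ} (s : ES(n)) (g : E2(n)) :
    Finset (ES(n)) := (cps H n).filter fun K => g ∈ K ∧ K ⊆ s

/-- No two edges lie in too many common copies. -/
def U2 (H : SimpleGraph α) (R : ℕ) {n : ℕ} (s : ES(n)) : Prop :=
  ∀ g g', g ≠ g' → ((cps H n).filter fun K => g ∈ K ∧ g' ∈ K ∧ K ⊆ s).card ≤ R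

/-- Chains of copies. -/
def Ch (H : SimpleGraph α) {n : ℕ} (s : ES(n)) : ℕ → ES(n) → Prop
  | 0, _ => True
  | t + 1, U => ∃ K ∈ cps H n, 2 ≤ (K ∩ U).card ∧ ¬ K ⊆ U ∧ K ⊆ s ∧ Ch H s t (U ∪ K)

lemma chain_prob (h : Up H C n p) (m : ℕ) (t : ℕ) : ∀ (U : ES(n)), U ⊆ EE n →
    U.card + t * (HE H).card ≤ m →
    pr (EE n) p (fun s => U ⊆ s ∧ Ch H s t U) ≤ p ^ U.card * (cU H m * tht H n) ^ t := by
  induction t with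
  | zero =>
    intro U hU _
    simp only [pow_zero, mul_one]
    rw [← pr_subset hU]
    exact pr_mono h.p0 h.p1 fun s _ hs => hs.1
  | succ t ih =>
    intro U hU hm
    have e1 : (t + 1) * (HE H).card = t * (HE H).card + (HE H).card := by ring
    refine le_trans (pr_mono h.p0 h.p1 (Q := fun s => ∃ K ∈ (cps H n).filter
      (fun K => 2 ≤ (K ∩ U).card ∧ ¬ K ⊆ U), U ∪ K ⊆ s ∧ Ch H s t (U ∪ K)) ?_) ?_
    · rintro s - ⟨hs, K, hK, h2, h3, h4, h5⟩
      exact ⟨K, mem_filter.2 ⟨hK, h2, h3⟩, union_subset hs h4, h5⟩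
    · refine (pr_exists h.p0 h.p1 _ _).trans ?_
      have ht := tht_pos (H := H) (show 1 ≤ n by have := h.hn; omega)
      have hc := cU_ge_one (H := H) m
      refine (sum_le_sum (g := fun K => p ^ (K \ U).card *
        (p ^ U.card * (cU H m * tht H n) ^ t)) fun K hK => ?_).trans ?_
      · rw [mem_filter] at hK
        refine (ih (U ∪ K) (union_subset hU (cps_subset_EE hK.1)) ?_).trans (le_of_eq ?_)
        · have := card_union_le U K
          rw [cps_card hK.1] at this
          omega
        · rw [← mul_assoc, ← pow_add, card_sdiff_add_card, union_comm]
      · rw [← sum_mul]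
        have := sumA h (u := m) (U := U) (by omega)
        calc _ ≤ (cU H m * tht H n) * (p ^ U.card * (cU H m * tht H n) ^ t) := by
              refine mul_le_mul_of_nonneg_right ?_ (mul_nonneg (pow_nonneg h.p0 _) (by positivity))
              exact this
          _ = _ := by ring

lemma chain_of_many {s : ES(n)} {g g' : E2(n)} (hg : g ≠ g') (t : ℕ) :
    ∀ (U : ES(n)), g ∈ U → g' ∈ U →
    2 ^ (U.card + t * (HE H).card) < ((cps H n).filter fun K => g ∈ K ∧ g' ∈ K ∧ K ⊆ s).card →
    Ch H s t U := by
  induction t with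
  | zero => intro U _ _ _; trivial
  | succ t ih =>
    intro U hgU hgU' hc
    have e1 : (t + 1) * (HE H).card = t * (HE H).card + (HE H).card := by ring
    obtain ⟨K, hK, hKU⟩ : ∃ K ∈ (cps H n).filter fun K => g ∈ K ∧ g' ∈ K ∧ K ⊆ s, K ∉ U.powerset := by
      refine exists_mem_notMem_of_card_lt_card (lt_of_le_of_lt ?_ hc)
      rw [card_powerset]
      exact Nat.pow_le_pow_right (by norm_num) (by omega)
    rw [mem_filter] at hK
    rw [mem_powerset] at hKU
    refine ⟨K, hK.1, ?_, hKU, hK.2.2.2, ?_⟩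
    · rw [← card_pair hg]
      refine card_le_card fun x hx => ?_
      rw [mem_insert, mem_singleton] at hx
      rcases hx with rfl | rfl
      · exact mem_inter.2 ⟨hK.2.1, hgU⟩
      · exact mem_inter.2 ⟨hK.2.2.1, hgU'⟩
    · refine ih _ (mem_union_left _ hgU) (mem_union_left _ hgU') (lt_of_le_of_lt ?_ hc)
      have := card_union_le U K
      rw [cps_card hK.1] at this
      exact Nat.pow_le_pow_right (by norm_num) (by omega)

lemma EE_card_le : ((EE n).card : ℝ) ≤ (n : ℝ) ^ 2 := by
  have h1 : (EE n).card ≤ Fintype.card (Fin n × Fin n) := by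
    refine le_trans (card_le_univ _) ?_
    exact Fintype.card_le_of_surjective (fun q : Fin n × Fin n => s(q.1, q.2)) (fun g => by
      induction g with
      | _ x y => exact ⟨(x, y), rfl⟩)
  rw [Fintype.card_prod, Fintype.card_fin] at h1
  calc ((EE n).card : ℝ) ≤ ((n * n : ℕ) : ℝ) := by exact_mod_cast h1
    _ = _ := by push_cast; ring

lemma tht_pow_tendsto (h3 : 3 ≤ (HE H).card) (k : ℕ) :
    ∃ t : ℕ, 0 < t ∧ ∀ c : ℝ, Tendsto (fun n : ℕ => (n : ℝ) ^ k * (c * tht H n) ^ t) atTop (𝓝 0) := by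
  have hg := gam_pos h3
  obtain ⟨t, ht⟩ := exists_nat_gt (((k : ℝ) + 1) / gam H)
  have htg : (k : ℝ) + 1 < t * gam H := by rwa [div_lt_iff₀ hg] at ht
  refine ⟨t, ?_, fun c => ?_⟩
  · rcases Nat.eq_zero_or_pos t with h | h
    · subst h; simp at htg; have : (0:ℝ) ≤ k := Nat.cast_nonneg _; linarith
    · exact h
  have h1 : Tendsto (fun n : ℕ => c ^ t * (n : ℝ) ^ (-(t * gam H - k))) atTop (𝓝 0) := by
    rw [← mul_zero (c ^ t)]
    exact ((tendsto_rpow_neg_atTop (by linarith : 0 < t * gam H - k)).comp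
      tendsto_natCast_atTop_atTop).const_mul _
  refine h1.congr' ?_
  filter_upwards [eventually_gt_atTop 0] with n hn
  have hn' : (0:ℝ) < n := by exact_mod_cast hn
  unfold tht
  rw [mul_pow, ← rpow_natCast (x := (n : ℝ) ^ (-gam H)), ← rpow_mul hn'.le, mul_left_comm,
    ← rpow_natCast (x := (n : ℝ)), ← rpow_add hn']
  congr 2; ring

/-- Few copies through two edges. -/
lemma U2_whp (h3 : 3 ≤ (HE H).card) (C : ℝ) :
    ∃ R : ℕ, Whp H C (fun _ _ s => U2 H R s) := by
  obtain ⟨t, -, ht⟩ := tht_pow_tendsto h3 4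
  set m := 2 + t * (HE H).card with hm
  refine ⟨2 ^ m, fun ζ hζ => ?_⟩
  filter_upwards [(ht (cU H m)).eventually_le_const hζ] with n hn p hw
  refine le_trans (pr_mono hw.p0 hw.p1 (Q := fun s => ∃ q ∈ ((EE n) ×ˢ (EE n)).filter
    (fun q => q.1 ≠ q.2), ({q.1, q.2} ⊆ s ∧ Ch H s t {q.1, q.2})) ?_) ?_
  · intro s hs hbad
    unfold U2 at hbad
    push Not at hbad
    obtain ⟨g, g', hg, hc⟩ := hbad
    obtain ⟨K, hK⟩ := card_pos.1 (lt_of_le_of_lt (Nat.zero_le _) hc)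
    rw [mem_filter] at hK
    refine ⟨(g, g'), ?_, ?_, ?_⟩
    · simp only [mem_filter, mem_product]
      exact ⟨⟨hs (hK.2.2.2 hK.2.1), hs (hK.2.2.2 hK.2.2.1)⟩, hg⟩
    · intro x hx
      rw [mem_insert, mem_singleton] at hx
      rcases hx with rfl | rfl
      · exact hK.2.2.2 hK.2.1
      · exact hK.2.2.2 hK.2.2.1
    · refine chain_of_many hg t _ (by simp) (by simp) ?_
      rw [card_pair hg]
      exact hc
  · refine (pr_exists hw.p0 hw.p1 _ _).trans ?_
    have ht0 := tht_pos (H := H) (show 1 ≤ n by have := hw.hn; omega)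
    have hc := cU_ge_one (H := H) m
    refine (sum_le_card_nsmul _ _ ((cU H m * tht H n) ^ t) fun q hq => ?_).trans ?_
    · simp only [mem_filter, mem_product] at hq
      have hcard : ({q.1, q.2} : ES(n)).card = 2 := card_pair hq.2
      refine (chain_prob hw.toUp m t {q.1, q.2} ?_ (by rw [hcard])).trans ?_
      · intro x hx
        rw [mem_insert, mem_singleton] at hx
        rcases hx with rfl | rfl
        · exact hq.1.1
        · exact hq.1.2
      · exact mul_le_of_le_one_left (by positivity) (pow_le_one₀ hw.p0 hw.p1)
    · rw [nsmul_eq_mul]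
      refine le_trans ?_ hn
      refine mul_le_mul_of_nonneg_right ?_ (by positivity)
      have h1 : ((((EE n) ×ˢ (EE n)).filter (fun q => q.1 ≠ q.2)).card : ℝ) ≤ (EE n).card * (EE n).card := by
        have := card_filter_le ((EE n) ×ˢ (EE n)) (fun q => q.1 ≠ q.2)
        rw [card_product] at this
        exact_mod_cast this
      have h2 := EE_card_le (n := n)
      calc _ ≤ _ := h1
        _ ≤ (n:ℝ)^2 * (n:ℝ)^2 := mul_le_mul h2 h2 (Nat.cast_nonneg _) (by positivity)
        _ = _ := by ring

/-- No edge lies in too many copies. -/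
def U1 (H : SimpleGraph α) (Cu : ℝ) {n : ℕ} (p : ℝ) (s : ES(n)) : Prop :=
  ∀ g, ((cpe H s g).card : ℝ) ≤ Cu * lam H n p

/-- Copies meeting a given copy through `g` elsewhere. -/
lemma conflict_count {R : ℕ} {s K : ES(n)} (hU : U2 H R s) (hK : K ∈ cps H n)
    (S : Finset (ES(n))) (hS : S ⊆ cps H n) (hSs : ∀ K' ∈ S, K' ⊆ s) {g : E2(n)} (hg : ∀ K' ∈ S, g ∈ K') :
    (S.filter fun K' => ¬ Disjoint (K \ {g}) (K' \ {g})).card ≤ (HE H).card * R := by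
  have : (S.filter fun K' => ¬ Disjoint (K \ {g}) (K' \ {g})) ⊆
      (K \ {g}).biUnion fun g' => (cps H n).filter fun K' => g ∈ K' ∧ g' ∈ K' ∧ K' ⊆ s := by
    intro K' hK'
    rw [mem_filter, not_disjoint_iff] at hK'
    obtain ⟨h1, g', h2, h4⟩ := hK'
    exact mem_biUnion.2 ⟨g', h2, mem_filter.2 ⟨hS h1, hg _ h1, (Finset.mem_sdiff.1 h4).1, hSs _ h1⟩⟩
  refine (card_le_card this).trans (card_biUnion_le.trans ?_)
  refine (sum_le_card_nsmul _ _ R fun g' hg' => ?_).trans ?_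
  · refine hU g g' ?_
    rintro rfl
    simp at hg'
  · rw [smul_eq_mul]
    refine Nat.mul_le_mul_right _ ?_
    rw [← cps_card hK]
    exact card_le_card sdiff_subset

lemma U1_whp (hH : Strictly2Balanced H) (h3 : 3 ≤ (HE H).card) {C : ℝ} (hC : 0 < C) :
    ∃ Cu : ℝ, 0 < Cu ∧ Whp H C (fun _ p s => U1 H Cu p s) := by
  obtain ⟨R, hR⟩ := U2_whp (H := H) h3 C
  set D : ℝ := (HE H).card * R + 1 with hD
  have hD1 : 1 ≤ D := by rw [hD]; have : (0:ℝ) ≤ (HE H).card * R := by positivity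
                         linarith
  set c1 := cU H 1 with hc1
  have hc11 : 1 ≤ c1 := cU_ge_one 1
  set Cu := 8 * c1 * (D * (3 * C + 1)) with hCu
  have hCu8 : 8 * c1 ≤ Cu := by
    rw [hCu]
    have : 1 ≤ D * (3 * C + 1) := by nlinarith
    nlinarith
  have hCuD : 8 * (D * (3 * C + 1)) ≤ Cu := by
    rw [hCu]
    have : 0 < D * (3 * C + 1) := by positivity
    nlinarith
  refine ⟨Cu, by linarith, Whp.step hR fun ζ hζ => ?_⟩
  have hlim : Tendsto (fun n : ℕ => ((n : ℝ))⁻¹) atTop (𝓝 0) :=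
    tendsto_inv_atTop_nhds_zero_nat
  filter_upwards [hlim.eventually_le_const hζ] with n hn p hw
  have hn3 := hw.hn
  have hn1 : (1:ℝ) ≤ n := by exact_mod_cast (by omega : 1 ≤ n)
  have hl1 := hw.lam1
  have hlog0 : 0 ≤ log n := log_nonneg hn1
  refine le_trans (pr_mono hw.p0 hw.p1 (Q := fun s => ∃ g ∈ EE n,
    dtEv ((cps H n).filter fun K => g ∈ K) (fun K => K \ {g}) D (Cu * lam H n p) s) ?_) ?_
  · rintro s hs ⟨hU2, hbad⟩
    unfold U1 at hbad
    push Not at hbad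
    obtain ⟨g, hg⟩ := hbad
    have hpos : 0 < (cpe H s g).card := by
      have : (0:ℝ) < (cpe H s g).card := lt_of_le_of_lt (by positivity) hg
      exact_mod_cast this
    have hmem : ∀ K ∈ cpe H s g, K ∈ cps H n ∧ g ∈ K ∧ K ⊆ s := fun K hK => by
      simpa [cpe] using hK
    obtain ⟨K0, hK0⟩ := card_pos.1 hpos
    refine ⟨g, hs ((hmem _ hK0).2.2 (hmem _ hK0).2.1), cpe H s g, ?_, hg.le, ?_, ?_⟩
    · intro K hK; exact mem_filter.2 ⟨(hmem K hK).1, (hmem K hK).2.1⟩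
    · intro K hK; exact sdiff_subset.trans (hmem K hK).2.2
    · intro K hK
      have := conflict_count hU2 (hmem K hK).1 (cpe H s g) (fun K' h => (hmem K' h).1)
        (fun K' h => (hmem K' h).2.2) (fun K' h => (hmem K' h).2.1)
      have h2 : (((cpe H s g).filter fun K' => ¬ Disjoint (K \ {g}) (K' \ {g})).card : ℝ) ≤ (HE H).card * R := by
        exact_mod_cast this
      rw [hD]; linarith
  · refine (pr_exists hw.p0 hw.p1 _ _).trans ?_
    set k := ⌈3 * log n⌉₊ with hk
    have hk1 : 3 * log n ≤ k := Nat.le_ceil _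
    have hk2 : (k : ℝ) < 3 * log n + 1 := Nat.ceil_lt_add_one (by positivity)
    have hkl : (k : ℝ) ≤ (3 * C + 1) * lam H n p := by nlinarith [hw.lamge]
    refine (sum_le_card_nsmul _ _ (exp (-1) ^ k) fun g hg => ?_).trans ?_
    · refine (dt_bound hw.p0 hw.p1 _ _ (fun K hK => sdiff_subset.trans
        (cps_subset_EE (mem_filter.1 hK).1)) (by linarith) (by nlinarith) k ?_).trans ?_
      · nlinarith
      · have hs := sumB hH h3 hw.toUp (u := 1) (U := {g}) (by simp)
        rw [hw.max_eq] at hs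
        have hs' : ∑ K ∈ (cps H n).filter (fun K => g ∈ K), p ^ (K \ {g}).card ≤ c1 * lam H n p := by
          refine le_trans (le_of_eq (sum_congr ?_ fun _ _ => rfl)) hs
          ext K
          rw [mem_filter, mem_filter]
          refine and_congr_right fun _ => ⟨fun h => ⟨g, by simp [h]⟩, fun ⟨x, hx⟩ => ?_⟩
          rw [mem_inter, mem_singleton] at hx
          rw [← hx.2]; exact hx.1
        have hs0 : 0 ≤ ∑ K ∈ (cps H n).filter (fun K => g ∈ K), p ^ (K \ {g}).card :=
          sum_nonneg fun _ _ => pow_nonneg hw.p0 _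
        have hCl : 0 < Cu * lam H n p := by nlinarith
        refine pow_le_pow_left₀ (by positivity) ?_ k
        rw [div_le_iff₀ hCl]
        have he : (1:ℝ) / 4 ≤ exp (-1) := by
          have := Real.exp_neg_one_gt_d9; linarith
        nlinarith
    · rw [nsmul_eq_mul, ← exp_nat_mul]
      refine le_trans ?_ hn
      have hn0 : (0:ℝ) < n := by linarith
      have h5 : exp (k * -1) ≤ ((n:ℝ)^3)⁻¹ := by
        rw [← exp_log (pow_pos hn0 3), ← exp_neg, exp_le_exp, log_pow]
        push_cast; linarith
      calc _ ≤ (n:ℝ)^2 * ((n:ℝ)^3)⁻¹ := mul_le_mul EE_card_le h5 (exp_pos _).le (by positivity)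
        _ = _ := by field_simp
end

/-! ### Sampling lemma -/
section
variable {ι : Type*} [DecidableEq ι]

/-- Members whose trace on `S` is the marked pair. -/
def K0 (Ks : Finset (Finset ι)) (m : Finset ι → Finset ι) (S : Finset ι) : Finset (Finset ι) :=
  Ks.filter fun K => K ∩ S = m K

/-- Members with few conflicts. -/
def K1 (Ks : Finset (Finset ι)) (m : Finset ι → Finset ι) (D : ℝ) (S : Finset ι) :
    Finset (Finset ι) :=
  (K0 Ks m S).filter fun K => ∀ g ∈ K \ m K,
    (((K0 Ks m S).filter fun K' => g ∈ K' \ m K').card : ℝ) ≤ D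

lemma mem_K0 {Ks : Finset (Finset ι)} {m : Finset ι → Finset ι} {S K : Finset ι} :
    K ∈ K0 Ks m S ↔ K ∈ Ks ∧ K ∩ S = m K := by
  unfold K0; exact mem_filter

lemma mem_K1 {Ks : Finset (Finset ι)} {m : Finset ι → Finset ι} {D : ℝ} {S K : Finset ι} :
    K ∈ K1 Ks m D S ↔ K ∈ K0 Ks m S ∧ ∀ g ∈ K \ m K,
    (((K0 Ks m S).filter fun K' => g ∈ K' \ m K').card : ℝ) ≤ D := by
  unfold K1; exact mem_filter

lemma sample_lower {E : Finset ι} {Ks : Finset (Finset ι)} {m : Finset ι → Finset ι} {e R : ℕ}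
    {T δ D : ℝ} (hE : ∀ K ∈ Ks, K ⊆ E) (he : ∀ K ∈ Ks, K.card = e) (hm : ∀ K ∈ Ks, m K ⊆ K)
    (hm2 : ∀ K ∈ Ks, (m K).card = 2)
    (hR : ∀ g x, g ≠ x → (Ks.filter fun K => g ∈ K ∧ x ∈ K).card ≤ R)
    (hT : ∀ g, ((Ks.filter fun K => g ∈ K).card : ℝ) ≤ T)
    (hδ : 0 < δ) (hδ1 : e * δ ≤ 1 / 2) (hδ2 : δ ≤ 1) (hT0 : 0 < T) (hRT : 2 * R ≤ δ ^ 2 * T)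
    (he1 : 1 ≤ e) (hD : D = 8 * e * δ ^ 2 * T) :
    (Ks.card : ℝ) * (δ ^ 2 / 4) ≤ ex E δ (fun S => ((K1 Ks m D S).card : ℝ)) := by
  have he1' : (1:ℝ) ≤ e := by exact_mod_cast he1
  have hD0 : 0 < D := by rw [hD]; positivity
  -- pointwise lower bound
  have pw : ∀ S ⊆ E, (∑ K ∈ Ks, (ind (m K ⊆ S) - ∑ g ∈ K \ m K, ind (insert g (m K) ⊆ S))) -
      (∑ K ∈ Ks, ∑ g ∈ K \ m K, ∑ K' ∈ Ks with g ∈ K' \ m K', ind (m K ∪ m K' ⊆ S)) / D ≤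
      ((K1 Ks m D S).card : ℝ) := by
    intro S _
    have hcard : ((K1 Ks m D S).card : ℝ) = ∑ K ∈ Ks, ind (K ∈ K1 Ks m D S) := by
      have : K1 Ks m D S = Ks.filter fun K => K ∈ K1 Ks m D S := by
        ext K
        rw [mem_filter]
        refine ⟨fun h => ⟨?_, h⟩, fun h => h.2⟩
        exact (mem_filter.1 (mem_filter.1 h).1).1
      conv_lhs => rw [this]
      rw [card_eq_sum_ones, Nat.cast_sum, sum_filter]
      refine sum_congr rfl fun K _ => ?_
      unfold ind; simp
    rw [hcard, sum_div, ← sum_sub_distrib]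
    refine sum_le_sum fun K hK => ?_
    have hs0 : 0 ≤ ∑ g ∈ K \ m K, ind (insert g (m K) ⊆ S) := sum_nonneg fun _ _ => ind_nonneg _
    have hs1 : 0 ≤ (∑ g ∈ K \ m K, ∑ K' ∈ Ks with g ∈ K' \ m K', ind (m K ∪ m K' ⊆ S)) / D :=
      div_nonneg (sum_nonneg fun _ _ => sum_nonneg fun _ _ => ind_nonneg _) hD0.le
    by_cases hin : K ∈ K1 Ks m D S
    · rw [ind_true hin]
      linarith [ind_le_one (m K ⊆ S)]
    rw [ind_false hin]
    by_cases h1 : m K ⊆ S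
    swap
    · rw [ind_false h1]; linarith
    rw [ind_true h1]
    by_cases h0 : K ∈ K0 Ks m S
    · -- a bad conflict
      have : ∃ g ∈ K \ m K, D < (((K0 Ks m S).filter fun K' => g ∈ K' \ m K').card : ℝ) := by
        by_contra hcon
        push Not at hcon
        exact hin (mem_filter.2 ⟨h0, hcon⟩)
      obtain ⟨g, hg, hgD⟩ := this
      have h2 : D ≤ ∑ g ∈ K \ m K, ∑ K' ∈ Ks with g ∈ K' \ m K', ind (m K ∪ m K' ⊆ S) := by
        refine le_trans ?_ (single_le_sum (f := fun g => ∑ K' ∈ Ks with g ∈ K' \ m K', ind (m K ∪ m K' ⊆ S)) (fun _ _ => sum_nonneg fun _ _ => ind_nonneg _) hg)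
        refine hgD.le.trans ?_
        rw [card_eq_sum_ones, Nat.cast_sum]
        refine (sum_le_sum (g := fun K' => ind (m K ∪ m K' ⊆ S)) fun K' hK' => ?_).trans
          (sum_le_sum_of_subset_of_nonneg ?_ fun _ _ _ => ind_nonneg _)
        · have h3 := (mem_filter.1 (mem_filter.1 hK').1).2
          rw [ind_true (union_subset h1 (h3 ▸ inter_subset_right))]; simp
        · intro K' hK'
          rw [mem_filter] at hK' ⊢
          exact ⟨(mem_filter.1 hK'.1).1, hK'.2⟩
      have h4 : 1 ≤ (∑ g ∈ K \ m K, ∑ K' ∈ Ks with g ∈ K' \ m K', ind (m K ∪ m K' ⊆ S)) / D := by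
        rw [le_div_iff₀ hD0]; linarith
      linarith
    · -- extra element in S
      have : ∃ g ∈ K \ m K, insert g (m K) ⊆ S := by
        by_contra hcon
        push Not at hcon
        refine h0 (mem_filter.2 ⟨hK, Finset.Subset.antisymm ?_ ?_⟩)
        · intro g hg
          rw [mem_inter] at hg
          by_contra hgm
          exact hcon g (Finset.mem_sdiff.2 ⟨hg.1, hgm⟩) (insert_subset hg.2 h1)
        · exact subset_inter (hm K hK) h1
      obtain ⟨g, hg, hgS⟩ := this
      have h2 : 1 ≤ ∑ g ∈ K \ m K, ind (insert g (m K) ⊆ S) := by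
        rw [← ind_true hgS]
        exact single_le_sum (f := fun g => ind (insert g (m K) ⊆ S)) (fun _ _ => ind_nonneg _) hg
      linarith
  refine le_trans ?_ (ex_mono hδ.le hδ2 pw)
  rw [ex_sub]
  simp only [div_eq_mul_inv]
  rw [ex_mul_right, ex_sum, ex_sum, sum_mul, ← sum_sub_distrib, card_eq_sum_ones,
    Nat.cast_sum, sum_mul]
  refine sum_le_sum fun K hK => ?_
  rw [ex_sub, ex_sum, ex_sum, Nat.cast_one, one_mul]
  have q1 : ex E δ (fun S => ind (m K ⊆ S)) = δ ^ 2 := by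
    have := pr_subset (p := δ) ((hm K hK).trans (hE K hK))
    rw [hm2 K hK] at this
    exact this
  have q2 : ∑ g ∈ K \ m K, ex E δ (fun S => ind (insert g (m K) ⊆ S)) ≤ e * δ ^ 3 := by
    refine (sum_le_card_nsmul _ _ (δ ^ 3) fun g hg => ?_).trans ?_
    · rw [Finset.mem_sdiff] at hg
      have := pr_subset (p := δ) (A := insert g (m K)) (E := E)
        (insert_subset (hE K hK hg.1) ((hm K hK).trans (hE K hK)))
      rw [card_insert_of_notMem hg.2, hm2 K hK] at this
      exact this.le
    · rw [nsmul_eq_mul]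
      refine mul_le_mul_of_nonneg_right ?_ (by positivity)
      have := card_le_card (sdiff_subset (s := K) (t := m K))
      rw [he K hK] at this
      exact_mod_cast this
  have q3 : ∑ g ∈ K \ m K, ex E δ (fun S => ∑ K' ∈ Ks with g ∈ K' \ m K', ind (m K ∪ m K' ⊆ S)) ≤
      e * (2 * T * δ ^ 4) := by
    refine (sum_le_card_nsmul _ _ (2 * T * δ ^ 4) fun g hg => ?_).trans ?_
    · rw [Finset.mem_sdiff] at hg
      rw [ex_sum]
      have h5 : ∀ K' ∈ Ks.filter (fun K' => g ∈ K' \ m K'), ex E δ (fun S => ind (m K ∪ m K' ⊆ S)) ≤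
          δ ^ 4 + ∑ x ∈ m K, ind (x ∈ K') * δ ^ 2 := by
        intro K' hK'
        rw [mem_filter] at hK'
        have h6 := pr_subset (p := δ) (A := m K ∪ m K') (E := E)
          (union_subset ((hm K hK).trans (hE K hK)) ((hm K' hK'.1).trans (hE K' hK'.1)))
        refine (le_of_eq h6).trans ?_
        by_cases hdis : Disjoint (m K) (m K')
        · rw [card_union_of_disjoint hdis, hm2 K hK, hm2 K' hK'.1]
          have : 0 ≤ ∑ x ∈ m K, ind (x ∈ K') * δ ^ 2 :=
            sum_nonneg fun _ _ => mul_nonneg (ind_nonneg _) (by positivity)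
          norm_num; exact this
        · rw [not_disjoint_iff] at hdis
          obtain ⟨x, hx, hx'⟩ := hdis
          have h7 : δ ^ 2 ≤ ∑ x ∈ m K, ind (x ∈ K') * δ ^ 2 := by
            have := single_le_sum (f := fun x => ind (x ∈ K') * δ ^ 2)
              (fun _ _ => mul_nonneg (ind_nonneg _) (by positivity)) hx
            simp only [ind_true (hm K' hK'.1 hx'), one_mul] at this
            exact this
          have h8 : δ ^ (m K ∪ m K').card ≤ δ ^ 2 := by
            refine pow_le_pow_of_le_one hδ.le hδ2 ?_
            rw [← hm2 K hK]
            exact card_le_card subset_union_left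
          have : 0 < δ ^ 4 := by positivity
          linarith
      refine (sum_le_sum h5).trans ?_
      rw [sum_add_distrib, sum_const, nsmul_eq_mul, sum_comm]
      have h9 : ((Ks.filter fun K' => g ∈ K' \ m K').card : ℝ) ≤ T := by
        refine le_trans ?_ (hT g)
        have : (Ks.filter fun K' => g ∈ K' \ m K').card ≤ (Ks.filter fun K => g ∈ K).card := by
          refine card_le_card fun K' hK' => ?_
          rw [mem_filter] at hK' ⊢
          exact ⟨hK'.1, (Finset.mem_sdiff.1 hK'.2).1⟩
        exact_mod_cast this
      have h10 : ∀ x ∈ m K, ∑ K' ∈ Ks with g ∈ K' \ m K', ind (x ∈ K') * δ ^ 2 ≤ R * δ ^ 2 := by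
        intro x hx
        rw [← sum_mul]
        refine mul_le_mul_of_nonneg_right ?_ (by positivity)
        have hgx : g ≠ x := by rintro rfl; exact hg.2 hx
        have h11 : ∑ K' ∈ Ks with g ∈ K' \ m K', ind (x ∈ K') =
            (((Ks.filter fun K' => g ∈ K' \ m K').filter fun K' => x ∈ K').card : ℝ) := by
          rw [card_eq_sum_ones, Nat.cast_sum, sum_filter (s := Ks.filter _)]
          refine sum_congr rfl fun K' _ => ?_
          unfold ind; simp
        rw [h11]
        have : ((Ks.filter fun K' => g ∈ K' \ m K').filter fun K' => x ∈ K').card ≤ R := by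
          refine le_trans (card_le_card fun K' hK' => ?_) (hR g x hgx)
          simp only [mem_filter, Finset.mem_sdiff] at hK' ⊢
          exact ⟨hK'.1.1, hK'.1.2.1, hK'.2⟩
        exact_mod_cast this
      have h12 := sum_le_card_nsmul _ _ _ h10
      rw [hm2 K hK, nsmul_eq_mul] at h12
      push_cast at h12
      have h13 : ((Ks.filter fun K' => g ∈ K' \ m K').card : ℝ) * δ ^ 4 ≤ T * δ ^ 4 :=
        mul_le_mul_of_nonneg_right h9 (by positivity)
      nlinarith [mul_le_mul_of_nonneg_right hRT (by positivity : 0 ≤ δ ^ 2)]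
    · rw [nsmul_eq_mul]
      refine mul_le_mul_of_nonneg_right ?_ (by positivity)
      have := card_le_card (sdiff_subset (s := K) (t := m K))
      rw [he K hK] at this
      exact_mod_cast this
  have q3' : (∑ g ∈ K \ m K, ex E δ (fun S => ∑ K' ∈ Ks with g ∈ K' \ m K', ind (m K ∪ m K' ⊆ S))) * D⁻¹ ≤
      δ ^ 2 / 4 := by
    rw [← div_eq_mul_inv, div_le_iff₀ hD0]
    refine q3.trans (le_of_eq ?_)
    rw [hD]; ring
  have q2' : e * δ ^ 3 ≤ δ ^ 2 / 2 := by
    nlinarith [mul_le_mul_of_nonneg_right hδ1 (by positivity : 0 ≤ δ ^ 2)]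
  linarith

lemma ex_card_inter {E F : Finset ι} {δ : ℝ} (hF : F ⊆ E) :
    ex E δ (fun S => ((F ∩ S).card : ℝ)) = δ * F.card := by
  have : ∀ S ⊆ E, ((F ∩ S).card : ℝ) = ∑ g ∈ F, ind ({g} ⊆ S) := by
    intro S _
    rw [← filter_mem_eq_inter, card_eq_sum_ones, Nat.cast_sum, sum_filter]
    refine sum_congr rfl fun g _ => ?_
    unfold ind; simp
  rw [ex_congr this, ex_sum, sum_congr rfl (g := fun _ => δ), sum_const, nsmul_eq_mul, mul_comm]
  intro g hg
  have := pr_subset (p := δ) (A := {g}) (E := E) (by simpa using hF hg)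
  rw [card_singleton, pow_one] at this
  exact this

/-- With positive probability the sample sees a positive proportion of the family. -/
lemma sample_prob {E F : Finset ι} {Ks : Finset (Finset ι)} {m : Finset ι → Finset ι} {e R : ℕ}
    {T δ D η lm : ℝ} (hE : ∀ K ∈ Ks, K ⊆ E) (he : ∀ K ∈ Ks, K.card = e) (hm : ∀ K ∈ Ks, m K ⊆ K)
    (hm2 : ∀ K ∈ Ks, (m K).card = 2)
    (hR : ∀ g x, g ≠ x → (Ks.filter fun K => g ∈ K ∧ x ∈ K).card ≤ R)
    (hT : ∀ g, ((Ks.filter fun K => g ∈ K).card : ℝ) ≤ T)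
    (hδ : 0 < δ) (hδ1 : e * δ ≤ 1 / 2) (hδ2 : δ ≤ 1) (hT0 : 0 < T) (hRT : 2 * R ≤ δ ^ 2 * T)
    (he1 : 1 ≤ e) (hD : D = 8 * e * δ ^ 2 * T) (hF : F ⊆ E) (hη : 0 ≤ η) (hlm : 0 ≤ lm)
    (hbig : η * lm * F.card < Ks.card) :
    δ ^ 2 / 8 ≤ pr E δ (fun S => η * δ / 8 * lm * (F ∩ S).card < ((K1 Ks m D S).card : ℝ)) := by
  have h1 := sample_lower hE he hm hm2 hR hT hδ hδ1 hδ2 hT0 hRT he1 hD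
  have h2 := ex_card_inter (δ := δ) hF
  have h3 : ex E δ (fun S => ((K1 Ks m D S).card : ℝ) - η * δ / 8 * lm * (F ∩ S).card) ≤
      ex E δ (fun S => Ks.card * ind (η * δ / 8 * lm * (F ∩ S).card < ((K1 Ks m D S).card : ℝ))) := by
    refine ex_mono hδ.le hδ2 fun S _ => ?_
    have hle : ((K1 Ks m D S).card : ℝ) ≤ Ks.card := by
      exact_mod_cast card_le_card ((filter_subset _ _).trans (filter_subset _ _))
    by_cases h : η * δ / 8 * lm * (F ∩ S).card < ((K1 Ks m D S).card : ℝ)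
    · rw [ind_true h, mul_one]
      have : 0 ≤ η * δ / 8 * lm * (F ∩ S).card := by positivity
      linarith
    · rw [ind_false h, mul_zero]; linarith
  rw [ex_sub, ex_mul_left, ex_mul_left, h2] at h3
  have hpos : (0:ℝ) < Ks.card := lt_of_le_of_lt (by positivity) hbig
  have h4 : (Ks.card : ℝ) * (δ ^ 2 / 8) ≤ Ks.card * pr E δ (fun S => η * δ / 8 * lm * (F ∩ S).card < ((K1 Ks m D S).card : ℝ)) := by
    refine le_trans ?_ h3
    have : η * δ / 8 * lm * (δ * F.card) ≤ δ ^ 2 / 8 * Ks.card := by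
      have := mul_le_mul_of_nonneg_left hbig.le (by positivity : 0 ≤ δ ^ 2 / 8)
      linarith
    linarith
  exact le_of_mul_le_mul_left h4 hpos
end

/-! ### The second intersection lemma -/
section

lemma series_aux {ι : Type*} {c4 ε N p : ℝ} (A : ℕ) (hA : 2 ≤ A) (hc4 : 0 < c4) (hε : 0 < ε) (hε1 : ε ≤ 1)
    (hN : 0 < N) (hp : 0 ≤ p) (hεc : exp 1 * c4 ^ A * ε ≤ 1 / 2) (T : Finset ι) (hT : T.card * p ≤ N) :
    ∑ F ∈ T.powerset with 1 ≤ F.card ∧ (F.card : ℝ) ≤ ε * N,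
      p ^ F.card * (c4 * F.card / N) ^ (A * F.card) ≤
    (2 * exp 1 * c4 ^ A * ∑' f : ℕ, (f : ℝ) ^ (A - 1) * (1 / 2 : ℝ) ^ f) / N ^ (A - 1) := by
  rw [sum_filter]
  rw [sum_powerset_apply_card (fun f : ℕ => if 1 ≤ f ∧ (f : ℝ) ≤ ε * N then
    p ^ f * (c4 * f / N) ^ (A * f) else 0)]
  have hsum : Summable fun f : ℕ => (f : ℝ) ^ (A - 1) * (1 / 2 : ℝ) ^ f :=
    summable_pow_mul_geometric_of_norm_lt_one (A - 1) (by norm_num)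
  have hterm : ∀ f ∈ range (T.card + 1), (T.card.choose f) • (if 1 ≤ f ∧ (f : ℝ) ≤ ε * N then
      p ^ f * (c4 * f / N) ^ (A * f) else 0) ≤
      2 * exp 1 * c4 ^ A / N ^ (A - 1) * ((f : ℝ) ^ (A - 1) * (1 / 2 : ℝ) ^ f) := by
    intro f _
    split_ifs with h
    swap
    · rw [smul_zero]; positivity
    obtain ⟨hf1, hf2⟩ := h
    have hf0 : (0:ℝ) < f := by exact_mod_cast hf1
    rw [nsmul_eq_mul]
    set x := exp 1 * c4 ^ A * (f / N) ^ (A - 1) with hx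
    have hx0 : 0 ≤ x := by positivity
    have hfN : (f : ℝ) / N ≤ ε := by rw [div_le_iff₀ hN]; exact hf2
    have hx1 : x ≤ 1 / 2 := by
      refine le_trans ?_ hεc
      rw [hx]
      refine mul_le_mul_of_nonneg_left ?_ (by positivity)
      calc ((f : ℝ) / N) ^ (A - 1) ≤ ε ^ (A - 1) := pow_le_pow_left₀ (by positivity) hfN _
        _ ≤ ε ^ 1 := pow_le_pow_of_le_one hε.le hε1 (by omega)
        _ = ε := pow_one _
    have h1 : (T.card.choose f : ℝ) * p ^ f ≤ N ^ f / f.factorial := by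
      have := Nat.choose_le_pow_div (α := ℝ) f T.card
      calc (T.card.choose f : ℝ) * p ^ f ≤ (T.card : ℝ) ^ f / f.factorial * p ^ f :=
            mul_le_mul_of_nonneg_right this (by positivity)
        _ = (T.card * p) ^ f / f.factorial := by rw [mul_pow]; ring
        _ ≤ _ := by gcongr
    have h2 : (T.card.choose f : ℝ) * (p ^ f * (c4 * f / N) ^ (A * f)) ≤ x ^ f := by
      rw [← mul_assoc]
      calc _ ≤ N ^ f / f.factorial * (c4 * f / N) ^ (A * f) :=
            mul_le_mul_of_nonneg_right h1 (by positivity)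
        _ = (f : ℝ) ^ f / f.factorial * (c4 ^ A * (f / N) ^ (A - 1)) ^ f := by
            obtain ⟨B, rfl⟩ : ∃ B, A = B + 1 := ⟨A - 1, by omega⟩
            rw [Nat.add_sub_cancel, pow_mul, div_mul_eq_mul_div, div_mul_eq_mul_div, ← mul_pow, ← mul_pow]
            congr 2
            rw [div_pow, div_pow, mul_pow, pow_succ (f:ℝ), pow_succ N]
            field_simp
        _ ≤ exp f * (c4 ^ A * (f / N) ^ (A - 1)) ^ f := by
            refine mul_le_mul_of_nonneg_right ?_ (by positivity)
            exact Real.pow_div_factorial_le_exp _ hf0.le _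
        _ = x ^ f := by
            rw [hx, mul_assoc, mul_pow (exp 1), ← exp_nat_mul, mul_one]
    refine h2.trans ?_
    obtain ⟨k, rfl⟩ : ∃ k, f = k + 1 := ⟨f - 1, by omega⟩
    calc x ^ (k + 1) = x ^ k * x := pow_succ _ _
      _ ≤ (1 / 2) ^ k * x := mul_le_mul_of_nonneg_right (pow_le_pow_left₀ hx0 hx1 _) hx0
      _ = _ := by rw [hx, div_pow ((k + 1 : ℕ) : ℝ), pow_succ (1 / 2 : ℝ)]; ring
  refine (sum_le_sum hterm).trans ?_
  rw [← mul_sum, mul_div_right_comm (2 * exp 1 * c4 ^ A)]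
  refine mul_le_mul_of_nonneg_left (a := 2 * exp 1 * c4 ^ A / N ^ (A - 1)) ?_ (by positivity)
  exact hsum.sum_le_tsum _ fun _ _ => by positivity

variable [Fintype α] {H : SimpleGraph α} {n : ℕ} {p C : ℝ}

/-- Copies inside `s` with a related pair of edges of `F`. -/
def pairK (H : SimpleGraph α) {n : ℕ} (rel : ES(n) → Prop)
    (s F : ES(n)) : Finset (ES(n)) :=
  (cps H n).filter fun K => K ⊆ s ∧ ∃ P ⊆ K, P ⊆ F ∧ P.card = 2 ∧ rel P

/-- The family used after sampling. -/
def famI (H : SimpleGraph α) {n : ℕ} (rel : ES(n) → Prop)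
    (S F : ES(n)) : Finset (ES(n)) :=
  (cps H n).filter fun K => K ∩ S ⊆ F ∧ (K ∩ S).card = 2 ∧ rel (K ∩ S)

lemma L_fixed {rel : ES(n) → Prop} (hp : 0 ≤ p) (hp1 : p ≤ 1)
    {Rg S F : ES(n)} (hS : S ⊆ EE n) (hF : F ⊆ S) (hFR : F ⊆ Rg)
    {c3 lm N D t : ℝ} (hcod : ∀ P ⊆ Rg, P.card = 2 → rel P →
      (((cps H n).filter fun K => P ⊆ K).card : ℝ) * p ^ ((HE H).card - 2) ≤ c3 * lm / N)
    (hD : 0 ≤ D) (ht : 0 < t) (hc : 0 ≤ c3 * lm / N) (k : ℕ) (hk : k * D ≤ t / 2) :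
    pr (EE n) p (fun s => F ⊆ s ∧ dtEv (famI H rel S F) (fun K => K \ S) D t s) ≤
      p ^ F.card * (2 * ((F.card : ℝ) ^ 2 * (c3 * lm / N)) / t) ^ k := by
  have e1 : pr (EE n) p (fun s => F ⊆ s ∧ dtEv (famI H rel S F) (fun K => K \ S) D t s) =
      p ^ F.card * pr (EE n) p (dtEv (famI H rel S F) (fun K => K \ S) D t) := by
    unfold pr
    rw [← ex_indep (hF.trans hS) (fun s => ind (dtEv (famI H rel S F) (fun K => K \ S) D t s))]
    · exact ex_congr fun s _ => ind_and _ _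
    · intro s
      refine ind_congr ?_
      unfold dtEv
      refine exists_congr fun I' => and_congr_right fun _ => and_congr_right fun _ =>
        and_congr_left fun _ => forall₂_congr fun K _ => ?_
      constructor
      · intro h x hx
        refine Finset.mem_sdiff.2 ⟨h hx, fun hxF => (Finset.mem_sdiff.1 hx).2 (hF hxF)⟩
      · intro h; exact h.trans sdiff_subset
  rw [e1]
  refine mul_le_mul_of_nonneg_left ?_ (pow_nonneg hp _)
  refine (dt_bound hp hp1 _ _ (fun K hK => sdiff_subset.trans
    (cps_subset_EE (mem_filter.1 hK).1)) hD ht k hk).trans ?_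
  have h0 : 0 ≤ ∑ K ∈ famI H rel S F, p ^ (K \ S).card := sum_nonneg fun _ _ => pow_nonneg hp _
  refine pow_le_pow_left₀ (by positivity) ?_ _
  refine div_le_div_of_nonneg_right (mul_le_mul_of_nonneg_left ?_ zero_le_two) ht.le
  have e2 : ∀ K ∈ famI H rel S F, p ^ (K \ S).card = p ^ ((HE H).card - 2) := by
    intro K hK
    have hK' := mem_filter.1 hK
    have := card_sdiff_add_card_inter K S
    rw [hK'.2.2.1, cps_card hK'.1] at this
    congr 1; omega
  change ∑ K ∈ famI H rel S F, p ^ (K \ S).card ≤ _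
  rw [sum_congr rfl e2, sum_const, nsmul_eq_mul]
  have h4 : famI H rel S F ⊆ ((F.powersetCard 2).filter rel).biUnion fun P => (cps H n).filter fun K => P ⊆ K := by
    intro K hK
    have hK' := mem_filter.1 hK
    refine mem_biUnion.2 ⟨K ∩ S, ?_, ?_⟩
    · exact mem_filter.2 ⟨mem_powersetCard.2 ⟨hK'.2.1, hK'.2.2.1⟩, hK'.2.2.2⟩
    · exact mem_filter.2 ⟨hK'.1, inter_subset_left⟩
  have h5 := (card_le_card h4).trans card_biUnion_le
  have h6 : ((famI H rel S F).card : ℝ) * p ^ ((HE H).card - 2) ≤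
      ∑ P ∈ (F.powersetCard 2).filter rel, (((cps H n).filter fun K => P ⊆ K).card : ℝ) * p ^ ((HE H).card - 2) := by
    rw [← sum_mul]
    refine mul_le_mul_of_nonneg_right ?_ (pow_nonneg hp _)
    exact_mod_cast h5
  refine h6.trans ((sum_le_card_nsmul _ _ (c3 * lm / N) fun P hP => ?_).trans ?_)
  · rw [mem_filter, mem_powersetCard] at hP
    exact hcod P (hP.1.1.trans hFR) hP.1.2 hP.2
  · rw [nsmul_eq_mul]
    refine mul_le_mul_of_nonneg_right ?_ hc
    have h7 := card_filter_le (F.powersetCard 2) rel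
    rw [card_powersetCard] at h7
    have h8 := h7.trans (Nat.choose_le_pow F.card 2)
    exact_mod_cast h8

lemma hgx {δ : ℝ} (h : δ ≠ 0) (x : ℝ) : x = (δ ^ 2 / 8 * x) * (8 / δ ^ 2) := by field_simp

lemma mem_pairK {rel : ES(n) → Prop} {s F K : ES(n)} :
    K ∈ pairK H rel s F ↔ K ∈ cps H n ∧ K ⊆ s ∧ ∃ P ⊆ K, P ⊆ F ∧ P.card = 2 ∧ rel P := by
  unfold pairK
  exact mem_filter

set_option maxHeartbeats 1000000 in
lemma L_key {Cu η : ℝ} {R : ℕ} {rel : ES(n) → Prop} {s F Rg : ES(n)} {lm T δ D D' M : ℝ}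
    {e : ℕ} (he : e = (HE H).card) (he3 : 3 ≤ e) (hs : s ⊆ EE n) (hU1 : U1 H Cu p s) (hU2 : U2 H R s)
    (hFs : F ⊆ s) (hFR : F ⊆ Rg) (hFN : (F.card : ℝ) ≤ M)
    (hlm : lm = lam H n p) (hlm0 : 0 < lm) (hT : T = Cu * lm) (hT0 : 0 < T)
    (hδ0 : 0 < δ) (hδe : e * δ ≤ 1 / 2) (hδ1 : δ ≤ 1) (hRT : 2 * (R:ℝ) ≤ δ ^ 2 * T) (hη : 0 < η)
    (hD : D = 8 * e * δ ^ 2 * T) (hD' : D' = e * D)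
    (hFbig : η * lm * F.card < (pairK H rel s F).card) :
    δ ^ 2 / 8 ≤ pr (EE n) δ (fun S =>
    ∃ F ∈ (S ∩ Rg).powerset.filter (fun F => 1 ≤ F.card ∧ (F.card : ℝ) ≤ M),
      F ⊆ s ∧ dtEv (famI H rel S F) (fun K => K \ S) D' (η * δ / 8 * lm * F.card) s) := by
  subst hT hlm he
  have hmem := fun K => (mem_pairK (H := H) (rel := rel) (s := s) (F := F) (K := K)).1
  have hch : ∀ K : ES(n), ∃ P, K ∈ pairK H rel s F → P ⊆ K ∧ P ⊆ F ∧ P.card = 2 ∧ rel P := by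
    intro K
    by_cases hK : K ∈ pairK H rel s F
    · obtain ⟨P, h1, h2, h4, h5⟩ := (hmem K hK).2.2
      exact ⟨P, fun _ => ⟨h1, h2, h4, h5⟩⟩
    · exact ⟨∅, fun h => absurd h hK⟩
  choose m hm using hch
  refine (sample_prob (E := EE n) (F := F) (Ks := pairK H rel s F) (m := m) (e := (HE H).card) (R := R) (T := Cu * lam H n p)
    (δ := δ) (D := D) (η := η) (lm := lam H n p) (fun K hK => cps_subset_EE (hmem K hK).1)
    (fun K hK => cps_card (hmem K hK).1) (fun K hK => (hm K hK).1) (fun K hK => (hm K hK).2.2.1)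
    (fun g x hgx => ?_) (fun g => ?_) hδ0 hδe hδ1 hT0 hRT (by omega) hD (hFs.trans hs) hη.le hlm0.le
    hFbig).trans ?_
  · refine le_trans (card_le_card fun K hK => ?_) (hU2 g x hgx)
    rw [mem_filter] at hK ⊢
    exact ⟨(hmem K hK.1).1, hK.2.1, hK.2.2, (hmem K hK.1).2.1⟩
  · refine le_trans ?_ (hU1 g)
    have : ((pairK H rel s F).filter fun K => g ∈ K).card ≤ (cpe H s g).card := by
      refine card_le_card fun K hK => ?_
      rw [mem_filter] at hK
      exact mem_filter.2 ⟨(hmem K hK.1).1, hK.2, (hmem K hK.1).2.1⟩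
    exact_mod_cast this
  · refine pr_mono hδ0.le hδ1 fun S hS hZ => ?_
    have hK1mem : ∀ K ∈ K1 (pairK H rel s F) m D S, K ∈ pairK H rel s F ∧ K ∩ S = m K ∧
        ∀ g ∈ K \ m K, (((K0 (pairK H rel s F) m S).filter fun K' => g ∈ K' \ m K').card : ℝ) ≤ D := by
      intro K hK
      have h1 := mem_K1.1 hK
      have h2 := mem_K0.1 h1.1
      exact ⟨h2.1, h2.2, h1.2⟩
    obtain ⟨Kx, hKx⟩ : (K1 (pairK H rel s F) m D S).Nonempty := by
      rw [← card_pos]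
      have : (0:ℝ) < (K1 (pairK H rel s F) m D S).card := lt_of_le_of_lt (by positivity) hZ
      exact_mod_cast this
    refine ⟨F ∩ S, ?_, inter_subset_left.trans hFs, K1 (pairK H rel s F) m D S, ?_, hZ.le, ?_, ?_⟩
    · rw [mem_filter, mem_powerset]
      refine ⟨fun x hx => ?_, ?_, ?_⟩
      · rw [mem_inter] at hx ⊢; exact ⟨hx.2, hFR hx.1⟩
      · obtain ⟨h1, h2, -⟩ := hK1mem Kx hKx
        obtain ⟨h4, h5, h6, -⟩ := hm Kx h1
        have : m Kx ⊆ F ∩ S := subset_inter h5 (h2 ▸ inter_subset_right)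
        have := card_le_card this
        omega
      · refine le_trans ?_ hFN
        exact_mod_cast card_le_card inter_subset_left
    · intro K hK
      obtain ⟨h1, h2, -⟩ := hK1mem K hK
      obtain ⟨h4, h5, h6, h7⟩ := hm K h1
      refine mem_filter.2 ⟨(hmem K h1).1, ?_, ?_, ?_⟩
      · refine subset_inter ?_ inter_subset_right
        rw [h2]; exact h5
      · rw [h2]; exact h6
      · rw [h2]; exact h7
    · intro K hK
      exact sdiff_subset.trans (hmem K (hK1mem K hK).1).2.1
    · intro K hK
      obtain ⟨h1, h2, h4⟩ := hK1mem K hK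
      have hsub : ((K1 (pairK H rel s F) m D S).filter fun K' => ¬ Disjoint (K \ S) (K' \ S)) ⊆
          (K \ m K).biUnion fun g => (K0 (pairK H rel s F) m S).filter fun K' => g ∈ K' \ m K' := by
        intro K' hK'
        rw [mem_filter, not_disjoint_iff] at hK'
        obtain ⟨h5, g, h6, h7⟩ := hK'
        obtain ⟨q1, q2, -⟩ := hK1mem K' h5
        have hcv : ∀ L : ES(n), L ∩ S = m L → g ∈ L \ S → g ∈ L \ m L := by
          intro L hL hgL
          rw [Finset.mem_sdiff] at hgL ⊢
          refine ⟨hgL.1, fun h => hgL.2 ?_⟩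
          rw [← hL] at h
          exact (mem_inter.1 h).2
        refine mem_biUnion.2 ⟨g, hcv K h2 h6, mem_filter.2 ⟨(mem_K1.1 h5).1, hcv K' q2 h7⟩⟩
      have h8 : (((K1 (pairK H rel s F) m D S).filter fun K' => ¬ Disjoint (K \ S) (K' \ S)).card : ℝ) ≤
          ∑ g ∈ K \ m K, (((K0 (pairK H rel s F) m S).filter fun K' => g ∈ K' \ m K').card : ℝ) := by
        exact_mod_cast (card_le_card hsub).trans card_biUnion_le
      refine h8.trans ((sum_le_card_nsmul _ _ D h4).trans ?_)
      rw [nsmul_eq_mul, hD']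
      refine mul_le_mul_of_nonneg_right ?_ (by rw [hD]; positivity)
      have := card_le_card (sdiff_subset (s := K) (t := m K))
      rw [cps_card (hmem K h1).1] at this
      exact_mod_cast this

set_option maxHeartbeats 1600000 in
/-- Lemma L. -/
lemma L_gen (h3 : 3 ≤ (HE H).card) {C Cu η c3 : ℝ} (R : ℕ) (hC : 0 < C) (hCu : 0 < Cu) (hη : 0 < η)
    (hη1 : η ≤ 1) (hCu1 : 1 ≤ Cu) (hc3 : 0 < c3) :
    ∃ ε > 0, ∃ B > 0, ∀ᶠ n in atTop, ∀ p, Win H C n p →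
      ∀ (Rg : ES(n)) (rel : ES(n) → Prop) (N : ℝ), Rg ⊆ EE n →
      (n : ℝ) ^ gam H ≤ N → Rg.card * p ≤ N →
      (∀ P ⊆ Rg, P.card = 2 → rel P →
        (((cps H n).filter fun K => P ⊆ K).card : ℝ) * p ^ ((HE H).card - 2) ≤ c3 * lam H n p / N) →
      pr (EE n) p (fun s => (U1 H Cu p s ∧ U2 H R s) ∧ ∃ F ⊆ s, F ⊆ Rg ∧ (F.card : ℝ) ≤ ε * N ∧
        η * lam H n p * F.card < (pairK H rel s F).card) ≤ B / (n : ℝ) ^ 2 := by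
  have hg := gam_pos h3
  set e := (HE H).card with he
  have he0 : (0:ℝ) < e := by exact_mod_cast (by omega : 0 < e)
  have he3 : (3:ℝ) ≤ e := by exact_mod_cast h3
  obtain ⟨A0, hA0⟩ := exists_nat_gt (2 / gam H)
  set A := A0 + 2 with hA
  have hAg : 2 ≤ gam H * ((A - 1 : ℕ) : ℝ) := by
    rw [div_lt_iff₀ hg] at hA0
    rw [hA, show A0 + 2 - 1 = A0 + 1 by omega]
    push_cast
    nlinarith
  have hA1 : (2:ℝ) ≤ A := by exact_mod_cast (by omega : 2 ≤ A)
  set δ := η / (128 * e ^ 2 * Cu * A) with hδ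
  have hden : 0 < 128 * (e:ℝ) ^ 2 * Cu * A := by positivity
  have hδ0 : 0 < δ := by positivity
  have hδden : δ * (128 * e ^ 2 * Cu * A) = η := by rw [hδ]; field_simp
  have hδe : e * δ ≤ 1 / 2 := by
    have : e * δ * 2 ≤ δ * (128 * e ^ 2 * Cu * A) := by
      have h1 : (2:ℝ) * e ≤ 128 * e ^ 2 * Cu * A := by
        have : (1:ℝ) ≤ Cu * A := by nlinarith
        nlinarith [mul_le_mul_of_nonneg_left this (by positivity : 0 ≤ 128 * (e:ℝ)^2)]
      nlinarith
    linarith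
  have hδ1 : δ ≤ 1 := by nlinarith
  set c4 := 16 * c3 / (η * δ) with hc4
  have hc40 : 0 < c4 := by positivity
  set ε := 1 / (2 * (exp 1 * c4 ^ A) + 1) with hε
  have hec : 0 < exp 1 * c4 ^ A := by positivity
  have hε0 : 0 < ε := by positivity
  have hε1 : ε ≤ 1 := by rw [hε, div_le_one (by positivity)]; linarith
  have hεc : exp 1 * c4 ^ A * ε ≤ 1 / 2 := by
    rw [hε, mul_one_div, div_le_iff₀ (by positivity)]; linarith
  set B0 := 2 * exp 1 * c4 ^ A * ∑' f : ℕ, (f : ℝ) ^ (A - 1) * (1 / 2 : ℝ) ^ f with hB0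
  have hB00 : 0 ≤ B0 := by
    rw [hB0]; exact mul_nonneg (by positivity) (tsum_nonneg fun _ => by positivity)
  refine ⟨ε, hε0, (B0 + 1) * (8 / δ ^ 2), by positivity, ?_⟩
  have hlogev : ∀ᶠ n : ℕ in atTop, 2 * R * C / (δ ^ 2 * Cu) ≤ log n :=
    (tendsto_log_atTop.comp tendsto_natCast_atTop_atTop).eventually_ge_atTop _
  filter_upwards [hlogev] with n hlog p hw Rg rel N hRg hN hRN hcod
  have hn1 : (1:ℝ) ≤ n := by exact_mod_cast (by have := hw.hn; omega : 1 ≤ n)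
  have hn0 : (0:ℝ) < n := by linarith
  have hN0 : 0 < N := lt_of_lt_of_le (Real.rpow_pos_of_pos hn0 _) hN
  have hl1 := hw.lam1
  set lm := lam H n p with hlm
  have hlm0 : 0 < lm := by linarith
  set T := Cu * lm with hT
  have hT0 : 0 < T := by positivity
  have hRT : 2 * (R:ℝ) ≤ δ ^ 2 * T := by
    rw [div_le_iff₀ (by positivity)] at hlog
    have h1 := hw.lamge
    have : 2 * (R:ℝ) * C ≤ C * (δ ^ 2 * T) := by
      calc _ ≤ log n * (δ ^ 2 * Cu) := hlog
        _ ≤ (C * lm) * (δ ^ 2 * Cu) := mul_le_mul_of_nonneg_right h1 (by positivity)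
        _ = _ := by rw [hT]; ring
    nlinarith
  set D := 8 * e * δ ^ 2 * T with hD
  set D' := e * D with hD'
  -- the sampled event
  set EV : ES(n) → ES(n) → Prop := fun S s =>
    ∃ F ∈ (S ∩ Rg).powerset.filter (fun F => 1 ≤ F.card ∧ (F.card : ℝ) ≤ ε * N),
      F ⊆ s ∧ dtEv (famI H rel S F) (fun K => K \ S) D' (η * δ / 8 * lm * F.card) s with hEV
  have hEVp : ∀ S ⊆ EE n, pr (EE n) p (EV S) ≤ B0 / N ^ (A - 1) := by
    intro S hS
    refine (pr_exists hw.p0 hw.p1 _ _).trans ?_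
    refine le_trans (sum_le_sum fun F hF => ?_) (series_aux A (by omega) hc40 hε0 hε1 hN0 hw.p0 hεc (S ∩ Rg) ?_)
    · rw [mem_filter, mem_powerset] at hF
      have hf0 : (0:ℝ) < F.card := by exact_mod_cast hF.2.1
      refine (L_fixed hw.p0 hw.p1 hS (hF.1.trans inter_subset_left)
        (hF.1.trans inter_subset_right) hcod (by positivity) (by positivity) (by positivity)
        (A * F.card) ?_).trans (le_of_eq ?_)
      · push_cast
        rw [hD', hD, hT]
        have : A * (F.card:ℝ) * (e * (8 * e * δ ^ 2 * (Cu * lm))) =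
          (δ * (128 * e ^ 2 * Cu * A)) * (δ * F.card * lm / 16) := by ring
        rw [this, hδden]
        apply le_of_eq; ring
      · congr 2
        rw [hc4]
        field_simp
        norm_num
    · refine le_trans ?_ hRN
      refine mul_le_mul_of_nonneg_right ?_ hw.p0
      exact_mod_cast card_le_card inter_subset_right
  -- comparison
  set bad : ES(n) → Prop := fun s => (U1 H Cu p s ∧ U2 H R s) ∧
    ∃ F ⊆ s, F ⊆ Rg ∧ (F.card : ℝ) ≤ ε * N ∧ η * lm * F.card < (pairK H rel s F).card with hbad
  have hkey : ∀ s ⊆ EE n, δ ^ 2 / 8 * ind (bad s) ≤ pr (EE n) δ (fun S => EV S s) := by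
    intro s hs
    by_cases hb : bad s
    swap
    · rw [ind_false hb, mul_zero]; exact pr_nonneg hδ0.le hδ1 _
    rw [ind_true hb, mul_one]
    obtain ⟨⟨hU1, hU2⟩, F, hFs, hFR, hFN, hFbig⟩ := hb
    exact L_key he h3 hs hU1 hU2 hFs hFR hFN hlm hlm0 hT hT0 hδ0 hδe hδ1 hRT hη hD hD' hFbig
  have hmain : δ ^ 2 / 8 * pr (EE n) p bad ≤ B0 / N ^ (A - 1) := by
    calc δ ^ 2 / 8 * pr (EE n) p bad = ex (EE n) p (fun s => δ ^ 2 / 8 * ind (bad s)) := (ex_mul_left _ _).symm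
      _ ≤ ex (EE n) p (fun s => ex (EE n) δ (fun S => ind (EV S s))) :=
          ex_mono hw.p0 hw.p1 hkey
      _ = ex (EE n) δ (fun S => ex (EE n) p (fun s => ind (EV S s))) := ex_comm _
      _ ≤ ex (EE n) δ (fun _ => B0 / N ^ (A - 1)) := ex_mono hδ0.le hδ1 hEVp
      _ = _ := ex_const _
  have hNA : (n:ℝ) ^ 2 ≤ N ^ (A - 1) := by
    calc (n:ℝ) ^ 2 = (n:ℝ) ^ (2:ℝ) := by norm_cast
      _ ≤ (n:ℝ) ^ (gam H * ((A - 1 : ℕ) : ℝ)) := Real.rpow_le_rpow_of_exponent_le hn1 hAg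
      _ = ((n:ℝ) ^ gam H) ^ (A - 1) := by rw [rpow_mul hn0.le, rpow_natCast]
      _ ≤ _ := pow_le_pow_left₀ (by positivity) hN _
  have h9 : B0 / N ^ (A - 1) ≤ (B0 + 1) / (n:ℝ) ^ 2 := by
    rw [div_le_div_iff₀ (by positivity) (by positivity)]
    nlinarith [pow_pos hN0 (A - 1)]
  have h10 := hmain.trans h9
  have hgen : ∀ x : ℝ, x = (δ ^ 2 / 8 * x) * (8 / δ ^ 2) := fun x => hgx hδ0.ne' x
  calc pr (EE n) p bad = (δ ^ 2 / 8 * pr (EE n) p bad) * (8 / δ ^ 2) := hgen _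
    _ ≤ (B0 + 1) / (n:ℝ) ^ 2 * (8 / δ ^ 2) := mul_le_mul_of_nonneg_right h10 (div_nonneg (by norm_num) (sq_nonneg _))
    _ = _ := by ring
end

/-! ### Instances of the intersection lemma -/
section
variable [Fintype α] {H : SimpleGraph α} {n : ℕ} {p C : ℝ}

lemma VJ_Jof_ge {ψ : α ↪ Fin n} {P : ES(n)} (hP : P ⊆ im H ψ) :
    (VU P).card ≤ (VJ (Jof H ψ P)).card := by
  have : VU P ⊆ (VJ (Jof H ψ P)).map ψ := by
    intro x hx
    obtain ⟨g, hg, hxg⟩ := mem_VU.1 hx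
    obtain ⟨f, hf, rfl⟩ := mem_im.1 (hP hg)
    obtain ⟨w, hw, rfl⟩ := Sym2.mem_map.1 hxg
    exact Finset.mem_map.2 ⟨w, mem_VJ.2 ⟨f, mem_Jof.2 ⟨hf, hg⟩, hw⟩, rfl⟩
  have h := card_le_card this
  rwa [card_map] at h

/-- The constant in the codegree bound. -/
def cD (H : SimpleGraph α) : ℝ := 2 ^ (HE H).card * 4 ^ ν(α)

lemma cD_pos : 0 < cD H := by unfold cD; positivity

lemma codeg (hn : 1 ≤ n) {P : ES(n)} {k : ℕ} (hP2 : P.card = 2) (hk : k ≤ (VU P).card) :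
    (((cps H n).filter fun K => P ⊆ K).card : ℝ) ≤ cD H * (n : ℝ) ^ (ν(α) - k) := by
  have h1 := sum_cps_le (H := H) (n := n) (fun K => P ⊆ K) (fun _ => 1) (fun _ => zero_le_one)
  have h2 : (((cps H n).filter fun K => P ⊆ K).card : ℝ) ≤
      ((univ.filter fun ψ : α ↪ Fin n => P ⊆ im H ψ).card : ℝ) := by
    simpa using h1
  refine h2.trans ?_
  have h3 : (univ.filter fun ψ : α ↪ Fin n => P ⊆ im H ψ) ⊆
      ((HE H).powerset.filter fun J => k ≤ (VJ J).card).biUnion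
        fun J => univ.filter fun ψ : α ↪ Fin n => ∀ f ∈ J, Sym2.map ψ f ∈ P := by
    intro ψ hψ
    simp only [mem_filter, mem_univ, true_and] at hψ
    simp only [mem_biUnion, mem_filter, mem_powerset, mem_univ, true_and]
    exact ⟨Jof H ψ P, ⟨Jof_subset _ _, hk.trans (VJ_Jof_ge hψ)⟩, fun f hf => (mem_Jof.1 hf).2⟩
  have h4 := (card_le_card h3).trans card_biUnion_le
  have h5 : ∀ J ∈ (HE H).powerset.filter fun J => k ≤ (VJ J).card,
      (univ.filter fun ψ : α ↪ Fin n => ∀ f ∈ J, Sym2.map ψ f ∈ P).card ≤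
        4 ^ ν(α) * n ^ (ν(α) - k) := by
    intro J hJ
    refine (ext_count J P).trans ?_
    rw [hP2]
    refine Nat.mul_le_mul (Nat.pow_le_pow_right (by norm_num) (card_le_univ _)) ?_
    have := (mem_filter.1 hJ).2
    exact Nat.pow_le_pow_right hn (by omega)
  have h6 := h4.trans (sum_le_card_nsmul _ _ _ h5)
  have h7 : ((HE H).powerset.filter fun J => k ≤ (VJ J).card).card ≤ 2 ^ (HE H).card := by
    refine (card_filter_le _ _).trans (le_of_eq ?_)
    rw [card_powerset]
  have h8 := h6.trans (Nat.mul_le_mul_right _ h7)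
  unfold cD
  rw [mul_assoc]
  exact_mod_cast h8

lemma codeg_lam (hw : Up H C n p) (h2 : 2 ≤ (HE H).card) {P : ES(n)} {k : ℕ} (hk2 : 2 ≤ k)
    (hP2 : P.card = 2) (hk : k ≤ (VU P).card) (hp : 0 < p) :
    (((cps H n).filter fun K => P ⊆ K).card : ℝ) * p ^ ((HE H).card - 2) ≤
      cD H * lam H n p / ((n : ℝ) ^ (k - 2) * p) := by
  have hn : 1 ≤ n := by have := hw.hn; omega
  have hn0 : (0:ℝ) < n := by exact_mod_cast hn
  have hl : 0 ≤ lam H n p := by unfold lam; positivity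
  rw [le_div_iff₀ (by positivity)]
  by_cases hkv : k ≤ ν(α)
  · calc (((cps H n).filter fun K => P ⊆ K).card : ℝ) * p ^ ((HE H).card - 2) * ((n : ℝ) ^ (k - 2) * p)
        ≤ cD H * (n : ℝ) ^ (ν(α) - k) * p ^ ((HE H).card - 2) * ((n : ℝ) ^ (k - 2) * p) := by
          have := codeg (H := H) hn hP2 hk
          gcongr
      _ = cD H * ((n : ℝ) ^ (ν(α) - k + (k - 2)) * p ^ ((HE H).card - 2 + 1)) := by
          rw [pow_add, pow_succ]; ring
      _ = _ := by
          unfold lam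
          rw [show ν(α) - k + (k - 2) = ν(α) - 2 by omega,
            show (HE H).card - 2 + 1 = (HE H).card - 1 by omega]
  · have : ((cps H n).filter fun K => P ⊆ K) = ∅ := by
      rw [filter_eq_empty_iff]
      intro K hK hPK
      obtain ⟨ψ, rfl⟩ := mem_cps.1 hK
      have h1 := VJ_Jof_ge hPK
      have h2 := card_le_univ (VJ (Jof H ψ P))
      omega
    rw [this]
    have := cD_pos (H := H)
    simp only [card_empty, Nat.cast_zero, zero_mul]
    positivity

lemma VU_three {P : ES(n)} (hP : P ⊆ EE n) (hP2 : P.card = 2) : 3 ≤ (VU P).card := by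
  obtain ⟨g, g', hne, rfl⟩ := card_eq_two.1 hP2
  have hg : ¬ g.IsDiag := mem_EE.1 (hP (by simp))
  have hg' : ¬ g'.IsDiag := mem_EE.1 (hP (by simp))
  have c1 := Sym2.card_toFinset_of_not_isDiag g hg
  have c2 := Sym2.card_toFinset_of_not_isDiag g' hg'
  have e : VU {g, g'} = g.toFinset ∪ g'.toFinset := by
    ext x; simp [mem_VU]
  rw [e]
  by_contra hlt
  have s1 : g.toFinset = g.toFinset ∪ g'.toFinset :=
    eq_of_subset_of_card_le subset_union_left (by omega)
  have s2 : g'.toFinset = g.toFinset ∪ g'.toFinset :=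
    eq_of_subset_of_card_le subset_union_right (by omega)
  have s3 : g.toFinset = g'.toFinset := s1.trans s2.symm
  apply hne
  ext x
  rw [← Sym2.mem_toFinset, s3, Sym2.mem_toFinset]

/-- The relation: the two edges are disjoint. -/
def relD {n : ℕ} (P : ES(n)) : Prop := 4 ≤ (VU P).card

/-- Few copies contain two disjoint edges of a small set. -/
def LD (H : SimpleGraph α) (η ε : ℝ) {n : ℕ} (p : ℝ) (s : ES(n)) : Prop :=
  ∀ F ⊆ s, (F.card : ℝ) ≤ ε * ((n : ℝ) ^ 2 * p) →
    ((pairK H relD s F).card : ℝ) ≤ η * lam H n p * F.card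

/-- Few copies contain two edges of a small star. -/
def LA (H : SimpleGraph α) (η κ : ℝ) {n : ℕ} (p : ℝ) (s : ES(n)) : Prop :=
  ∀ x : Fin n, ∀ F ⊆ s, (∀ g ∈ F, x ∈ g) → (F.card : ℝ) ≤ κ * (n * p) →
    ((pairK H (fun _ => True) s F).card : ℝ) ≤ η * lam H n p * F.card

lemma LD_whp (hH : Strictly2Balanced H) (h3 : 3 ≤ (HE H).card) {C Cu η : ℝ} {R : ℕ} (hC : 0 < C)
    (hCu1 : 1 ≤ Cu) (hη : 0 < η) (hη1 : η ≤ 1)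
    (hU : Whp H C (fun _ p s => U1 H Cu p s ∧ U2 H R s)) :
    ∃ ε > 0, Whp H C (fun _ p s => LD H η ε p s) := by
  obtain ⟨ε, hε, B, hB, hL⟩ := L_gen (H := H) h3 R hC (by linarith) hη hη1 hCu1 (cD_pos (H := H))
  refine ⟨ε, hε, hU.step fun ζ hζ => ?_⟩
  have ht : Tendsto (fun n : ℕ => B / (n:ℝ) ^ 2) atTop (𝓝 0) :=
    tendsto_const_nhds.div_atTop ((tendsto_pow_atTop (by norm_num)).comp tendsto_natCast_atTop_atTop)
  filter_upwards [hL, ht.eventually (gt_mem_nhds hζ)] with n h1 h2 p hw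
  have hp := hw.p_pos hH
  have hn : (1:ℝ) ≤ n := by exact_mod_cast (by have := hw.hn; omega : 1 ≤ n)
  refine le_trans (pr_mono hw.p0 hw.p1 ?_) ((h1 p hw (EE n) relD ((n:ℝ) ^ 2 * p) Finset.Subset.rfl ?_ ?_ ?_).trans h2.le)
  · intro s hs ⟨h4, h5⟩
    refine ⟨h4, ?_⟩
    unfold LD at h5
    push Not at h5
    obtain ⟨F, hF, h6, h7⟩ := h5
    exact ⟨F, hF, hF.trans hs, h6, h7⟩
  · refine hw.w3.trans ?_
    nlinarith [mul_nonneg (mul_nonneg (by linarith : (0:ℝ) ≤ n) hp.le) (by linarith : (0:ℝ) ≤ n - 1)]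
  · exact mul_le_mul_of_nonneg_right EE_card_le hw.p0
  · intro P _ hP2 hr
    exact codeg_lam hw.toUp (by omega) (by norm_num : 2 ≤ 4) hP2 hr hp

lemma LA_whp (hH : Strictly2Balanced H) (h3 : 3 ≤ (HE H).card) {C Cu η : ℝ} {R : ℕ} (hC : 0 < C)
    (hCu1 : 1 ≤ Cu) (hη : 0 < η) (hη1 : η ≤ 1)
    (hU : Whp H C (fun _ p s => U1 H Cu p s ∧ U2 H R s)) :
    ∃ κ > 0, Whp H C (fun _ p s => LA H η κ p s) := by
  obtain ⟨ε, hε, B, hB, hL⟩ := L_gen (H := H) h3 R hC (by linarith) hη hη1 hCu1 (cD_pos (H := H))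
  refine ⟨ε, hε, hU.step fun ζ hζ => ?_⟩
  have ht : Tendsto (fun n : ℕ => B / (n:ℝ)) atTop (𝓝 0) :=
    tendsto_const_nhds.div_atTop tendsto_natCast_atTop_atTop
  filter_upwards [hL, ht.eventually (gt_mem_nhds hζ)] with n h1 h2 p hw
  have hp := hw.p_pos hH
  have hn : (1:ℝ) ≤ n := by exact_mod_cast (by have := hw.hn; omega : 1 ≤ n)
  have hx : ∀ x : Fin n, pr (EE n) p (fun s => (U1 H Cu p s ∧ U2 H R s) ∧ ∃ F ⊆ s,
      F ⊆ (EE n).filter (fun g => x ∈ g) ∧ (F.card : ℝ) ≤ ε * (n * p) ∧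
        η * lam H n p * F.card < (pairK H (fun _ => True) s F).card) ≤ B / (n : ℝ) ^ 2 := by
    intro x
    refine h1 p hw _ _ _ (filter_subset _ _) hw.w3 ?_ ?_
    · refine mul_le_mul_of_nonneg_right ?_ hw.p0
      have : (EE n).filter (fun g => x ∈ g) ⊆ univ.image fun y => s(x, y) := by
        intro g hg
        obtain ⟨y, rfl⟩ := Sym2.mem_iff_exists.1 (mem_filter.1 hg).2
        simp
      have := (card_le_card this).trans card_image_le
      rw [card_univ, Fintype.card_fin] at this
      exact_mod_cast this
    · intro P hP hP2 _
      have := codeg_lam hw.toUp (by omega) (by norm_num : 2 ≤ 3) hP2 (VU_three (hP.trans (filter_subset _ _)) hP2) hp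
      simpa using this
  refine le_trans (pr_mono hw.p0 hw.p1 (Q := fun s => ∃ x ∈ (univ : Finset (Fin n)), (U1 H Cu p s ∧ U2 H R s) ∧ ∃ F ⊆ s,
      F ⊆ (EE n).filter (fun g => x ∈ g) ∧ (F.card : ℝ) ≤ ε * (n * p) ∧
        η * lam H n p * F.card < (pairK H (fun _ => True) s F).card) ?_) ?_
  · intro s hs ⟨h4, h5⟩
    unfold LA at h5
    push Not at h5
    obtain ⟨x, F, hF, h6, h7, h8⟩ := h5
    exact ⟨x, mem_univ _, h4, F, hF, fun g hg => mem_filter.2 ⟨hs (hF hg), h6 g hg⟩, h7, h8⟩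
  · refine (pr_exists hw.p0 hw.p1 _ _).trans ((sum_le_sum fun x _ => hx x).trans ?_)
    rw [sum_const, card_univ, Fintype.card_fin, nsmul_eq_mul]
    refine le_trans (le_of_eq ?_) h2.le
    field_simp
end

/-! ### Degree and density bounds -/
section
variable {ι : Type*} [DecidableEq ι] {E : Finset ι} {p : ℝ}

lemma chernoff (hp : 0 ≤ p) (hp1 : p ≤ 1) {A : Finset ι} (hA : A ⊆ E) {μ b t : ℝ} (hμ : A.card * p ≤ μ) (hb : 0 ≤ b) :
    pr E p (fun s => t ≤ (s ∩ A).card) ≤ exp ((exp b - 1) * μ - b * t) := by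
  have h0 : 0 ≤ exp b - 1 := by linarith [add_one_le_exp b]
  have h1 : ex E p (fun s => exp b ^ (s ∩ A).card) = (1 + p * (exp b - 1)) ^ A.card := by
    rw [ex_inter hA (fun s => exp b ^ s.card), ex_pow_card]
  have h2 := markov hp hp1 (E := E) (f := fun s => exp b ^ (s ∩ A).card) (fun s _ => by positivity)
    (exp_pos (b * t)) (fun s => t ≤ (s ∩ A).card) (fun s _ h => by
      rw [← exp_nat_mul]
      exact exp_le_exp.2 (by nlinarith))
  refine h2.trans ?_
  rw [h1, exp_sub]
  refine div_le_div_of_nonneg_right ?_ (exp_pos _).le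
  calc (1 + p * (exp b - 1)) ^ A.card ≤ (exp (p * (exp b - 1))) ^ A.card := by
        refine pow_le_pow_left₀ (by positivity) ?_ _
        rw [add_comm]; exact add_one_le_exp _
    _ = exp (A.card * p * (exp b - 1)) := by rw [← exp_nat_mul]; ring_nf
    _ ≤ _ := exp_le_exp.2 (by nlinarith)
end

section
variable [Fintype α] {H : SimpleGraph α} {n : ℕ} {p C : ℝ}

lemma exp_gam_small (h3 : 3 ≤ (HE H).card) {c : ℝ} (hc : 0 < c) (k : ℕ) :
    Tendsto (fun n : ℕ => (n : ℝ) ^ k * exp (-(c * (n : ℝ) ^ gam H))) atTop (𝓝 0) := by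
  have hg := gam_pos h3
  obtain ⟨m, hm⟩ := exists_nat_gt (k / gam H)
  rw [div_lt_iff₀ hg] at hm
  have h1 : Tendsto (fun n : ℕ => c * (n : ℝ) ^ gam H) atTop atTop :=
    ((tendsto_rpow_atTop hg).comp tendsto_natCast_atTop_atTop).const_mul_atTop hc
  have h2 := ((Real.tendsto_pow_mul_exp_neg_atTop_nhds_zero m).comp h1).mul_const (1 / c ^ m)
  rw [zero_mul] at h2
  refine squeeze_zero' (Eventually.of_forall fun n => by positivity) ?_ h2
  filter_upwards [eventually_ge_atTop 1] with n hn
  have hn1 : (1:ℝ) ≤ n := by exact_mod_cast hn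
  have : (n:ℝ) ^ k ≤ ((n : ℝ) ^ gam H) ^ m := by
    rw [← rpow_natCast, ← Real.rpow_mul_natCast (by positivity)]
    exact Real.rpow_le_rpow_of_exponent_le hn1 (by linarith)
  simp only [Function.comp]
  calc (n:ℝ) ^ k * exp (-(c * (n : ℝ) ^ gam H)) ≤
      ((n : ℝ) ^ gam H) ^ m * exp (-(c * (n : ℝ) ^ gam H)) := by gcongr
    _ = _ := by rw [mul_pow]; field_simp

/-- The edges at a vertex. -/
def star {n : ℕ} (s : ES(n)) (x : Fin n) : ES(n) := s.filter fun g => x ∈ g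

lemma mem_star {s : ES(n)} {x : Fin n} {g : E2(n)} : g ∈ star s x ↔ g ∈ s ∧ x ∈ g := by
  unfold star; exact mem_filter

lemma star_EE_card (x : Fin n) : (star (EE n) x).card ≤ n := by
  have : star (EE n) x ⊆ univ.image fun y => s(x, y) := by
    intro g hg
    obtain ⟨y, rfl⟩ := Sym2.mem_iff_exists.1 (mem_star.1 hg).2
    simp
  have := (card_le_card this).trans card_image_le
  rwa [card_univ, Fintype.card_fin] at this

/-- All degrees are at most `4np`. -/
def DegB {n : ℕ} (p : ℝ) (s : ES(n)) : Prop :=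
  ∀ x, ((star s x).card : ℝ) ≤ 4 * (n * p)

lemma DegB_whp (h3 : 3 ≤ (HE H).card) (C : ℝ) : Whp H C (fun _ p s => DegB p s) := by
  intro ζ hζ
  filter_upwards [(exp_gam_small (H := H) h3 one_pos 1).eventually (gt_mem_nhds hζ)] with n h1 p hw
  have h2 : ∀ x : Fin n, pr (EE n) p (fun s => 4 * (n * p) ≤ (s ∩ star (EE n) x).card) ≤
      exp (-(1 * (n:ℝ) ^ gam H)) := by
    intro x
    have hs : star (EE n) x ⊆ EE n := filter_subset _ _
    refine (chernoff hw.p0 hw.p1 hs (μ := n * p) (b := 1) ?_ zero_le_one).trans ?_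
    · exact mul_le_mul_of_nonneg_right (by exact_mod_cast star_EE_card x) hw.p0
    · refine exp_le_exp.2 ?_
      have := exp_one_lt_d9
      have := hw.w3
      have h0 : 0 ≤ (n:ℝ) ^ gam H := by positivity
      nlinarith
  refine le_trans (pr_mono hw.p0 hw.p1 (Q := fun s => ∃ x ∈ (univ : Finset (Fin n)),
    4 * (n * p) ≤ (s ∩ star (EE n) x).card) ?_) ?_
  · intro s hs h
    unfold DegB at h
    push Not at h
    obtain ⟨x, hx⟩ := h
    refine ⟨x, mem_univ _, ?_⟩
    have : s ∩ star (EE n) x = star s x := by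
      ext g
      rw [mem_inter, mem_star, mem_star]
      exact ⟨fun h => ⟨h.1, h.2.2⟩, fun h => ⟨h.1, hs h.1, h.2⟩⟩
    rw [this]; exact hx.le
  · refine (pr_exists hw.p0 hw.p1 _ _).trans ((sum_le_sum fun x _ => h2 x).trans ?_)
    rw [sum_const, card_univ, Fintype.card_fin, nsmul_eq_mul]
    rw [pow_one] at h1
    exact h1.le

/-- Edges inside a vertex set. -/
def ins {n : ℕ} (s : ES(n)) (X : Finset (Fin n)) : ES(n) :=
  s.filter fun g => ∀ x ∈ g, x ∈ X

lemma mem_ins {s : ES(n)} {X : Finset (Fin n)} {g : E2(n)} :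
    g ∈ ins s X ↔ g ∈ s ∧ ∀ x ∈ g, x ∈ X := by
  unfold ins; exact mem_filter

lemma ins_card (X : Finset (Fin n)) : (ins (EE n) X).card ≤ X.card ^ 2 := by
  have : ins (EE n) X ⊆ (X ×ˢ X).image fun z => s(z.1, z.2) := by
    intro g hg
    induction g with
    | h x y =>
      have h := (mem_ins.1 hg).2
      exact mem_image.2 ⟨(x, y), mem_product.2 ⟨h x (by simp), h y (by simp)⟩, rfl⟩
  have := (card_le_card this).trans card_image_le
  rw [card_product] at this
  rw [sq]; exact this

/-- Small vertex sets span few edges. -/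
def DenB (η ε : ℝ) {n : ℕ} (p : ℝ) (s : ES(n)) : Prop :=
  ∀ X : Finset (Fin n), (X.card : ℝ) ≤ ε * n → ((ins s X).card : ℝ) ≤ η * (n * p) * X.card

lemma DenB_whp (h3 : 3 ≤ (HE H).card) (C : ℝ) {η : ℝ} (hη : 0 < η) :
    Whp H C (fun _ p s => DenB η (η / 6) p s) := by
  intro ζ hζ
  set ζ' := min (ζ / 2) 1 with hζ'
  have hζ'0 : 0 < ζ' := by positivity
  filter_upwards [(exp_gam_small (H := H) h3 (half_pos hη) 1).eventually (gt_mem_nhds hζ'0)] with n h1 p hw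
  set x := exp (-(η / 2 * (n:ℝ) ^ gam H)) with hx
  have hx0 : 0 < x := exp_pos _
  rw [pow_one] at h1
  have h2 : ∀ X : Finset (Fin n), (X.card : ℝ) ≤ η / 6 * n →
      pr (EE n) p (fun s => η * (n * p) * X.card ≤ (s ∩ ins (EE n) X).card) ≤ x ^ X.card := by
    intro X hX
    have hs : ins (EE n) X ⊆ EE n := filter_subset _ _
    refine (chernoff hw.p0 hw.p1 hs (μ := X.card ^ 2 * p) (b := 1) ?_ zero_le_one).trans ?_
    · exact mul_le_mul_of_nonneg_right (by exact_mod_cast ins_card X) hw.p0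
    · rw [hx, ← exp_nat_mul]
      refine exp_le_exp.2 ?_
      have h5 := exp_one_lt_d9
      have h6 := hw.w3
      have hp := hw.p0
      have hc0 : (0:ℝ) ≤ X.card := by positivity
      have h7 : (X.card : ℝ) ^ 2 * p ≤ η / 6 * (X.card * (n * p)) := by
        nlinarith [mul_le_mul_of_nonneg_left hX (mul_nonneg hc0 hp)]
      have h8 : (exp 1 - 1) * ((X.card:ℝ) ^ 2 * p) ≤ 3 * (η / 6 * (X.card * (n * p))) := by
        have : 0 ≤ (X.card:ℝ) ^ 2 * p := by positivity
        nlinarith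
      nlinarith [mul_le_mul_of_nonneg_left h6 (mul_nonneg hc0 hη.le)]
  refine le_trans (pr_mono hw.p0 hw.p1 (Q := fun s => ∃ X ∈ (univ : Finset (Fin n)).powerset.filter
    fun X => X ≠ ∅ ∧ (X.card : ℝ) ≤ η / 6 * n,
    η * (n * p) * X.card ≤ (s ∩ ins (EE n) X).card) ?_) ?_
  · intro s hs h
    unfold DenB at h
    push Not at h
    obtain ⟨X, hX, hX2⟩ := h
    refine ⟨X, mem_filter.2 ⟨mem_powerset.2 (subset_univ _), ?_, hX⟩, ?_⟩
    · rintro rfl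
      have : ins s ∅ = ∅ := by
        rw [eq_empty_iff_forall_notMem]
        intro g hg
        induction g with
        | h a b => exact absurd ((mem_ins.1 hg).2 a (by simp)) (by simp)
      rw [this] at hX2
      simp at hX2
    · have : s ∩ ins (EE n) X = ins s X := by
        ext g
        rw [mem_inter, mem_ins, mem_ins]
        exact ⟨fun h => ⟨h.1, h.2.2⟩, fun h => ⟨h.1, hs h.1, h.2⟩⟩
      rw [this]; exact hX2.le
  · refine (pr_exists hw.p0 hw.p1 _ _).trans
      ((sum_le_sum fun X hX => h2 X (mem_filter.1 hX).2.2).trans ?_)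
    have h3 : ∑ X ∈ (univ : Finset (Fin n)).powerset with X ≠ ∅ ∧ (X.card : ℝ) ≤ η / 6 * n, x ^ X.card ≤
        ∑ X ∈ (univ : Finset (Fin n)).powerset.erase ∅, x ^ X.card := by
      refine sum_le_sum_of_subset_of_nonneg ?_ fun _ _ _ => by positivity
      intro X hX
      rw [mem_filter] at hX
      exact mem_erase.2 ⟨hX.2.1, hX.1⟩
    refine h3.trans ?_
    have h4 := add_sum_erase (univ : Finset (Fin n)).powerset (fun X => x ^ X.card)
      (a := ∅) (by simp)
    have h5 := sum_pow_mul_eq_add_pow x 1 (univ : Finset (Fin n))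
    simp only [one_pow, mul_one, card_univ, Fintype.card_fin] at h5
    rw [h5] at h4
    simp only [card_empty, pow_zero] at h4
    have h6 : (x + 1) ^ n ≤ exp (n * x) := by
      rw [exp_nat_mul]
      exact pow_le_pow_left₀ (by positivity) (add_one_le_exp x) _
    have h7 : (n:ℝ) * x ≤ 1 := h1.le.trans (min_le_right _ _)
    have h8 : (n:ℝ) * x ≤ ζ / 2 := h1.le.trans (min_le_left _ _)
    have h9 := Real.abs_exp_sub_one_le (x := n * x) (by rw [abs_of_nonneg (by positivity)]; exact h7)
    rw [abs_of_nonneg (by positivity : 0 ≤ (n:ℝ) * x)] at h9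
    have := le_abs_self (exp (n * x) - 1)
    linarith
end

/-! ### The star lemma -/
section
variable {ι κ : Type*} [DecidableEq ι] [DecidableEq κ] {p : ℝ}

lemma jDelta_le (hp : 0 ≤ p) {I : Finset κ} {A : κ → Finset ι} {M : ℝ}
    (h : ∀ i ∈ I, ∑ j ∈ I with ¬ Disjoint (A i) (A j), p ^ (A j \ A i).card ≤ M) :
    jDelta p I A ≤ (∑ i ∈ I, p ^ (A i).card) * M := by
  unfold jDelta
  rw [sum_mul]
  refine sum_le_sum fun i hi => ?_
  refine le_trans ?_ (mul_le_mul_of_nonneg_left (h i hi) (pow_nonneg hp _))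
  rw [mul_sum]
  have e : ∀ j, p ^ (A i ∪ A j).card = p ^ (A i).card * p ^ (A j \ A i).card := by
    intro j
    rw [← pow_add, ← card_union_of_disjoint disjoint_sdiff, union_sdiff_self_eq_union]
  rw [sum_congr rfl fun j _ => e j]
  refine sum_le_sum_of_subset_of_nonneg ?_ fun _ _ _ => by positivity
  intro j hj
  rw [mem_filter] at hj ⊢
  exact ⟨hj.1, hj.2.2⟩
end

section
variable [Fintype α] {H : SimpleGraph α} {n : ℕ} {p C : ℝ}

/-- Neighbours. -/
def nb (H : SimpleGraph α) (u : α) : Finset α := univ.filter fun w => H.Adj u w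

lemma mem_nb {u w : α} : w ∈ nb H u ↔ H.Adj u w := by simp [nb]

lemma inc_eq (u : α) : inc H u = (nb H u).image fun w => s(u, w) := by
  ext f
  rw [mem_inc, mem_image]
  constructor
  · rintro ⟨h1, h2⟩
    obtain ⟨w, rfl⟩ := Sym2.mem_iff_exists.1 h2
    exact ⟨w, mem_nb.2 (by simpa [mem_HE] using h1), rfl⟩
  · rintro ⟨w, hw, rfl⟩
    exact ⟨mem_HE.2 (by simpa using mem_nb.1 hw), by simp⟩

lemma inc_card' (u : α) : (inc H u).card = (nb H u).card := by
  rw [inc_eq, card_image_of_injective]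
  intro a b h
  exact Sym2.congr_right.1 h

/-- The exponent estimate behind the star lemma. -/
lemma star_term (hH : Strictly2Balanced H) (h3 : 3 ≤ (HE H).card) (h : Win H C n p)
    (hCn : C * log n ≤ n) {u : α} {J : Finset (Sym2 α)} (hJ : J ⊆ HE H) (hne : J.Nonempty) (hu : u ∉ VJ J) :
    (n : ℝ) ^ (ν(α) - 1 - (VJ J).card) * p ^ ((HE H).card - J.card - (nb H u ∩ VJ J).card) ≤ 1 := by
  have hn1 : 1 ≤ n := by have := h.hn; omega
  have hn0 : (0:ℝ) < n := by exact_mod_cast hn1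
  have hlt : (VJ J).card < ν(α) := by
    rw [← card_univ]
    exact card_lt_card (ssubset_univ_iff.2 fun h => hu (h ▸ mem_univ u))
  by_cases hb : (nb H u ∩ VJ J).card = 0
  · have h1 := emb_term_le hH h3 h.toUp J hJ hne
    rw [h.max_eq] at h1
    rw [hb, Nat.sub_zero]
    rw [show ν(α) - (VJ J).card = (ν(α) - 1 - (VJ J).card) + 1 by omega, pow_succ] at h1
    have h2 := h1.trans (h.lamle.trans hCn)
    have : (n : ℝ) * ((n : ℝ) ^ (ν(α) - 1 - (VJ J).card) * p ^ ((HE H).card - J.card)) ≤ n * 1 := by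
      rw [mul_one]; refine le_trans (le_of_eq (by ring)) h2
    exact le_of_mul_le_mul_left this hn0
  · set J' := (nb H u ∩ VJ J).image (fun w => s(u, w)) with hJ'
    have hJ'c : J'.card = (nb H u ∩ VJ J).card := by
      rw [hJ', card_image_of_injective]
      intro a b h; exact Sym2.congr_right.1 h
    have hd : Disjoint J J' := by
      rw [Finset.disjoint_left]
      intro f hf hf'
      obtain ⟨w, _, rfl⟩ := mem_image.1 hf'
      exact hu (mem_VJ.2 ⟨_, hf, by simp⟩)
    have hc : (J ∪ J').card = J.card + (nb H u ∩ VJ J).card := by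
      rw [card_union_of_disjoint hd, hJ'c]
    have hsub : J ∪ J' ⊆ HE H := by
      refine union_subset hJ fun f hf => ?_
      obtain ⟨w, hw, rfl⟩ := mem_image.1 hf
      exact mem_HE.2 (by simpa using mem_nb.1 (mem_inter.1 hw).1)
    have hV : VJ (J ∪ J') = insert u (VJ J) := by
      ext w
      rw [mem_insert, mem_VJ]
      constructor
      · rintro ⟨f, hf, hwf⟩
        rcases mem_union.1 hf with hf | hf
        · exact Or.inr (mem_VJ.2 ⟨f, hf, hwf⟩)
        · obtain ⟨w', hw', rfl⟩ := mem_image.1 hf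
          rcases Sym2.mem_iff.1 hwf with rfl | rfl
          · exact Or.inl rfl
          · exact Or.inr (mem_inter.1 hw').2
      · rintro (rfl | hw)
        · obtain ⟨w', hw'⟩ := card_pos.1 (Nat.pos_of_ne_zero hb)
          exact ⟨s(w, w'), mem_union_right _ (mem_image.2 ⟨w', hw', rfl⟩), by simp⟩
        · obtain ⟨f, hf, hwf⟩ := mem_VJ.1 hw
          exact ⟨f, mem_union_left _ hf, hwf⟩
    have hVc : (VJ (J ∪ J')).card = (VJ J).card + 1 := by
      rw [hV, card_insert_of_notMem hu]
    have e1 : ν(α) - 1 - (VJ J).card = ν(α) - (VJ (J ∪ J')).card := by omega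
    have e2 : (HE H).card - J.card - (nb H u ∩ VJ J).card = (HE H).card - (J ∪ J').card := by omega
    rw [e1, e2]
    by_cases hall : J ∪ J' = HE H
    · rw [hall, sb_cover hH, card_univ]; simp
    · refine (h.w2 _ hsub hall ?_).trans (tht_le_one h3 hn1)
      have := card_pos.2 hne
      omega

/-- Data of a rooted star family. -/
structure StarT (H : SimpleGraph α) (κ : ℝ) {n : ℕ} (p : ℝ) (u : α) (x : Fin n) (B : Finset (Fin n))
    (T : α → Finset (Fin n)) : Prop where
  hu : T u = {x}
  hx : ∀ w, w ≠ u → x ∉ T w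
  hB : ∀ w ∈ nb H u, T w ⊆ B
  hB4 : (B.card : ℝ) ≤ 4 * (n * p)
  hk : ∀ w ∈ nb H u, κ * (n * p) ≤ (T w).card
  hh : ∀ w, w ≠ u → w ∉ nb H u → (n : ℝ) / 2 ≤ (T w).card

/-- The rooted embeddings. -/
def sI {n : ℕ} (T : α → Finset (Fin n)) : Finset (α ↪ Fin n) :=
  univ.filter fun ψ : α ↪ Fin n => ∀ w, ψ w ∈ T w

lemma mem_sI {T : α → Finset (Fin n)} {ψ : α ↪ Fin n} : ψ ∈ sI T ↔ ∀ w, ψ w ∈ T w := by simp [sI]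

/-- The part of a copy away from `x`. -/
def sA (H : SimpleGraph α) {n : ℕ} (x : Fin n) (ψ : α ↪ Fin n) : ES(n) :=
  im H ψ \ star (EE n) x

lemma im_star {ψ : α ↪ Fin n} {u : α} {x : Fin n} (h : ψ u = x) :
    im H ψ ∩ star (EE n) x = (nb H u).image fun w => s(x, ψ w) := by
  ext g
  rw [mem_inter, mem_star, mem_image]
  constructor
  · rintro ⟨h1, h2, h4⟩
    obtain ⟨f, hf, rfl⟩ := mem_im.1 h1
    obtain ⟨w, hw, hwx⟩ := Sym2.mem_map.1 h4
    have hwu : w = u := ψ.injective (hwx.trans h.symm)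
    subst hwu
    have : f ∈ inc H w := mem_inc.2 ⟨hf, hw⟩
    rw [inc_eq] at this
    obtain ⟨w', hw', rfl⟩ := mem_image.1 this
    exact ⟨w', hw', by simp [h]⟩
  · rintro ⟨w, hw, rfl⟩
    have h1 : s(u, w) ∈ HE H := mem_HE.2 (by simpa using mem_nb.1 hw)
    have h2 : s(x, ψ w) ∈ im H ψ := mem_im.2 ⟨s(u, w), h1, by simp [h]⟩
    exact ⟨h2, im_subset_EE ψ h2, by simp⟩

lemma im_star_card {ψ : α ↪ Fin n} {u : α} {x : Fin n} (h : ψ u = x) :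
    (im H ψ ∩ star (EE n) x).card = (nb H u).card := by
  rw [im_star h, card_image_of_injective]
  intro a b hab
  exact ψ.injective (Sym2.congr_right.1 hab)

lemma sA_card {ψ : α ↪ Fin n} {u : α} {x : Fin n} (h : ψ u = x) :
    (sA H x ψ).card = (HE H).card - (nb H u).card := by
  have := card_sdiff_add_card_inter (im H ψ) (star (EE n) x)
  rw [im_star_card h, im_card] at this
  unfold sA
  omega

lemma nb_le (u : α) : (nb H u).card ≤ (HE H).card := by
  rw [← inc_card']; exact card_filter_le _ _

lemma sA_sdiff_card {ψ : α ↪ Fin n} {u : α} {x : Fin n} (h : ψ u = x) {U : ES(n)}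
    (hU : Disjoint U (star (EE n) x)) :
    (sA H x ψ \ U).card = (HE H).card - (nb H u).card - (Jof H ψ U).card := by
  have h1 : sA H x ψ ∩ U = im H ψ ∩ U := by
    ext g
    simp only [sA, mem_inter, Finset.mem_sdiff]
    exact ⟨fun h => ⟨h.1.1, h.2⟩, fun h => ⟨⟨h.1, Finset.disjoint_left.1 hU h.2⟩, h.2⟩⟩
  have h2 := card_sdiff_add_card_inter (sA H x ψ) U
  rw [h1, ← Jof_card, sA_card h] at h2
  omega

/-- Counting rooted embeddings with a prescribed part inside `U`. -/
lemma star_count {κ : ℝ} {u : α} {x : Fin n} {B : Finset (Fin n)} {T : α → Finset (Fin n)}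
    (hT : StarT H κ p u x B T) (J : Finset (Sym2 α)) (hu : u ∉ VJ J) (U : ES(n)) :
    (((sI T).filter fun ψ => Jof H ψ U = J).card : ℝ) ≤
      (2 * U.card : ℝ) ^ (VJ J).card * ((B.card : ℝ) ^ (nb H u \ VJ J).card *
        (n : ℝ) ^ (ν(α) - 1 - (VJ J).card - (nb H u \ VJ J).card)) := by
  set T' : α → Finset (Fin n) := fun w => if w = u then {x} else if w ∈ VJ J then VU U else
    if w ∈ nb H u then B else univ with hT'
  have h1 : ((sI T).filter fun ψ => Jof H ψ U = J) ⊆ univ.filter fun ψ : α ↪ Fin n => ∀ w, ψ w ∈ T' w := by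
    intro ψ hψ
    rw [mem_filter, mem_sI] at hψ
    rw [mem_filter]
    refine ⟨mem_univ _, fun w => ?_⟩
    simp only [hT']
    split_ifs with c1 c2 c3
    · subst c1; have := hψ.1 w; rwa [hT.hu] at this
    · obtain ⟨f, hf, hwf⟩ := mem_VJ.1 c2
      rw [← hψ.2] at hf
      exact mem_VU.2 ⟨_, (mem_Jof.1 hf).2, Sym2.mem_map.2 ⟨w, hwf, rfl⟩⟩
    · exact hT.hB w c3 (hψ.1 w)
    · exact mem_univ _
  have h2 := (card_le_card h1).trans (emb_count_le T')
  have hunb : u ∉ nb H u := by rw [mem_nb]; exact H.irrefl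
  -- product
  have h4 : ∏ w, (T' w).card = (VU U).card ^ (VJ J).card * (B.card ^ (nb H u \ VJ J).card *
        n ^ (ν(α) - 1 - (VJ J).card - (nb H u \ VJ J).card)) := by
    set R := (univ : Finset α) \ insert u (VJ J ∪ (nb H u \ VJ J)) with hR
    have hd1 : Disjoint (VJ J) (nb H u \ VJ J) := disjoint_sdiff
    have hu1 : u ∉ VJ J ∪ (nb H u \ VJ J) := by
      rw [mem_union, Finset.mem_sdiff]; tauto
    have hc : (insert u (VJ J ∪ (nb H u \ VJ J))).card = 1 + (VJ J).card + (nb H u \ VJ J).card := by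
      rw [card_insert_of_notMem hu1, card_union_of_disjoint hd1]; omega
    have hRc : R.card = ν(α) - 1 - (VJ J).card - (nb H u \ VJ J).card := by
      rw [hR, card_sdiff_of_subset (subset_univ _), hc, card_univ]; omega
    rw [← prod_sdiff (subset_univ (insert u (VJ J ∪ (nb H u \ VJ J)))),
      prod_insert hu1, prod_union hd1]
    rw [prod_congr rfl (g := fun _ => n), prod_const]
    rotate_left
    · intro w hw
      simp only [Finset.mem_sdiff, mem_univ, mem_insert, mem_union, true_and] at hw
      push Not at hw
      have : w ∉ nb H u := fun h => hw.2.1 (hw.2.2 h)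
      simp only [hT']
      rw [if_neg hw.1, if_neg hw.2.1, if_neg this, card_univ, Fintype.card_fin]
    have q1 : ∏ w ∈ VJ J, (T' w).card = (VU U).card ^ (VJ J).card := by
      refine prod_eq_pow_card fun w hw => ?_
      simp only [hT']
      rw [if_neg (fun h : w = u => hu (h ▸ hw)), if_pos hw]
    have q2 : ∏ w ∈ nb H u \ VJ J, (T' w).card = B.card ^ (nb H u \ VJ J).card := by
      refine prod_eq_pow_card fun w hw => ?_
      rw [Finset.mem_sdiff] at hw
      simp only [hT']
      rw [if_neg (fun h : w = u => hunb (h ▸ hw.1)), if_neg hw.2, if_pos hw.1]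
    have q3 : (T' u).card = 1 := by simp [hT']
    rw [q1, q2, q3, hRc]
    ring
  rw [h4] at h2
  have h5 : (VU U).card ^ (VJ J).card ≤ (2 * U.card) ^ (VJ J).card := Nat.pow_le_pow_left (VU_card U) _
  have h6 := h2.trans (Nat.mul_le_mul_right _ h5)
  exact_mod_cast h6

/-- Constant. -/
def cM (H : SimpleGraph α) : ℝ := 2 ^ (HE H).card * (8 * (HE H).card) ^ ν(α)

lemma star_inner (hH : Strictly2Balanced H) (h3 : 3 ≤ (HE H).card) (h : Win H C n p)
    (hCn : C * log n ≤ n) {κ : ℝ} {u : α} {x : Fin n} {B : Finset (Fin n)} {T : α → Finset (Fin n)}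
    (hT : StarT H κ p u x B T) {U : ES(n)} (hU : Disjoint U (star (EE n) x)) (hUe : U ⊆ EE n)
    (hUc : U.card ≤ (HE H).card) :
    ∑ ψ ∈ sI T with ¬ Disjoint U (sA H x ψ), p ^ (sA H x ψ \ U).card ≤ cM H := by
  have hp := h.p0
  have he1 : (1:ℝ) ≤ (HE H).card := by exact_mod_cast (by omega : 1 ≤ (HE H).card)
  rw [← sum_fiberwise_of_maps_to (t := (HE H).powerset) (g := fun ψ => Jof H ψ U)
    (fun ψ _ => mem_powerset.2 (Jof_subset ψ U))]
  have key : ∀ J ∈ (HE H).powerset, ∑ ψ ∈ ((sI T).filter fun ψ => ¬ Disjoint U (sA H x ψ)) with Jof H ψ U = J,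
      p ^ (sA H x ψ \ U).card ≤ (8 * (HE H).card : ℝ) ^ ν(α) := by
    intro J hJ
    rw [mem_powerset] at hJ
    rcases eq_empty_or_nonempty (((sI T).filter fun ψ => ¬ Disjoint U (sA H x ψ)).filter
      fun ψ => Jof H ψ U = J) with he | ⟨ψ0, hψ0⟩
    · rw [he, sum_empty]; positivity
    have hroot : ∀ ψ ∈ sI T, ψ u = x := by
      intro ψ hψ
      have := mem_sI.1 hψ u
      rw [hT.hu] at this
      simpa using this
    rw [mem_filter, mem_filter] at hψ0
    have hx0 := hroot ψ0 hψ0.1.1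
    have huJ : u ∉ VJ J := by
      intro hu
      obtain ⟨f, hf, huf⟩ := mem_VJ.1 hu
      rw [← hψ0.2] at hf
      have h4 := (mem_Jof.1 hf).2
      exact Finset.disjoint_left.1 hU h4 (mem_star.2 ⟨hUe h4, Sym2.mem_map.2 ⟨u, huf, hx0⟩⟩)
    have hJne : J.Nonempty := by
      obtain ⟨g, hg1, hg2⟩ := not_disjoint_iff.1 hψ0.1.2
      obtain ⟨f, hf, hfg⟩ := mem_im.1 (Finset.mem_sdiff.1 hg2).1
      exact ⟨f, hψ0.2 ▸ mem_Jof.2 ⟨hf, hfg ▸ hg1⟩⟩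
    have hdJ : (nb H u).card + J.card ≤ (HE H).card := by
      have hd : Disjoint (inc H u) J := by
        rw [Finset.disjoint_left]
        intro f hf hfJ
        exact huJ (mem_VJ.2 ⟨f, hfJ, (mem_inc.1 hf).2⟩)
      rw [← inc_card', ← card_union_of_disjoint hd]
      exact card_le_card (union_subset (filter_subset _ _) hJ)
    rw [sum_congr rfl (g := fun _ => p ^ ((HE H).card - (nb H u).card - J.card)) fun ψ hψ => by
      rw [mem_filter, mem_filter] at hψ
      rw [sA_sdiff_card (hroot ψ hψ.1.1) hU, hψ.2], sum_const, nsmul_eq_mul]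
    have c1 : (((((sI T).filter fun ψ => ¬ Disjoint U (sA H x ψ)).filter
      fun ψ => Jof H ψ U = J).card : ℕ) : ℝ) ≤ (((sI T).filter fun ψ => Jof H ψ U = J).card : ℝ) := by
      have : (((sI T).filter fun ψ => ¬ Disjoint U (sA H x ψ)).filter fun ψ => Jof H ψ U = J) ⊆
        (sI T).filter fun ψ => Jof H ψ U = J := by
        intro ψ hψ
        rw [mem_filter, mem_filter] at hψ
        exact mem_filter.2 ⟨hψ.1.1, hψ.2⟩
      exact_mod_cast card_le_card this
    set a := (nb H u \ VJ J).card with ha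
    set b := (nb H u ∩ VJ J).card with hb
    have hab : a + b = (nb H u).card := card_sdiff_add_card_inter _ _
    have hunb : u ∉ nb H u := by rw [mem_nb]; exact H.irrefl
    have hva : (VJ J).card + a ≤ ν(α) - 1 := by
      have hd1 : Disjoint (VJ J) (nb H u \ VJ J) := disjoint_sdiff
      have hu1 : u ∉ VJ J ∪ (nb H u \ VJ J) := by
        rw [mem_union, Finset.mem_sdiff]; tauto
      have : (insert u (VJ J ∪ (nb H u \ VJ J))).card = 1 + (VJ J).card + (nb H u \ VJ J).card := by
        rw [card_insert_of_notMem hu1, card_union_of_disjoint hd1]; omega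
      have h5 := card_le_univ (insert u (VJ J ∪ (nb H u \ VJ J)))
      omega
    have c2 := c1.trans (star_count hT J huJ U)
    have hU' : (U.card : ℝ) ≤ (HE H).card := by exact_mod_cast hUc
    have hst := star_term hH h3 h hCn hJ hJne huJ
    have hvJ := card_le_univ (VJ J)
    calc _ ≤ ((2 * U.card : ℝ) ^ (VJ J).card * ((B.card : ℝ) ^ a *
          (n : ℝ) ^ (ν(α) - 1 - (VJ J).card - a))) * p ^ ((HE H).card - (nb H u).card - J.card) :=
          mul_le_mul_of_nonneg_right c2 (pow_nonneg hp _)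
      _ ≤ ((2 * (HE H).card : ℝ) ^ (VJ J).card * ((4 * (n * p)) ^ a *
          (n : ℝ) ^ (ν(α) - 1 - (VJ J).card - a))) * p ^ ((HE H).card - (nb H u).card - J.card) := by
          have := hT.hB4
          gcongr
      _ = (2 * (HE H).card : ℝ) ^ (VJ J).card * 4 ^ a * ((n : ℝ) ^ (a + (ν(α) - 1 - (VJ J).card - a)) *
          p ^ (a + ((HE H).card - (nb H u).card - J.card))) := by
          rw [mul_pow, mul_pow, pow_add, pow_add]; ring
      _ = (2 * (HE H).card : ℝ) ^ (VJ J).card * 4 ^ a * ((n : ℝ) ^ (ν(α) - 1 - (VJ J).card) *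
          p ^ ((HE H).card - J.card - b)) := by
          rw [show a + (ν(α) - 1 - (VJ J).card - a) = ν(α) - 1 - (VJ J).card by omega,
            show a + ((HE H).card - (nb H u).card - J.card) = (HE H).card - J.card - b by omega]
      _ ≤ (2 * (HE H).card : ℝ) ^ (VJ J).card * 4 ^ a * 1 := by gcongr
      _ ≤ (2 * (HE H).card : ℝ) ^ ν(α) * 4 ^ ν(α) := by
          rw [mul_one]
          have : (1:ℝ) ≤ 2 * (HE H).card := by linarith
          gcongr
          · norm_num
          · omega
      _ = _ := by rw [← mul_pow]; ring_nf
  refine (sum_le_card_nsmul _ _ _ key).trans (le_of_eq ?_)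
  rw [card_powerset, nsmul_eq_mul]
  unfold cM
  push_cast; ring
lemma star_prod_aux {u : α} (f : α → ℝ) : ∏ w, f w = f u * ((∏ w ∈ nb H u, f w) *
    ∏ w ∈ univ \ insert u (nb H u), f w) := by
  have hunb : u ∉ nb H u := by rw [mem_nb]; exact H.irrefl
  rw [← prod_sdiff (subset_univ (insert u (nb H u))), prod_insert hunb]
  ring

lemma star_rest_card (u : α) : (univ \ insert u (nb H u)).card + (nb H u).card + 1 = ν(α) := by
  have hunb : u ∉ nb H u := by rw [mem_nb]; exact H.irrefl
  have h1 := card_sdiff_add_card_eq_card (subset_univ (insert u (nb H u)))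
  rw [card_insert_of_notMem hunb, card_univ] at h1
  omega

lemma star_pow_aux (hH : Strictly2Balanced H) (h3 : 3 ≤ (HE H).card) (u : α) (n : ℕ) (p : ℝ) :
    ((n : ℝ) * p) ^ (nb H u).card * (n : ℝ) ^ (univ \ insert u (nb H u)).card * p ^ ((HE H).card - (nb H u).card) =
      lam H n p * (n * p) := by
  have h1 := star_rest_card (H := H) u
  have h2 := nb_le (H := H) u
  have h4 := sb_card hH
  unfold lam
  rw [mul_pow]
  calc _ = (n : ℝ) ^ ((nb H u).card + (univ \ insert u (nb H u)).card) *
        p ^ ((nb H u).card + ((HE H).card - (nb H u).card)) := by rw [pow_add, pow_add]; ring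
    _ = (n : ℝ) ^ (ν(α) - 2 + 1) * p ^ ((HE H).card - 1 + 1) := by
        congr 2 <;> omega
    _ = _ := by rw [pow_succ, pow_succ]; ring

lemma cM_ge (h3 : 3 ≤ (HE H).card) : 1 ≤ cM H := by
  unfold cM
  have he1 : (3:ℝ) ≤ (HE H).card := by exact_mod_cast h3
  refine one_le_mul_of_one_le_of_one_le (one_le_pow₀ (by norm_num)) (one_le_pow₀ (by linarith))

lemma star_real1 {κ N m : ℝ} {a b v : ℕ} (hκ : 0 < κ) (hκ1 : κ ≤ 1) (hN : 0 ≤ N) (hm : 0 ≤ m)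
    (ha : a ≤ v) (hb : b ≤ v) : (κ / 2) ^ v * (N ^ a * m ^ b) ≤ (κ * N) ^ a * (m / 2) ^ b := by
  have e3 : κ ^ v ≤ κ ^ a := pow_le_pow_of_le_one hκ.le hκ1 ha
  have e4 : ((1:ℝ) / 2) ^ v ≤ (1 / 2) ^ b := pow_le_pow_of_le_one (by norm_num) (by norm_num) hb
  have e5 : (κ / 2) ^ v = κ ^ v * (1 / 2) ^ v := by rw [← mul_pow]; congr 1; ring
  have e6 : (m / 2) ^ b = m ^ b * (1 / 2) ^ b := by rw [← mul_pow]; congr 1; ring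
  rw [e5, e6, mul_pow κ]
  calc _ ≤ (κ ^ a * (1 / 2) ^ b) * (N ^ a * m ^ b) := by gcongr
    _ = _ := by ring

lemma star_real2 {N m : ℝ} {a b v : ℕ} (hN : 0 ≤ N) (hm : 0 ≤ m)
    (ha : a ≤ v) : (4 * N) ^ a * m ^ b ≤ 4 ^ v * (N ^ a * m ^ b) := by
  have e3 : (4:ℝ) ^ a ≤ 4 ^ v := pow_le_pow_right₀ (by norm_num) ha
  rw [mul_pow]
  calc _ = 4 ^ a * (N ^ a * m ^ b) := by ring
    _ ≤ _ := by gcongr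

/-- Constant of the star lemma. -/
def cS (H : SimpleGraph α) (κ : ℝ) : ℝ := (κ / 2) ^ ν(α) / 2

set_option maxHeartbeats 1000000 in
lemma star_fixed (hH : Strictly2Balanced H) (h3 : 3 ≤ (HE H).card) (h : Win H C n p)
    (hCn : C * log n ≤ n) {κ : ℝ} (hκ : 0 < κ) (hκ1 : κ ≤ 1) {u : α} {x : Fin n} {B : Finset (Fin n)}
    {T : α → Finset (Fin n)}
    (hT : StarT H κ p u x B T) (hb1 : (ν(α) : ℝ) ^ 2 ≤ κ * (n * p))
    (hb2 : (ν(α) : ℝ) ^ 2 ≤ n / 2) :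
    pr (EE n \ star (EE n) x) p (fun s => (cnt (sI T) (sA H x) s : ℝ) ≤ cS H κ / 4 * (lam H n p * (n * p))) ≤
      exp (-(cS H κ ^ 2 / (16 * (4 ^ ν(α) * cM H)) * (lam H n p * (n * p)))) := by
  have hp := h.p_pos hH
  have hn0 : (0:ℝ) < n := by have := h.hn; exact_mod_cast (by omega : 0 < n)
  have hl : 0 < lam H n p := by have := h.lam1; linarith
  have hcM := cM_ge (H := H) h3
  set L := lam H n p * (n * p) with hL
  have hL0 : 0 < L := by positivity
  have hc : 0 < cS H κ := by unfold cS; positivity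
  have hroot : ∀ ψ ∈ sI T, ψ u = x := by
    intro ψ hψ
    have := mem_sI.1 hψ u
    rw [hT.hu] at this
    simpa using this
  have hsum : ∑ ψ ∈ sI T, p ^ (sA H x ψ).card = ((sI T).card : ℝ) * p ^ ((HE H).card - (nb H u).card) := by
    rw [sum_congr rfl fun ψ hψ => by rw [sA_card (hroot ψ hψ)], sum_const, nsmul_eq_mul]
  have hd : (nb H u).card ≤ ν(α) := card_le_univ _
  have hr : (univ \ insert u (nb H u)).card ≤ ν(α) := card_le_univ _
  have hlow : cS H κ * L ≤ ∑ ψ ∈ sI T, p ^ (sA H x ψ).card := by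
    rw [hsum]
    have h1 := emb_count_ge T (by
      have key : ∀ w, w ≠ u → ν(α) ^ 2 ≤ (T w).card := by
        intro w hw
        by_cases hwn : w ∈ nb H u
        · exact_mod_cast hb1.trans (hT.hk w hwn)
        · exact_mod_cast hb2.trans (hT.hh w hw hwn)
      intro w w' hww
      by_cases hw : w = u
      · exact Or.inr (Or.inr (key w' fun h => hww (hw.trans h.symm)))
      · exact Or.inr (Or.inl (key w hw)))
    have h2 : (κ / 2) ^ ν(α) * ((n * p) ^ (nb H u).card * (n : ℝ) ^ (univ \ insert u (nb H u)).card) ≤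
        ∏ w, ((T w).card : ℝ) := by
      rw [star_prod_aux (H := H) (u := u), hT.hu, card_singleton, Nat.cast_one, one_mul]
      have e1 : (κ * (n * p)) ^ (nb H u).card ≤ ∏ w ∈ nb H u, ((T w).card : ℝ) := by
        rw [← prod_const]
        exact Finset.prod_le_prod (fun _ _ => by positivity) fun w hw => hT.hk w hw
      have e2 : ((n:ℝ) / 2) ^ (univ \ insert u (nb H u)).card ≤ ∏ w ∈ univ \ insert u (nb H u), ((T w).card : ℝ) := by
        rw [← prod_const]
        refine Finset.prod_le_prod (fun _ _ => by positivity) fun w hw => ?_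
        simp only [Finset.mem_sdiff, mem_insert, mem_univ, true_and] at hw
        push Not at hw
        exact hT.hh w hw.1 hw.2
      exact (star_real1 hκ hκ1 (by positivity) (by positivity) hd hr).trans
        (mul_le_mul e1 e2 (by positivity) (prod_nonneg fun _ _ => by positivity))
    have h4 : (sI T).card = (univ.filter fun ψ : α ↪ Fin n => ∀ w, ψ w ∈ T w).card := rfl
    rw [h4]
    have hpp : 0 ≤ p ^ ((HE H).card - (nb H u).card) := by positivity
    calc cS H κ * L = (κ / 2) ^ ν(α) * ((n * p) ^ (nb H u).card * (n : ℝ) ^ (univ \ insert u (nb H u)).card) / 2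
          * p ^ ((HE H).card - (nb H u).card) := by
          rw [hL, ← star_pow_aux hH h3 u n p]; unfold cS; ring
      _ ≤ _ := mul_le_mul_of_nonneg_right ((div_le_div_of_nonneg_right h2 (by norm_num)).trans h1) hpp
  have hup : ∑ ψ ∈ sI T, p ^ (sA H x ψ).card ≤ 4 ^ ν(α) * L := by
    rw [hsum]
    have h1 : ((sI T).card : ℝ) ≤ ∏ w, ((T w).card : ℝ) := by exact_mod_cast emb_count_le T
    have h2 : ∏ w, ((T w).card : ℝ) ≤ 4 ^ ν(α) * ((n * p) ^ (nb H u).card * (n : ℝ) ^ (univ \ insert u (nb H u)).card) := by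
      rw [star_prod_aux (H := H) (u := u), hT.hu, card_singleton, Nat.cast_one, one_mul]
      have e1 : ∏ w ∈ nb H u, ((T w).card : ℝ) ≤ (4 * (n * p)) ^ (nb H u).card := by
        rw [← prod_const]
        refine Finset.prod_le_prod (fun _ _ => by positivity) fun w hw => le_trans ?_ hT.hB4
        exact_mod_cast card_le_card (hT.hB w hw)
      have e2 : ∏ w ∈ univ \ insert u (nb H u), ((T w).card : ℝ) ≤ (n:ℝ) ^ (univ \ insert u (nb H u)).card := by
        rw [← prod_const]
        refine Finset.prod_le_prod (fun _ _ => by positivity) fun w hw => ?_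
        have := card_le_univ (T w)
        rw [Fintype.card_fin] at this
        exact_mod_cast this
      exact (mul_le_mul e1 e2 (prod_nonneg fun _ _ => by positivity) (by positivity)).trans
        (star_real2 (by positivity) (by positivity) hd)
    calc _ ≤ (4 ^ ν(α) * ((n * p) ^ (nb H u).card * (n : ℝ) ^ (univ \ insert u (nb H u)).card)) *
          p ^ ((HE H).card - (nb H u).card) := mul_le_mul_of_nonneg_right (h1.trans h2) (by positivity)
      _ = _ := by rw [hL, ← star_pow_aux hH h3 u n p]; ring
  have hD : jDelta p (sI T) (sA H x) ≤ 4 ^ ν(α) * cM H * L := by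
    refine (jDelta_le hp.le (M := cM H) fun ψ hψ => ?_).trans ?_
    · refine star_inner hH h3 h hCn hT sdiff_disjoint ?_ ?_
      · exact sdiff_subset.trans (im_subset_EE ψ)
      · rw [← im_card (H := H) ψ]; exact card_le_card sdiff_subset
    · calc _ ≤ 4 ^ ν(α) * L * cM H := by gcongr
        _ = _ := by ring
  have hfin := janson_quarter (E := EE n \ star (EE n) x) hp.le h.p1 (sI T) (sA H x) (fun ψ _ =>
    sdiff_subset_sdiff (im_subset_EE ψ) subset_rfl) (mu := cS H κ * L)
    (D := 4 ^ ν(α) * cM H * L) (by positivity) hlow hD (by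
      refine (hlow.trans hup).trans ?_
      rw [mul_right_comm]
      exact le_mul_of_one_le_right (by positivity) hcM)
  have e1 : cS H κ * L / 4 = cS H κ / 4 * L := by ring
  have e2 : (cS H κ * L) ^ 2 / (16 * (4 ^ ν(α) * cM H * L)) =
      cS H κ ^ 2 / (16 * (4 ^ ν(α) * cM H)) * L := by
    have : cM H ≠ 0 := by linarith
    field_simp
  rw [e1, e2] at hfin
  exact hfin

/-- Neighbourhood of `x` in a set of edges. -/
def yN {n : ℕ} (x : Fin n) (S : ES(n)) : Finset (Fin n) := univ.filter fun y => s(x, y) ∈ S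

lemma mem_yN {x y : Fin n} {S : ES(n)} : y ∈ yN x S ↔ s(x, y) ∈ S := by simp [yN]

lemma yN_card {x : Fin n} {S : ES(n)} (hS : ∀ g ∈ S, x ∈ g) : (yN x S).card = S.card := by
  have : S = (yN x S).image fun y => s(x, y) := by
    ext g
    rw [mem_image]
    constructor
    · intro hg
      obtain ⟨y, rfl⟩ := Sym2.mem_iff_exists.1 (hS g hg)
      exact ⟨y, mem_yN.2 hg, rfl⟩
    · rintro ⟨y, hy, rfl⟩; exact mem_yN.1 hy
  conv_rhs => rw [this]
  rw [card_image_of_injective]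
  intro a b h
  exact Sym2.congr_right.1 h

lemma not_mem_yN {x : Fin n} {S : ES(n)} (hS : S ⊆ EE n) : x ∉ yN x S := by
  rw [mem_yN]
  intro h
  exact (mem_EE_mk.1 (hS h)) rfl

/-- The star property. -/
def Star (H : SimpleGraph α) (κ c : ℝ) {n : ℕ} (p : ℝ) (s : ES(n)) : Prop :=
  ∀ x, ∀ S ⊆ star s x, κ * (n * p) ≤ S.card → (IsEulerianGraph H → κ * (n * p) ≤ (star s x \ S).card) →
    c * (lam H n p * (n * p)) ≤ ((cps H n).filter fun K => K ⊆ s ∧ Odd (K ∩ S).card).card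

lemma odd_star (h3 : 3 ≤ (HE H).card) :
    ∃ u, ∃ M ⊆ nb H u, Odd M.card ∧ (M = nb H u ∨ IsEulerianGraph H) := by
  by_cases hE : IsEulerianGraph H
  · obtain ⟨f, hf⟩ : (HE H).Nonempty := card_pos.1 (by omega)
    induction f with
    | _ a b =>
      have : H.Adj a b := by simpa using mem_HE.1 hf
      exact ⟨a, {b}, by simpa [mem_nb] using this, by simp, Or.inr hE⟩
  · unfold IsEulerianGraph at hE
    push Not at hE
    obtain ⟨u, hu⟩ := hE
    refine ⟨u, nb H u, subset_rfl, ?_, Or.inl rfl⟩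
    have : Nat.card (H.neighborSet u) = (nb H u).card := by
      rw [Nat.card_eq_fintype_card, Fintype.card_subtype]
      rfl
    rw [this] at hu
    exact Nat.not_even_iff_odd.1 hu

end

lemma cnt_le {ι κ : Type*} {I B : Finset κ} {A : κ → Finset ι} {s : Finset ι}
    (h : ∀ i ∈ I, A i ⊆ s → i ∈ B) : cnt I A s ≤ B.card := by
  unfold cnt
  refine card_le_card fun i hi => ?_
  simp only [mem_filter] at hi
  exact h i hi.1 hi.2

section
variable [Fintype α] {H : SimpleGraph α} {n : ℕ} {p C : ℝ}

/-- The target sets of the star lemma. -/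
def sT (H : SimpleGraph α) {n : ℕ} (u : α) (M : Finset α) (x : Fin n) (a S : ES(n)) :
    α → Finset (Fin n) := fun w =>
  if w = u then {x} else if w ∈ M then yN x S else if w ∈ nb H u then yN x (a \ S) else univ.erase x

lemma sT_star {κ : ℝ} {u : α} {M : Finset α} (hM : M ⊆ nb H u) {x : Fin n} {a S : ES(n)}
    (ha : a ⊆ star (EE n) x) (hS : S ⊆ a) (ha4 : (a.card : ℝ) ≤ 4 * (n * p)) (hk : κ * (n * p) ≤ S.card)
    (hk2 : M = nb H u ∨ κ * (n * p) ≤ (a \ S).card) (hn : 2 ≤ n) :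
    StarT H κ p u x (yN x a) (sT H u M x a S) := by
  have hax : ∀ g ∈ a, x ∈ g := fun g hg => (mem_star.1 (ha hg)).2
  have haE : a ⊆ EE n := ha.trans (filter_subset _ _)
  have hunb : u ∉ nb H u := by rw [mem_nb]; exact H.irrefl
  have hne : ∀ w ∈ nb H u, w ≠ u := fun w hw h => hunb (h ▸ hw)
  refine ⟨by simp [sT], ?_, ?_, ?_, ?_, ?_⟩
  · intro w hw
    simp only [sT]
    rw [if_neg hw]
    split_ifs
    · exact not_mem_yN (hS.trans haE)
    · exact not_mem_yN (sdiff_subset.trans haE)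
    · simp
  · intro w hw y hy
    simp only [sT] at hy
    rw [if_neg (hne w hw)] at hy
    rw [mem_yN]
    split_ifs at hy
    · exact hS (mem_yN.1 hy)
    · exact (Finset.mem_sdiff.1 (mem_yN.1 hy)).1
  · rw [yN_card hax]; exact ha4
  · intro w hw
    simp only [sT]
    rw [if_neg (hne w hw)]
    split_ifs with h1
    · rw [yN_card fun g hg => hax g (hS hg)]; exact hk
    · rw [yN_card fun g hg => hax g (Finset.mem_sdiff.1 hg).1]
      rcases hk2 with h2 | h2
      · exact absurd (h2 ▸ hw) h1
      · exact h2
  · intro w hw hwn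
    simp only [sT]
    rw [if_neg hw, if_neg (fun h => hwn (hM h)), if_neg hwn, card_erase_of_mem (mem_univ _),
      card_univ, Fintype.card_fin, Nat.cast_sub (by omega)]
    have : (2:ℝ) ≤ n := by exact_mod_cast hn
    push_cast; linarith

lemma sT_copy {u : α} {M : Finset α} (hM : M ⊆ nb H u) (hodd : Odd M.card) {x : Fin n} {a S : ES(n)}
    (ha : a ⊆ star (EE n) x) (hS : S ⊆ a) {t : ES(n)} {ψ : α ↪ Fin n}
    (hψ : ψ ∈ sI (sT H u M x a S)) (ht : sA H x ψ ⊆ t) :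
    im H ψ ⊆ a ∪ t ∧ Odd (im H ψ ∩ S).card := by
  have hunb : u ∉ nb H u := by rw [mem_nb]; exact H.irrefl
  have hne : ∀ w ∈ nb H u, w ≠ u := fun w hw h => hunb (h ▸ hw)
  rw [mem_sI] at hψ
  have hu : ψ u = x := by have := hψ u; simpa [sT] using this
  have h1 : ∀ w ∈ nb H u, (w ∈ M → s(x, ψ w) ∈ S) ∧ (w ∉ M → s(x, ψ w) ∈ a \ S) := by
    intro w hw
    have := hψ w
    simp only [sT] at this
    rw [if_neg (hne w hw)] at this
    constructor
    · intro h; rw [if_pos h] at this; exact mem_yN.1 this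
    · intro h; rw [if_neg h, if_pos hw] at this; exact mem_yN.1 this
  constructor
  · intro g hg
    by_cases hgx : g ∈ star (EE n) x
    · have : g ∈ im H ψ ∩ star (EE n) x := mem_inter.2 ⟨hg, hgx⟩
      rw [im_star hu] at this
      obtain ⟨w, hw, rfl⟩ := mem_image.1 this
      refine mem_union_left _ ?_
      by_cases hwM : w ∈ M
      · exact hS ((h1 w hw).1 hwM)
      · exact (Finset.mem_sdiff.1 ((h1 w hw).2 hwM)).1
    · exact mem_union_right _ (ht (Finset.mem_sdiff.2 ⟨hg, hgx⟩))
  · have : im H ψ ∩ S = M.image fun w => s(x, ψ w) := by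
      ext g
      rw [mem_inter, mem_image]
      constructor
      · rintro ⟨hg, hgS⟩
        have : g ∈ im H ψ ∩ star (EE n) x := mem_inter.2 ⟨hg, ha (hS hgS)⟩
        rw [im_star hu] at this
        obtain ⟨w, hw, rfl⟩ := mem_image.1 this
        refine ⟨w, ?_, rfl⟩
        by_contra hwM
        exact (Finset.mem_sdiff.1 ((h1 w hw).2 hwM)).2 hgS
      · rintro ⟨w, hw, rfl⟩
        have : s(x, ψ w) ∈ im H ψ ∩ star (EE n) x := by
          rw [im_star hu]; exact mem_image.2 ⟨w, hM hw, rfl⟩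
        exact ⟨(mem_inter.1 this).1, (h1 w (hM hw)).1 hw⟩
    rw [this, card_image_of_injective]
    · exact hodd
    · intro w w' h
      exact ψ.injective (Sym2.congr_right.1 h)

lemma pow_two_exp {k : ℕ} {t : ℝ} (h : (k : ℝ) ≤ t) : (2:ℝ) ^ k ≤ exp t := by
  have h1 : (2:ℝ) ≤ exp 1 := by have := Real.exp_one_gt_d9; linarith
  calc (2:ℝ) ^ k ≤ exp 1 ^ k := by gcongr
    _ = exp k := by rw [← exp_nat_mul]; simp
    _ ≤ _ := exp_le_exp.2 h

lemma log_lam_ge (hC : 0 < C) (K : ℝ) : ∀ᶠ n : ℕ in atTop, ∀ p, Win H C n p → K ≤ lam H n p := by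
  have h1 : Tendsto (fun n : ℕ => log n) atTop atTop :=
    tendsto_log_atTop.comp tendsto_natCast_atTop_atTop
  filter_upwards [h1.eventually_ge_atTop (C * K)] with n hn p hw
  have := hn.trans hw.lamge
  exact le_of_mul_le_mul_left this hC

lemma np_ge (h3 : 3 ≤ (HE H).card) (K : ℝ) : ∀ᶠ n : ℕ in atTop, ∀ p, Win H C n p → K ≤ n * p := by
  have h1 : Tendsto (fun n : ℕ => (n : ℝ) ^ gam H) atTop atTop :=
    (tendsto_rpow_atTop (gam_pos h3)).comp tendsto_natCast_atTop_atTop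
  filter_upwards [h1.eventually_ge_atTop K] with n hn p hw
  exact hn.trans hw.w3

lemma Star_whp (hH : Strictly2Balanced H) (h3 : 3 ≤ (HE H).card) (hC : 0 < C) {κ : ℝ} (hκ : 0 < κ) (hκ1 : κ ≤ 1) :
    ∃ c > 0, Whp H C (fun _ p s => Star H κ c p s) := by
  obtain ⟨u, M, hM, hodd, hMn⟩ := odd_star (H := H) h3
  have he0 : (0:ℝ) < (HE H).card := by exact_mod_cast (by omega : 0 < (HE H).card)
  have hcS : 0 < cS H κ := by unfold cS; positivity
  have hcM := cM_ge (H := H) h3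
  set Q : ℝ := (2 * (HE H).card) ^ ν(α) with hQ
  have hQ0 : 0 < Q := by positivity
  set c' := cS H κ ^ 2 / (16 * (4 ^ ν(α) * cM H)) with hc'
  have hc'0 : 0 < c' := by positivity
  refine ⟨cS H κ / 4 / Q, by positivity, Whp.step (DegB_whp h3 C) fun ζ hζ => ?_⟩
  filter_upwards [(exp_gam_small (H := H) h3 one_pos 1).eventually (gt_mem_nhds hζ), log_pow_le C 1,
    log_lam_ge (H := H) hC (5 / c'), np_ge (H := H) (C := C) h3 ((ν(α) : ℝ) ^ 2 / κ),
    tendsto_natCast_atTop_atTop.eventually_ge_atTop ((ν(α) : ℝ) ^ 2 * 2)] with n h1 h2 h4 h5 h6 p hw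
  rw [pow_one] at h2
  have hp := hw.p_pos hH
  have hn3 := hw.hn
  have hn0 : (0:ℝ) < n := by exact_mod_cast (by omega : 0 < n)
  have hlam := h4 p hw
  rw [div_le_iff₀ hc'0] at hlam
  have hnp := h5 p hw
  rw [div_le_iff₀ hκ] at hnp
  -- fixed `x`
  have hx : ∀ x : Fin n, pr (EE n) p (fun s => DegB p s ∧ ∃ S ⊆ star s x, κ * (n * p) ≤ S.card ∧
      (IsEulerianGraph H → κ * (n * p) ≤ (star s x \ S).card) ∧
      ((((cps H n).filter fun K => K ⊆ s ∧ Odd (K ∩ S).card).card : ℕ) : ℝ) <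
        cS H κ / 4 / Q * (lam H n p * (n * p))) ≤ exp (-(1 * (n:ℝ) ^ gam H)) := by
    intro x
    have hEE : EE n = star (EE n) x ∪ (EE n \ star (EE n) x) :=
      (union_sdiff_of_subset (filter_subset _ _)).symm
    unfold pr
    rw [hEE, ex_union disjoint_sdiff]
    refine (ex_mono hp.le hw.p1 fun a ha => ?_).trans (le_of_eq (ex_const _))
    have hst : ∀ t ⊆ EE n \ star (EE n) x, star (a ∪ t) x = a := by
      intro t ht
      ext g
      rw [mem_star, mem_union]
      constructor
      · rintro ⟨h | h, hg⟩
        · exact h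
        · have := Finset.mem_sdiff.1 (ht h)
          exact absurd (mem_star.2 ⟨this.1, hg⟩) this.2
      · intro h
        exact ⟨Or.inl h, (mem_star.1 (ha h)).2⟩
    by_cases ha4 : (a.card : ℝ) ≤ 4 * (n * p)
    swap
    · rw [ex_congr (g := fun _ => 0), ex_const]
      · positivity
      · intro t ht
        refine ind_false ?_
        rintro ⟨hD, -⟩
        have := hD x
        rw [hst t ht] at this
        exact ha4 this
    · have hb := pr_exists (E := EE n \ star (EE n) x) hp.le hw.p1
        (a.powerset.filter fun S => κ * (n * p) ≤ S.card ∧ (M = nb H u ∨ κ * (n * p) ≤ (a \ S).card))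
        (fun S t => (cnt (sI (sT H u M x a S)) (sA H x) t : ℝ) ≤ cS H κ / 4 * (lam H n p * (n * p)))
      refine (le_trans (pr_mono hp.le hw.p1 fun t ht h => ?_) hb).trans ?_
      · obtain ⟨-, S, hS, hSk, hSk2, hlt⟩ := h
        rw [hst t ht] at hS hSk2
        refine ⟨S, mem_filter.2 ⟨mem_powerset.2 hS, hSk, hMn.imp_right hSk2⟩, ?_⟩
        have e1 : cnt (sI (sT H u M x a S)) (sA H x) t ≤
            (univ.filter fun ψ : α ↪ Fin n => (im H ψ ⊆ a ∪ t ∧ Odd (im H ψ ∩ S).card)).card := by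
          refine cnt_le fun ψ hψ hψ2 => ?_
          exact mem_filter.2 ⟨mem_univ _, sT_copy hM hodd ha hS hψ hψ2⟩
        have e2 := e1.trans (emb_le_cps hH fun K => K ⊆ a ∪ t ∧ Odd (K ∩ S).card)
        have e3 : (cnt (sI (sT H u M x a S)) (sA H x) t : ℝ) ≤ Q *
          (((cps H n).filter fun K => K ⊆ a ∪ t ∧ Odd (K ∩ S).card).card : ℝ) := by
          rw [hQ]; exact_mod_cast e2
        refine e3.trans ((mul_le_mul_of_nonneg_left hlt.le hQ0.le).trans (le_of_eq ?_))
        field_simp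
      · have e1 : ∀ S ∈ a.powerset.filter fun S => κ * (n * p) ≤ S.card ∧ (M = nb H u ∨ κ * (n * p) ≤ (a \ S).card),
            pr (EE n \ star (EE n) x) p (fun t => (cnt (sI (sT H u M x a S)) (sA H x) t : ℝ) ≤
              cS H κ / 4 * (lam H n p * (n * p))) ≤ exp (-(c' * (lam H n p * (n * p)))) := by
          intro S hS
          rw [mem_filter, mem_powerset] at hS
          exact star_fixed hH h3 hw h2 hκ hκ1 (sT_star hM ha hS.1 ha4 hS.2.1 hS.2.2 (by omega))
            (by rw [mul_comm κ]; exact hnp) (by rw [le_div_iff₀ (by norm_num)]; exact h6)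
        refine (sum_le_card_nsmul _ _ _ e1).trans ?_
        rw [nsmul_eq_mul]
        have e2 : (((a.powerset.filter fun S => κ * (n * p) ≤ S.card ∧ (M = nb H u ∨ κ * (n * p) ≤ (a \ S).card)).card : ℕ) : ℝ)
            ≤ exp (4 * (n * p)) := by
          refine le_trans ?_ (pow_two_exp ha4)
          have := card_filter_le a.powerset fun S => κ * (n * p) ≤ S.card ∧ (M = nb H u ∨ κ * (n * p) ≤ (a \ S).card)
          rw [card_powerset] at this
          exact_mod_cast this
        refine (mul_le_mul_of_nonneg_right e2 (exp_pos _).le).trans ?_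
        rw [← exp_add]
        refine exp_le_exp.2 ?_
        have e3 : 5 * (n * p) ≤ c' * (lam H n p * (n * p)) := by
          have h0 : 0 ≤ (n:ℝ) * p := by positivity
          calc 5 * ((n:ℝ) * p) ≤ lam H n p * c' * (n * p) := mul_le_mul_of_nonneg_right hlam h0
            _ = _ := by ring
        have := hw.w3
        linarith
  refine (le_trans (pr_mono hp.le hw.p1 fun s _ hs => ?_) (pr_exists hp.le hw.p1 univ _)).trans
    ((sum_le_card_nsmul _ _ _ fun x _ => hx x).trans ?_)
  · obtain ⟨hD, hs⟩ := hs
    unfold Star at hs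
    push Not at hs
    obtain ⟨x, S, hS, h7, h8, h9⟩ := hs
    exact ⟨x, mem_univ _, hD, S, hS, h7, h8, h9⟩
  · rw [card_univ, Fintype.card_fin, nsmul_eq_mul]
    rw [pow_one] at h1
    exact h1.le

/-! ### The number of copies on an edge -/
/-- Copies containing `g`. -/
def cpg (H : SimpleGraph α) {n : ℕ} (g : E2(n)) : Finset (ES(n)) :=
  (cps H n).filter fun K => g ∈ K

lemma mem_cpg {g : E2(n)} {K : ES(n)} : K ∈ cpg H g ↔ K ∈ cps H n ∧ g ∈ K := by
  unfold cpg; exact mem_filter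

lemma cpg_le (σ : Equiv.Perm (Fin n)) (g : E2(n)) :
    (cpg H g).card ≤ (cpg H (Sym2.map σ g)).card := by
  refine card_le_card_of_injOn (fun K => K.image (Sym2.map σ)) ?_ ?_
  · intro K hK
    rw [mem_coe, mem_cpg] at hK ⊢
    obtain ⟨ψ, hψ⟩ := mem_cps.1 hK.1
    refine ⟨mem_cps.2 ⟨ψ.trans σ.toEmbedding, ?_⟩, mem_image_of_mem _ hK.2⟩
    rw [← hψ]
    ext f
    rw [mem_im, mem_image]
    constructor
    · rintro ⟨f', hf', rfl⟩
      exact ⟨Sym2.map ψ f', mem_im.2 ⟨f', hf', rfl⟩, by rw [Sym2.map_map]; rfl⟩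
    · rintro ⟨_, hf, rfl⟩
      obtain ⟨f', hf', rfl⟩ := mem_im.1 hf
      exact ⟨f', hf', by rw [Sym2.map_map]; rfl⟩
  · intro K _ K' _ h
    exact image_injective (Sym2.map.injective σ.injective) h

lemma cpg_le' {g g' : E2(n)} (hg : g ∈ EE n) (hg' : g' ∈ EE n) : (cpg H g).card ≤ (cpg H g').card := by
  induction g with
  | _ a b =>
  induction g' using Sym2.ind with
  | _ c d =>
    have hab : a ≠ b := mem_EE_mk.1 hg
    have hcd : c ≠ d := mem_EE_mk.1 hg'
    have h := cpg_le (H := H) (Equiv.swap (Equiv.swap a c b) d * Equiv.swap a c) s(a, b)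
    have e1 : (Equiv.swap (Equiv.swap a c b) d * Equiv.swap a c) a = c := by
      rw [Equiv.Perm.mul_apply, Equiv.swap_apply_left, Equiv.swap_apply_of_ne_of_ne ?_ hcd]
      intro h
      have : Equiv.swap a c a = Equiv.swap a c b := by rw [Equiv.swap_apply_left]; exact h
      exact hab ((Equiv.swap a c).injective this)
    have e2 : (Equiv.swap (Equiv.swap a c b) d * Equiv.swap a c) b = d := by
      rw [Equiv.Perm.mul_apply, Equiv.swap_apply_left]
    rw [Sym2.map_mk, e1, e2] at h
    exact h

lemma VJ_single {f : Sym2 α} (hf : f ∈ HE H) : (VJ ({f} : Finset (Sym2 α))).card = 2 := by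
  induction f with
  | _ a b =>
    have hab : a ≠ b := by
      have : H.Adj a b := by simpa using mem_HE.1 hf
      exact this.ne
    have : VJ ({s(a, b)} : Finset (Sym2 α)) = {a, b} := by ext w; simp [mem_VJ]
    rw [this, card_pair hab]

/-- The number of copies on an edge of the complete graph. -/
def bN (H : SimpleGraph α) (n : ℕ) : ℕ := (EE n).sup fun g => (cpg H g).card

lemma cpg_card {g : E2(n)} (hg : g ∈ EE n) : (cpg H g).card = bN H n := by
  unfold bN
  refine le_antisymm (le_sup (f := fun g => (cpg H g).card) hg) (Finset.sup_le fun g' hg' => cpg_le' hg' hg)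

/-- The expected number of copies on an edge. -/
def LL (H : SimpleGraph α) (n : ℕ) (p : ℝ) : ℝ := bN H n * p ^ ((HE H).card - 1)

lemma bN_le (n : ℕ) : (bN H n : ℝ) ≤ 4 * (HE H).card * (n : ℝ) ^ (ν(α) - 2) := by
  have : bN H n ≤ 4 * (HE H).card * n ^ (ν(α) - 2) := by
    unfold bN
    refine Finset.sup_le fun g hg => ?_
    have h1 : cpg H g ⊆ ((HE H).biUnion fun f => univ.filter fun ψ : α ↪ Fin n => ∀ f' ∈ ({f} : Finset (Sym2 α)),
        Sym2.map ψ f' ∈ ({g} : ES(n))).image (im H) := by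
      intro K hK
      rw [mem_cpg] at hK
      obtain ⟨ψ, rfl⟩ := mem_cps.1 hK.1
      obtain ⟨f, hf, hfg⟩ := mem_im.1 hK.2
      refine mem_image.2 ⟨ψ, mem_biUnion.2 ⟨f, hf, ?_⟩, rfl⟩
      simp [hfg]
    refine (card_le_card h1).trans (card_image_le.trans (card_biUnion_le.trans ?_))
    refine (sum_le_card_nsmul _ _ (4 * n ^ (ν(α) - 2)) fun f hf => ?_).trans (le_of_eq ?_)
    · refine (ext_count {f} {g}).trans (le_of_eq ?_)
      have : (VJ ({f} : Finset (Sym2 α))).card = 2 := VJ_single hf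
      rw [this]; simp
    · rw [smul_eq_mul]; ring
  exact_mod_cast this

lemma LL_le (hp : 0 ≤ p) : LL H n p ≤ 4 * (HE H).card * lam H n p := by
  unfold LL lam
  have := mul_le_mul_of_nonneg_right (bN_le (H := H) n) (pow_nonneg hp ((HE H).card - 1))
  linarith

/-- Constant. -/
def cB (H : SimpleGraph α) : ℝ := 2 * (2 * (HE H).card) ^ ν(α)

lemma cB_pos (h3 : 3 ≤ (HE H).card) : 0 < cB H := by
  have : (0:ℝ) < (HE H).card := by exact_mod_cast (by omega : 0 < (HE H).card)
  unfold cB; positivity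

lemma bN_ge (hH : Strictly2Balanced H) (h3 : 3 ≤ (HE H).card) (hn : ν(α) ^ 2 ≤ n) :
    (n : ℝ) ^ (ν(α) - 2) ≤ cB H * bN H n := by
  have hv := sb_card hH
  have hn2 : 2 ≤ n := by nlinarith
  obtain ⟨f, hf⟩ : (HE H).Nonempty := card_pos.1 (by omega)
  induction f with
  | _ a b =>
  have hab : a ≠ b := by
    have : H.Adj a b := by simpa using mem_HE.1 hf
    exact this.ne
  set x : Fin n := ⟨0, by omega⟩ with hx
  set y : Fin n := ⟨1, by omega⟩ with hy
  have hxy : x ≠ y := by simp [hx, hy]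
  set T : α → Finset (Fin n) := fun w => if w = a then {x} else if w = b then {y} else univ with hT
  have h1 := emb_count_ge T (by
    intro w w' hww
    have key : ∀ w, w ≠ a → w ≠ b → ν(α) ^ 2 ≤ (T w).card := by
      intro w h1 h2
      simp only [hT]; rw [if_neg h1, if_neg h2]; simpa using hn
    by_cases h1 : w = a
    · by_cases h2 : w' = b
      · left
        simp only [hT]
        rw [if_pos h1, if_neg (by rw [h2]; exact hab.symm), if_pos h2]
        simpa using hxy
      · exact Or.inr (Or.inr (key w' (fun h => hww (h1.trans h.symm)) h2))
    · by_cases h2 : w = b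
      · by_cases h4 : w' = a
        · left
          simp only [hT]
          rw [if_neg h1, if_pos h2, if_pos h4]
          simpa using hxy.symm
        · exact Or.inr (Or.inr (key w' h4 (fun h => hww (h2.trans h.symm))))
      · exact Or.inr (Or.inl (key w h1 h2)))
  have h2 : ∏ w, ((T w).card : ℝ) = (n:ℝ) ^ (ν(α) - 2) := by
    rw [← prod_sdiff (subset_univ ({a, b} : Finset α)), prod_pair hab]
    have e1 : ∀ w ∈ univ \ ({a, b} : Finset α), ((T w).card : ℝ) = n := by
      intro w hw
      simp only [Finset.mem_sdiff, mem_insert, mem_singleton, mem_univ, true_and] at hw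
      push Not at hw
      simp only [hT]; rw [if_neg hw.1, if_neg hw.2]; simp
    rw [prod_congr rfl e1, prod_const, card_sdiff_of_subset (subset_univ _),
      card_pair hab, card_univ]
    have e2 : (T a).card = 1 := by simp [hT]
    have e3 : (T b).card = 1 := by simp [hT, hab.symm]
    rw [e2, e3]; simp
  have h4 : (univ.filter fun ψ : α ↪ Fin n => ∀ w, ψ w ∈ T w) ⊆
      univ.filter fun ψ : α ↪ Fin n => s(x, y) ∈ im H ψ := by
    intro ψ hψ
    rw [mem_filter] at hψ ⊢
    refine ⟨mem_univ _, mem_im.2 ⟨s(a, b), hf, ?_⟩⟩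
    have e1 := hψ.2 a
    have e2 := hψ.2 b
    have e3 : T a = {x} := by simp [hT]
    have e4 : T b = {y} := by simp [hT, hab.symm]
    rw [e3, mem_singleton] at e1
    rw [e4, mem_singleton] at e2
    rw [Sym2.map_mk, e1, e2]
  have h5 := emb_le_cps (n := n) hH fun K => s(x, y) ∈ K
  have h6 : ((cps H n).filter fun K => s(x, y) ∈ K).card = bN H n := cpg_card (mem_EE_mk.2 hxy)
  rw [h6] at h5
  have h7 : ((univ.filter fun ψ : α ↪ Fin n => ∀ w, ψ w ∈ T w).card : ℝ) ≤
      (2 * (HE H).card : ℝ) ^ ν(α) * bN H n := by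
    exact_mod_cast (card_le_card h4).trans h5
  rw [h2] at h1
  unfold cB
  linarith

lemma lam_le_LL (hH : Strictly2Balanced H) (h3 : 3 ≤ (HE H).card) (hn : ν(α) ^ 2 ≤ n) (hp : 0 ≤ p) :
    lam H n p ≤ cB H * LL H n p := by
  unfold LL lam
  have := mul_le_mul_of_nonneg_right (bN_ge hH h3 hn) (pow_nonneg hp ((HE H).card - 1))
  linarith

/-- Copies on `g` through a further vertex `z`. -/
lemma cpz_le (hH : Strictly2Balanced H) {g : E2(n)} {z : Fin n} (hz : z ∉ g) :
    (((cpg H g).filter fun K => z ∈ VU K).card : ℝ) ≤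
      4 * (HE H).card * ν(α) * (n : ℝ) ^ (ν(α) - 3) := by
  have : ((cpg H g).filter fun K => z ∈ VU K).card ≤ 4 * (HE H).card * ν(α) * n ^ (ν(α) - 3) := by
    set T : Sym2 α → α → α → Finset (Fin n) := fun f w0 w =>
      if w = w0 then {z} else if w ∈ f then VU {g} else univ with hT
    have h1 : (cpg H g).filter (fun K => z ∈ VU K) ⊆ (((HE H) ×ˢ (univ : Finset α)).biUnion fun q =>
        if q.2 ∈ q.1 then ∅ else univ.filter fun ψ : α ↪ Fin n => ∀ w, ψ w ∈ T q.1 q.2 w).image (im H) := by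
      intro K hK
      rw [mem_filter, mem_cpg] at hK
      obtain ⟨ψ, rfl⟩ := mem_cps.1 hK.1.1
      obtain ⟨f, hf, hfg⟩ := mem_im.1 hK.1.2
      obtain ⟨g', hg', hzg'⟩ := mem_VU.1 hK.2
      obtain ⟨f', hf', rfl⟩ := mem_im.1 hg'
      obtain ⟨w0, hw0, hw0z⟩ := Sym2.mem_map.1 hzg'
      refine mem_image.2 ⟨ψ, mem_biUnion.2 ⟨(f, w0), by simp [hf], ?_⟩, rfl⟩
      have hn : w0 ∉ f := fun h => hz (hfg ▸ Sym2.mem_map.2 ⟨w0, h, hw0z⟩)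
      simp only [if_neg hn]
      refine mem_filter.2 ⟨mem_univ _, fun w => ?_⟩
      simp only [hT]
      split_ifs with c1 c2
      · rw [c1]; simpa using hw0z
      · exact mem_VU.2 ⟨g, by simp, hfg ▸ Sym2.mem_map.2 ⟨w, c2, rfl⟩⟩
      · simp
    refine (card_le_card h1).trans (card_image_le.trans (card_biUnion_le.trans ?_))
    refine (sum_le_card_nsmul _ _ (4 * n ^ (ν(α) - 3)) fun q hq => ?_).trans (le_of_eq ?_)
    · split_ifs with h2
      · simp
      · refine (emb_count_le _).trans ?_
        obtain ⟨f, w0⟩ := q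
        have hf : f ∈ HE H := (mem_product.1 hq).1
        have hc2 : (VJ ({f} : Finset (Sym2 α))).card = 2 := VJ_single hf
        have hmem : ∀ w, w ∈ VJ ({f} : Finset (Sym2 α)) ↔ w ∈ f := by intro w; simp [mem_VJ]
        have hw0 : w0 ∉ VJ ({f} : Finset (Sym2 α)) := fun h => h2 ((hmem w0).1 h)
        rw [← prod_sdiff (subset_univ (insert w0 (VJ ({f} : Finset (Sym2 α))))),
          prod_insert hw0]
        have e1 : ∏ w ∈ univ \ insert w0 (VJ ({f} : Finset (Sym2 α))), (T f w0 w).card ≤ n ^ (ν(α) - 3) := by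
          refine (prod_le_pow_card _ _ n fun w _ => ?_).trans (le_of_eq ?_)
          · simpa using card_le_univ (T f w0 w)
          · rw [card_sdiff_of_subset (subset_univ _), card_insert_of_notMem hw0, hc2, card_univ]
        have e2 : (T f w0 w0).card = 1 := by simp [hT]
        have e3 : ∏ w ∈ VJ ({f} : Finset (Sym2 α)), (T f w0 w).card ≤ 4 := by
          refine (prod_le_pow_card _ _ 2 fun w hw => ?_).trans (le_of_eq ?_)
          · simp only [hT]
            rw [if_neg (fun h : w = w0 => hw0 (h ▸ hw)), if_pos ((hmem w).1 hw)]
            simpa using VU_card ({g} : ES(n))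
          · rw [hc2]; norm_num
        calc _ ≤ n ^ (ν(α) - 3) * (1 * 4) := by
              rw [e2]; gcongr
          _ = _ := by ring
    · rw [smul_eq_mul, card_product, card_univ]; ring
  exact_mod_cast this

/-! ### Bridges of a pair of edges -/
/-- Copies containing exactly one of two edges. -/
def PF (H : SimpleGraph α) {n : ℕ} (a b : E2(n)) : Finset (ES(n)) :=
  (cps H n).filter fun K => (a ∈ K ∧ b ∉ K) ∨ (b ∈ K ∧ a ∉ K)

lemma mem_PF {a b : E2(n)} {K : ES(n)} :
    K ∈ PF H a b ↔ K ∈ cps H n ∧ ((a ∈ K ∧ b ∉ K) ∨ (b ∈ K ∧ a ∉ K)) := by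
  unfold PF; exact mem_filter

/-- Copies containing the first and not the second. -/
def PF1 (H : SimpleGraph α) {n : ℕ} (a b : E2(n)) : Finset (ES(n)) :=
  (cps H n).filter fun K => a ∈ K ∧ b ∉ K

lemma mem_PF1 {a b : E2(n)} {K : ES(n)} :
    K ∈ PF1 H a b ↔ K ∈ cps H n ∧ a ∈ K ∧ b ∉ K := by
  unfold PF1; exact mem_filter

lemma PF_eq (a b : E2(n)) : PF H a b = PF1 H a b ∪ PF1 H b a := by
  ext K; rw [mem_PF, mem_union, mem_PF1, mem_PF1]; tauto

lemma PF_disj (a b : E2(n)) : Disjoint (PF1 H a b) (PF1 H b a) :=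
  Finset.disjoint_left.2 fun K h1 h2 => (mem_PF1.1 h2).2.2 (mem_PF1.1 h1).2.1

lemma PF_card (a b : E2(n)) {K : ES(n)} (hK : K ∈ PF H a b) :
    (K \ {a, b}).card = (HE H).card - 1 := by
  rw [mem_PF] at hK
  have hc := cps_card hK.1
  rcases hK.2 with h | h
  · have : K \ {a, b} = K.erase a := by
      ext x; simp only [Finset.mem_sdiff, mem_insert, mem_singleton, mem_erase]
      constructor
      · rintro ⟨h1, h2⟩; exact ⟨fun h' => h2 (Or.inl h'), h1⟩
      · rintro ⟨h1, h2⟩; exact ⟨h2, fun h' => h'.elim h1 fun h'' => h.2 (h'' ▸ h2)⟩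
    rw [this, card_erase_of_mem h.1, hc]
  · have : K \ {a, b} = K.erase b := by
      ext x; simp only [Finset.mem_sdiff, mem_insert, mem_singleton, mem_erase]
      constructor
      · rintro ⟨h1, h2⟩; exact ⟨fun h' => h2 (Or.inr h'), h1⟩
      · rintro ⟨h1, h2⟩; exact ⟨h2, fun h' => h'.elim (fun h'' => h.2 (h'' ▸ h2)) h1⟩
    rw [this, card_erase_of_mem h.1, hc]

lemma PF1_ge (h3 : 3 ≤ (HE H).card) (h : Up H C n p) {a b : E2(n)} (ha : a ∈ EE n) (hab : a ≠ b) :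
    LL H n p - cU H 2 * tht H n ≤ (PF1 H a b).card * p ^ ((HE H).card - 1) := by
  have h1 := sumA (H := H) h (U := {a, b}) (u := 2) card_le_two
  set B := (cps H n).filter fun K => 2 ≤ (K ∩ {a, b}).card ∧ ¬ K ⊆ {a, b} with hB
  have h2 : cpg H a ⊆ PF1 H a b ∪ B.filter fun K => a ∈ K ∧ b ∈ K := by
    intro K hK
    rw [mem_cpg] at hK
    by_cases hb : b ∈ K
    · refine mem_union_right _ (mem_filter.2 ⟨mem_filter.2 ⟨hK.1, ?_, ?_⟩, hK.2, hb⟩)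
      · have : K ∩ {a, b} = {a, b} := inter_eq_right.2 (by
          intro x hx; simp only [mem_insert, mem_singleton] at hx; rcases hx with rfl | rfl
          · exact hK.2
          · exact hb)
        rw [this, card_pair hab]
      · intro h'
        have := card_le_card h'
        rw [cps_card hK.1, card_pair hab] at this; omega
    · exact mem_union_left _ (mem_PF1.2 ⟨hK.1, hK.2, hb⟩)
  have h4 := (card_le_card h2).trans (card_union_le _ _)
  rw [cpg_card ha] at h4
  have h5 : ((B.filter fun K => a ∈ K ∧ b ∈ K).card : ℝ) * p ^ ((HE H).card - 1) ≤ cU H 2 * tht H n := by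
    refine le_trans ?_ h1
    rw [← nsmul_eq_mul, ← sum_const]
    refine (sum_le_sum fun K hK => ?_).trans
      (sum_le_sum_of_subset_of_nonneg (filter_subset _ _) fun _ _ _ => pow_nonneg h.p0 _)
    rw [mem_filter] at hK
    refine pow_le_pow_of_le_one h.p0 h.p1 ?_
    have hKc := cps_card (mem_filter.1 hK.1).1
    have : (K \ {a, b}).card ≤ (K.erase a).card := card_le_card (by
      intro x hx; simp only [Finset.mem_sdiff, mem_insert, mem_singleton] at hx
      exact mem_erase.2 ⟨fun h' => hx.2 (Or.inl h'), hx.1⟩)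
    rwa [card_erase_of_mem hK.2.1, hKc] at this
  have h6 : (bN H n : ℝ) ≤ (PF1 H a b).card + (B.filter fun K => a ∈ K ∧ b ∈ K).card := by exact_mod_cast h4
  have h7 := mul_le_mul_of_nonneg_right h6 (pow_nonneg h.p0 ((HE H).card - 1))
  unfold LL
  linarith

lemma PF1_le {a b : E2(n)} (ha : a ∈ EE n) : (PF1 H a b).card ≤ bN H n := by
  rw [← cpg_card ha]
  refine card_le_card fun K hK => ?_
  rw [mem_PF1] at hK
  exact mem_cpg.2 ⟨hK.1, hK.2.1⟩

/-- Two distinct copies in the pair family with the same bridge are rare. -/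
lemma swap_z (hH : Strictly2Balanced H) (h3 : 3 ≤ (HE H).card) {a b : E2(n)} {z : Fin n}
    (hz : z ∈ b) {K K' : ES(n)} (hK' : K' ∈ cps H n) (hb : b ∈ K')
    (ha : a ∉ K') (hKK : K' \ {a, b} = K \ {a, b}) : z ∈ VU K := by
  obtain ⟨ψ, rfl⟩ := mem_cps.1 hK'
  obtain ⟨f, hf, hfb⟩ := mem_im.1 hb
  rw [← hfb] at hz
  obtain ⟨u, hu, huz⟩ := Sym2.mem_map.1 hz
  have hd := sb_mindeg hH h3 u
  obtain ⟨f', hf', hne⟩ : ∃ f' ∈ inc H u, f' ≠ f := by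
    by_contra hcon
    push Not at hcon
    have : inc H u ⊆ {f} := fun x hx => mem_singleton.2 (hcon x hx)
    have := card_le_card this
    rw [card_singleton] at this; omega
  rw [mem_inc] at hf'
  have hm : Sym2.map ψ f' ∈ im H ψ := mem_im.2 ⟨f', hf'.1, rfl⟩
  have : Sym2.map ψ f' ∈ im H ψ \ {a, b} := by
    simp only [Finset.mem_sdiff, mem_insert, mem_singleton]
    refine ⟨hm, fun h => h.elim (fun h => ha (h ▸ hm)) fun h => hne ?_⟩
    exact Sym2.map.injective ψ.injective (h.trans hfb.symm)
  rw [hKK] at this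
  exact mem_VU.2 ⟨_, (Finset.mem_sdiff.1 this).1, Sym2.mem_map.2 ⟨u, hf'.2, huz⟩⟩

lemma exists_z {a b : E2(n)} (hb : b ∈ EE n) (hab : a ≠ b) : ∃ z ∈ b, z ∉ a := by
  by_contra hcon
  push Not at hcon
  induction b with
  | _ x y =>
    have hxy : x ≠ y := mem_EE_mk.1 hb
    exact hab ((Sym2.mem_and_mem_iff hxy).1 ⟨hcon x (by simp), hcon y (by simp)⟩)

lemma pair_jD (hH : Strictly2Balanced H) (h3 : 3 ≤ (HE H).card) (h : Up H C n p) {a b : E2(n)}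
    (ha : a ∈ EE n) (hb : b ∈ EE n) (hab : a ≠ b) {I : Finset (ES(n))} (hI : I ⊆ PF H a b) :
    jDelta p I (fun K => K \ {a, b}) ≤ 2 * LL H n p * (cU H ((HE H).card + 2) * tht H n) +
      8 * (HE H).card * ν(α) * (lam H n p / n) := by
  have hp := h.p0
  obtain ⟨z, hz, hza⟩ := exists_z hb hab
  obtain ⟨y, hy, hyb⟩ := exists_z ha hab.symm
  set D := ((cpg H a).filter fun K => z ∈ VU K) ∪ ((cpg H b).filter fun K => y ∈ VU K) with hD
  have key : ∀ i ∈ I, ∑ j ∈ I with j ≠ i ∧ ¬ Disjoint (i \ {a, b}) (j \ {a, b}), p ^ ((i \ {a, b}) ∪ (j \ {a, b})).card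
      ≤ p ^ ((HE H).card - 1) * (cU H ((HE H).card + 2) * tht H n) + (if i ∈ D then p ^ ((HE H).card - 1) else 0) := by
    intro i hi
    have hiP := hI hi
    have hic := PF_card a b hiP
    set J := I.filter fun j => j ≠ i ∧ ¬ Disjoint (i \ {a, b}) (j \ {a, b}) with hJ
    rw [← sum_filter_add_sum_filter_not J fun j => ¬ (j \ {a, b} = i \ {a, b})]
    refine add_le_add ?_ ?_
    · have hU : (i ∪ {a, b}).card ≤ (HE H).card + 2 := by
        refine (card_union_le _ _).trans ?_
        rw [cps_card (mem_PF.1 hiP).1]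
        exact Nat.add_le_add_left card_le_two _
      have := mul_le_mul_of_nonneg_left (sumA (H := H) h hU) (pow_nonneg hp ((HE H).card - 1))
      refine le_trans ?_ this
      rw [mul_sum]
      refine (sum_le_sum fun j hj => ?_).trans
        (sum_le_sum_of_subset_of_nonneg (s := J.filter fun j => ¬ (j \ {a, b} = i \ {a, b})) ?_ fun _ _ _ => ?_)
      · rw [← pow_add]
        refine le_of_eq (congrArg _ ?_)
        rw [← hic, ← card_union_of_disjoint]
        · congr 1
          ext x; simp only [mem_union, Finset.mem_sdiff]; tauto
        · refine Finset.disjoint_left.2 fun x h1 h2 => ?_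
          simp only [Finset.mem_sdiff, mem_union] at h1 h2; tauto
      · intro j hj
        rw [mem_filter, hJ, mem_filter] at hj
        have hjP := hI hj.1.1
        have hjc := PF_card a b hjP
        rw [mem_filter]
        refine ⟨(mem_PF.1 hjP).1, ?_, ?_⟩
        · obtain ⟨x, hx1, hx2⟩ := not_disjoint_iff.1 hj.1.2.2
          rw [Finset.mem_sdiff] at hx1 hx2
          obtain ⟨w, hw, hwj⟩ : ∃ w ∈ ({a, b} : ES(n)), w ∈ j := by
            rcases (mem_PF.1 hjP).2 with h' | h'
            · exact ⟨a, by simp, h'.1⟩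
            · exact ⟨b, by simp, h'.1⟩
          have hne : x ≠ w := fun h' => hx1.2 (h' ▸ hw)
          rw [← card_pair hne]
          refine card_le_card fun t ht => ?_
          simp only [mem_insert, mem_singleton] at ht
          rcases ht with rfl | rfl
          · exact mem_inter.2 ⟨hx2.1, mem_union_left _ hx1.1⟩
          · exact mem_inter.2 ⟨hwj, mem_union_right _ hw⟩
        · intro hsub
          refine hj.2 (eq_of_subset_of_card_le (fun x hx => ?_) (by rw [hic, hjc]))
          rw [Finset.mem_sdiff] at hx ⊢
          exact ⟨(mem_union.1 (hsub hx.1)).resolve_right hx.2, hx.2⟩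
      · exact mul_nonneg (pow_nonneg hp _) (pow_nonneg hp _)
    · have hone : ∀ j ∈ J.filter fun j => ¬¬ (j \ {a, b} = i \ {a, b}),
          ((a ∈ i ∧ b ∉ i ∧ b ∈ j ∧ a ∉ j) ∨ (b ∈ i ∧ a ∉ i ∧ a ∈ j ∧ b ∉ j)) ∧ j \ {a, b} = i \ {a, b} := by
        intro j hj
        rw [mem_filter, hJ, mem_filter, not_not] at hj
        refine ⟨?_, hj.2⟩
        have same : (a ∈ i ↔ a ∈ j) → (b ∈ i ↔ b ∈ j) → False := by
          intro e1 e2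
          apply hj.1.2.1
          ext x
          by_cases hx : x ∈ ({a, b} : ES(n))
          · simp only [mem_insert, mem_singleton] at hx
            rcases hx with rfl | rfl
            · exact e1.symm
            · exact e2.symm
          · have := Finset.ext_iff.1 hj.2 x
            simp only [Finset.mem_sdiff, hx, not_false_eq_true, and_true] at this
            exact this
        have h1 := (mem_PF.1 hiP).2
        have h2 := (mem_PF.1 (hI hj.1.1)).2
        by_cases c1 : a ∈ i <;> by_cases c2 : a ∈ j <;> by_cases c3 : b ∈ i <;> by_cases c4 : b ∈ j <;>
          simp_all
      have hcard : (J.filter fun j => ¬¬ (j \ {a, b} = i \ {a, b})).card ≤ 1 := by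
        refine card_le_one.2 fun j hj j' hj' => ?_
        obtain ⟨h1, h1'⟩ := hone j hj
        obtain ⟨h2, h2'⟩ := hone j' hj'
        ext x
        by_cases hx : x ∈ ({a, b} : ES(n))
        · simp only [mem_insert, mem_singleton] at hx
          rcases hx with rfl | rfl <;> tauto
        · have := Finset.ext_iff.1 (h1'.trans h2'.symm) x
          simp only [Finset.mem_sdiff, hx, not_false_eq_true, and_true] at this
          exact this
      by_cases hiD : i ∈ D
      · rw [if_pos hiD]
        refine (sum_le_card_nsmul _ _ (p ^ ((HE H).card - 1)) fun j hj => ?_).trans ?_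
        · rw [(hone j hj).2, union_self, hic]
        · have := nsmul_le_nsmul_left (pow_nonneg hp ((HE H).card - 1)) hcard
          simpa using this
      · rw [if_neg hiD]
        refine le_of_eq (sum_eq_zero fun j hj => ?_)
        exfalso
        have hjm : j ∈ cps H n := by
          rw [mem_filter, hJ, mem_filter] at hj
          exact (mem_PF.1 (hI hj.1.1)).1
        obtain ⟨h1, h1'⟩ := hone j hj
        apply hiD
        rw [hD, mem_union, mem_filter, mem_filter, mem_cpg, mem_cpg]
        rcases h1 with h1 | h1
        · exact Or.inl ⟨⟨(mem_PF.1 hiP).1, h1.1⟩, swap_z hH h3 hz hjm h1.2.2.1 h1.2.2.2 h1'⟩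
        · refine Or.inr ⟨⟨(mem_PF.1 hiP).1, h1.1⟩, swap_z (a := b) (b := a) hH h3 hy hjm h1.2.2.1 h1.2.2.2 ?_⟩
          rw [pair_comm]; exact h1'
  unfold jDelta
  refine (sum_le_sum key).trans ?_
  rw [sum_add_distrib, sum_const, nsmul_eq_mul]
  have hIc : (I.card : ℝ) ≤ 2 * bN H n := by
    have h1 := (card_le_card hI)
    rw [PF_eq] at h1
    have h2 := h1.trans ((card_union_le _ _).trans
      (Nat.add_le_add (PF1_le ha) (PF1_le hb)))
    have : ((I.card : ℕ) : ℝ) ≤ ((bN H n + bN H n : ℕ) : ℝ) := by exact_mod_cast h2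
    push_cast at this; linarith
  have hn := h.hn
  have hn0 : (0:ℝ) < n := by exact_mod_cast (by omega : 0 < n)
  have hcU : 0 ≤ cU H ((HE H).card + 2) * tht H n :=
    mul_nonneg (zero_le_one.trans (cU_ge_one _)) (tht_pos (by omega)).le
  refine add_le_add ?_ ?_
  · have := mul_le_mul_of_nonneg_right hIc
      (mul_nonneg (pow_nonneg hp ((HE H).card - 1)) hcU)
    unfold LL
    linarith
  · rw [← sum_filter, sum_const, nsmul_eq_mul]
    have hc : ((I.filter fun i => i ∈ D).card : ℝ) ≤
        8 * (HE H).card * ν(α) * (n : ℝ) ^ (ν(α) - 3) := by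
      have h1 : (I.filter fun i => i ∈ D).card ≤ D.card :=
        card_le_card fun x hx => (mem_filter.1 hx).2
      have h2 : ((I.filter fun i => i ∈ D).card : ℝ) ≤
        (((cpg H a).filter fun K => z ∈ VU K).card : ℝ) + (((cpg H b).filter fun K => y ∈ VU K).card : ℝ) := by
        exact_mod_cast h1.trans (card_union_le _ _)
      have h4 := cpz_le hH hza
      have h5 := cpz_le hH hyb
      linarith
    have hl : lam H n p / n = (n : ℝ) ^ (ν(α) - 3) * p ^ ((HE H).card - 1) := by
      unfold lam
      have := sb_card hH
      rw [show ν(α) - 2 = (ν(α) - 3) + 1 by omega, pow_succ]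
      field_simp
    rw [hl, ← mul_assoc]
    exact mul_le_mul_of_nonneg_right hc (pow_nonneg hp _)

/-- The pair family has a negligible correction term. -/
lemma pair_fam (hH : Strictly2Balanced H) (h3 : 3 ≤ (HE H).card) (C : ℝ) {δ : ℝ} (hδ : 0 < δ) :
    ∀ᶠ n : ℕ in atTop, ∀ p, Up H C n p → ∀ a ∈ EE n, ∀ b ∈ EE n, a ≠ b →
      (∀ I ⊆ PF H a b, jDelta p I (fun K => K \ {a, b}) ≤ δ) ∧
      LL H n p - δ ≤ (PF1 H a b).card * p ^ ((HE H).card - 1) ∧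
      2 * LL H n p - δ ≤ (PF H a b).card * p ^ ((HE H).card - 1) := by
  have t1 : Tendsto (fun n : ℕ => 2 * (4 * (HE H).card * |C|) * cU H ((HE H).card + 2) * (log n ^ 1 * tht H n) +
      8 * (HE H).card * ν(α) * |C| * (log n ^ 1 * tht H n)) atTop (𝓝 0) := by
    simpa using ((log_pow_mul_tht h3 1).const_mul (2 * (4 * (HE H).card * |C|) * cU H ((HE H).card + 2))).add
      ((log_pow_mul_tht h3 1).const_mul (8 * (HE H).card * ν(α) * |C|))
  have t2 : Tendsto (fun n : ℕ => 2 * (cU H 2 * tht H n)) atTop (𝓝 0) := by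
    simpa using ((tht_tendsto h3).const_mul (cU H 2)).const_mul 2
  filter_upwards [t1.eventually (eventually_le_nhds hδ), t2.eventually (eventually_le_nhds hδ)] with n h1 h2 p h a ha b hb hab
  have hn := h.hn
  have hn0 : (1:ℝ) ≤ n := by exact_mod_cast (by omega : 1 ≤ n)
  have hlog : 0 ≤ log n := log_nonneg hn0
  have hth := tht_pos (H := H) (n := n) (by omega)
  have hl : lam H n p ≤ |C| * log n := h.lamle.trans (mul_le_mul_of_nonneg_right (le_abs_self C) hlog)
  have hlam0 : 0 ≤ lam H n p := by unfold lam; have := h.p0; positivity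
  have hinv : (n:ℝ)⁻¹ ≤ tht H n := by
    unfold tht
    rw [← Real.rpow_neg_one]
    refine Real.rpow_le_rpow_of_exponent_le hn0 (neg_le_neg ?_)
    unfold gam
    have : (3:ℝ) ≤ (HE H).card := by exact_mod_cast h3
    rw [div_le_one (by linarith)]; linarith
  have hg1 := PF1_ge h3 h ha hab
  have hg2 := PF1_ge h3 h hb hab.symm
  have hcu : 0 ≤ cU H 2 * tht H n := mul_nonneg (zero_le_one.trans (cU_ge_one _)) hth.le
  refine ⟨fun I hI => (pair_jD hH h3 h ha hb hab hI).trans (le_trans (add_le_add ?_ ?_) h1), by linarith, ?_⟩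
  · have e1 := (LL_le (H := H) (n := n) h.p0).trans
      (mul_le_mul_of_nonneg_left hl (by positivity : (0:ℝ) ≤ 4 * (HE H).card))
    have e2 := mul_le_mul_of_nonneg_right e1
      (mul_nonneg (zero_le_one.trans (cU_ge_one (H := H) ((HE H).card + 2))) hth.le)
    rw [pow_one]
    linarith
  · have e1 : lam H n p / n ≤ |C| * log n * tht H n := by
      rw [div_eq_mul_inv]
      exact mul_le_mul hl hinv (by positivity) (by positivity)
    have e2 := mul_le_mul_of_nonneg_left e1 (by positivity : (0:ℝ) ≤ 8 * (HE H).card * ν(α))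
    rw [pow_one]
    linarith
  · rw [PF_eq, card_union_of_disjoint (PF_disj a b)]
    push_cast
    linarith

/-! ### Edges in few copies -/
lemma cnt_mono {ι κ : Type*} (I : Finset κ) (A : κ → Finset ι) {s t : Finset ι} (h : s ⊆ t) :
    cnt I A s ≤ cnt I A t := by
  unfold cnt
  refine card_le_card fun i hi => ?_
  rw [mem_filter] at hi ⊢
  exact ⟨hi.1, hi.2.trans h⟩

/-- The critical exponent. -/
def aH (H : SimpleGraph α) : ℝ := ((ν(α) : ℝ) - 2) / ((HE H).card - 1)

lemma aH_lt (hH : Strictly2Balanced H) (h3 : 3 ≤ (HE H).card) : aH H < 1 := by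
  have h1 := sb_dense hH h3
  have h2 := sb_card hH
  have h4 : (3:ℝ) ≤ (HE H).card := by exact_mod_cast h3
  unfold aH
  rw [div_lt_one (by linarith)]
  have : ν(α) < (HE H).card + 1 := by omega
  have : (ν(α) : ℝ) < (HE H).card + 1 := by exact_mod_cast this
  linarith

lemma rpow_aH (hH : Strictly2Balanced H) (h3 : 3 ≤ (HE H).card) (n : ℕ) :
    ((n:ℝ) ^ (-aH H)) ^ ((HE H).card - 1) = ((n:ℝ) ^ (ν(α) - 2))⁻¹ := by
  have h4 : (3:ℝ) ≤ (HE H).card := by exact_mod_cast h3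
  have h2 := sb_card hH
  rw [← rpow_natCast, ← rpow_mul (Nat.cast_nonneg n), ← rpow_natCast, ← rpow_neg (Nat.cast_nonneg n)]
  congr 1
  rw [Nat.cast_sub (by omega), Nat.cast_sub (by omega)]
  unfold aH
  push_cast
  have : ((HE H).card : ℝ) - 1 ≠ 0 := by linarith
  field_simp

lemma p_le_aH (hH : Strictly2Balanced H) (h3 : 3 ≤ (HE H).card) (hn : 1 ≤ n) {L : ℝ}
    (hl : lam H n p ≤ L) (hL : 1 ≤ L) : p ≤ L * (n:ℝ) ^ (-aH H) := by
  have hn0 : (0:ℝ) < n := by exact_mod_cast hn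
  have he : (HE H).card - 1 ≠ 0 := by omega
  refine le_of_pow_le_pow_left₀ he (by positivity) ?_
  rw [mul_pow, rpow_aH hH h3, ← div_eq_mul_inv, le_div_iff₀ (by positivity)]
  have h1 : L ≤ L ^ ((HE H).card - 1) := le_self_pow₀ hL he
  unfold lam at hl
  linarith

lemma n2p_le (hH : Strictly2Balanced H) (h3 : 3 ≤ (HE H).card) (hn : 1 ≤ n) {L : ℝ}
    (hl : lam H n p ≤ L) (hL : 1 ≤ L) : (n:ℝ) ^ 2 * p ≤ L * (n:ℝ) ^ (2 - aH H) := by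
  have hn0 : (0:ℝ) < n := by exact_mod_cast hn
  have := mul_le_mul_of_nonneg_left (p_le_aH hH h3 hn hl hL) (by positivity : (0:ℝ) ≤ (n:ℝ) ^ 2)
  rw [sub_eq_add_neg, rpow_add hn0, rpow_two]
  linarith

lemma log_pow_rpow {c : ℝ} (hc : 0 < c) (k : ℕ) :
    Tendsto (fun n : ℕ => log n ^ k * (n:ℝ) ^ (-c)) atTop (𝓝 0) := by
  have h := (isLittleO_log_rpow_rpow_atTop (k : ℝ) hc).tendsto_div_nhds_zero
  refine (h.comp tendsto_natCast_atTop_atTop).congr fun n => ?_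
  simp only [Function.comp, rpow_natCast]
  rw [rpow_neg (Nat.cast_nonneg n), div_eq_mul_inv]

lemma cps_count (hH : Strictly2Balanced H) (n : ℕ) :
    ((cps H n).card : ℝ) ≤ (n:ℝ) ^ (ν(α) - 2) * (n:ℝ) ^ 2 := by
  have h1 : (cps H n).card ≤ n ^ ν(α) := by
    unfold cps
    refine card_image_le.trans ?_
    have := emb_count_le (α := α) (fun _ => (univ : Finset (Fin n)))
    simpa using this
  have := sb_card hH
  rw [← pow_add, show ν(α) - 2 + 2 = ν(α) by omega]
  exact_mod_cast h1

/-- No two low edges in touching copies. -/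
def LowB (H : SimpleGraph α) {n : ℕ} (p : ℝ) (s : ES(n)) : Prop :=
  ∀ K ∈ cps H n, ∀ K' ∈ cps H n, K ⊆ s → K' ⊆ s → (K' ∩ K).Nonempty → ∀ g ∈ K, ∀ g' ∈ K', g ≠ g' →
    LL H n p / 100 < (cpe H s g).card ∨ LL H n p / 100 < (cpe H s g').card

lemma low_pair (hH : Strictly2Balanced H) (h3 : 3 ≤ (HE H).card) (C : ℝ) :
    ∀ᶠ n : ℕ in atTop, ∀ p, Up H C n p → ∀ a ∈ EE n, ∀ b ∈ EE n, a ≠ b →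
      pr (EE n) p (fun s => (cnt (PF H a b) (fun K => K \ {a, b}) s : ℝ) ≤ LL H n p / 50) ≤
        exp (2 - 17 / 10 * LL H n p) := by
  filter_upwards [pair_fam hH h3 C one_pos] with n h1 p h a ha b hb hab
  obtain ⟨e1, _, e2⟩ := h1 p h a ha b hb hab
  refine (janson_lower h.p0 h.p1 (PF H a b) (fun K => K \ {a, b})
    (fun K hK => sdiff_subset.trans (cps_subset_EE (mem_PF.1 hK).1)) (q := 9 / 10) (by norm_num) (by norm_num) _).trans ?_
  rw [exp_le_exp]
  rw [sum_congr rfl fun K hK => by rw [PF_card a b hK], sum_const, nsmul_eq_mul]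
  have e3 := e1 _ (Finset.Subset.refl _)
  have hLL : 0 ≤ LL H n p := by unfold LL; have := h.p0; positivity
  have hlog : -log (1 - 9 / 10) ≤ 4 * 0.6931471808 := by
    rw [← Real.log_inv]
    have : log (1 - 9 / 10 : ℝ)⁻¹ ≤ log (2 ^ 4) := Real.log_le_log (by norm_num) (by norm_num)
    rw [log_pow] at this
    have := Real.log_two_lt_d9
    push_cast at *
    linarith
  have := mul_le_mul_of_nonneg_left hlog (by positivity : 0 ≤ LL H n p / 50)
  nlinarith

lemma Low_whp (hH : Strictly2Balanced H) (h3 : 3 ≤ (HE H).card) (C : ℝ) :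
    Whp H C (fun n p s => 9 / 10 * ((2 - aH H) * log n) ≤ LL H n p → LowB H p s) := by
  intro ζ hζ
  have ha := aH_lt hH h3
  have t : Tendsto (fun n : ℕ => (HE H).card ^ 2 * cU H (HE H).card * |C| ^ 3 * exp 2 *
      (log n ^ 3 * (n:ℝ) ^ (-((2 - aH H) / 2)))) atTop (𝓝 0) := by
    simpa using (log_pow_rpow (by linarith : 0 < (2 - aH H) / 2) 3).const_mul
      ((HE H).card ^ 2 * cU H (HE H).card * |C| ^ 3 * exp 2)
  filter_upwards [low_pair hH h3 C, t.eventually (eventually_le_nhds hζ)] with n h1 h2 p hw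
  by_cases hr : 9 / 10 * ((2 - aH H) * log n) ≤ LL H n p
  swap
  · refine le_trans (le_of_eq ?_) hζ.le
    unfold pr
    rw [ex_congr (g := fun _ => 0) fun s _ => ind_false (by push Not; intro h; exact absurd h hr), ex_const]
  have hn := hw.hn
  have hp := hw.p0
  have hn0 : (0:ℝ) < n := by exact_mod_cast (by omega : 0 < n)
  have hlog : 0 ≤ log n := log_nonneg (by exact_mod_cast (by omega : 1 ≤ n))
  set I := (cps H n ×ˢ cps H n).filter fun q => (q.2 ∩ q.1).Nonempty with hI
  set I2 := I.sigma fun q => ((q.1 ×ˢ q.2).filter fun g => g.1 ≠ g.2) with hI2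
  set B := exp (2 - 17 / 10 * LL H n p) with hB
  have hstep : pr (EE n) p (fun s => ¬ (9 / 10 * ((2 - aH H) * log n) ≤ LL H n p → LowB H p s)) ≤
      ∑ i ∈ I2, p ^ (i.1.1 ∪ i.1.2).card * B := by
    refine (pr_mono hp hw.p1 (Q := fun s => ∃ i ∈ I2, (i.1.1 ∪ i.1.2) ⊆ s ∧
      (cnt (PF H i.2.1 i.2.2) (fun K => K \ {i.2.1, i.2.2}) s : ℝ) ≤ LL H n p / 50) ?_).trans
      ((pr_exists hp hw.p1 _ _).trans (sum_le_sum fun i hi => ?_))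
    · intro s _ hs
      unfold LowB at hs
      push Not at hs
      obtain ⟨_, K, hK, K', hK', hKs, hKs', hne, g, hg, g', hg', hgg, hl, hl'⟩ := hs
      refine ⟨⟨(K, K'), (g, g')⟩, ?_, union_subset hKs hKs', ?_⟩
      · simp [hI2, hI, hK, hK', hne, hg, hg', hgg]
      · have : cnt (PF H g g') (fun K => K \ {g, g'}) s ≤ (cpe H s g ∪ cpe H s g').card := by
          refine cnt_le fun K1 hK1 hK1s => ?_
          have hsub : K1 ⊆ s := by
            intro x hx
            by_cases hx' : x ∈ ({g, g'} : ES(n))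
            · simp only [mem_insert, mem_singleton] at hx'
              rcases hx' with rfl | rfl
              · exact hKs hg
              · exact hKs' hg'
            · exact hK1s (Finset.mem_sdiff.2 ⟨hx, hx'⟩)
          rw [mem_PF] at hK1
          unfold cpe
          rcases hK1.2 with h' | h'
          · exact mem_union_left _ (mem_filter.2 ⟨hK1.1, h'.1, hsub⟩)
          · exact mem_union_right _ (mem_filter.2 ⟨hK1.1, h'.1, hsub⟩)
        have := this.trans (card_union_le _ _)
        have : ((cnt (PF H g g') (fun K => K \ {g, g'}) s : ℕ) : ℝ) ≤ (cpe H s g).card + (cpe H s g').card := by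
          exact_mod_cast this
        show (cnt (PF H g g') (fun K => K \ {g, g'}) s : ℝ) ≤ _
        linarith
    · obtain ⟨⟨K, K'⟩, g, g'⟩ := i
      simp only [hI2, hI, mem_sigma, mem_filter, mem_product] at hi
      have hKE := cps_subset_EE hi.1.1.1
      have hKE' := cps_subset_EE hi.1.1.2
      unfold pr
      simp only [ind_and]
      refine (harris hp hw.p1 (fun s t hst => ind_mono fun h => h.trans hst) fun s t hst => ind_mono fun h => ?_).trans ?_
      · refine le_trans ?_ h
        exact_mod_cast cnt_mono (PF H g g') _ hst
      · have e1 := pr_subset (p := p) (union_subset hKE hKE')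
        have e2 := h1 p hw.toUp g (hKE hi.2.1.1) g' (hKE' hi.2.1.2) hi.2.2
        unfold pr at e1 e2
        rw [e1]
        exact mul_le_mul_of_nonneg_left e2 (pow_nonneg hp _)
  refine hstep.trans (le_trans ?_ h2)
  have hB0 : 0 < B := exp_pos _
  have hl := hw.lamle
  have hl' : lam H n p ≤ |C| * log n := hl.trans (mul_le_mul_of_nonneg_right (le_abs_self C) hlog)
  have hl0 : 0 ≤ lam H n p := zero_le_one.trans hw.lam1
  have hcU : 0 ≤ cU H (HE H).card := zero_le_one.trans (cU_ge_one _)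
  have hS1 : ∑ i ∈ I2, p ^ (i.1.1 ∪ i.1.2).card * B ≤ (HE H).card ^ 2 * B * ∑ q ∈ I, p ^ (q.1 ∪ q.2).card := by
    rw [hI2, sum_sigma, mul_sum]
    refine sum_le_sum fun q hq => ?_
    dsimp only
    rw [sum_const, nsmul_eq_mul]
    rw [hI, mem_filter, mem_product] at hq
    have hc : (((q.1 ×ˢ q.2).filter fun g => g.1 ≠ g.2).card : ℝ) ≤ (HE H).card ^ 2 := by
      have := card_filter_le (q.1 ×ˢ q.2) (fun g => g.1 ≠ g.2)
      rw [card_product, cps_card hq.1.1, cps_card hq.1.2, ← sq] at this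
      exact_mod_cast this
    have := mul_le_mul_of_nonneg_right hc (mul_nonneg (pow_nonneg hp (q.1 ∪ q.2).card) hB0.le)
    linarith
  have hS2 : ∑ q ∈ I, p ^ (q.1 ∪ q.2).card ≤ (n:ℝ) ^ 2 * p * (cU H (HE H).card * lam H n p ^ 2) := by
    rw [hI, sum_filter, sum_product]
    have : ∀ K ∈ cps H n, (∑ K' ∈ cps H n, if (K' ∩ K).Nonempty then p ^ (K ∪ K').card else 0) ≤
        p ^ (HE H).card * (cU H (HE H).card * lam H n p) := by
      intro K hK
      rw [← sum_filter]
      have e1 := sumB hH h3 hw.toUp (U := K) (cps_card hK).le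
      rw [hw.max_eq] at e1
      refine le_trans (le_of_eq ?_) (mul_le_mul_of_nonneg_left e1 (pow_nonneg hp _))
      rw [mul_sum]
      refine sum_congr rfl fun K' _ => ?_
      rw [← pow_add, ← cps_card hK, ← card_union_of_disjoint disjoint_sdiff, union_sdiff_self_eq_union]
    refine (sum_le_sum this).trans ?_
    rw [sum_const, nsmul_eq_mul]
    have e2 := mul_le_mul_of_nonneg_right (cps_count hH n)
      (mul_nonneg (pow_nonneg hp (HE H).card) (mul_nonneg hcU hl0))
    refine e2.trans (le_of_eq ?_)
    have e4 : p ^ (HE H).card = p ^ ((HE H).card - 1) * p := by rw [← pow_succ]; congr 1; omega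
    rw [e4]; unfold lam; ring
  have hn2 := n2p_le hH h3 (by omega : 1 ≤ n) le_rfl hw.lam1
  have hBb : B ≤ exp 2 * (n:ℝ) ^ (-(3 / 2 * (2 - aH H))) := by
    rw [hB, Real.rpow_def_of_pos hn0, ← exp_add, exp_le_exp]
    have : 0 ≤ (2 - aH H) * log n := mul_nonneg (by linarith) hlog
    linarith
  have hn3 : (n:ℝ) ^ (2 - aH H) * (n:ℝ) ^ (-(3 / 2 * (2 - aH H))) = (n:ℝ) ^ (-((2 - aH H) / 2)) := by
    rw [← rpow_add hn0]; congr 1; ring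
  have hlc : lam H n p ^ 3 ≤ |C| ^ 3 * log n ^ 3 := by
    rw [← mul_pow]; exact pow_le_pow_left₀ hl0 hl' 3
  calc _ ≤ (HE H).card ^ 2 * B * ((n:ℝ) ^ 2 * p * (cU H (HE H).card * lam H n p ^ 2)) :=
        hS1.trans (mul_le_mul_of_nonneg_left hS2 (by positivity))
    _ ≤ (HE H).card ^ 2 * (exp 2 * (n:ℝ) ^ (-(3 / 2 * (2 - aH H)))) *
        ((lam H n p * (n:ℝ) ^ (2 - aH H)) * (cU H (HE H).card * lam H n p ^ 2)) := by gcongr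
    _ = (HE H).card ^ 2 * cU H (HE H).card * exp 2 * (lam H n p ^ 3 *
        ((n:ℝ) ^ (2 - aH H) * (n:ℝ) ^ (-(3 / 2 * (2 - aH H))))) := by ring
    _ ≤ (HE H).card ^ 2 * cU H (HE H).card * exp 2 * ((|C| ^ 3 * log n ^ 3) * (n:ℝ) ^ (-((2 - aH H) / 2))) := by
        rw [hn3]; gcongr
    _ = _ := by ring

end

/-! ### Second moment and sparse range -/
section
variable {ι κ : Type*} {E : Finset ι} {p : ℝ}

lemma second_moment (hp : 0 ≤ p) (hp1 : p ≤ 1) (I : Finset κ) (Y : κ → Finset ι → Prop) {m q : ℝ}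
    (hI : I.Nonempty) (hm : 0 < m) (h1 : ∀ i ∈ I, m ≤ pr E p (Y i)) (hq : 0 ≤ q)
    (h2 : ∀ i ∈ I, ∀ j ∈ I, i ≠ j → pr E p (fun s => Y i s ∧ Y j s) ≤ q) :
    pr E p (fun s => ∀ i ∈ I, ¬ Y i s) ≤ 1 / (I.card * m) + (q / m ^ 2 - 1) := by
  set X : Finset ι → ℝ := fun s => ∑ i ∈ I, ind (Y i s) with hX
  set μ := ex E p X with hμ
  have hc : (0:ℝ) < I.card := by exact_mod_cast hI.card_pos
  have hμ' : μ = ∑ i ∈ I, pr E p (Y i) := ex_sum _ _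
  have hM : I.card * m ≤ μ := by
    rw [hμ', ← nsmul_eq_mul, ← sum_const]; exact sum_le_sum h1
  have hM0 : 0 < I.card * m := mul_pos hc hm
  have hμ0 : 0 < μ := hM0.trans_le hM
  have hsq : ex E p (fun s => X s ^ 2) ≤ μ + I.card ^ 2 * q := by
    have e1 : (fun s => X s ^ 2) = fun s => ∑ i ∈ I, ∑ j ∈ I, ind (Y i s) * ind (Y j s) := by
      funext s; rw [sq, sum_mul_sum]
    rw [e1, ex_sum]
    have e2 : ∀ i ∈ I, ex E p (fun s => ∑ j ∈ I, ind (Y i s) * ind (Y j s)) ≤ pr E p (Y i) + I.card * q := by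
      intro i hi
      rw [ex_sum]
      have : ∀ j ∈ I, ex E p (fun s => ind (Y i s) * ind (Y j s)) ≤ (if i = j then pr E p (Y i) else 0) + q := by
        intro j hj
        by_cases hij : i = j
        · subst hij
          rw [if_pos rfl]
          refine le_trans (le_of_eq ?_) (le_add_of_nonneg_right hq)
          exact ex_congr fun s _ => by rw [← ind_and, and_self]
        · rw [if_neg hij, zero_add]
          refine le_trans (le_of_eq ?_) (h2 i hi j hj hij)
          exact ex_congr fun s _ => by rw [← ind_and]
      refine (sum_le_sum this).trans (le_of_eq ?_)
      rw [sum_add_distrib, sum_ite_eq, if_pos hi, sum_const, nsmul_eq_mul]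
    refine (sum_le_sum e2).trans (le_of_eq ?_)
    rw [sum_add_distrib, ← hμ', sum_const, nsmul_eq_mul]; ring
  have hvar : ex E p (fun s => (X s - μ) ^ 2) ≤ μ + I.card ^ 2 * q - μ ^ 2 := by
    have e1 : (fun s => (X s - μ) ^ 2) = fun s => (X s ^ 2 - (2 * μ) * X s) + μ ^ 2 := by funext s; ring
    rw [e1, ex_add, ex_sub, ex_mul_left, ex_const, ← hμ]
    linarith
  have hch : μ ^ 2 * pr E p (fun s => ∀ i ∈ I, ¬ Y i s) ≤ μ + I.card ^ 2 * q - μ ^ 2 := by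
    refine le_trans ?_ hvar
    unfold pr
    rw [← ex_mul_left]
    refine ex_mono hp hp1 fun s _ => ?_
    by_cases h : ∀ i ∈ I, ¬ Y i s
    · rw [ind_true h]
      have : X s = 0 := sum_eq_zero fun i hi => ind_false (h i hi)
      rw [this]; linarith
    · rw [ind_false h]; simpa using sq_nonneg _
  have h5 : 1 / μ ≤ 1 / (I.card * m) := one_div_le_one_div_of_le hM0 hM
  have h6 : I.card ^ 2 * q / μ ^ 2 ≤ q / m ^ 2 := by
    rw [div_le_div_iff₀ (by positivity) (by positivity)]
    have : (I.card * m) ^ 2 ≤ μ ^ 2 := pow_le_pow_left₀ hM0.le hM 2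
    nlinarith [mul_le_mul_of_nonneg_left this hq]
  have h7 : pr E p (fun s => ∀ i ∈ I, ¬ Y i s) ≤ 1 / μ + I.card ^ 2 * q / μ ^ 2 - 1 := by
    rw [← mul_le_mul_iff_right₀ (by positivity : 0 < μ ^ 2)]
    refine hch.trans (le_of_eq ?_)
    field_simp
  linarith

lemma fkg_prod [DecidableEq ι] (hp : 0 ≤ p) (hp1 : p ≤ 1) (I : Finset κ) (A : κ → Finset ι) (hA : ∀ i ∈ I, A i ⊆ E) :
    ∏ i ∈ I, (1 - p ^ (A i).card) ≤ pr E p (fun s => ∀ i ∈ I, ¬ A i ⊆ s) := by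
  induction I using Finset.induction_on with
  | empty =>
    unfold pr
    rw [ex_congr (g := fun _ => 1) fun s _ => ind_true (by simp), ex_const]; simp
  | insert i I hi ih =>
    have h1 := ih fun j hj => hA j (mem_insert_of_mem hj)
    have h2 : pr E p (fun s => ¬ A i ⊆ s) = 1 - p ^ (A i).card := by
      rw [← pr_subset (hA i (mem_insert_self _ _))]
      unfold pr
      rw [← ex_const (E := E) (p := p) 1, ← ex_sub]
      refine ex_congr fun s _ => ?_
      by_cases h : A i ⊆ s <;> simp [ind, h]
    rw [prod_insert hi, ← h2]
    refine (mul_le_mul_of_nonneg_left h1 (pr_nonneg hp hp1 _)).trans ?_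
    refine (harris_dec hp hp1 (fun s t hst => ind_mono fun h h' => h (h'.trans hst))
      fun s t hst => ind_mono fun h j hj h' => h j hj (h'.trans hst)).trans (le_of_eq ?_)
    refine ex_congr fun s _ => ?_
    rw [← ind_and]
    refine ind_congr ?_
    simp

lemma one_sub_ge {x : ℝ} (hx : x ≤ 1 / 2) : exp (-(x + 2 * x ^ 2)) ≤ 1 - x := by
  have h1 : 0 < 1 - x := by linarith
  have h2 := add_one_le_exp (x / (1 - x))
  have h4 : x / (1 - x) + 1 = (1 - x)⁻¹ := by field_simp; ring
  rw [h4] at h2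
  have h5 : x / (1 - x) ≤ x + 2 * x ^ 2 := by
    rw [div_le_iff₀ h1]; nlinarith [mul_nonneg (sq_nonneg x) (by linarith : 0 ≤ 1 - 2 * x)]
  rw [exp_neg]
  exact inv_le_of_inv_le₀ h1 (h2.trans (exp_le_exp.2 h5))

end

section
variable [Fintype α] {H : SimpleGraph α} {n : ℕ} {p C : ℝ}

/-- `g` is present but in no copy. -/
def Iso (H : SimpleGraph α) {n : ℕ} (g : E2(n)) (s : ES(n)) : Prop :=
  g ∈ s ∧ ∀ K ∈ cpg H g, ¬ K ⊆ s

lemma iso_prob {g : E2(n)} (hg : g ∈ EE n) (hp : 0 ≤ p) (hp1 : p ≤ 1) (hx : p ^ ((HE H).card - 1) ≤ 1 / 2) :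
    p * exp (-(LL H n p * (1 + 2 * p ^ ((HE H).card - 1)))) ≤ pr (EE n) p (Iso H g) := by
  have h1 := fkg_prod (E := EE n) hp hp1 (cpg H g) (fun K => K.erase g)
    fun K hK => (erase_subset _ _).trans (cps_subset_EE (mem_cpg.1 hK).1)
  rw [prod_congr rfl fun K hK => by
    rw [card_erase_of_mem (mem_cpg.1 hK).2, cps_card (mem_cpg.1 hK).1], prod_const, cpg_card hg] at h1
  have h2 : exp (-(LL H n p * (1 + 2 * p ^ ((HE H).card - 1)))) ≤ (1 - p ^ ((HE H).card - 1)) ^ bN H n := by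
    refine le_trans (le_of_eq ?_) (pow_le_pow_left₀ (exp_pos _).le (one_sub_ge hx) _)
    rw [← exp_nat_mul]; unfold LL; congr 1; ring
  have h3 : pr (EE n) p (Iso H g) = p * pr (EE n) p (fun s => ∀ K ∈ cpg H g, ¬ K.erase g ⊆ s) := by
    have := ex_indep (E := EE n) (p := p) (A := {g}) (by simpa using hg)
      (fun s => ind (∀ K ∈ cpg H g, ¬ K.erase g ⊆ s)) (fun s => ind_congr (by
        refine forall₂_congr fun K hK => not_congr ?_
        constructor
        · intro h x hx; simp only [Finset.mem_sdiff, mem_singleton]; exact ⟨h hx, ne_of_mem_erase hx⟩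
        · intro h x hx; exact (Finset.mem_sdiff.1 (h hx)).1))
    rw [card_singleton, pow_one] at this
    unfold pr
    rw [← this]
    refine ex_congr fun s _ => ?_
    rw [← ind_and]
    refine ind_congr ?_
    unfold Iso
    rw [singleton_subset_iff]
    refine and_congr_right fun hgs => forall₂_congr fun K hK => not_congr ?_
    constructor
    · exact fun h => (erase_subset _ _).trans h
    · intro h x hx
      by_cases hxg : x = g
      · rw [hxg]; exact hgs
      · exact h (mem_erase.2 ⟨hxg, hx⟩)
  rw [h3]
  exact mul_le_mul_of_nonneg_left (h2.trans h1) hp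

lemma iso_pair {δ : ℝ} {a b : E2(n)} (ha : a ∈ EE n) (hb : b ∈ EE n) (hab : a ≠ b) (hp : 0 ≤ p) (hp1 : p ≤ 1)
    (h1 : jDelta p (PF H a b) (fun K => K \ {a, b}) ≤ δ)
    (h2 : 2 * LL H n p - δ ≤ (PF H a b).card * p ^ ((HE H).card - 1)) :
    pr (EE n) p (fun s => Iso H a s ∧ Iso H b s) ≤ p ^ 2 * exp (-(2 * LL H n p) + 2 * δ) := by
  have hE : ({a, b} : ES(n)) ⊆ EE n := by
    intro x hx; simp only [mem_insert, mem_singleton] at hx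
    rcases hx with rfl | rfl <;> assumption
  have h3 := ex_indep (E := EE n) (p := p) hE
    (fun s => ind (∀ K ∈ PF H a b, ¬ K \ {a, b} ⊆ s)) (fun s => ind_congr (by
      refine forall₂_congr fun K hK => not_congr ?_
      constructor
      · intro h x hx; exact Finset.mem_sdiff.2 ⟨h hx, (Finset.mem_sdiff.1 hx).2⟩
      · intro h x hx; exact (Finset.mem_sdiff.1 (h hx)).1))
  rw [card_pair hab] at h3
  have h4 := janson_zero hp hp1 (PF H a b) (fun K => K \ {a, b})
    (fun K hK => sdiff_subset.trans (cps_subset_EE (mem_PF.1 hK).1))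
  rw [sum_congr rfl fun K hK => by rw [PF_card a b hK], sum_const, nsmul_eq_mul] at h4
  have h5 := h4.trans (exp_le_exp.2 (by linarith : _ ≤ -(2 * LL H n p) + 2 * δ))
  refine le_trans ?_ (mul_le_mul_of_nonneg_left h5 (sq_nonneg p))
  unfold pr
  rw [← h3]
  refine ex_mono hp hp1 fun s _ => ?_
  rw [← ind_and]
  refine ind_mono fun ⟨⟨h6, h7⟩, h8, h9⟩ => ?_
  have hs : ({a, b} : ES(n)) ⊆ s := by
    intro x hx; simp only [mem_insert, mem_singleton] at hx
    rcases hx with rfl | rfl <;> assumption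
  refine ⟨hs, fun K hK hKs => ?_⟩
  have hsub : K ⊆ s := fun x hx => by
    by_cases hx' : x ∈ ({a, b} : ES(n))
    · exact hs hx'
    · exact hKs (Finset.mem_sdiff.2 ⟨hx, hx'⟩)
  rw [mem_PF] at hK
  rcases hK.2 with h' | h'
  · exact h7 K (mem_cpg.2 ⟨hK.1, h'.1⟩) hsub
  · exact h9 K (mem_cpg.2 ⟨hK.1, h'.1⟩) hsub

lemma cQ_iso {s : ES(n)} (h : cQ H s) (g : E2(n)) : ¬ Iso H g s := by
  rintro ⟨h1, h2⟩
  obtain ⟨K, hK, hgK, hKs⟩ := h g h1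
  exact h2 K (mem_cpg.2 ⟨hK, hgK⟩) hKs

lemma cT_empty : cT H (∅ : ES(n)) := by
  intro F _
  exact ⟨fun _ => 0, 0, ⟨Or.inr fun _ => rfl, fun _ => rfl⟩, by simp⟩

lemma bad_copy (hp : 0 ≤ p) (hp1 : p ≤ 1) :
    pr (EE n) p (fun s => cQ H s ∧ ¬ cT H s) ≤ (cps H n).card * p ^ (HE H).card := by
  refine (pr_mono hp hp1 (Q := fun s => ∃ K ∈ cps H n, K ⊆ s) fun s _ hs => ?_).trans
    ((pr_exists hp hp1 _ _).trans (le_of_eq ?_))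
  · obtain ⟨g, hg⟩ : s.Nonempty := by
      rw [nonempty_iff_ne_empty]; rintro rfl; exact hs.2 cT_empty
    obtain ⟨K, hK, _, hKs⟩ := hs.1 g hg
    exact ⟨K, hK, hKs⟩
  · rw [sum_congr rfl fun K hK => by rw [pr_subset (cps_subset_EE hK), cps_card hK], sum_const, nsmul_eq_mul]

lemma EE_card_ge (hn : 2 ≤ n) : (n:ℝ) ^ 2 / 4 ≤ (EE n).card := by
  have h1 : (EE n).card = n.choose 2 := by
    rw [← EE_eq]
    convert card_edgeFinset_top_eq_card_choose_two (V := Fin n) using 1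
    rw [Fintype.card_fin]
  rw [h1, Nat.cast_choose_two]
  have : (2:ℝ) ≤ n := by exact_mod_cast hn
  nlinarith

/-- The sparse range. -/
lemma rangeA (hH : Strictly2Balanced H) (h3 : 3 ≤ (HE H).card) {ζ : ℝ} (hζ : 0 < ζ) :
    ∀ᶠ n : ℕ in atTop, ∀ p, 0 ≤ p → p ≤ 1 → LL H n p ≤ 9 / 10 * ((2 - aH H) * log n) →
      pr (EE n) p (fun s => cQ H s ∧ ¬ cT H s) ≤ ζ := by
  have ha := aH_lt hH h3
  have ha0 : 0 ≤ aH H := by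
    unfold aH
    have h1 : (3:ℝ) ≤ (HE H).card := by exact_mod_cast h3
    have h2 : (3:ℝ) ≤ ν(α) := by exact_mod_cast sb_card hH
    exact div_nonneg (by linarith) (by linarith)
  have hcB := cB_pos h3
  have he0 : (0:ℝ) < (HE H).card := by exact_mod_cast (by omega : 0 < (HE H).card)
  set δ := log (1 + ζ / 2) / 4 with hδ
  have hδ0 : 0 < δ := div_pos (log_pos (by linarith)) (by norm_num)
  have hlogt : Tendsto (fun n : ℕ => log n) atTop atTop := tendsto_log_atTop.comp tendsto_natCast_atTop_atTop
  have t1 : ∀ᶠ n : ℕ in atTop, 2 / ζ ≤ log n * (exp (-(1 + δ)) / 4) :=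
    (hlogt.atTop_mul_const (by positivity)).eventually_ge_atTop _
  have t2 : ∀ᶠ n : ℕ in atTop, 2 / ζ ≤ (n:ℝ) ^ ((2 - aH H) / 10) * (exp (-δ) / (16 * (HE H).card)) :=
    (((tendsto_rpow_atTop (by linarith : 0 < (2 - aH H) / 10)).comp tendsto_natCast_atTop_atTop).atTop_mul_const
      (by positivity)).eventually_ge_atTop _
  have t3 : Tendsto (fun n : ℕ => 4 * (log n ^ 1 * tht H n)) atTop (𝓝 0) := by
    simpa using (log_pow_mul_tht h3 1).const_mul 4
  filter_upwards [t1, t2, t3.eventually (eventually_le_nhds hδ0), pair_fam hH h3 (2 * cB H) hδ0,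
    up_of hH h3 (2 * cB H), eventually_ge_atTop (ν(α) ^ 2), eventually_ge_atTop 3, log_pow_le (1 / ζ) 1,
    log_pow_le 1 1, (tht_tendsto h3).eventually (eventually_le_nhds (by norm_num : (0:ℝ) < 1 / 2))]
    with n k1 k2 k3 k4 k5 k6 k7 k8 k9 k10 p hp hp1 hL
  have hn0 : (0:ℝ) < n := by exact_mod_cast (by omega : 0 < n)
  have hlog : 0 ≤ log n := log_nonneg (by exact_mod_cast (by omega : 1 ≤ n))
  rw [pow_one] at k8 k9
  by_cases hc : (n:ℝ) ^ 2 * p ≤ log n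
  · refine (bad_copy hp hp1).trans ?_
    have hv : ν(α) ≤ (HE H).card := by have := sb_dense hH h3; have := sb_card hH; omega
    have e0 := cps_count hH n
    have hvv := sb_card hH
    rw [← pow_add, show ν(α) - 2 + 2 = ν(α) by omega] at e0
    have e1 : ((cps H n).card : ℝ) * p ^ (HE H).card ≤ (n * p) ^ (HE H).card := by
      rw [mul_pow]
      refine mul_le_mul_of_nonneg_right (e0.trans ?_) (pow_nonneg hp _)
      exact pow_le_pow_right₀ (by exact_mod_cast (by omega : 1 ≤ n)) hv
    have e2 : n * p ≤ log n / n := by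
      rw [le_div_iff₀ hn0]; linarith
    have e4 : log n / n ≤ 1 := by rw [div_le_one hn0]; linarith
    have e5 : log n / n ≤ ζ := by
      rw [div_le_iff₀ hn0]
      rw [one_div, inv_mul_le_iff₀ hζ] at k8; linarith
    exact e1.trans ((pow_le_of_le_one (by positivity) (e2.trans e4) (by omega)).trans (e2.trans e5))
  push Not at hc
  have hLL : LL H n p ≤ 2 * log n := by nlinarith
  have hlam : lam H n p ≤ 2 * cB H * log n := by
    have := lam_le_LL hH h3 k6 hp
    have := mul_le_mul_of_nonneg_left hLL hcB.le
    linarith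
  have hu := k5 p hp hp1 hlam
  have hp0 : 0 < p := by
    rcases hp.lt_or_eq with h | h
    · exact h
    · rw [← h, mul_zero] at hc; linarith
  have hx : p ^ ((HE H).card - 1) ≤ tht H n := (pow_le_of_le_one hp hp1 (by omega)).trans (p_le_tht hu h3)
  have hLL0 : 0 ≤ LL H n p := by unfold LL; positivity
  set m := p * exp (-(LL H n p + δ)) with hm
  have hm0 : 0 < m := by positivity
  have hmle : ∀ g ∈ EE n, m ≤ pr (EE n) p (Iso H g) := fun g hg => by
    refine le_trans ?_ (iso_prob hg hp hp1 (hx.trans k10))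
    refine mul_le_mul_of_nonneg_left (exp_le_exp.2 ?_) hp
    have := mul_le_mul hLL hx (pow_nonneg hp _) (by linarith)
    rw [pow_one] at k3
    nlinarith
  have hq : ∀ g ∈ EE n, ∀ g' ∈ EE n, g ≠ g' → pr (EE n) p (fun s => Iso H g s ∧ Iso H g' s) ≤
      p ^ 2 * exp (-(2 * LL H n p) + 2 * δ) := fun g hg g' hg' hne => by
    obtain ⟨e1, _, e2⟩ := k4 p hu g hg g' hg' hne
    exact iso_pair hg hg' hne hp hp1 (e1 _ (Finset.Subset.refl _)) e2
  have hEE := EE_card_ge (n := n) (by omega)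
  have hne : (EE n).Nonempty := card_pos.1 (by
    have : (0:ℝ) < (EE n).card := lt_of_lt_of_le (by positivity) hEE
    exact_mod_cast this)
  have hsm := second_moment hp hp1 (EE n) (fun g => Iso H g) hne hm0 hmle (by positivity) hq
  refine (pr_mono hp hp1 fun s _ hs => ?_).trans (hsm.trans ?_)
  · exact fun g _ => cQ_iso hs.1 g
  have hr : p ^ 2 * exp (-(2 * LL H n p) + 2 * δ) / m ^ 2 = 1 + ζ / 2 := by
    rw [hm, mul_pow, ← exp_nat_mul, mul_div_mul_left _ _ (by positivity), ← exp_sub]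
    push_cast
    rw [show -(2 * LL H n p) + 2 * δ - 2 * -(LL H n p + δ) = 4 * δ by ring, hδ, mul_div_cancel₀ _ (by norm_num),
      exp_log (by linarith)]
  have hM : 2 / ζ ≤ (EE n).card * m := by
    have e0 : (n:ℝ) ^ 2 / 4 * m ≤ (EE n).card * m := mul_le_mul_of_nonneg_right hEE hm0.le
    refine le_trans ?_ e0
    by_cases h1 : LL H n p ≤ 1
    · refine k1.trans ?_
      rw [hm]
      have e1 : exp (-(1 + δ)) ≤ exp (-(LL H n p + δ)) := exp_le_exp.2 (by linarith)
      have := mul_le_mul hc.le e1 (exp_pos _).le (by positivity)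
      linarith
    · push Not at h1
      refine k2.trans ?_
      have e1 : (n:ℝ) ^ (-aH H) / (4 * (HE H).card) ≤ p := by
        have he : (HE H).card - 1 ≠ 0 := by omega
        refine le_of_pow_le_pow_left₀ he hp ?_
        rw [div_pow, rpow_aH hH h3]
        have e2 := h1.le.trans (LL_le (H := H) (n := n) hp)
        unfold lam at e2
        have e4 : (4 * (HE H).card : ℝ) ≤ (4 * (HE H).card : ℝ) ^ ((HE H).card - 1) :=
          le_self_pow₀ (by have : (3:ℝ) ≤ (HE H).card := by exact_mod_cast h3
                           linarith) he
        rw [div_le_iff₀ (by positivity), inv_le_iff_one_le_mul₀ (by positivity)]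
        have := mul_le_mul_of_nonneg_left e4 (by positivity : 0 ≤ (n:ℝ) ^ (ν(α) - 2) * p ^ ((HE H).card - 1))
        linarith
      have e2 : (n:ℝ) ^ (-(9 / 10 * (2 - aH H))) * exp (-δ) ≤ exp (-(LL H n p + δ)) := by
        rw [Real.rpow_def_of_pos hn0, ← exp_add, exp_le_exp]; linarith
      have e3 := mul_le_mul e1 e2 (by positivity) hp
      have e4 : (n:ℝ) ^ ((2 - aH H) / 10) = (n:ℝ) ^ 2 * ((n:ℝ) ^ (-aH H) * (n:ℝ) ^ (-(9 / 10 * (2 - aH H)))) := by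
        rw [← rpow_add hn0, ← rpow_two, ← rpow_add hn0]; congr 1; ring
      rw [e4, hm]
      refine le_trans (le_of_eq ?_) (mul_le_mul_of_nonneg_left e3 (by positivity : 0 ≤ (n:ℝ) ^ 2 / 4))
      field_simp; ring
  rw [hr]
  have : 1 / ((EE n).card * m) ≤ ζ / 2 := by
    rw [one_div, ← inv_div]
    exact inv_anti₀ (by positivity) hM
  linarith

/-! ### The dense range -/
/-- Every pair can be completed to a copy by edges of `s`. -/
def Br (H : SimpleGraph α) {n : ℕ} (s : ES(n)) : Prop :=
  ∀ a ∈ EE n, ∃ K ∈ cps H n, a ∈ K ∧ K \ {a} ⊆ s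

lemma sum_tf_cps {c : Fin n → ZMod 2} {b : ZMod 2} (h : Triv H c b) {K : ES(n)}
    (hK : K ∈ cps H n) : ∑ g ∈ K, tf c b g = 0 := by
  obtain ⟨ψ, rfl⟩ := mem_cps.1 hK
  have := triv_even h ψ
  unfold im
  rw [sum_map]
  exact this

lemma br_ext {s₀ s : ES(n)} (h0 : s₀ ⊆ s) (hs : s ⊆ EE n) (hb : Br H s₀)
    (hT : cT H s₀) : cT H s := by
  intro F hF
  obtain ⟨c, b, ht, h⟩ := hT F fun K hK hKs => hF K hK (hKs.trans h0)
  refine ⟨c, b, ht, fun g hg => ?_⟩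
  obtain ⟨K, hK, hgK, hKs⟩ := hb g (hs hg)
  have hsub : K ⊆ s := fun k hk => by
    by_cases hkg : k = g
    · rwa [hkg]
    · exact h0 (hKs (Finset.mem_sdiff.2 ⟨hk, by simpa using hkg⟩))
  have e1 := hF K hK hsub
  have e2 := sum_tf_cps ht hK
  rw [← sum_sdiff (singleton_subset_iff.2 hgK), sum_singleton] at e1 e2
  rw [sum_congr rfl fun k hk => h k (hKs hk)] at e1
  exact add_left_cancel (e1.trans e2.symm)

lemma LL_mul (q : ℝ) : LL H n (p * q) = LL H n p * q ^ ((HE H).card - 1) := by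
  unfold LL; rw [mul_pow]; ring

lemma no_bridge (hH : Strictly2Balanced H) (h3 : 3 ≤ (HE H).card) (C : ℝ) :
    ∀ᶠ n : ℕ in atTop, ∀ p, Up H C n p → ∀ a ∈ EE n,
      pr (EE n) p (fun s => ∀ K ∈ cps H n, a ∈ K → ¬ K \ {a} ⊆ s) ≤ exp (2 - LL H n p) := by
  filter_upwards [pair_fam hH h3 C one_pos, eventually_ge_atTop 3] with n hpf hn p hU a ha
  have hp0 := hU.p0
  have hp01 := hU.p1
  have hnr : (3:ℝ) ≤ n := by exact_mod_cast hn
  obtain ⟨b, hb, hab⟩ : ∃ b ∈ EE n, a ≠ b := by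
    have : 1 < (EE n).card := by
      have := EE_card_ge (n := n) (by omega)
      have h4 : (1:ℝ) < (EE n).card := by nlinarith
      exact_mod_cast h4
    obtain ⟨b, hb, h⟩ := exists_mem_ne this a
    exact ⟨b, hb, h.symm⟩
  obtain ⟨j1, j2, _⟩ := hpf _ hU a ha b hb hab
  have hsub : PF1 H a b ⊆ PF H a b := fun K hK => by
    rw [PF_eq]; exact mem_union_left _ hK
  have hj := janson_zero (E := EE n) hp0 hp01 (PF1 H a b) (fun K => K \ {a, b})
    (fun K hK => (sdiff_subset).trans (cps_subset_EE (mem_PF1.1 hK).1))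
  refine (pr_mono hp0 hp01 fun s _ h => ?_).trans (hj.trans ?_)
  · intro K hK hKs
    obtain ⟨k1, k2, k3⟩ := mem_PF1.1 hK
    refine h K k1 k2 fun k hk => hKs ?_
    simp only [Finset.mem_sdiff, mem_singleton, mem_insert] at hk ⊢
    refine ⟨hk.1, fun h => h.elim hk.2 fun h => k3 (h ▸ hk.1)⟩
  · rw [sum_congr rfl fun K hK => by rw [PF_card a b (hsub hK)], sum_const, nsmul_eq_mul,
      exp_le_exp]
    have := j1 _ hsub
    linarith

lemma rangeC (hH : Strictly2Balanced H) (h3 : 3 ≤ (HE H).card)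
    (hw : ∀ ζ : ℝ, 0 < ζ → ∀ᶠ n : ℕ in atTop, ∀ p, 0 ≤ p → p ≤ 1 →
      9 / 10 * ((2 - aH H) * log n) ≤ LL H n p → LL H n p ≤ 3 * log n →
      pr (EE n) p (fun s => cQ H s ∧ ¬ cT H s) ≤ ζ) {ζ : ℝ} (hζ : 0 < ζ) :
    ∀ᶠ n : ℕ in atTop, ∀ p, 0 ≤ p → p ≤ 1 → 3 * log n ≤ LL H n p →
      pr (EE n) p (fun s => cQ H s ∧ ¬ cT H s) ≤ ζ := by
  have ha0 : 0 ≤ aH H := by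
    unfold aH
    have h1 := sb_card hH
    have : (3:ℝ) ≤ ν(α) := by exact_mod_cast h1
    have : (3:ℝ) ≤ (HE H).card := by exact_mod_cast h3
    apply div_nonneg <;> linarith
  have t1 : Tendsto (fun n : ℕ => exp 2 * (1 / (n:ℝ))) atTop (𝓝 0) := by
    simpa using (tendsto_one_div_atTop_nhds_zero_nat).const_mul (exp 2)
  filter_upwards [hw (ζ / 2) (by positivity), up_of hH h3 (cB H * 3),
    no_bridge hH h3 (cB H * 3), t1.eventually (eventually_le_nhds (half_pos hζ)),
    eventually_ge_atTop 3, eventually_ge_atTop (ν(α) ^ 2)] with n hw hup hnb ht hn hn2 p hp hp1 hL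
  have hnr : (3:ℝ) ≤ n := by exact_mod_cast hn
  have hlog : 0 < log n := log_pos (by linarith)
  set m := (HE H).card - 1 with hm
  have hLpos : 0 < LL H n p := by linarith
  set q : ℝ := (3 * log n / LL H n p) ^ ((m:ℝ)⁻¹) with hq
  have hr0 : 0 ≤ 3 * log n / LL H n p := by positivity
  have hr1 : 3 * log n / LL H n p ≤ 1 := (div_le_one hLpos).2 hL
  have hq0 : 0 ≤ q := Real.rpow_nonneg hr0 _
  have hq1 : q ≤ 1 := Real.rpow_le_one hr0 hr1 (by positivity)
  have hqm : q ^ m = 3 * log n / LL H n p := Real.rpow_inv_natCast_pow hr0 (by omega)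
  have hL0 : LL H n (p * q) = 3 * log n := by
    rw [LL_mul, ← hm, hqm]; field_simp
  have hp0 : 0 ≤ p * q := mul_nonneg hp hq0
  have hp01 : p * q ≤ 1 := mul_le_one₀ hp1 hq0 hq1
  have hU : Up H (cB H * 3) n (p * q) := by
    refine hup _ hp0 hp01 ((lam_le_LL hH h3 hn2 hp0).trans (le_of_eq ?_))
    rw [hL0]; ring
  have key : pr (EE n) p (fun s => cQ H s ∧ ¬ cT H s) ≤
      pr (EE n) (p * q) (fun s => ¬ Br H s ∨ (cQ H s ∧ ¬ cT H s)) := by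
    unfold pr
    rw [← thinning]
    refine ex_mono hp hp1 fun s hs => ?_
    by_cases hb : cQ H s ∧ ¬ cT H s
    · rw [ex_congr (g := fun _ => 1), ex_const]
      · exact ind_le_one _
      · intro s0 h0
        refine ind_true ?_
        by_contra hc
        push Not at hc
        obtain ⟨h1, h2⟩ := hc
        refine hb.2 (br_ext h0 hs h1 (h2 fun g hg => ?_))
        obtain ⟨K, hK, hgK, hKs⟩ := h1 g (hs (h0 hg))
        refine ⟨K, hK, hgK, fun k hk => ?_⟩
        by_cases hkg : k = g
        · rwa [hkg]
        · exact hKs (Finset.mem_sdiff.2 ⟨hk, by simpa using hkg⟩)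
    · rw [ind_false hb]
      exact ex_nonneg hq0 hq1 fun _ _ => ind_nonneg _
  refine key.trans ((pr_or hp0 hp01 _ _).trans ?_)
  have h2 := hw (p * q) hp0 hp01 (by rw [hL0]; nlinarith) hL0.le
  have h1 : pr (EE n) (p * q) (fun s => ¬ Br H s) ≤ ζ / 2 := by
    refine le_trans ?_ ht
    refine (pr_mono hp0 hp01 (Q := fun s => ∃ a ∈ EE n, ∀ K ∈ cps H n, a ∈ K → ¬ K \ {a} ⊆ s)
      fun s _ h => ?_).trans ((pr_exists hp0 hp01 _ _).trans ?_)
    · unfold Br at h; push Not at h; exact h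
    · refine (sum_le_card_nsmul _ _ (exp 2 * ((n:ℝ) ^ 3)⁻¹) fun a ha => ?_).trans ?_
      · refine (hnb _ hU a ha).trans (le_of_eq ?_)
        rw [hL0, exp_sub, div_eq_mul_inv]
        congr 2
        rw [show 3 * log n = log n * (3:ℕ) by push_cast; ring, Real.exp_mul, exp_log (by linarith)]
        norm_cast
      · rw [nsmul_eq_mul]
        have := EE_card_le (n := n)
        calc _ ≤ (n:ℝ) ^ 2 * (exp 2 * ((n:ℝ) ^ 3)⁻¹) := by gcongr
          _ = _ := by field_simp
  linarith
end

/-! ### The deterministic contradiction for small exceptional sets -/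
section
variable [Fintype α] {H : SimpleGraph α} {n : ℕ} {p C : ℝ} {s F : ES(n)}

lemma relD_of {g g' : E2(n)} (hg : g ∈ EE n) (hg' : g' ∈ EE n) (h : ∀ x ∈ g, x ∉ g') :
    relD {g, g'} := by
  have c1 := Sym2.card_toFinset_of_not_isDiag g (mem_EE.1 hg)
  have c2 := Sym2.card_toFinset_of_not_isDiag g' (mem_EE.1 hg')
  have hd : Disjoint g.toFinset g'.toFinset := Finset.disjoint_left.2 fun x hx hx' =>
    h x (Sym2.mem_toFinset.1 hx) (Sym2.mem_toFinset.1 hx')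
  have hs : g.toFinset ∪ g'.toFinset ⊆ VU {g, g'} := by
    intro x hx
    rw [mem_VU]
    rcases mem_union.1 hx with hx | hx
    · exact ⟨g, by simp, Sym2.mem_toFinset.1 hx⟩
    · exact ⟨g', by simp, Sym2.mem_toFinset.1 hx⟩
  have := card_le_card hs
  rw [card_union_of_disjoint hd, c1, c2] at this
  exact this

lemma pairK_of {rel : ES(n) → Prop} {K : ES(n)} (hK : K ∈ cps H n) (hKs : K ⊆ s)
    {g g' : E2(n)} (hne : g ≠ g') (hg : g ∈ K) (hg' : g' ∈ K) (hF : g ∈ F) (hF' : g' ∈ F)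
    (hr : rel {g, g'}) : K ∈ pairK H rel s F := by
  refine mem_pairK.2 ⟨hK, hKs, {g, g'}, ?_, ?_, card_pair hne, hr⟩ <;>
  · intro k hk
    rcases mem_insert.1 hk with rfl | hk
    · assumption
    · rw [mem_singleton] at hk; rwa [hk]

lemma sum_star_le (F : ES(n)) : ∑ x, (star F x).card ≤ 2 * F.card := by
  unfold star
  have h2 := sum_card_bipartiteAbove_eq_sum_card_bipartiteBelow (s := univ) (t := F) (fun (x : Fin n) g => x ∈ g)
  unfold bipartiteAbove at h2
  refine le_trans (le_of_eq (Eq.trans (sum_congr rfl fun _ _ => by congr) h2)) ?_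
  refine (sum_le_card_nsmul _ _ 2 fun g _ => ?_).trans (by rw [smul_eq_mul, mul_comm])
  induction g with
  | _ a b =>
    refine (card_le_card (t := {a, b}) fun x hx => ?_).trans card_le_two
    have : x ∈ s(a, b) := (mem_filter.1 hx).2
    rw [Sym2.mem_iff] at this
    simpa using this

lemma other_edge {K : ES(n)} (hev : Even (K ∩ F).card) {g : E2(n)} (hg : g ∈ K ∩ F) :
    ∃ g' ∈ K ∩ F, g' ≠ g := by
  refine exists_mem_ne ?_ g
  have := card_pos.2 ⟨g, hg⟩
  obtain ⟨k, hk⟩ := hev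
  omega

lemma high_edges (hQ : cQ H s) (hlow : LowB H p s) (hF : F ⊆ s)
    (hev : ∀ K ∈ cps H n, K ⊆ s → Even (K ∩ F).card) :
    F.card ≤ 2 * (F.filter fun g => LL H n p / 100 < (cpe H s g).card).card := by
  have hex : ∀ g ∈ F.filter (fun g => ¬ LL H n p / 100 < (cpe H s g).card),
      ∃ g', ∃ K ∈ cps H n, K ⊆ s ∧ g ∈ K ∧ g' ∈ K ∧ g' ∈ F.filter fun g => LL H n p / 100 < (cpe H s g).card := by
    intro g hg
    rw [mem_filter] at hg
    obtain ⟨K, hK, hgK, hKs⟩ := hQ g (hF hg.1)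
    obtain ⟨g', hg', hne⟩ := other_edge (hev K hK hKs) (mem_inter.2 ⟨hgK, hg.1⟩)
    rw [mem_inter] at hg'
    refine ⟨g', K, hK, hKs, hgK, hg'.1, mem_filter.2 ⟨hg'.2, ?_⟩⟩
    exact (hlow K hK K hK hKs hKs ⟨g, by simpa using hgK⟩ g hgK g' hg'.1 hne.symm).resolve_left hg.2
  choose! f K hK using hex
  have := card_le_card_of_injOn (s := F.filter (fun g => ¬ LL H n p / 100 < (cpe H s g).card)) f
    (fun g hg => (hK g hg).2.2.2.2) (by
      intro g hg g' hg' he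
      by_contra hne
      have a := hK g hg
      have b := hK g' hg'
      have := hlow _ a.1 _ b.1 a.2.1 b.2.1 ⟨f g, mem_inter.2 ⟨he ▸ b.2.2.2.1, a.2.2.2.1⟩⟩ g a.2.2.1 g' b.2.2.1 hne
      exact this.elim (mem_filter.1 hg).2 (mem_filter.1 hg').2)
  have h2 := card_filter_add_card_filter_not (s := F) (fun g => LL H n p / 100 < (cpe H s g).card)
  omega

/-- Copies inside `s` meeting `F`. -/
def mt (H : SimpleGraph α) {n : ℕ} (s F : ES(n)) : Finset (ES(n)) :=
  (cps H n).filter fun K => K ⊆ s ∧ (K ∩ F).Nonempty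

lemma mem_mt {K : ES(n)} : K ∈ mt H s F ↔ K ∈ cps H n ∧ K ⊆ s ∧ (K ∩ F).Nonempty := by
  unfold mt; exact mem_filter

lemma mem_cpe {K : ES(n)} {g : E2(n)} : K ∈ cpe H s g ↔ K ∈ cps H n ∧ g ∈ K ∧ K ⊆ s := by
  unfold cpe; exact mem_filter

lemma sum_cpe_le : ∑ g ∈ F, (cpe H s g).card ≤ (HE H).card * (mt H s F).card := by
  have : ∀ g ∈ F, (cpe H s g).card = ((mt H s F).filter fun K => g ∈ K).card := by
    intro g hg
    congr 1
    ext K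
    rw [mem_cpe, mem_filter, mem_mt]
    constructor
    · rintro ⟨h1, h2, h3⟩; exact ⟨⟨h1, h3, g, mem_inter.2 ⟨h2, hg⟩⟩, h2⟩
    · rintro ⟨⟨h1, h3, -⟩, h2⟩; exact ⟨h1, h2, h3⟩
  rw [sum_congr rfl this]
  have h2 := sum_card_bipartiteAbove_eq_sum_card_bipartiteBelow (s := F) (t := mt H s F) (fun g K => g ∈ K)
  unfold bipartiteAbove at h2
  rw [h2]
  refine (sum_le_card_nsmul _ _ (HE H).card fun K hK => ?_).trans (by rw [smul_eq_mul, mul_comm])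
  rw [← cps_card (mem_mt.1 hK).1]
  exact card_le_card fun g hg => (mem_filter.1 hg).2

lemma U1.mt_le {Cu : ℝ} (hU : U1 H Cu p s) (F : ES(n)) :
    ((mt H s F).card : ℝ) ≤ Cu * lam H n p * F.card := by
  have : mt H s F ⊆ F.biUnion fun g => cpe H s g := fun K hK => by
    obtain ⟨h1, h2, g, hg⟩ := mem_mt.1 hK
    rw [mem_inter] at hg
    exact mem_biUnion.2 ⟨g, hg.2, mem_cpe.2 ⟨h1, hg.1, h2⟩⟩
  have h2 := (card_le_card this).trans card_biUnion_le
  calc ((mt H s F).card : ℝ) ≤ ∑ g ∈ F, ((cpe H s g).card : ℝ) := by exact_mod_cast h2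
    _ ≤ F.card • (Cu * lam H n p) := sum_le_card_nsmul _ _ _ fun g _ => hU g
    _ = _ := by rw [nsmul_eq_mul]; ring

lemma LA.sum_le {η κ : ℝ} (hη : 0 ≤ η * lam H n p) (hL : LA H η κ p s) (hF : F ⊆ s) (Y : Finset (Fin n))
    (hY : ∀ y ∈ Y, ((star F y).card : ℝ) ≤ κ * (n * p)) :
    ((Y.biUnion fun y => pairK H (fun _ => True) s (star F y)).card : ℝ) ≤ η * lam H n p * (2 * F.card) := by
  calc _ ≤ ∑ y ∈ Y, ((pairK H (fun _ => True) s (star F y)).card : ℝ) := by exact_mod_cast card_biUnion_le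
    _ ≤ ∑ y ∈ Y, η * lam H n p * (star F y).card := sum_le_sum fun y hy =>
        hL y _ (fun g hg => hF (mem_star.1 hg).1) (fun g hg => (mem_star.1 hg).2) (hY y hy)
    _ ≤ ∑ y, η * lam H n p * (star F y).card := sum_le_sum_of_subset_of_nonneg (subset_univ _)
        fun y _ _ => by positivity
    _ = η * lam H n p * ∑ y, ((star F y).card : ℝ) := by rw [mul_sum]
    _ ≤ _ := by
      gcongr
      exact_mod_cast sum_star_le F

/-- Vertices of large degree. -/
def big {n : ℕ} (F : ES(n)) (t : ℝ) : Finset (Fin n) := univ.filter fun x => t < (star F x).card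

lemma mem_big {x : Fin n} {t : ℝ} : x ∈ big F t ↔ t < (star F x).card := by
  simp [big]

lemma big_card (t : ℝ) : t * (big F t).card ≤ 2 * F.card := by
  have h1 : ∑ x ∈ big F t, t ≤ ∑ x ∈ big F t, ((star F x).card : ℝ) :=
    sum_le_sum fun x hx => (mem_big.1 hx).le
  have h2 : ∑ x ∈ big F t, ((star F x).card : ℝ) ≤ ∑ x, ((star F x).card : ℝ) :=
    sum_le_sum_of_subset_of_nonneg (subset_univ _) fun y _ _ => by positivity
  have h3 : ∑ x, ((star F x).card : ℝ) ≤ 2 * F.card := by exact_mod_cast sum_star_le F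
  rw [sum_const, nsmul_eq_mul] at h1
  linarith

/-- The deterministic finish. -/
lemma finish (hn : ν(α) ^ 2 ≤ n) (hH : Strictly2Balanced H) (h3 : 3 ≤ (HE H).card) (hw : Win H C n p)
    {Cu η₁ ε η κ c η' κ' η'' ε'' : ℝ} (hCu : 1 ≤ Cu) (hη : 0 < η) (hη1 : 0 < η₁) (hη' : 0 < η') (hη'' : 0 < η'')
    (hκ' : 0 < κ') (hκκ : κ' ≤ κ) (hc : 0 < c)
    (c1 : η₁ + 2 * η ≤ 1 / (400 * (HE H).card * cB H))
    (c2 : (η₁ + 2 * η' + Cu * (η'' * (2 / κ'))) * (8 * Cu * (HE H).card / c) < 1 / (400 * (HE H).card * cB H))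
    (c3 : 2 * ε ≤ κ' * ε'')
    (hs : s ⊆ EE n) (hQ : cQ H s) (hlow : LowB H p s) (hU : U1 H Cu p s) (hD : DegB p s)
    (hLD : LD H η₁ ε p s) (hLA : LA H η κ p s) (hS : Star H κ c p s) (hLA' : LA H η' κ' p s)
    (hDen : DenB η'' ε'' p s) (hF : F ⊆ s) (hne : F.Nonempty) (hFc : (F.card : ℝ) ≤ ε * ((n:ℝ) ^ 2 * p))
    (hev : ∀ K ∈ cps H n, K ⊆ s → Even (K ∩ F).card)
    (hmin : IsEulerianGraph H → ∀ x, (star F x).card ≤ (star s x \ star F x).card) : False := by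
  have hFpos : (0:ℝ) < F.card := by exact_mod_cast card_pos.2 hne
  have hlam : 0 < lam H n p := by linarith [hw.lam1]
  have hnr : (3:ℝ) ≤ n := by exact_mod_cast hw.hn
  have hppos := hw.p_pos hH
  have hnp : 0 < n * p := by positivity
  have he : (0:ℝ) < (HE H).card := by exact_mod_cast (by omega : 0 < (HE H).card)
  have hcB := cB_pos h3
  set L := lam H n p with hLdef
  set f : ℝ := (F.card : ℝ) with hf
  -- many copies meet `F`
  have b1 : L * f ≤ 200 * (HE H).card * cB H * (mt H s F).card := by
    have h1 := high_edges hQ hlow hF hev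
    have h2 : (LL H n p / 100) * (F.filter fun g => LL H n p / 100 < (cpe H s g).card).card ≤
        ∑ g ∈ F, ((cpe H s g).card : ℝ) := by
      rw [mul_comm, ← nsmul_eq_mul]
      refine (card_nsmul_le_sum _ _ _ fun g hg => (mem_filter.1 hg).2.le).trans
        (sum_le_sum_of_subset_of_nonneg (filter_subset _ _) fun _ _ _ => by positivity)
    have h4 : ∑ g ∈ F, ((cpe H s g).card : ℝ) ≤ (HE H).card * (mt H s F).card := by exact_mod_cast sum_cpe_le
    have h5 : f ≤ 2 * (F.filter fun g => LL H n p / 100 < (cpe H s g).card).card   := by rw [hf]; exact_mod_cast h1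
    have h6 := lam_le_LL hH h3 hn hppos.le
    have h7 : 0 ≤ LL H n p := by
      by_contra hc; push Not at hc; nlinarith
    calc L * f ≤ (cB H * LL H n p) * (2 * (F.filter fun g => LL H n p / 100 < (cpe H s g).card).card) := by gcongr
      _ = 200 * cB H * ((LL H n p / 100) * (F.filter fun g => LL H n p / 100 < (cpe H s g).card).card) := by ring
      _ ≤ 200 * cB H * ((HE H).card * (mt H s F).card) :=
        mul_le_mul_of_nonneg_left (h2.trans h4) (by positivity)
      _ = _ := by ring
  set X := big F (κ * (n * p)) with hX
  set X' := big F (κ' * (n * p)) with hX'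
  have hXX : X ⊆ X' := fun x hx => mem_big.2 (lt_of_le_of_lt (by gcongr) (mem_big.1 hx))
  have hLDF := hLD F hF hFc
  -- the first upper bound
  have b2 : ((mt H s F).card : ℝ) ≤ η₁ * L * f + η * L * (2 * f) + 4 * Cu * L * (n * p) * X.card := by
    have hsub : mt H s F ⊆ (pairK H relD s F ∪ (Xᶜ).biUnion fun y => pairK H (fun _ => True) s (star F y)) ∪
        X.biUnion fun y => mt H s (star F y) := by
      intro K hK
      obtain ⟨h1, h2, g, hg⟩ := mem_mt.1 hK
      obtain ⟨g', hg', hne⟩ := other_edge (hev K h1 h2) hg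
      rw [mem_inter] at hg hg'
      by_cases hd : ∀ x ∈ g, x ∉ g'
      · exact mem_union_left _ (mem_union_left _
          (pairK_of h1 h2 hne.symm hg.1 hg'.1 hg.2 hg'.2 (relD_of (hs (hF hg.2)) (hs (hF hg'.2)) hd)))
      · push Not at hd
        obtain ⟨x, hx, hx'⟩ := hd
        by_cases hxX : x ∈ X
        · exact mem_union_right _ (mem_biUnion.2 ⟨x, hxX, mem_mt.2 ⟨h1, h2, g,
            mem_inter.2 ⟨hg.1, mem_star.2 ⟨hg.2, hx⟩⟩⟩⟩)
        · exact mem_union_left _ (mem_union_right _ (mem_biUnion.2 ⟨x, mem_compl.2 hxX,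
            pairK_of h1 h2 hne.symm hg.1 hg'.1 (mem_star.2 ⟨hg.2, hx⟩) (mem_star.2 ⟨hg'.2, hx'⟩) trivial⟩))
    have h1 := (card_le_card hsub).trans ((card_union_le _ _).trans
      (add_le_add_left (card_union_le _ _) _))
    have h1' : ((mt H s F).card : ℝ) ≤ (pairK H relD s F).card +
      ((Xᶜ).biUnion fun y => pairK H (fun _ => True) s (star F y)).card +
        (X.biUnion fun y => mt H s (star F y)).card := by exact_mod_cast h1
    have h2 := hLA.sum_le (by positivity) hF Xᶜ fun y hy => by
      rw [mem_compl, mem_big] at hy; exact not_lt.1 hy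
    have h4 : ((X.biUnion fun y => mt H s (star F y)).card : ℝ) ≤ 4 * Cu * L * (n * p) * X.card := by
      calc _ ≤ ∑ y ∈ X, ((mt H s (star F y)).card : ℝ) := by exact_mod_cast card_biUnion_le
        _ ≤ X.card • (4 * Cu * L * (n * p)) := by
          refine sum_le_card_nsmul _ _ _ fun y _ => (hU.mt_le _).trans ?_
          have h5 : ((star F y).card : ℝ) ≤ 4 * (n * p) := by
            refine le_trans ?_ (hD y)
            exact_mod_cast card_le_card (filter_subset_filter _ hF)
          calc Cu * lam H n p * (star F y).card ≤ Cu * lam H n p * (4 * (n * p)) := by gcongr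
            _ = _ := by rw [← hLdef]; ring
        _ = _ := by rw [nsmul_eq_mul]; ring
    linarith
  -- the odd copies
  set D := fun x => (cps H n).filter fun K => K ⊆ s ∧ Odd (K ∩ star F x).card with hDdef
  have memD : ∀ x K, K ∈ D x ↔ K ∈ cps H n ∧ K ⊆ s ∧ Odd (K ∩ star F x).card := fun x K => mem_filter
  have b3 : c * (L * (n * p)) * X.card ≤ 2 * (HE H).card * (X.biUnion D).card := by
    have h1 : ∑ x ∈ X, (D x).card ≤ 2 * (HE H).card * (X.biUnion D).card := by
      have : ∀ x ∈ X, (D x).card ≤ ((X.biUnion D).filter fun K => x ∈ VU K).card := by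
        intro x hx
        refine card_le_card fun K hK => mem_filter.2 ⟨mem_biUnion.2 ⟨x, hx, hK⟩, ?_⟩
        obtain ⟨g, hg⟩ := card_pos.1 ((memD x K).1 hK).2.2.pos
        rw [mem_inter, mem_star] at hg
        exact mem_VU.2 ⟨g, hg.1, hg.2.2⟩
      refine (sum_le_sum this).trans ?_
      have h2 := sum_card_bipartiteAbove_eq_sum_card_bipartiteBelow (s := X) (t := X.biUnion D) (fun x K => x ∈ VU K)
      unfold bipartiteAbove at h2
      rw [h2]
      refine (sum_le_card_nsmul _ _ (2 * (HE H).card) fun K hK => ?_).trans (by rw [smul_eq_mul, mul_comm])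
      obtain ⟨x, -, hx⟩ := mem_biUnion.1 hK
      rw [← cps_card ((memD x K).1 hx).1]
      exact (card_le_card fun y hy => (mem_filter.1 hy).2).trans (VU_card K)
    have h2 : X.card • (c * (L * (n * p))) ≤ ∑ x ∈ X, ((D x).card : ℝ) := by
      refine card_nsmul_le_sum _ _ _ fun x hx => ?_
      have hx' := (mem_big.1 hx).le
      refine hS x (star F x) (filter_subset_filter _ hF) hx' fun hE => hx'.trans ?_
      exact_mod_cast hmin hE x
    rw [nsmul_eq_mul] at h2
    have h4 : ∑ x ∈ X, ((D x).card : ℝ) ≤ 2 * (HE H).card * (X.biUnion D).card := by exact_mod_cast h1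
    linarith
  have b4 : ((X.biUnion D).card : ℝ) ≤ η₁ * L * f + η' * L * (2 * f) + Cu * L * (ins s X').card := by
    have hsub : X.biUnion D ⊆ (pairK H relD s F ∪ (X'ᶜ).biUnion fun y => pairK H (fun _ => True) s (star F y)) ∪
        mt H s (ins s X') := by
      intro K hK
      obtain ⟨x, hxX, hxK⟩ := mem_biUnion.1 hK
      obtain ⟨h1, h2, hodd⟩ := (memD x K).1 hxK
      obtain ⟨g', hg'⟩ := card_pos.1 hodd.pos
      rw [mem_inter, mem_star] at hg'
      obtain ⟨g, hg, hxg⟩ : ∃ g ∈ K ∩ F, x ∉ g := by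
        by_contra hc
        push Not at hc
        have : K ∩ star F x = K ∩ F := by
          ext g
          simp only [mem_inter, mem_star]
          exact ⟨fun h => ⟨h.1, h.2.1⟩, fun h => ⟨h.1, h.2, hc g (mem_inter.2 h)⟩⟩
        rw [this] at hodd
        exact (Nat.not_odd_iff_even.2 (hev K h1 h2)) hodd
      rw [mem_inter] at hg
      have hgg : g ≠ g' := fun h => hxg (h ▸ hg'.2.2)
      by_cases hd : ∀ x ∈ g, x ∉ g'
      · exact mem_union_left _ (mem_union_left _
          (pairK_of h1 h2 hgg hg.1 hg'.1 hg.2 hg'.2.1 (relD_of (hs (hF hg.2)) (hs (hF hg'.2.1)) hd)))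
      · push Not at hd
        obtain ⟨y, hy, hy'⟩ := hd
        have hxy : x ≠ y := fun h => hxg (h ▸ hy)
        by_cases hyX : y ∈ X'
        · refine mem_union_right _ (mem_mt.2 ⟨h1, h2, g', mem_inter.2 ⟨hg'.1, mem_ins.2 ⟨hF hg'.2.1, ?_⟩⟩⟩)
          have hgxy : g' = s(x, y) := (Sym2.mem_and_mem_iff hxy).1 ⟨hg'.2.2, hy'⟩
          intro z hz
          rw [hgxy, Sym2.mem_iff] at hz
          rcases hz with rfl | rfl
          · exact hXX hxX
          · exact hyX
        · exact mem_union_left _ (mem_union_right _ (mem_biUnion.2 ⟨y, mem_compl.2 hyX,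
            pairK_of h1 h2 hgg hg.1 hg'.1 (mem_star.2 ⟨hg.2, hy⟩) (mem_star.2 ⟨hg'.2.1, hy'⟩) trivial⟩))
    have h1 := (card_le_card hsub).trans ((card_union_le _ _).trans
      (add_le_add_left (card_union_le _ _) _))
    have h1' : ((X.biUnion D).card : ℝ) ≤ (pairK H relD s F).card +
      ((X'ᶜ).biUnion fun y => pairK H (fun _ => True) s (star F y)).card +
        (mt H s (ins s X')).card := by exact_mod_cast h1
    have h2 := hLA'.sum_le (by positivity) hF X'ᶜ fun y hy => by
      rw [mem_compl, mem_big] at hy; exact not_lt.1 hy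
    have h4 := hU.mt_le (ins s X')
    rw [← hLdef] at h4
    linarith
  have b5 : ((ins s X').card : ℝ) ≤ η'' * (2 / κ') * f := by
    have h1 := big_card (F := F) (κ' * (n * p))
    rw [← hX', ← hf] at h1
    have h2 : (X'.card : ℝ) ≤ ε'' * n := by
      have : κ' * (n * p) * X'.card ≤ κ' * (n * p) * (ε'' * n) := by
        calc _ ≤ 2 * f := h1
          _ ≤ 2 * (ε * ((n:ℝ) ^ 2 * p)) := by gcongr
          _ = (2 * ε) * ((n:ℝ) ^ 2 * p) := by ring
          _ ≤ (κ' * ε'') * ((n:ℝ) ^ 2 * p) := by gcongr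
          _ = _ := by ring
      exact le_of_mul_le_mul_left this (by positivity)
    refine (hDen X' h2).trans ?_
    calc η'' * (n * p) * X'.card = η'' / κ' * (κ' * (n * p) * X'.card) := by field_simp
      _ ≤ η'' / κ' * (2 * f) := by gcongr
      _ = _ := by ring
  -- conclusion
  set A : ℝ := η₁ + 2 * η' + Cu * (η'' * (2 / κ')) with hA
  have b6 : ((X.biUnion D).card : ℝ) ≤ A * (L * f) := by
    have : Cu * L * (ins s X').card ≤ Cu * L * (η'' * (2 / κ') * f) := by gcongr
    calc _ ≤ _ := b4
      _ ≤ η₁ * L * f + η' * L * (2 * f) + Cu * L * (η'' * (2 / κ') * f) := by linarith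
      _ = _ := by rw [hA]; ring
  have b7 : L * (n * p) * X.card ≤ (2 * (HE H).card / c) * (A * (L * f)) := by
    rw [div_mul_eq_mul_div, le_div_iff₀ hc]
    calc _ = c * (L * (n * p)) * X.card := by ring
      _ ≤ _ := b3
      _ ≤ _ := by gcongr
  set q : ℝ := 1 / (400 * (HE H).card * cB H) with hq
  have hLf : 0 < L * f := by positivity
  have b8 : 2 * q * (L * f) ≤ (mt H s F).card := by
    rw [hq]
    have : 2 * (1 / (400 * (HE H).card * cB H)) = 1 / (200 * (HE H).card * cB H) := by field_simp; norm_num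
    rw [this, div_mul_eq_mul_div, one_mul, div_le_iff₀ (by positivity)]
    linarith
  have b9 : 4 * Cu * L * (n * p) * X.card ≤ (A * (8 * Cu * (HE H).card / c)) * (L * f) := by
    calc _ = 4 * Cu * (L * (n * p) * X.card) := by ring
      _ ≤ 4 * Cu * ((2 * (HE H).card / c) * (A * (L * f))) := by gcongr
      _ = _ := by ring
  have b10 : (A * (8 * Cu * (HE H).card / c)) * (L * f) < q * (L * f) := mul_lt_mul_of_pos_right c2 hLf
  have b11 : (η₁ + 2 * η) * (L * f) ≤ q * (L * f) := mul_le_mul_of_nonneg_right c1 hLf.le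
  nlinarith
end

/-! ### Dense stability -/
section
variable [Fintype α] {H : SimpleGraph α} {n : ℕ} {p C : ℝ}

/-- The embeddings on which `φ` is odd. -/
def oddE (H : SimpleGraph α) (φ : E2(n) → ZMod 2) : Finset (α ↪ Fin n) :=
  univ.filter fun ψ => ∑ f ∈ HE H, φ (Sym2.map ψ f) ≠ 0

/-- Maps seeing an odd embedding. -/
def badM (H : SimpleGraph α) {W : Type*} (φ : E2(n) → ZMod 2) (θ : W → Fin n) : Prop :=
  ∃ χ : α ↪ W, ∃ ψ ∈ oddE H φ, ⇑ψ = θ ∘ χ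

/-- The bad maps. -/
def badS (H : SimpleGraph α) (W : Type*) [Fintype W] (φ : E2(n) → ZMod 2) : Finset (W → Fin n) :=
  univ.filter fun θ => badM H φ θ

lemma mem_badS {W : Type*} [Fintype W] {φ : E2(n) → ZMod 2} {θ : W → Fin n} :
    θ ∈ badS H W φ ↔ badM H φ θ := by
  unfold badS; simp

lemma badM_count {W : Type*} [Fintype W] (φ : E2(n) → ZMod 2) :
    (badS H W φ).card ≤ Fintype.card (α ↪ W) * ((oddE H φ).card * n ^ (Fintype.card W - ν(α))) := by
  have h1 : badS H W φ ⊆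
      (univ : Finset (α ↪ W)).biUnion fun χ => univ.filter fun θ : W → Fin n => ∃ ψ ∈ oddE H φ, ⇑ψ = θ ∘ χ := by
    intro θ hθ
    obtain ⟨χ, hχ⟩ := (mem_filter.1 hθ).2
    exact mem_biUnion.2 ⟨χ, mem_univ _, mem_filter.2 ⟨mem_univ _, hχ⟩⟩
  refine (card_le_card h1).trans (card_biUnion_le.trans ?_)
  refine (sum_le_card_nsmul _ _ _ fun χ _ => ?_).trans (by rw [smul_eq_mul, card_univ])
  have h2 : Fintype.card {w // w ∈ (Set.range χ)ᶜ} = Fintype.card W - ν(α) := by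
    rw [Fintype.card_compl_set, Set.card_range_of_injective χ.injective]
  have h3 : ((oddE H φ) ×ˢ (univ : Finset ({w // w ∈ (Set.range χ)ᶜ} → Fin n))).card =
      (oddE H φ).card * n ^ (Fintype.card W - ν(α)) := by
    rw [card_product, card_univ, Fintype.card_fun, h2, Fintype.card_fin]
  rw [← h3]
  refine card_le_card_of_surjOn (fun q => fun w => if h : ∃ a, χ a = w then q.1 h.choose else
    q.2 ⟨w, fun h' => h (h')⟩) ?_
  intro θ hθ
  obtain ⟨ψ, hψ, he⟩ := (mem_filter.1 (mem_coe.1 hθ)).2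
  refine ⟨(ψ, fun w => θ w), by simpa using hψ, ?_⟩
  funext w
  dsimp only
  split_ifs with h
  · rw [he, Function.comp, h.choose_spec]
  · rfl

lemma z2_a (u u' u'' b : ZMod 2) : u + u' + b + (u' + u'' + b) + (u + u'' + b) = b := by
  revert u u' u'' b; decide

lemma z2_b (u x y b : ZMod 2) : x + y + b = u + x + b + b + (u + y + b + b) + b := by
  revert u x y b; decide

/-- The triangle value of `φ` at three base points. -/
def triT (φ : E2(n) → ZMod 2) (b : Fin 3 → Fin n) : ZMod 2 :=
  φ s(b 0, b 1) + φ s(b 1, b 2) + φ s(b 0, b 2)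

lemma stab_key (hne : (HE H).Nonempty) {m : ℕ} (hm : m = ν(α) + 2) (h3 : 3 ≤ m) (φ : E2(n) → ZMod 2)
    (β : Fin m ↪ Fin n) {b : Fin 3 → Fin n} (hb : ∀ i, b i = β ⟨i, by omega⟩) {x y : Fin n}
    (hxy : x ≠ y) (hx : x ∉ univ.map β) (hy : y ∉ univ.map β) (hg' : ¬ badM H φ (Sum.elim β ![x, y])) :
    φ s(x, y) = tf (fun x => if IsEulerianGraph H then φ s(b 0, x) + triT φ b else 0)
      (if Odd (eCount H) then 0 else triT φ b) s(x, y) := by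
  simp only [Finset.mem_map, mem_univ, true_and, not_exists] at hx hy
  have hinj : Function.Injective (Sum.elim β ![x, y]) := by
    refine Function.Injective.sumElim β.injective ?_ ?_
    · intro i j; fin_cases i <;> fin_cases j <;> simp [hxy, hxy.symm]
    · intro i j; fin_cases j
      · exact hx i
      · exact hy i
  obtain ⟨c', b', ht, h⟩ := dense_alg (H := H) (V := Fin m ⊕ Fin 2)
    (φ := fun g => φ (Sym2.map (Sum.elim β ![x, y]) g)) (by simp; omega) (fun χ => by
      by_contra hodd
      refine hg' ⟨χ, ⟨Sum.elim β ![x, y] ∘ χ, hinj.comp χ.injective⟩, mem_filter.2 ⟨mem_univ _, ?_⟩, rfl⟩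
      simpa only [Sym2.map_map, Function.Embedding.coeFn_mk] using hodd) hne
  have eb : ∀ i j : Fin 3, i ≠ j → φ s(b i, b j) = c' (Sum.inl ⟨i, by omega⟩) + c' (Sum.inl ⟨j, by omega⟩) + b' := by
    intro i j hij
    rw [hb, hb]
    exact h (Sum.inl ⟨i, by omega⟩) (Sum.inl ⟨j, by omega⟩) (fun h => hij (by simpa [Fin.ext_iff] using h))
  have e3 : φ s(b 0, x) = c' (Sum.inl ⟨(0 : Fin 3), by omega⟩) + c' (Sum.inr 0) + b' := by
    rw [hb 0]; exact h (Sum.inl ⟨(0 : Fin 3), by omega⟩) (Sum.inr 0) (by simp)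
  have e4 : φ s(b 0, y) = c' (Sum.inl ⟨(0 : Fin 3), by omega⟩) + c' (Sum.inr 1) + b' := by
    rw [hb 0]; exact h (Sum.inl ⟨(0 : Fin 3), by omega⟩) (Sum.inr 1) (by simp)
  have e5 : φ s(x, y) = _ := h (Sum.inr 0) (Sum.inr 1) (by simp)
  rw [tf_mk] at e5
  have hTb : triT φ b = b' := by
    unfold triT
    rw [eb 0 1 (by decide), eb 1 2 (by decide), eb 0 2 (by decide)]
    exact z2_a _ _ _ _
  have hbb : (if Odd (eCount H) then 0 else triT φ b) = b' := by
    split_ifs with ho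
    · exact (ht.2 ho).symm
    · exact hTb
  rw [tf_mk, hbb, e5, hTb]
  split_ifs with hE
  · rw [e3, e4]; exact z2_b _ _ _ _
  · have := ht.1.resolve_left hE
    rw [this, this]

/-- Pairs extending a base to a bad map. -/
def bpr (H : SimpleGraph α) {m : ℕ} (φ : E2(n) → ZMod 2) (β : Fin m ↪ Fin n) : Finset (Fin n × Fin n) :=
  univ.filter fun q => badM H φ (Sum.elim β ![q.1, q.2])

lemma sum_bpr (m : ℕ) (φ : E2(n) → ZMod 2) : ∑ β : Fin m ↪ Fin n, (bpr H φ β).card ≤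
    (badS H (Fin m ⊕ Fin 2) φ).card := by
  rw [← card_sigma]
  refine card_le_card_of_injOn (fun q => Sum.elim q.1 ![q.2.1, q.2.2]) ?_ ?_
  · rintro ⟨β, q⟩ hq
    have := (mem_filter.1 (mem_sigma.1 hq).2).2
    exact mem_coe.2 (mem_badS.2 this)
  · rintro ⟨β, x, y⟩ _ ⟨β', x', y'⟩ _ he
    have hb : β = β' := by
      ext i; exact congrArg Fin.val (congrFun he (Sum.inl i))
    have hx := congrFun he (Sum.inr 0)
    have hy := congrFun he (Sum.inr 1)
    simp at hx hy
    subst hb hx hy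
    rfl

lemma stab (hH : Strictly2Balanced H) {ε : ℝ} (hε : 0 < ε) :
    ∃ ε₁ > 0, ∀ᶠ n : ℕ in atTop, ∀ φ : E2(n) → ZMod 2,
      ((oddE H φ).card : ℝ) ≤ ε₁ * (n:ℝ) ^ ν(α) → ∃ c b, Triv H c b ∧
        (((EE n).filter fun g => φ g ≠ tf c b g).card : ℝ) ≤ ε * (n:ℝ) ^ 2 := by
  set v := ν(α) with hv
  obtain ⟨m, hm⟩ : ∃ m, m = v + 2 := ⟨_, rfl⟩
  obtain ⟨M, hMpos, hM⟩ : ∃ M : ℝ, 0 < M ∧ (Fintype.card (α ↪ Fin m ⊕ Fin 2) : ℝ) ≤ M :=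
    ⟨_, Nat.cast_add_one_pos _, (lt_add_one _).le⟩
  refine ⟨ε / (2 * M * 2 ^ m), by positivity, ?_⟩
  filter_upwards [eventually_ge_atTop (2 * m), tendsto_natCast_atTop_atTop.eventually_ge_atTop (4 * m / ε)]
    with n hn hn2 φ hφ
  have hm5 : 5 ≤ m := by have := sb_card hH; omega
  have hnr : (0:ℝ) < n := by exact_mod_cast (by omega : 0 < n)
  -- a good base
  have h2 := (sum_bpr (H := H) m φ).trans (badM_count (H := H) (W := Fin m ⊕ Fin 2) φ)
  have hcard : (n:ℝ) ^ m / 2 ^ m ≤ Fintype.card (Fin m ↪ Fin n) := by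
    rw [Fintype.card_embedding_eq, Fintype.card_fin, Fintype.card_fin, ← div_pow]
    have h5 := Nat.pow_sub_le_descFactorial n m
    calc ((n:ℝ) / 2) ^ m ≤ ((n + 1 - m : ℕ) : ℝ) ^ m := by
          gcongr
          rw [div_le_iff₀ two_pos]
          exact_mod_cast (by omega : n ≤ (n + 1 - m) * 2)
      _ ≤ _ := by exact_mod_cast h5
  have hcp : (0:ℝ) < Fintype.card (Fin m ↪ Fin n) := lt_of_lt_of_le (by positivity) hcard
  obtain ⟨β, hβ⟩ : ∃ β : Fin m ↪ Fin n, ((bpr H φ β).card : ℝ) ≤ ε / 2 * (n:ℝ) ^ 2 := by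
    by_contra hc
    push Not at hc
    have h6 : (Fintype.card (Fin m ↪ Fin n) : ℝ) * (ε / 2 * (n:ℝ) ^ 2) < ∑ β : Fin m ↪ Fin n, ((bpr H φ β).card : ℝ) := by
      rw [← nsmul_eq_mul, ← card_univ, ← sum_const]
      refine sum_lt_sum_of_nonempty ?_ fun β _ => hc β
      exact card_pos.1 (by rw [card_univ]; exact_mod_cast hcp)
    have h7 : ∑ β : Fin m ↪ Fin n, ((bpr H φ β).card : ℝ) ≤ Fintype.card (α ↪ Fin m ⊕ Fin 2) *
        ((oddE H φ).card * (n:ℝ) ^ 4) := by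
      have : Fintype.card (Fin m ⊕ Fin 2) - ν(α) = 4 := by simp; omega
      rw [this] at h2
      exact_mod_cast h2
    have h8 : ∑ β : Fin m ↪ Fin n, ((bpr H φ β).card : ℝ) ≤ M * ((ε / (2 * M * 2 ^ m) * (n:ℝ) ^ v) * (n:ℝ) ^ 4) := by
      refine h7.trans ?_
      gcongr
    have h9 : M * ((ε / (2 * M * 2 ^ m) * (n:ℝ) ^ v) * (n:ℝ) ^ 4) = (n:ℝ) ^ m / 2 ^ m * (ε / 2 * (n:ℝ) ^ 2) := by
      rw [hm, pow_add, show (n:ℝ) ^ 4 = n ^ 2 * n ^ 2 by ring]; field_simp; rw [pow_add]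
    have h10 := mul_le_mul_of_nonneg_right hcard (show 0 ≤ ε / 2 * (n:ℝ) ^ 2 by positivity)
    linarith
  set b3 : Fin 3 → Fin n := fun i => β ⟨i, by omega⟩ with hb3
  set c : Fin n → ZMod 2 := fun x => if IsEulerianGraph H then φ s(b3 0, x) + triT φ b3 else 0 with hc
  set b : ZMod 2 := if Odd (eCount H) then 0 else triT φ b3 with hb
  have hne : (HE H).Nonempty := card_pos.1 (by have := sb_e2 hH; omega)
  have key : ∀ x y, x ≠ y → x ∉ univ.map β → y ∉ univ.map β → (x, y) ∉ bpr H φ β → φ s(x, y) = tf c b s(x, y) := by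
    intro x y hxy hx hy hg
    exact stab_key hne hm (by omega) φ β (fun _ => rfl) hxy hx hy
      fun h => hg (mem_filter.2 ⟨mem_univ _, h⟩)
  refine ⟨c, b, ⟨?_, fun h => by rw [hb, if_pos h]⟩, ?_⟩
  · by_cases hE : IsEulerianGraph H
    · exact Or.inl hE
    · right; intro x; rw [hc]; dsimp only; rw [if_neg hE]
  · have hsub : (EE n).filter (fun g => φ g ≠ tf c b g) ⊆
        (bpr H φ β ∪ (univ.map β ×ˢ univ ∪ univ ×ˢ univ.map β)).image fun q => s(q.1, q.2) := by
      intro g hg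
      rw [mem_filter] at hg
      induction g with
      | _ x y =>
        refine mem_image.2 ⟨(x, y), ?_, rfl⟩
        by_contra hc
        simp only [mem_union, mem_product, mem_univ, true_and, and_true, not_or] at hc
        refine hg.2 (key x y ?_ hc.2.1 hc.2.2 hc.1)
        rintro rfl
        exact mem_EE.1 hg.1 (by simp)
    have h1 := (card_le_card hsub).trans (card_image_le.trans ((card_union_le _ _).trans
      (add_le_add_right (card_union_le _ _) _)))
    rw [card_product, card_product, card_map, card_univ, card_univ, Fintype.card_fin, Fintype.card_fin] at h1
    have h2 : (((EE n).filter fun g => φ g ≠ tf c b g).card : ℝ) ≤ (bpr H φ β).card + ((m:ℝ) * n + n * m) := by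
      exact_mod_cast h1
    have h3 : 2 * (m:ℝ) * n ≤ ε / 2 * (n:ℝ) ^ 2 := by
      rw [div_le_iff₀ hε] at hn2
      nlinarith
    linarith
end

/-! ### Even sets are close to trivial ones -/

lemma two_round {ι : Type*} {E : Finset ι} {p p0 p1 : ℝ} (h : 1 - p = (1 - p0) * (1 - p1)) (f : Finset ι → ℝ) :
    ex E p f = ex E p0 (fun s0 => ex E p1 fun s1 => f (s0 ∪ s1)) := by
  induction E using Finset.induction_on generalizing f with
  | empty => simp [ex_empty]
  | insert a E ha ih =>
    simp only [ex_insert ha, ih, insert_union, union_insert, insert_idem, ex_add, ex_mul_left]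
    rw [h, show p = 1 - (1 - p0) * (1 - p1) by linarith]
    ring

section
variable [Fintype α] {H : SimpleGraph α} {n : ℕ} {p C : ℝ}

/-- Every even function is close to a trivial one. -/
def LargeP (H : SimpleGraph α) (ε p : ℝ) {n : ℕ} (s : ES(n)) : Prop :=
  ∀ F, EvenOn H s F → ∃ c b, Triv H c b ∧ ((s.filter fun g => F g ≠ tf c b g).card : ℝ) ≤ ε * ((n:ℝ) ^ 2 * p)

/-- Pairs without a bridge. -/
def nob (H : SimpleGraph α) {n : ℕ} (s : ES(n)) : ES(n) :=
  (EE n).filter fun a => ∀ K ∈ cps H n, a ∈ K → ¬ K \ {a} ⊆ s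

/-- The extension of a function along bridges. -/
def bext (H : SimpleGraph α) {n : ℕ} (s F : ES(n)) (g : E2(n)) : ZMod 2 :=
  if h : ∃ K ∈ cps H n, g ∈ K ∧ K \ {g} ⊆ s then ∑ k ∈ h.choose \ {g}, if k ∈ F then 1 else 0 else 0

lemma z2_ite (x : ZMod 2) : (if x ≠ 0 then 1 else 0) = x := by revert x; decide

lemma bext_eq {s0 s : ES(n)} (h0 : s0 ⊆ s) (hs : s ⊆ EE n) {F : E2(n) → ZMod 2}
    (hF : EvenOn H s F) {g : E2(n)} (hg : g ∈ s) (hn : g ∉ nob H s0) :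
    F g = bext H s0 (s0.filter fun g => F g ≠ 0) g := by
  have h : ∃ K ∈ cps H n, g ∈ K ∧ K \ {g} ⊆ s0 := by
    by_contra hc; push Not at hc
    exact hn (mem_filter.2 ⟨hs hg, hc⟩)
  unfold bext
  rw [dif_pos h]
  obtain ⟨hK, hgK, hKs⟩ := h.choose_spec
  have e := hF _ hK fun k hk => by
    by_cases hkg : k = g
    · rwa [hkg]
    · exact h0 (hKs (Finset.mem_sdiff.2 ⟨hk, by simpa using hkg⟩))
  rw [← sum_sdiff (singleton_subset_iff.2 hgK), sum_singleton] at e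
  rw [sum_congr rfl fun k hk => by
    rw [show (if k ∈ s0.filter (fun g => F g ≠ 0) then (1 : ZMod 2) else 0) = F k by
      rw [← z2_ite (F k)]; simp only [mem_filter, hKs hk, true_and, z2_ite]]]
  have := z2_add_self (F g)
  exact add_right_cancel (this.trans e.symm)

/-- The odd copies avoiding the pairs without bridges. -/
def oddC (H : SimpleGraph α) {n : ℕ} (B : ES(n)) (φ : E2(n) → ZMod 2) :
    Finset (ES(n)) :=
  (cps H n).filter fun K => (∀ k ∈ K, k ∉ B) ∧ ∑ k ∈ K, φ k ≠ 0

lemma oddC_card (hH : Strictly2Balanced H) (B : ES(n)) (φ : E2(n) → ZMod 2) :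
    (oddE H φ).card ≤ (2 * (HE H).card) ^ ν(α) * (oddC H B φ).card +
      4 * (HE H).card * B.card * n ^ (ν(α) - 2) := by
  have h1 : oddE H φ ⊆ (univ.filter fun ψ : α ↪ Fin n => (∀ k ∈ im H ψ, k ∉ B) ∧ ∑ k ∈ im H ψ, φ k ≠ 0) ∪
      (HE H ×ˢ B).biUnion fun q => univ.filter fun ψ : α ↪ Fin n => ∀ f' ∈ ({q.1} : Finset (Sym2 α)),
        Sym2.map ψ f' ∈ ({q.2} : ES(n)) := by
    intro ψ hψ
    rw [mem_union]
    by_cases hc : ∀ k ∈ im H ψ, k ∉ B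
    · left
      refine mem_filter.2 ⟨mem_univ _, hc, ?_⟩
      have := (mem_filter.1 hψ).2
      unfold im
      rwa [sum_map]
    · right
      push Not at hc
      obtain ⟨k, hk, hkB⟩ := hc
      obtain ⟨f, hf, rfl⟩ := mem_im.1 hk
      exact mem_biUnion.2 ⟨(f, Sym2.map ψ f), mem_product.2 ⟨hf, hkB⟩,
        mem_filter.2 ⟨mem_univ _, fun f' h => by rw [mem_singleton] at h ⊢; rw [h]⟩⟩
  refine (card_le_card h1).trans ((card_union_le _ _).trans (add_le_add ?_ ?_))
  · exact emb_le_cps hH fun K => (∀ k ∈ K, k ∉ B) ∧ ∑ k ∈ K, φ k ≠ 0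
  · refine card_biUnion_le.trans
      ((sum_le_card_nsmul _ _ (4 * n ^ (ν(α) - 2)) fun q hq => ?_).trans (le_of_eq ?_))
    · refine (ext_count {q.1} {q.2}).trans (le_of_eq ?_)
      have : (VJ ({q.1} : Finset (Sym2 α))).card = 2 := VJ_single (mem_product.1 hq).1
      rw [this]; simp
    · rw [smul_eq_mul, card_product]; ring

lemma caseI (hH : Strictly2Balanced H) (h3 : 3 ≤ (HE H).card) (hw : Win H C n p) {p1 : ℝ} (h2 : p / 2 ≤ p1)
    (hle : p1 ≤ p) (hup : Up H C n p1) {I : Finset (ES(n))} (hI : I ⊆ cps H n) {c0 : ℝ} (hc0 : 0 < c0)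
    (hc : c0 * (n:ℝ) ^ ν(α) ≤ I.card) :
    pr (EE n) p1 (fun s => ∀ K ∈ I, ¬ K ⊆ s) ≤
      exp (-(c0 / (16 * 2 ^ (HE H).card * cU H (HE H).card) * ((n:ℝ) ^ 2 * p))) := by
  have hp := hw.p_pos hH
  have hp1 : 0 < p1 := by linarith
  have hn : (0:ℝ) < n := by have := hw.hn; exact_mod_cast (by omega : 0 < n)
  have hv := sb_card hH
  have hlam : lam H n p1 ≤ lam H n p := by unfold lam; gcongr
  have hcU := cU_ge_one (H := H) (HE H).card
  obtain ⟨M, hM⟩ : ∃ M, M = cU H (HE H).card * lam H n p := ⟨_, rfl⟩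
  have hM1 : 1 ≤ M := by rw [hM]; exact one_le_mul_of_one_le_of_one_le hcU hw.lam1
  have hS : ∑ K ∈ I, p1 ^ K.card = I.card * p1 ^ (HE H).card := by
    rw [sum_congr rfl fun K hK => by rw [cps_card (hI hK)], sum_const, nsmul_eq_mul]
  have hIpos : (0:ℝ) < I.card := lt_of_lt_of_le (by positivity) hc
  have hSpos : 0 < ∑ K ∈ I, p1 ^ K.card := by rw [hS]; positivity
  have hj : jDelta p1 I (fun K => K) ≤ (∑ K ∈ I, p1 ^ K.card) * M := by
    refine jDelta_le hp1.le fun K hK => ?_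
    refine le_trans ?_ ((sumB hH h3 hup (U := K) (cps_card (hI hK)).le).trans ?_)
    · refine sum_le_sum_of_subset_of_nonneg (fun K' hK' => ?_) fun _ _ _ => by positivity
      rw [mem_filter] at hK' ⊢
      refine ⟨hI hK'.1, ?_⟩
      rw [inter_comm]
      exact not_disjoint_iff_nonempty_inter.1 hK'.2
    · rw [hM]
      exact mul_le_mul_of_nonneg_left (max_le hlam hw.lam1) (by linarith)
  have := janson_quarter hup.p0 hup.p1 I (fun K => K) (fun K hK => cps_subset_EE (hI hK)) hSpos le_rfl hj
    (le_mul_of_one_le_right hSpos.le hM1)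
  refine (pr_mono hup.p0 hup.p1 fun s _ hs => ?_).trans (this.trans ?_)
  · have : cnt I (fun K => K) s ≤ (∅ : Finset (ES(n))).card := cnt_le fun K hK h => (hs K hK h).elim
    rw [card_empty, Nat.le_zero] at this
    rw [this]
    have := hSpos.le
    push_cast; linarith
  · rw [exp_le_exp, neg_le_neg_iff]
    have e1 : (∑ K ∈ I, p1 ^ K.card) ^ 2 / (16 * ((∑ K ∈ I, p1 ^ K.card) * M)) = (I.card * p1 ^ (HE H).card) / (16 * M) := by
      rw [hS] at hSpos ⊢
      generalize (I.card:ℝ) * p1 ^ (HE H).card = S at hSpos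
      field_simp
    rw [e1, le_div_iff₀ (by linarith)]
    have e2 : c0 * (n:ℝ) ^ ν(α) * (p / 2) ^ (HE H).card ≤ I.card * p1 ^ (HE H).card := by gcongr
    refine le_trans (le_of_eq ?_) e2
    rw [hM]
    unfold lam
    obtain ⟨v', hv'⟩ : ∃ v', ν(α) = v' + 2 := ⟨_, (by omega : ν(α) = ν(α) - 2 + 2)⟩
    obtain ⟨e', he'⟩ : ∃ e', (HE H).card = e' + 1 := ⟨_, (by omega : (HE H).card = (HE H).card - 1 + 1)⟩
    generalize cU H (HE H).card = u at hcU
    rw [hv', he', Nat.add_sub_cancel, Nat.add_sub_cancel, div_pow, pow_succ p, pow_add (n:ℝ)]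
    have hu : 0 < u := by linarith
    field_simp

lemma fix_s0 (hH : Strictly2Balanced H) (h3 : 3 ≤ (HE H).card) {ε : ℝ} (hε : 0 < ε) :
    ∃ c > 0, ∃ δ > 0, ∀ᶠ n : ℕ in atTop, ∀ p, Win H C n p → ∀ p1, p / 2 ≤ p1 → p1 ≤ p → Up H C n p1 →
      ∀ s0 ⊆ EE n, ((nob H s0).card : ℝ) ≤ δ * (n:ℝ) ^ 2 → (s0.card : ℝ) ≤ ε / 2 * ((n:ℝ) ^ 2 * p) → ∀ F0,
      pr (EE n) p1 (fun s1 => ∃ F, EvenOn H (s0 ∪ s1) F ∧ s0.filter (fun g => F g ≠ 0) = F0 ∧ ∀ c b, Triv H c b →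
        ε * ((n:ℝ) ^ 2 * p) < ((s0 ∪ s1).filter fun g => F g ≠ tf c b g).card) ≤ exp (-(c * ((n:ℝ) ^ 2 * p))) := by
  obtain ⟨ε₁, hε₁, hst⟩ := stab hH (show 0 < ε / 16 by positivity)
  have hep : (0:ℝ) < (HE H).card := by exact_mod_cast (by omega : 0 < (HE H).card)
  have hcU := lt_of_lt_of_le one_pos (cU_ge_one (H := H) (HE H).card)
  obtain ⟨c0, hc0, hc0p⟩ : ∃ c0 : ℝ, c0 = ε₁ / (2 * (2 * (HE H).card) ^ ν(α)) ∧ 0 < c0 := ⟨_, rfl, by positivity⟩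
  refine ⟨min (c0 / (16 * 2 ^ (HE H).card * cU H (HE H).card)) (ε / 4), lt_min (by positivity) (by positivity),
    min (ε / 16) (ε₁ / (8 * (HE H).card)), lt_min (by positivity) (by positivity), ?_⟩
  filter_upwards [hst] with n hst p hw p1 hp12 hp1 hup s0 hs0 hB hs0c F0
  have hp := hw.p_pos hH
  have hn : (0:ℝ) < n := by have := hw.hn; exact_mod_cast (by omega : 0 < n)
  have hv := sb_card hH
  have hN : 0 < (n:ℝ) ^ 2 * p := by positivity
  have hB1 : ((nob H s0).card : ℝ) ≤ ε / 16 * (n:ℝ) ^ 2 := hB.trans (by gcongr; exact min_le_left _ _)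
  have hB2 : ((nob H s0).card : ℝ) ≤ ε₁ / (8 * (HE H).card) * (n:ℝ) ^ 2 := hB.trans (by gcongr; exact min_le_right _ _)
  by_cases hodd : ((oddE H (bext H s0 F0)).card : ℝ) ≤ ε₁ * (n:ℝ) ^ ν(α)
  · obtain ⟨c, b, ht, hd⟩ := hst _ hodd
    set A := ((EE n).filter fun g => bext H s0 F0 g ≠ tf c b g) ∪ nob H s0 with hA
    have hAE : A ⊆ EE n := union_subset (filter_subset _ _) (filter_subset _ _)
    have hAc : (A.card : ℝ) ≤ ε / 8 * (n:ℝ) ^ 2 := by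
      have : (A.card : ℝ) ≤ ((EE n).filter fun g => bext H s0 F0 g ≠ tf c b g).card + (nob H s0).card := by
        exact_mod_cast card_union_le _ _
      linarith
    have hch := chernoff hup.p0 hup.p1 hAE (μ := ε / 8 * ((n:ℝ) ^ 2 * p)) (b := 1) (t := ε / 2 * ((n:ℝ) ^ 2 * p))
      (by calc (A.card : ℝ) * p1 ≤ (ε / 8 * (n:ℝ) ^ 2) * p := by gcongr; exact hup.p0
            _ = _ := by ring) zero_le_one
    refine (pr_mono hup.p0 hup.p1 fun s1 hs1 hs => ?_).trans (hch.trans ?_)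
    · obtain ⟨F, hF, rfl, hbad⟩ := hs
      have h1 := hbad c b ht
      have h2 : (s0 ∪ s1).filter (fun g => F g ≠ tf c b g) ⊆ s0 ∪ (s1 ∩ A) := by
        intro g hg
        obtain ⟨hg1, hg2⟩ := mem_filter.1 hg
        rcases mem_union.1 hg1 with h | h
        · exact mem_union_left _ h
        · refine mem_union_right _ (mem_inter.2 ⟨h, ?_⟩)
          by_cases hgB : g ∈ nob H s0
          · exact mem_union_right _ hgB
          · rw [bext_eq subset_union_left (union_subset hs0 hs1) hF hg1 hgB] at hg2
            exact mem_union_left _ (mem_filter.2 ⟨hs1 h, hg2⟩)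
      have h3 : (((s0 ∪ s1).filter fun g => F g ≠ tf c b g).card : ℝ) ≤ s0.card + (s1 ∩ A).card := by
        exact_mod_cast (card_le_card h2).trans (card_union_le _ _)
      linarith
    · rw [exp_le_exp]
      have h1 : min (c0 / (16 * 2 ^ (HE H).card * cU H (HE H).card)) (ε / 4) * ((n:ℝ) ^ 2 * p) ≤ ε / 4 * ((n:ℝ) ^ 2 * p) := by
        gcongr; exact min_le_right _ _
      have h2 := exp_one_lt_d9
      have h3 : (exp 1 - 1) * (ε / 8 * ((n:ℝ) ^ 2 * p)) ≤ 2 * (ε / 8 * ((n:ℝ) ^ 2 * p)) := by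
        gcongr; linarith
      linarith
  · push Not at hodd
    have hI : c0 * (n:ℝ) ^ ν(α) ≤ (oddC H (nob H s0) (bext H s0 F0)).card := by
      have h1 : ((oddE H (bext H s0 F0)).card : ℝ) ≤ (2 * (HE H).card) ^ ν(α) *
          (oddC H (nob H s0) (bext H s0 F0)).card + 4 * (HE H).card * (nob H s0).card * (n:ℝ) ^ (ν(α) - 2) := by
        exact_mod_cast oddC_card hH (nob H s0) (bext H s0 F0)
      have h2 : 4 * (HE H).card * (nob H s0).card * (n:ℝ) ^ (ν(α) - 2) ≤ ε₁ / 2 * (n:ℝ) ^ ν(α) := by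
        calc _ ≤ 4 * (HE H).card * (ε₁ / (8 * (HE H).card) * (n:ℝ) ^ 2) * (n:ℝ) ^ (ν(α) - 2) := by gcongr
          _ = ε₁ / 2 * ((n:ℝ) ^ (ν(α) - 2) * (n:ℝ) ^ 2) := by field_simp; ring
          _ = _ := by rw [← pow_add, Nat.sub_add_cancel (by omega)]
      rw [hc0, div_mul_eq_mul_div, div_le_iff₀ (by positivity)]
      linarith
    refine (pr_mono hup.p0 hup.p1 fun s1 hs1 hs => ?_).trans
      ((caseI hH h3 hw hp12 hp1 hup (filter_subset _ _) hc0p hI).trans ?_)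
    · obtain ⟨F, hF, rfl, -⟩ := hs
      intro K hK hKs
      obtain ⟨k1, k2, k3⟩ := mem_filter.1 hK
      refine k3 (Eq.trans ?_ (hF K k1 (hKs.trans subset_union_right)))
      exact sum_congr rfl fun k hk => (bext_eq subset_union_left (union_subset hs0 hs1) hF
        (mem_union_right _ (hKs hk)) (k2 k hk)).symm
    · rw [exp_le_exp, neg_le_neg_iff]
      gcongr
      exact min_le_left _ _

lemma Large_whp (hH : Strictly2Balanced H) (h3 : 3 ≤ (HE H).card) (hC : 0 < C) {ε : ℝ} (hε : 0 < ε) :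
    Whp H C (fun _ p s => LargeP H ε p s) := by
  intro ζ hζ
  obtain ⟨c, hc, δ', hδ', hfix⟩ := fix_s0 (C := C) hH h3 hε
  obtain ⟨d, hd, hdc, hdε⟩ : ∃ d > 0, d ≤ c / 2 ∧ d ≤ ε / 2 :=
    ⟨min (c / 2) (ε / 2), lt_min (by positivity) (by positivity), min_le_left _ _, min_le_right _ _⟩
  obtain ⟨δ, hδ, hδ2, hδd⟩ : ∃ δ > 0, δ ≤ 1 / 2 ∧ δ / d ≤ ζ / 4 :=
    ⟨min (1 / 2) (d * ζ / 4), lt_min (by norm_num) (by positivity), min_le_left _ _, by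
      rw [div_le_iff₀ hd]; exact (min_le_right _ _).trans (by linarith)⟩
  have hcB := cB_pos h3
  have t0 : Tendsto (fun x : ℝ => exp (-x)) atTop (𝓝 0) := Real.tendsto_exp_neg_atTop_nhds_zero
  obtain ⟨x1, hx1⟩ := (t0.eventually (eventually_le_nhds (show 0 < δ' * (ζ / 4) / exp 2 by positivity))).exists
  obtain ⟨x2, hx2, hx20⟩ := ((t0.eventually (eventually_le_nhds (show 0 < ζ / 4 by positivity))).and
    (eventually_ge_atTop 0)).exists
  filter_upwards [hfix, up_of hH h3 C, no_bridge hH h3 C, log_lam_ge (H := H) hC (x1 * cB H / δ ^ ((HE H).card - 1)),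
    np_ge (H := H) (C := C) h3 (x2 / (c / 2)), eventually_ge_atTop (ν(α) ^ 2)] with n hfix hup hnb hlam hnp hnv p hw
  have hp := hw.p_pos hH
  have hn : (1:ℝ) ≤ n := by have := hw.hn; exact_mod_cast (by omega : 1 ≤ n)
  have hN : 0 < (n:ℝ) ^ 2 * p := by positivity
  have hpp := hw.p1
  have hlm : ∀ q, 0 ≤ q → q ≤ p → Up H C n q := fun q hq hqp =>
    hup q hq (hqp.trans hpp) (le_trans (by unfold lam; gcongr) hw.lamle)
  have hδp : δ * p ≤ p := by nlinarith
  have hden : 0 < 1 - δ * p := by nlinarith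
  have hU0 := hlm (δ * p) (by positivity) hδp
  obtain ⟨p1, hp1⟩ : ∃ p1, p1 = (p - δ * p) / (1 - δ * p) := ⟨_, rfl⟩
  have e1 : p1 * (1 - δ * p) = p - δ * p := by rw [hp1, div_mul_cancel₀ _ hden.ne']
  have hp1a : p / 2 ≤ p1 := by
    rw [hp1, le_div_iff₀ hden]; nlinarith [mul_nonneg hδ.le (sq_nonneg p)]
  have hp1b : p1 ≤ p := by
    rw [hp1, div_le_iff₀ hden]; nlinarith [mul_nonneg hδ.le hp.le]
  have hU1 := hlm p1 (by linarith) hp1b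
  have b1 : pr (EE n) (δ * p) (fun s0 => ¬ ((nob H s0).card : ℝ) ≤ δ' * (n:ℝ) ^ 2) ≤ ζ / 4 := by
    refine (markov hU0.p0 hU0.p1 (f := fun s0 => ((nob H s0).card : ℝ)) (fun _ _ => Nat.cast_nonneg _)
      (show 0 < δ' * (n:ℝ) ^ 2 by positivity) _ fun s _ h => (not_le.1 h).le).trans ?_
    have h1 : ex (EE n) (δ * p) (fun s0 => ((nob H s0).card : ℝ)) ≤ (n:ℝ) ^ 2 * exp (2 - LL H n (δ * p)) := by
      have : ∀ s0 : ES(n), ((nob H s0).card : ℝ) =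
          ∑ a ∈ EE n, ind (∀ K ∈ cps H n, a ∈ K → ¬ K \ {a} ⊆ s0) := fun s0 => by
        unfold nob ind; rw [card_filter]; push_cast
        exact sum_congr rfl fun a _ => by congr
      simp only [this, ex_sum]
      refine (sum_le_card_nsmul _ _ _ fun a ha => hnb _ hU0 a ha).trans ?_
      rw [nsmul_eq_mul]
      gcongr
      exact EE_card_le
    have h2 : exp (2 - LL H n (δ * p)) ≤ δ' * (ζ / 4) := by
      rw [sub_eq_add_neg, exp_add, ← le_div_iff₀' (exp_pos 2)]
      refine le_trans (exp_le_exp.2 (neg_le_neg ?_)) hx1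
      have h4 := (hlam p hw).trans (lam_le_LL hH h3 hnv hp.le)
      rw [mul_comm, LL_mul]
      rw [div_le_iff₀ (by positivity)] at h4
      have : cB H * x1 ≤ cB H * (LL H n p * δ ^ ((HE H).card - 1)) := by linarith
      exact le_of_mul_le_mul_left this hcB
    rw [div_le_iff₀ (by positivity)]
    calc _ ≤ (n:ℝ) ^ 2 * (δ' * (ζ / 4)) := h1.trans (by gcongr)
      _ = _ := by ring
  have b2 : pr (EE n) (δ * p) (fun s0 => ¬ (s0.card : ℝ) ≤ d * ((n:ℝ) ^ 2 * p)) ≤ ζ / 4 := by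
    refine (markov hU0.p0 hU0.p1 (f := fun s0 => ((EE n ∩ s0).card : ℝ)) (fun _ _ => Nat.cast_nonneg _)
      (show 0 < d * ((n:ℝ) ^ 2 * p) by positivity) _ fun s hs h => by
        rw [inter_eq_right.2 hs]; exact (not_le.1 h).le).trans (le_trans ?_ hδd)
    rw [ex_card_inter (Finset.Subset.refl _), div_le_div_iff₀ (by positivity) hd]
    calc δ * p * (EE n).card * d ≤ δ * p * (n:ℝ) ^ 2 * d := by gcongr; exact EE_card_le
      _ = _ := by ring
  have hexp : exp (-(c / 2 * ((n:ℝ) ^ 2 * p))) ≤ ζ / 4 := by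
    refine le_trans (exp_le_exp.2 (neg_le_neg ?_)) hx2
    have h1 := hnp p hw
    rw [div_le_iff₀ (by positivity)] at h1
    have h2 : (n:ℝ) * p ≤ (n:ℝ) ^ 2 * p := by gcongr; nlinarith
    nlinarith
  have main : pr (EE n) p (fun s => ¬ LargeP H ε p s) ≤ pr (EE n) (δ * p)
      (fun s0 => ¬ ((nob H s0).card : ℝ) ≤ δ' * (n:ℝ) ^ 2 ∨ ¬ (s0.card : ℝ) ≤ d * ((n:ℝ) ^ 2 * p)) + ζ / 4 := by
    have tr : pr (EE n) p (fun s => ¬ LargeP H ε p s) = ex (EE n) (δ * p) fun s0 => pr (EE n) p1 fun s1 =>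
        ¬ LargeP H ε p (s0 ∪ s1) := by
      unfold pr
      convert two_round (E := EE n) (p := p) (p0 := δ * p) (p1 := p1) (by linarith) _
    rw [tr, pr, ← ex_const (E := EE n) (p := δ * p) (c := ζ / 4), ← ex_add]
    refine ex_mono hU0.p0 hU0.p1 fun s0 hs0 => ?_
    by_cases hg : ¬ ((nob H s0).card : ℝ) ≤ δ' * (n:ℝ) ^ 2 ∨ ¬ (s0.card : ℝ) ≤ d * ((n:ℝ) ^ 2 * p)
    · rw [ind_true hg]
      have := pr_le_one (E := EE n) hU1.p0 hU1.p1 (fun s1 => ¬ LargeP H ε p (s0 ∪ s1))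
      exact this.trans (by linarith)
    · rw [ind_false hg, zero_add]
      push Not at hg
      have hf := hfix p hw p1 hp1a hp1b hU1 s0 hs0 hg.1 (hg.2.trans (by gcongr))
      refine le_trans (pr_mono hU1.p0 hU1.p1 (Q := fun s1 => ∃ F0 ∈ s0.powerset, ∃ F, EvenOn H (s0 ∪ s1) F ∧
        s0.filter (fun g => F g ≠ 0) = F0 ∧ ∀ c b, Triv H c b →
        ε * ((n:ℝ) ^ 2 * p) < ((s0 ∪ s1).filter fun g => F g ≠ tf c b g).card) fun s1 _ h => ?_)
        ((pr_exists hU1.p0 hU1.p1 _ _).trans ((sum_le_card_nsmul _ _ _ fun F0 _ => hf F0).trans ?_))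
      · unfold LargeP at h
        push Not at h
        obtain ⟨F, h1, h2⟩ := h
        exact ⟨_, mem_powerset.2 (filter_subset _ _), F, h1, rfl, h2⟩
      · rw [nsmul_eq_mul, card_powerset]
        push_cast
        calc _ ≤ exp (d * ((n:ℝ) ^ 2 * p)) * exp (-(c * ((n:ℝ) ^ 2 * p))) := by
              gcongr; exact pow_two_exp hg.2
          _ ≤ exp (-(c / 2 * ((n:ℝ) ^ 2 * p))) := by
              rw [← exp_add, exp_le_exp]
              have : d * ((n:ℝ) ^ 2 * p) ≤ c / 2 * ((n:ℝ) ^ 2 * p) := by gcongr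
              linarith
          _ ≤ _ := hexp
  have := pr_or (E := EE n) hU0.p0 hU0.p1 (fun s0 => ¬ ((nob H s0).card : ℝ) ≤ δ' * (n:ℝ) ^ 2)
    (fun s0 => ¬ (s0.card : ℝ) ≤ d * ((n:ℝ) ^ 2 * p))
  linarith
/-! ### The critical window -/
lemma z2_ne (x y : ZMod 2) : x + y = if x ≠ y then 1 else 0 := by revert x y; decide

lemma z2_flip (x y : ZMod 2) : x ≠ y + 1 ↔ x = y := by revert x y; decide

lemma tf_update {c : Fin n → ZMod 2} {b : ZMod 2} {x : Fin n} {g : E2(n)} (hg : g ∈ EE n) :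
    tf (Function.update c x (c x + 1)) b g = tf c b g + if x ∈ g then 1 else 0 := by
  induction g with
  | _ y z =>
    have hyz := mem_EE_mk.1 hg
    simp only [tf_mk, Sym2.mem_iff]
    by_cases h1 : x = y
    · subst h1
      rw [Function.update_self, Function.update_of_ne hyz.symm, if_pos (Or.inl rfl)]; ring
    · by_cases h2 : x = z
      · subst h2
        rw [Function.update_self, Function.update_of_ne hyz, if_pos (Or.inr rfl)]; ring
      · rw [Function.update_of_ne (Ne.symm h1), Function.update_of_ne (Ne.symm h2), if_neg (by tauto)]; ring

/-- A closest trivial function leaves a minimal difference set. -/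
lemma reduce {ε : ℝ} {s : ES(n)} (hs : s ⊆ EE n) (hL : LargeP H ε p s) (hT : ¬ cT H s) :
    ∃ F ⊆ s, F.Nonempty ∧ (F.card : ℝ) ≤ ε * ((n:ℝ) ^ 2 * p) ∧
      (∀ K ∈ cps H n, K ⊆ s → Even (K ∩ F).card) ∧
      (IsEulerianGraph H → ∀ x, (star F x).card ≤ (star s x \ star F x).card) := by
  unfold cT at hT
  push Not at hT
  obtain ⟨F, hF, hT⟩ := hT
  obtain ⟨c0, b0, ht0, hc0⟩ := hL F hF
  obtain ⟨⟨c, b⟩, hcb, hmin⟩ := exists_min_image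
    (univ.filter fun q : (Fin n → ZMod 2) × ZMod 2 => Triv H q.1 q.2)
    (fun q => (s.filter fun g => F g ≠ tf q.1 q.2 g).card) ⟨(c0, b0), by simpa using ht0⟩
  simp only [mem_filter, mem_univ, true_and, Prod.forall] at hcb hmin
  refine ⟨s.filter fun g => F g ≠ tf c b g, filter_subset _ _, ?_, ?_, ?_, ?_⟩
  · obtain ⟨g, hg, hne⟩ := hT c b hcb
    exact ⟨g, mem_filter.2 ⟨hg, hne⟩⟩
  · exact le_trans (by exact_mod_cast hmin c0 b0 ht0) hc0
  · intro K hK hKs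
    rw [← ZMod.natCast_eq_zero_iff_even]
    have h1 : ∑ g ∈ K, (F g + tf c b g) = 0 := by
      rw [sum_add_distrib, hF K hK hKs, sum_tf_cps hcb hK, add_zero]
    rw [sum_congr rfl fun g _ => z2_ne _ _, sum_boole] at h1
    rw [← h1]
    congr 2
    ext g
    simp only [mem_inter, mem_filter]
    exact ⟨fun h => ⟨h.1, h.2.2⟩, fun h => ⟨h.1, hKs h.1, h.2⟩⟩
  · intro hE x
    set Fs := s.filter fun g => F g ≠ tf c b g with hFs
    have h1 := hmin (Function.update c x (c x + 1)) b ⟨Or.inl hE, hcb.2⟩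
    have h2 : s.filter (fun g => F g ≠ tf (Function.update c x (c x + 1)) b g) ⊆
        (Fs \ star Fs x) ∪ (star s x \ star Fs x) := by
      intro g hg
      obtain ⟨hgs, hne⟩ := mem_filter.1 hg
      rw [tf_update (hs hgs)] at hne
      simp only [mem_union, Finset.mem_sdiff, mem_star, hFs, mem_filter]
      by_cases hx : x ∈ g
      · rw [if_pos hx] at hne
        have := (z2_flip _ _).1 hne
        exact Or.inr ⟨⟨hgs, hx⟩, fun h => h.1.2 this⟩
      · rw [if_neg hx, add_zero] at hne
        exact Or.inl ⟨⟨hgs, hne⟩, fun h => hx h.2⟩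
    have h3 := h1.trans ((card_le_card h2).trans (card_union_le _ _))
    have h4 : star Fs x ⊆ Fs := filter_subset _ _
    rw [card_sdiff_of_subset h4] at h3
    have := card_le_card h4
    omega

lemma Whp.mono {P Q : ∀ n : ℕ, ℝ → ES(n) → Prop} (h : Whp H C P)
    (hPQ : ∀ n p s, Win H C n p → P n p s → Q n p s) : Whp H C Q := by
  refine Whp.step h fun ζ hζ => ?_
  filter_upwards with n p hw
  refine le_trans (le_of_eq ?_) hζ.le
  unfold pr
  rw [ex_congr (g := fun _ => 0) fun s _ => ind_false fun h => h.2 (hPQ n p s hw h.1), ex_const]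

lemma window (hH : Strictly2Balanced H) (h3 : 3 ≤ (HE H).card) (ζ : ℝ) (hζ : 0 < ζ) :
    ∀ᶠ n : ℕ in atTop, ∀ p, 0 ≤ p → p ≤ 1 →
      9 / 10 * ((2 - aH H) * log n) ≤ LL H n p → LL H n p ≤ 3 * log n →
      pr (EE n) p (fun s => cQ H s ∧ ¬ cT H s) ≤ ζ := by
  have he : (3:ℝ) ≤ (HE H).card := by exact_mod_cast h3
  have hcB := cB_pos h3
  have ha := aH_lt hH h3
  obtain ⟨C, hC, hC1, hC2⟩ : ∃ C : ℝ, 0 < C ∧ cB H * 3 ≤ C ∧ 5 * (HE H).card ≤ C :=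
    ⟨max (cB H * 3) (5 * (HE H).card), lt_max_of_lt_left (by positivity), le_max_left _ _, le_max_right _ _⟩
  obtain ⟨T, hT, hT0⟩ : ∃ T : ℝ, T = 1 / (400 * (HE H).card * cB H) ∧ 0 < T := ⟨_, rfl, by positivity⟩
  obtain ⟨Cu0, hCu0, hU1⟩ := U1_whp hH h3 hC
  obtain ⟨R, hU2⟩ := U2_whp (H := H) h3 C
  obtain ⟨Cu, hCu, hU1⟩ : ∃ Cu : ℝ, 1 ≤ Cu ∧ Whp H C (fun _ p s => U1 H Cu p s) := by
    refine ⟨max Cu0 1, le_max_right _ _, hU1.mono fun n p s hw h g => (h g).trans ?_⟩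
    have := hw.lam1
    gcongr
    exact le_max_left _ _
  have hU := hU1.and hU2
  have monA : ∀ {η κ κ₁ : ℝ}, κ₁ ≤ κ → Whp H C (fun _ p s => LA H η κ p s) → Whp H C (fun _ p s => LA H η κ₁ p s) := by
    refine fun hk h => h.mono fun n p s hw h x F hF hx hc => h x F hF hx (hc.trans ?_)
    have := hw.p0
    gcongr
  obtain ⟨η, hη, hη1, hηT⟩ : ∃ η : ℝ, 0 < η ∧ η ≤ 1 ∧ η ≤ T / 4 :=
    ⟨min 1 (T / 4), by positivity, min_le_left _ _, min_le_right _ _⟩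
  obtain ⟨κ0, hκ0, hA0⟩ := LA_whp hH h3 hC hCu hη hη1 hU
  obtain ⟨κ, hκ, hκ1, hκ2⟩ : ∃ κ : ℝ, 0 < κ ∧ κ ≤ 1 ∧ κ ≤ κ0 := ⟨min 1 κ0, by positivity, min_le_left _ _, min_le_right _ _⟩
  have hA := monA hκ2 hA0
  obtain ⟨c, hc, hSt⟩ := Star_whp hH h3 hC hκ hκ1
  obtain ⟨W, hW, hW0⟩ : ∃ W : ℝ, W = 8 * Cu * (HE H).card / c ∧ 0 < W := ⟨_, rfl, by positivity⟩
  obtain ⟨η', hη', hη'1, hη'T⟩ : ∃ η : ℝ, 0 < η ∧ η ≤ 1 ∧ η * W ≤ T / 8 :=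
    ⟨min 1 (T / (8 * W)), by positivity, min_le_left _ _, by
      rw [← le_div_iff₀ hW0, div_div]; exact min_le_right _ _⟩
  obtain ⟨κ'0, hκ'0, hA'0⟩ := LA_whp hH h3 hC hCu hη' hη'1 hU
  obtain ⟨κ', hκ', hκ'1, hκ'2⟩ : ∃ κ' : ℝ, 0 < κ' ∧ κ' ≤ κ ∧ κ' ≤ κ'0 :=
    ⟨min κ κ'0, by positivity, min_le_left _ _, min_le_right _ _⟩
  have hA' := monA hκ'2 hA'0
  obtain ⟨η'', hη'', hη''T⟩ : ∃ η : ℝ, 0 < η ∧ Cu * (η * (2 / κ')) * W = T / 4 :=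
    ⟨T * κ' / (8 * Cu * W), by positivity, by field_simp; norm_num⟩
  have hDen := DenB_whp (H := H) h3 C hη''
  obtain ⟨η₁, hη₁, hη₁1, hη₁T, hη₁W⟩ : ∃ η : ℝ, 0 < η ∧ η ≤ 1 ∧ η ≤ T / 2 ∧ η * W ≤ T / 4 :=
    ⟨min 1 (min (T / 2) (T / (4 * W))), by positivity, min_le_left _ _, (min_le_right _ _).trans (min_le_left _ _), by
      rw [← le_div_iff₀ hW0, div_div]; exact (min_le_right _ _).trans (min_le_right _ _)⟩
  obtain ⟨ε0, hε0, hLD⟩ := LD_whp hH h3 hC hCu hη₁ hη₁1 hU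
  obtain ⟨ε, hε, hε1, hε2⟩ : ∃ ε : ℝ, 0 < ε ∧ ε ≤ ε0 ∧ 2 * ε ≤ κ' * (η'' / 6) :=
    ⟨min ε0 (κ' * (η'' / 6) / 2), by positivity, min_le_left _ _, by
      have := min_le_right ε0 (κ' * (η'' / 6) / 2); linarith⟩
  have all := (((((((hU1.and (DegB_whp h3 C)).and hLD).and hA).and hSt).and hA').and hDen).and
    (Low_whp hH h3 C)).and (Large_whp hH h3 hC hε)
  filter_upwards [all ζ hζ, win_of hH h3 C, eventually_ge_atTop (ν(α) ^ 2), eventually_ge_atTop 3]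
    with n hall hwin hnv hn p hp hp1 hlo hhi
  have hlog : 0 < log n := log_pos (by exact_mod_cast (by omega : 1 < n))
  have hw : Win H C n p := by
    refine hwin p hp hp1 ?_ ?_
    · calc _ ≤ cB H * LL H n p := lam_le_LL hH h3 hnv hp
        _ ≤ cB H * (3 * log n) := by gcongr
        _ = cB H * 3 * log n := by ring
        _ ≤ _ := by gcongr
    · have h1 := hlo.trans (LL_le hp)
      have h2 : 0 ≤ lam H n p := by unfold lam; positivity
      have h4 : 5 * (HE H).card * lam H n p ≤ C * lam H n p := by gcongr
      nlinarith
  refine (pr_mono hp hp1 fun s hs h => ?_).trans (hall p hw)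
  rintro ⟨⟨⟨⟨⟨⟨⟨⟨g1, g2⟩, g3⟩, g4⟩, g5⟩, g6⟩, g7⟩, g8⟩, g9⟩
  obtain ⟨F, f1, f2, f3, f4, f5⟩ := reduce hs g9 h.2
  refine finish hnv hH h3 hw hCu hη hη₁ hη' hη'' hκ' hκ'1 hc (by rw [← hT]; linarith) ?_ hε2 hs h.1 (g8 hlo) g1 g2
    (fun F hF hc => g3 F hF (hc.trans (by gcongr))) g4 g5 g6 g7 f1 f2 f3 f4 f5
  rw [← hT, ← hW]
  nlinarith
/-! ### Graphs with two edges -/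
/-- The copies of a two-edge path. -/
def IsP (H : SimpleGraph α) : Prop := ν(α) ≤ 3 ∧ ∀ n : ℕ,
  (∀ x y z : Fin n, x ≠ y → x ≠ z → y ≠ z → {s(x, y), s(x, z)} ∈ cps H n) ∧
  ∀ K ∈ cps H n, ∃ x y z : Fin n, x ≠ y ∧ x ≠ z ∧ y ≠ z ∧ K = {s(x, y), s(x, z)}

/-- The copies of a two-edge matching. -/
def IsM (H : SimpleGraph α) : Prop := ∀ (n : ℕ) (x y z w : Fin n), x ≠ y → x ≠ z → x ≠ w → y ≠ z → y ≠ w → z ≠ w →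
  {s(x, y), s(z, w)} ∈ cps H n

lemma two_cases (hH : Strictly2Balanced H) (h2 : (HE H).card = 2) : IsP H ∨ IsM H := by
  obtain ⟨f, g, hfg, hE⟩ := card_eq_two.1 h2
  have hf : ¬ f.IsDiag := HE_not_diag (H := H) (by rw [hE]; simp)
  have hg : ¬ g.IsDiag := HE_not_diag (H := H) (by rw [hE]; simp)
  have hcov : ∀ u : α, u ∈ f ∨ u ∈ g := fun u => by
    have : u ∈ VJ (HE H) := by rw [sb_cover hH]; simp
    rw [mem_VJ, hE] at this; simpa using this
  have him : ∀ {n : ℕ} (ψ : α ↪ Fin n), im H ψ = {Sym2.map ψ f, Sym2.map ψ g} := fun ψ => by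
    ext k; rw [mem_im, hE]; simp [eq_comm]
  by_cases hx : ∃ a, a ∈ f ∧ a ∈ g
  · left
    obtain ⟨a, ⟨b, rfl⟩, c, rfl⟩ := hx
    have hab : a ≠ b := hf
    have hac : a ≠ c := hg
    have hbc : b ≠ c := fun h => hfg (by rw [h])
    simp only [Sym2.mem_iff] at hcov
    refine ⟨?_, fun n => ⟨fun x y z hxy hxz hyz => ?_, fun K hK => ?_⟩⟩
    · rw [← card_univ]
      exact (card_le_card fun u _ => by have := hcov u; simp; tauto).trans (card_le_three (a := a) (b := b) (c := c))
    · obtain ⟨ψ, rfl, rfl, rfl⟩ : ∃ ψ : α ↪ Fin n, ψ a = x ∧ ψ b = y ∧ ψ c = z :=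
        ⟨⟨fun u => if u = a then x else if u = b then y else z, fun u v h => by
          have := hcov u; have := hcov v; grind⟩, if_pos rfl, by change ite _ _ _ = _; grind, by change ite _ _ _ = _; grind⟩
      exact mem_cps.2 ⟨ψ, him ψ⟩
    · obtain ⟨ψ, rfl⟩ := mem_cps.1 hK
      exact ⟨ψ a, ψ b, ψ c, ψ.injective.ne hab, ψ.injective.ne hac, ψ.injective.ne hbc, him ψ⟩
  · right
    intro n x y z w h1 h2 h3 h4 h5 h6
    induction f with
    | _ a b =>
    induction g with
    | _ c d =>
    have hab : a ≠ b := hf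
    have hcd : c ≠ d := hg
    simp only [Sym2.mem_iff] at hcov hx
    push Not at hx
    have ha := hx a (Or.inl rfl)
    have hb := hx b (Or.inr rfl)
    obtain ⟨ψ, rfl, rfl, rfl, rfl⟩ : ∃ ψ : α ↪ Fin n, ψ a = x ∧ ψ b = y ∧ ψ c = z ∧ ψ d = w :=
      ⟨⟨fun u => if u = a then x else if u = b then y else if u = c then z else w, fun u v h => by
        have := hcov u; have := hcov v; grind⟩, if_pos rfl, by change ite _ _ _ = _; grind, by change ite _ _ _ = _; grind,
        by change ite _ _ _ = _; grind⟩
    exact mem_cps.2 ⟨ψ, him ψ⟩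

lemma two_vals {s : ES(n)} (h2 : (HE H).card = 2) (h : ¬ cT H s) :
    ∃ F, EvenOn H s F ∧ ∀ i, ∃ g ∈ s, F g = i := by
  unfold cT at h
  push Not at h
  obtain ⟨F, hF, h⟩ := h
  refine ⟨F, hF, fun i => ?_⟩
  obtain ⟨g, hg, hne⟩ := h (fun _ => 0) (i + 1) ⟨Or.inr fun _ => rfl, fun h => by
    rw [eCount_eq, h2] at h; exact absurd h (by decide)⟩
  have e : tf (fun _ : Fin n => (0 : ZMod 2)) (i + 1) g = i + 1 := by
    induction g with
    | _ x y => simp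
  rw [e] at hne
  exact ⟨g, hg, (z2_flip _ _).1 hne⟩

lemma pr_pat {ι : Type*} {E A B : Finset ι} (hA : A ⊆ E) (hB : B ⊆ E)
    (h : Disjoint A B) : pr E p (fun s => A ⊆ s ∧ Disjoint B s) = p ^ A.card * (1 - p) ^ B.card := by
  have h1 := ex_indep (p := p) hA (fun s => ind (Disjoint B s)) fun s => ind_congr (by
    simp only [Finset.disjoint_left, Finset.mem_sdiff] at h ⊢
    exact ⟨fun h1 x hx h2 => h1 hx h2.1, fun h1 x hx h2 => h1 hx ⟨h2, fun h3 => h h3 hx⟩⟩)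
  unfold pr
  simp only [ind_and]
  rw [h1]
  congr 1
  have h2 := ex_inter (p := p) hB fun s => (0:ℝ) ^ s.card
  rw [ex_pow_card, show 1 + p * (0 - 1) = 1 - p by ring] at h2
  rw [← h2]
  refine ex_congr fun s _ => ?_
  by_cases hd : Disjoint B s
  · rw [ind_true hd, inter_comm, disjoint_iff_inter_eq_empty.1 hd]; simp
  · rw [ind_false hd, zero_pow]
    rwa [disjoint_iff_inter_eq_empty, inter_comm, ← card_eq_zero] at hd

/-- The edges between `A` and `B`. -/
def bip (A B : Finset (Fin n)) : ES(n) := (A ×ˢ B).image fun q => s(q.1, q.2)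

lemma mem_bip {A B : Finset (Fin n)} {g : E2(n)} : g ∈ bip A B ↔ ∃ x ∈ A, ∃ y ∈ B, s(x, y) = g := by
  simp [bip, and_assoc]

lemma bip_card {A B : Finset (Fin n)} (h : Disjoint A B) : (bip A B).card = A.card * B.card := by
  unfold bip
  rw [card_image_of_injOn, card_product]
  rintro ⟨a, b⟩ h1 ⟨c, d⟩ h2 h3
  simp only [coe_product, Set.mem_prod, mem_coe, Sym2.eq_iff, Prod.mk.injEq] at *
  rcases h3 with h3 | h3
  · exact h3
  · exact absurd (h3.1 ▸ h1.1) fun h4 => Finset.disjoint_left.1 h h4 h2.2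

lemma bip_EE {A B : Finset (Fin n)} (h : Disjoint A B) : bip A B ⊆ EE n := fun g hg => by
  obtain ⟨x, hx, y, hy, rfl⟩ := mem_bip.1 hg
  exact mem_EE_mk.2 fun e => Finset.disjoint_left.1 h hx (e ▸ hy)

lemma one_sub_pow_le (hp1 : p ≤ 1) (N : ℕ) : (1 - p) ^ N ≤ exp (-(p * N)) := by
  refine (pow_le_pow_left₀ (by linarith) (Real.one_sub_le_exp_neg p) N).trans (le_of_eq ?_)
  rw [← exp_nat_mul]; congr 1; ring

lemma match_all (h2 : (HE H).card = 2) (hM : IsM H) {ζ : ℝ} (hζ : 0 < ζ) :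
    ∀ᶠ n : ℕ in atTop, ∀ p, 0 ≤ p → p ≤ 1 → pr (EE n) p (fun s => cQ H s ∧ ¬ cT H s) ≤ ζ := by
  filter_upwards [eventually_ge_atTop 20, tendsto_natCast_atTop_atTop.eventually_ge_atTop (1250 / ζ)] with n hn hz p hp hp1
  have hn0 : (20:ℝ) ≤ n := by exact_mod_cast hn
  refine (pr_mono hp hp1 (Q := fun s => ∃ q ∈ (univ : Finset (Fin n × Fin n × Fin n)),
    s(q.1, q.2.1) ∈ s ∧ s(q.1, q.2.2) ∈ s ∧ q.2.1 ≠ q.2.2 ∧ ∀ g ∈ s, q.1 ∈ g ∨ q.2.1 ∈ g ∨ q.2.2 ∈ g) fun s hs h => ?_).trans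
    ((pr_exists hp hp1 _ _).trans ((sum_le_card_nsmul _ _ (1250 / (n:ℝ) ^ 4) fun q _ => ?_).trans ?_))
  · obtain ⟨F, hF, hv⟩ := two_vals h2 h.2
    have key : ∀ x y z w, s(x, y) ∈ s → s(z, w) ∈ s → F s(x, y) ≠ F s(z, w) → x = z ∨ x = w ∨ y = z ∨ y = w := by
      intro x y z w h1 h2 hne
      by_contra hc
      push Not at hc
      have hd := sum_pair (f := F) (a := s(x, y)) (b := s(z, w)) fun e => hne (by rw [e])
      rw [hF _ (hM n x y z w (mem_EE_mk.1 (hs h1)) hc.1 hc.2.1 hc.2.2.1 hc.2.2.2 (mem_EE_mk.1 (hs h2)))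
        (by simp [insert_subset_iff, h1, h2])] at hd
      rw [z2_ne, if_pos hne] at hd
      exact absurd hd (by decide)
    obtain ⟨g, hg, hg0⟩ := hv 0
    obtain ⟨k, hk, hk1⟩ := hv 1
    have key2 : ∀ x y z, s(x, y) ∈ s → s(x, z) ∈ s → F s(x, y) ≠ F s(x, z) → ∃ q ∈ (univ : Finset (Fin n × Fin n × Fin n)),
        s(q.1, q.2.1) ∈ s ∧ s(q.1, q.2.2) ∈ s ∧ q.2.1 ≠ q.2.2 ∧ ∀ g ∈ s, q.1 ∈ g ∨ q.2.1 ∈ g ∨ q.2.2 ∈ g := by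
      intro x y z h1 h2 hne
      refine ⟨(x, y, z), mem_univ _, h1, h2, fun e => hne (by simp only at e; rw [e]), fun g hg => ?_⟩
      induction g with
      | _ u v =>
        simp only [Sym2.mem_iff]
        by_cases h3 : F s(x, y) = F s(u, v)
        · have := key x z u v h2 hg (by rw [← h3]; exact hne.symm); tauto
        · have := key x y u v h1 hg h3; tauto
    induction g with
    | _ x y =>
    induction k with
    | _ z w =>
    have hne : F s(x, y) ≠ F s(z, w) := by rw [hg0, hk1]; decide
    rcases key x y z w hg hk hne with rfl | rfl | rfl | rfl
    · exact key2 _ _ _ hg hk hne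
    · rw [Sym2.eq_swap (a := z)] at hk hne; exact key2 _ _ _ hg hk hne
    · rw [Sym2.eq_swap (a := x)] at hg hne; exact key2 _ _ _ hg hk hne
    · rw [Sym2.eq_swap (a := z)] at hk hne; rw [Sym2.eq_swap (a := x)] at hg hne; exact key2 _ _ _ hg hk hne
  · obtain ⟨x, y, z⟩ := q
    by_cases hq : x ≠ y ∧ x ≠ z ∧ y ≠ z
    swap
    · unfold pr
      rw [ex_congr (g := fun _ => 0) fun s hs => ind_false fun h => hq
        ⟨mem_EE_mk.1 (hs h.1), mem_EE_mk.1 (hs h.2.1), h.2.2.1⟩, ex_const]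
      positivity
    have hS : ({x, y, z} : Finset (Fin n)).card ≤ 3 := card_le_three
    obtain ⟨A, hA, hAc⟩ := exists_subset_card_eq (s := ({x, y, z} : Finset (Fin n))ᶜ) (n := n / 3) (by
      rw [card_compl, Fintype.card_fin]; omega)
    obtain ⟨B, hB, hBc⟩ := exists_subset_card_eq (s := ({x, y, z} : Finset (Fin n))ᶜ \ A) (n := n / 3) (by
      rw [card_sdiff_of_subset hA, card_compl, Fintype.card_fin]; omega)
    have hAB : Disjoint A B := Finset.disjoint_left.2 fun u h1 h2 => (Finset.mem_sdiff.1 (hB h2)).2 h1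
    have hav : ∀ g ∈ bip A B, ¬ (x ∈ g ∨ y ∈ g ∨ z ∈ g) := fun g hg => by
      obtain ⟨u, hu, v, hv, rfl⟩ := mem_bip.1 hg
      have h1 := hA hu
      have h2 := (Finset.mem_sdiff.1 (hB hv)).1
      simp only [mem_compl, mem_insert, mem_singleton, Sym2.mem_iff] at h1 h2 ⊢
      grind
    refine (pr_mono hp hp1 (Q := fun s => {s(x, y), s(x, z)} ⊆ s ∧ Disjoint (bip A B) s) fun s _ h => ⟨?_, ?_⟩).trans ?_
    · simp [insert_subset_iff, h.1, h.2.1]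
    · exact Finset.disjoint_left.2 fun g h1 h2 => hav g h1 (h.2.2.2 g h2)
    rw [pr_pat (by simp [insert_subset_iff, mem_EE_mk, hq.1, hq.2.1]) (bip_EE hAB)
      (Finset.disjoint_left.2 fun g h1 h2 => hav g h2 (by simp at h1; rcases h1 with rfl | rfl <;> simp)),
      card_pair (by rw [Ne, Sym2.congr_right]; exact hq.2.2), bip_card hAB, hAc, hBc]
    obtain ⟨N, hN⟩ : ∃ N : ℕ, N = n / 3 * (n / 3) := ⟨_, rfl⟩
    have hN1 : (n:ℝ) ^ 2 / 25 ≤ N := by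
      have h1 : n ≤ 5 * (n / 3) := by omega
      have h2 : (n:ℝ) ≤ 5 * ((n / 3 : ℕ) : ℝ) := by exact_mod_cast h1
      rw [hN]; push_cast at h2 ⊢; nlinarith
    rw [← hN, le_div_iff₀ (by positivity)]
    have h4 : (p * N) ^ 2 / 2 ≤ exp (p * N) := by
      have := Real.pow_div_factorial_le_exp (p * N) (by positivity) 2; simpa using this
    have h5 := one_sub_pow_le hp1 N
    have h6 : (p * N) ^ 2 * (1 - p) ^ N ≤ 2 := by
      calc _ ≤ (2 * exp (p * N)) * exp (-(p * N)) := by gcongr; linarith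
        _ = 2 := by rw [mul_assoc, ← exp_add]; simp
    have h7 : (n:ℝ) ^ 4 ≤ 625 * (N:ℝ) ^ 2 := by
      have := pow_le_pow_left₀ (by positivity) hN1 2; nlinarith
    have h8 : 0 ≤ p ^ 2 * (1 - p) ^ N := mul_nonneg (sq_nonneg p) (pow_nonneg (by linarith) _)
    nlinarith [mul_le_mul_of_nonneg_left h7 h8]
  · rw [nsmul_eq_mul, card_univ, Fintype.card_prod, Fintype.card_prod, Fintype.card_fin]
    push_cast
    rw [div_le_iff₀ hζ] at hz
    rw [mul_div_assoc', div_le_iff₀ (by positivity)]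
    nlinarith [mul_le_mul_of_nonneg_left hz (by positivity : 0 ≤ (n:ℝ) ^ 3)]
/-! ### The two-edge path -/
/-- `S` is a union of components. -/
def Clo (s : ES(n)) (S : Finset (Fin n)) : Prop := ∀ x y, s(x, y) ∈ s → x ∈ S → y ∈ S

lemma path_comp {s : ES(n)} (hs : s ⊆ EE n) (h2 : (HE H).card = 2) (hP : IsP H) (hQ : cQ H s)
    (hT : ¬ cT H s) : ∃ S : Finset (Fin n), 3 ≤ S.card ∧ 2 * S.card ≤ n ∧ Disjoint (bip S Sᶜ) s ∧
      ∃ J ⊆ s, J ⊆ S.sym2 ∧ J.card + 1 = S.card := by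
  obtain ⟨F, hF, hv⟩ := two_vals h2 hT
  have key : ∀ x y z, s(x, y) ∈ s → s(x, z) ∈ s → F s(x, y) = F s(x, z) := by
    intro x y z h1 h3
    by_contra hne
    have hyz : y ≠ z := fun e => hne (by rw [e])
    have hd := sum_pair (f := F) (a := s(x, y)) (b := s(x, z)) fun e => hne (by rw [e])
    rw [hF _ ((hP.2 n).1 x y z (mem_EE_mk.1 (hs h1)) (mem_EE_mk.1 (hs h3)) hyz)
      (by simp [insert_subset_iff, h1, h3]), z2_ne, if_pos hne] at hd
    exact absurd hd (by decide)
  obtain ⟨U, hU⟩ : ∃ U : ZMod 2 → Finset (Fin n), ∀ i x, x ∈ U i ↔ ∃ y, s(x, y) ∈ s ∧ F s(x, y) = i :=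
    ⟨fun i => univ.filter fun x => ∃ y, s(x, y) ∈ s ∧ F s(x, y) = i, fun i x => by simp⟩
  obtain ⟨i, hi⟩ : ∃ i, 2 * (U i).card ≤ n := by
    by_contra hc
    push Not at hc
    have hd : Disjoint (U 0) (U 1) := Finset.disjoint_left.2 fun x h0 h1 => by
      obtain ⟨y, hy, e0⟩ := (hU _ _).1 h0
      obtain ⟨z, hz, e1⟩ := (hU _ _).1 h1
      have := key x y z hy hz
      rw [e0, e1] at this; exact absurd this (by decide)
    have := card_le_univ (U 0 ∪ U 1)
    rw [card_union_of_disjoint hd, Fintype.card_fin] at this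
    have := hc 0; have := hc 1; omega
  have hUc : (U i).Nonempty ∧ Clo s (U i) := by
    constructor
    · obtain ⟨g, hg, e⟩ := hv i
      induction g with
      | _ x y => exact ⟨x, (hU _ _).2 ⟨y, hg, e⟩⟩
    · intro x y hxy hx
      obtain ⟨z, hz, e⟩ := (hU _ _).1 hx
      refine (hU _ _).2 ⟨x, by rwa [Sym2.eq_swap], ?_⟩
      rw [Sym2.eq_swap, key x y z hxy hz, e]
  obtain ⟨S, hS, hmin⟩ := exists_min_image ((U i).powerset.filter fun S => S.Nonempty ∧ Clo s S) card
    ⟨U i, by simpa using hUc⟩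
  simp only [mem_filter, mem_powerset] at hS hmin
  obtain ⟨hSU, ⟨x0, hx0⟩, hcl⟩ := hS
  have hcl' : ∀ x y, s(x, y) ∈ s → y ∈ S → x ∈ S := fun x y h hy => hcl y x (by rwa [Sym2.eq_swap]) hy
  have h3 : 3 ≤ S.card := by
    obtain ⟨y, hy, -⟩ := (hU _ _).1 (hSU hx0)
    obtain ⟨K, hK, hgK, hKs⟩ := hQ _ hy
    obtain ⟨u, v, w, huv, huw, hvw, rfl⟩ := (hP.2 n).2 K hK
    have e1 : s(u, v) ∈ s := hKs (by simp)
    have e2 : s(u, w) ∈ s := hKs (by simp)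
    have hu : u ∈ S := by
      simp only [mem_insert, mem_singleton, Sym2.eq_iff] at hgK
      rcases hgK with (⟨rfl, -⟩ | ⟨rfl, -⟩) | (⟨rfl, -⟩ | ⟨rfl, -⟩)
      exacts [hx0, hcl' _ _ e1 hx0, hx0, hcl' _ _ e2 hx0]
    rw [← card_eq_three.2 ⟨u, v, w, huv, huw, hvw, rfl⟩]
    refine card_le_card ?_
    simp [insert_subset_iff, hu, hcl _ _ e1 hu, hcl _ _ e2 hu]
  refine ⟨S, h3, by have := card_le_card hSU; omega, Finset.disjoint_left.2 fun g hg hgs => ?_, ?_⟩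
  · obtain ⟨x, hx, y, hy, rfl⟩ := mem_bip.1 hg
    exact mem_compl.1 hy (hcl x y hgs hx)
  have grow : ∀ m : ℕ, m + 1 ≤ S.card → ∃ T ⊆ S, T.card = m + 1 ∧ ∃ J ⊆ s, J ⊆ T.sym2 ∧ J.card = m := by
    intro m
    induction m with
    | zero => exact fun _ => ⟨{x0}, by simpa using hx0, by simp, ∅, by simp, by simp, by simp⟩
    | succ m ih =>
      intro hm
      obtain ⟨T, hTS, hTc, J, hJ, hJT, hJc⟩ := ih (by omega)
      have hnc : ¬ Clo s T := fun h => by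
        have := hmin T ⟨hTS.trans hSU, card_pos.1 (by omega), h⟩; omega
      unfold Clo at hnc
      push Not at hnc
      obtain ⟨x, y, hxy, hx, hy⟩ := hnc
      refine ⟨insert y T, insert_subset (hcl x y hxy (hTS hx)) hTS, by rw [card_insert_of_notMem hy, hTc],
        insert s(x, y) J, insert_subset hxy hJ, insert_subset ?_ ?_, ?_⟩
      · simp [mk_mem_sym2_iff, hx]
      · exact hJT.trans (sym2_mono (subset_insert _ _))
      · rw [card_insert_of_notMem fun h => hy (mk_mem_sym2_iff.1 (hJT h)).2, hJc]
  obtain ⟨T, hTS, hTc, J, hJ, hJT, hJc⟩ := grow (S.card - 1) (by omega)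
  exact ⟨J, hJ, hJT.trans (sym2_mono hTS), by omega⟩

lemma path_term {k : ℕ} (hk : 3 ≤ k) (hkn : 2 * k ≤ n) (hp : 0 ≤ p) (hp1 : p ≤ 1) :
    (n.choose k : ℝ) * (((k + 1).choose 2).choose (k - 1) * (p ^ (k - 1) * (1 - p) ^ (k * (n - k)))) ≤
      n * (10 * exp 2 * exp (n * p / 10 - p * (n - k))) ^ k := by
  have hk0 : (3:ℝ) ≤ k := by exact_mod_cast hk
  have f1 : (n.choose k : ℝ) ≤ n ^ k / k.factorial := Nat.choose_le_pow_div _ _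
  have f2 : (((k + 1).choose 2).choose (k - 1) : ℝ) ≤ ((k:ℝ) ^ 2) ^ (k - 1) / (k - 1).factorial := by
    refine (Nat.choose_le_pow_div _ _).trans ?_
    gcongr
    rw [Nat.cast_choose_two]; push_cast; nlinarith
  have f3 := Real.pow_div_factorial_le_exp (k:ℝ) (by positivity) k
  have f4 := Real.pow_div_factorial_le_exp (k:ℝ) (by positivity) (k - 1)
  have f5 : (k:ℝ) ^ (k - 1) / k.factorial ≤ exp k :=
    le_trans (by gcongr <;> first | linarith | omega) f3
  have f6 := one_sub_pow_le hp1 (k * (n - k))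
  have f7 : (n * p) ^ (k - 1) ≤ (10 * exp (n * p / 10)) ^ k := by
    have e1 := add_one_le_exp (n * p / 10)
    have e0 : 0 ≤ n * p := by positivity
    have e2 : 1 ≤ 10 * exp (n * p / 10) := by linarith
    calc _ ≤ (10 * exp (n * p / 10)) ^ (k - 1) := pow_le_pow_left₀ e0 (by linarith) _
      _ ≤ _ := pow_le_pow_right₀ e2 (by omega)
  have hnk : ((n - k : ℕ) : ℝ) = n - k := Nat.cast_sub (by omega)
  have q0 : 0 ≤ (1 - p) ^ (k * (n - k)) := pow_nonneg (by linarith) _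
  calc _ ≤ n ^ k / k.factorial * (((k:ℝ) ^ 2) ^ (k - 1) / (k - 1).factorial *
        (p ^ (k - 1) * exp (-(p * (k * (n - k) : ℕ))))) := by gcongr
    _ = n * ((k:ℝ) ^ (k - 1) / k.factorial) * ((k:ℝ) ^ (k - 1) / (k - 1).factorial) * (n * p) ^ (k - 1) *
        exp (-(p * (k * (n - k) : ℕ))) := by
      rw [mul_pow, ← pow_mul, two_mul, pow_add,
        show (n:ℝ) ^ k = n * n ^ (k - 1) by rw [← pow_succ', Nat.sub_add_cancel (by omega)]]
      ring
    _ ≤ n * exp k * exp k * (10 * exp (n * p / 10)) ^ k * exp (-(p * (k * (n - k) : ℕ))) := by gcongr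
    _ = _ := by
      push_cast
      rw [hnk, mul_pow, mul_pow, mul_pow, ← exp_nat_mul, ← exp_nat_mul, ← exp_nat_mul]
      rw [show (k:ℝ) * (n * p / 10 - p * (n - k)) = k * (n * p / 10) + -(p * (k * (n - k))) by ring, exp_add,
        show (k:ℝ) * 2 = k + k by ring, exp_add]
      ring

lemma path_high (h2 : (HE H).card = 2) (hP : IsP H) {ζ : ℝ} (hζ : 0 < ζ) :
    ∀ᶠ n : ℕ in atTop, ∀ p, 0 ≤ p → p ≤ 1 → 9 / 20 * log n ≤ n * p →
      pr (EE n) p (fun s => cQ H s ∧ ¬ cT H s) ≤ ζ := by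
  obtain ⟨D, hD⟩ : ∃ D : ℝ, D = 10 * exp 2 := ⟨_, rfl⟩
  have hD0 : 0 < D := by rw [hD]; positivity
  obtain ⟨ξ, hξ, hξ1, hξζ⟩ : ∃ ξ : ℝ, 0 < ξ ∧ ξ ≤ 1 ∧ 20 * ξ ≤ ζ :=
    ⟨min 1 (ζ / 20), by positivity, min_le_left _ _, by have := min_le_right 1 (ζ / 20); linarith⟩
  have lim : ∀ {a b : ℝ}, 0 < b → ∀ᶠ n : ℕ in atTop, a * exp (-(b * log n)) ≤ ξ := fun {a b} hb => by
    have := ((Real.tendsto_exp_neg_atTop_nhds_zero.comp ((tendsto_log_atTop.comp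
      tendsto_natCast_atTop_atTop).const_mul_atTop hb))).const_mul a
    rw [mul_zero] at this
    exact this.eventually (eventually_le_nhds hξ)
  filter_upwards [lim (a := D ^ 3) (b := 1 / 5) (by norm_num), lim (a := D ^ 18) (b := 1) (by norm_num),
    eventually_ge_atTop 2000] with n l1 l2 hn p hp hp1 ht
  have hn0 : (2000:ℝ) ≤ n := by exact_mod_cast hn
  have hlog : 0 ≤ log n := log_nonneg (by linarith)
  have hen : exp (log n) = n := exp_log (by linarith)
  have pw : ∀ {y b : ℝ} {j k : ℕ}, 1 ≤ b → j ≤ k → 0 < j → 0 ≤ y → b * y ^ j ≤ ξ → b * y ^ k ≤ ξ := by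
    intro y b j k hb hjk hj hy h
    have h1 : y ^ j ≤ 1 := by nlinarith [pow_nonneg hy j]
    have h4 : y ≤ 1 := (pow_le_one_iff_of_nonneg hy (by omega)).1 h1
    exact le_trans (mul_le_mul_of_nonneg_left (pow_le_pow_of_le_one hy h4 hjk) (by linarith)) h
  obtain ⟨B, hB⟩ : ∃ B : ℕ → ℝ, ∀ k, B k = if k ≤ 18 then ξ else ξ / n := ⟨_, fun _ => rfl⟩
  have tb : ∀ k, 3 ≤ k → 2 * k ≤ n → n * (D * exp (n * p / 10 - p * (n - k))) ^ k ≤ B k := by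
    intro k hk hkn
    have hkn' : (2 * k : ℝ) ≤ n := by exact_mod_cast hkn
    rw [hB]
    split_ifs with h18
    · have h18' : (k:ℝ) ≤ 18 := by exact_mod_cast h18
      refine pw (by linarith) hk (by norm_num) (by positivity) (le_trans ?_ l1)
      rw [mul_pow, ← exp_nat_mul, mul_left_comm]
      gcongr
      nth_rw 1 [← hen]
      rw [← exp_add, exp_le_exp]
      push_cast
      nlinarith [mul_le_mul_of_nonneg_left h18' hp, mul_le_mul_of_nonneg_left hn0 hp]
    · rw [le_div_iff₀ (by linarith), mul_right_comm]
      refine pw (by nlinarith) (by omega : 18 ≤ k) (by norm_num) (by positivity) (le_trans ?_ l2)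
      rw [mul_pow, ← exp_nat_mul, mul_left_comm]
      gcongr
      nth_rw 1 2 [← hen]
      rw [← exp_add, ← exp_add, exp_le_exp]
      push_cast
      nlinarith [mul_le_mul_of_nonneg_left hkn' hp]
  refine (pr_mono hp hp1 (Q := fun s => ∃ k ∈ Finset.Icc 3 (n / 2), ∃ S ∈ powersetCard k (univ : Finset (Fin n)),
    ∃ J ∈ powersetCard (k - 1) (S.sym2 ∩ EE n), J ⊆ s ∧ Disjoint (bip S Sᶜ) s) fun s hs h => ?_).trans
    ((pr_exists hp hp1 _ _).trans ((sum_le_sum (g := B) fun k hk => ?_).trans ?_))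
  · obtain ⟨S, a1, a2, a3, J, a4, a5, a6⟩ := path_comp hs h2 hP h.1 h.2
    exact ⟨S.card, mem_Icc.2 ⟨a1, by omega⟩, S, by simp, J, mem_powersetCard.2
      ⟨subset_inter a5 (a4.trans hs), by omega⟩, a4, a3⟩
  · obtain ⟨k3, kn⟩ := mem_Icc.1 hk
    have q0 : 0 ≤ p ^ (k - 1) * (1 - p) ^ (k * (n - k)) := mul_nonneg (pow_nonneg hp _) (pow_nonneg (by linarith) _)
    refine (pr_exists hp hp1 _ _).trans ((sum_le_card_nsmul _ _
      (((k + 1).choose 2).choose (k - 1) * (p ^ (k - 1) * (1 - p) ^ (k * (n - k)))) fun S hS => ?_).trans ?_)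
    · obtain ⟨-, hSc⟩ := mem_powersetCard.1 hS
      refine (pr_exists hp hp1 _ _).trans ((sum_le_card_nsmul _ _ (p ^ (k - 1) * (1 - p) ^ (k * (n - k)))
        fun J hJ => le_of_eq ?_).trans ?_)
      · obtain ⟨hJS, hJc⟩ := mem_powersetCard.1 hJ
        rw [pr_pat (hJS.trans inter_subset_right) (bip_EE disjoint_compl_right), bip_card disjoint_compl_right, hJc,
          card_compl, hSc, Fintype.card_fin]
        refine Finset.disjoint_left.2 fun g h3 h4 => ?_
        obtain ⟨x, hx, y, hy, rfl⟩ := mem_bip.1 h4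
        exact mem_compl.1 hy (mk_mem_sym2_iff.1 (mem_inter.1 (hJS h3)).1).2
      · rw [nsmul_eq_mul, card_powersetCard]
        refine mul_le_mul_of_nonneg_right ?_ q0
        have := card_le_card (inter_subset_left (s₁ := S.sym2) (s₂ := EE n))
        rw [card_sym2, hSc] at this
        exact_mod_cast Nat.choose_le_choose _ this
    · rw [nsmul_eq_mul, card_powersetCard, card_univ, Fintype.card_fin]
      exact (path_term k3 (by omega) hp hp1).trans (by rw [← hD]; exact tb k k3 (by omega))
  · calc ∑ k ∈ Finset.Icc 3 (n / 2), B k ≤ ∑ k ∈ range n, ((if k ∈ range 19 then ξ else 0) + ξ / n) := by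
          refine (sum_le_sum fun k _ => ?_).trans (sum_le_sum_of_subset_of_nonneg (fun k hk => ?_) fun k _ _ => ?_)
          · rw [hB]
            have : 0 ≤ ξ / n := by positivity
            by_cases h : k ≤ 18
            · rw [if_pos h, if_pos (by simp; omega)]; linarith
            · rw [if_neg h]; split_ifs <;> linarith
          · have := mem_Icc.1 hk; simp; omega
          · have : 0 ≤ ξ / n := by positivity
            split_ifs <;> linarith
      _ = 19 * ξ + ξ := by
          rw [sum_add_distrib, sum_ite_mem, inter_eq_right.2 (by
            intro k; simp; omega), sum_const, sum_const, card_range, card_range,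
            nsmul_eq_mul, nsmul_eq_mul, mul_div_cancel₀ _ (by linarith)]
          norm_num
      _ ≤ ζ := by linarith
/-! ### Sparse paths and the conclusion -/
set_option maxHeartbeats 1000000 in
lemma path_low (hH : Strictly2Balanced H) (h2 : (HE H).card = 2) (hP : IsP H) {ζ : ℝ} (hζ : 0 < ζ) :
    ∀ᶠ n : ℕ in atTop, ∀ p, 0 ≤ p → p ≤ 1 → n * p ≤ 9 / 20 * log n →
      pr (EE n) p (fun s => cQ H s ∧ ¬ cT H s) ≤ ζ := by
  obtain ⟨δ, hδ, hδ1, hδ2⟩ : ∃ δ : ℝ, 0 < δ ∧ δ ≤ 1 ∧ exp δ = 1 + min (ζ / 2) 1 := by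
    have h0 : 0 < min (ζ / 2) 1 := by positivity
    refine ⟨log (1 + min (ζ / 2) 1), log_pos (by linarith), ?_, exp_log (by linarith)⟩
    have := Real.log_le_sub_one_of_pos (by linarith : 0 < 1 + min (ζ / 2) 1)
    linarith [min_le_right (ζ / 2) 1]
  have hlogt : Tendsto (fun n : ℕ => log n) atTop atTop := tendsto_log_atTop.comp tendsto_natCast_atTop_atTop
  filter_upwards [hlogt.eventually_ge_atTop (2 / ζ * 4 * exp 3),
    (Real.tendsto_exp_atTop.comp (hlogt.atTop_div_const (by norm_num : (0:ℝ) < 10))).eventually_ge_atTop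
      (2 / ζ * 4 * exp 1), log_pow_le (1 / ζ) 2, log_pow_le (16 / δ) 2, eventually_ge_atTop 8]
    with n k1 k2 k3 k4 hn p hp hp1 ht
  have hn0 : (8:ℝ) ≤ n := by exact_mod_cast hn
  have hl1 : 1 ≤ log n := by
    rw [Real.le_log_iff_exp_le (by linarith)]; linarith [exp_one_lt_d9]
  by_cases hc : (n:ℝ) ^ 2 * p ≤ log n
  · refine (bad_copy hp hp1).trans ?_
    have e0 : ((cps H n).card : ℝ) ≤ n ^ 1 * n ^ 2 := (cps_count hH n).trans (by
      gcongr
      · linarith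
      · have := hP.1; omega)
    rw [h2]
    rw [one_div, inv_mul_le_iff₀ hζ] at k3
    have e1 := (pow_le_pow_left₀ (by positivity) hc 2).trans k3
    have e2 : (n:ℝ) * ((cps H n).card * p ^ 2) ≤ n * ζ := by
      calc _ ≤ (n:ℝ) * (n ^ 1 * n ^ 2 * p ^ 2) := by gcongr
        _ = (n ^ 2 * p) ^ 2 := by ring
        _ ≤ _ := by linarith
    exact le_of_mul_le_mul_left e2 (by linarith)
  push Not at hc
  have hp0 : 0 < p := by
    rcases hp.lt_or_eq with h | h
    · exact h
    · rw [← h, mul_zero] at hc; linarith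
  have kδ : 16 * log n ^ 2 ≤ n * δ := by
    rw [div_mul_eq_mul_div, div_le_iff₀ hδ] at k4; exact k4
  have hpl : p * (16 * log n) ≤ δ := by
    have : n * (p * (16 * log n)) ≤ n * δ := by nlinarith
    exact le_of_mul_le_mul_left this (by linarith)
  have hpδ : 16 * p ≤ δ := by nlinarith
  have hq1 : exp (-(p + 2 * p ^ 2)) ≤ 1 - p := one_sub_ge (by linarith)
  have h1p : 0 < 1 - p := (exp_pos _).trans_le hq1
  obtain ⟨m, hm⟩ : ∃ m : ℝ, m = p * (1 - p) ^ (2 * (n - 2)) := ⟨_, rfl⟩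
  have hm0 : 0 < m := by rw [hm]; positivity
  have hnk : ((n - 2 : ℕ) : ℝ) = n - 2 := Nat.cast_sub (by omega)
  have hme : p * exp (-(2 * (n * p)) - 1) ≤ m := by
    rw [hm]
    refine mul_le_mul_of_nonneg_left (le_trans ?_ (pow_le_pow_left₀ (exp_pos _).le hq1 _)) hp
    rw [← exp_nat_mul, exp_le_exp]
    push_cast
    rw [hnk]
    nlinarith [mul_nonneg hp hp]
  obtain ⟨Y, hY⟩ : ∃ Y : E2(n) → ES(n) → Prop,
      ∀ x y s, Y s(x, y) s ↔ {s(x, y)} ⊆ s ∧ Disjoint (bip {x, y} {x, y}ᶜ) s :=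
    ⟨fun g s => {g} ⊆ s ∧ Disjoint (bip g.toFinset g.toFinsetᶜ) s, fun x y s => by simp only [Sym2.toFinset_mk_eq]⟩
  have hEE := EE_card_ge (n := n) (by omega)
  have hne : (EE n).Nonempty := card_pos.1 (by
    have : (0:ℝ) < (EE n).card := lt_of_lt_of_le (by positivity) hEE
    exact_mod_cast this)
  have hA1 : ∀ g ∈ EE n, m ≤ pr (EE n) p (Y g) := by
    intro g hg
    induction g with
    | _ x y =>
    have hxy := mem_EE_mk.1 hg
    rw [show Y s(x, y) = fun s => {s(x, y)} ⊆ s ∧ Disjoint (bip {x, y} {x, y}ᶜ) s from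
      funext fun s => propext (hY x y s)]
    rw [pr_pat (by simpa using hg) (bip_EE disjoint_compl_right), bip_card disjoint_compl_right, card_compl,
      card_pair hxy, Fintype.card_fin, card_singleton, pow_one, hm]
    rw [disjoint_singleton_left, mem_bip]
    rintro ⟨a, ha, b, hb, e⟩
    simp only [mem_insert, mem_singleton, mem_compl, Sym2.eq_iff] at *
    grind
  have hA2 : ∀ g ∈ EE n, ∀ k ∈ EE n, g ≠ k →
      pr (EE n) p (fun s => Y g s ∧ Y k s) ≤ p ^ 2 * (1 - p) ^ (4 * (n - 4)) := by
    intro g hg k hk hgk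
    induction g with
    | _ x y =>
    induction k with
    | _ z w =>
    have hxy := mem_EE_mk.1 hg
    have hzw := mem_EE_mk.1 hk
    simp only [hY]
    by_cases hd : x = z ∨ x = w ∨ y = z ∨ y = w
    · unfold pr
      suffices hns : ∀ s : ES(n), ¬ (({s(x, y)} ⊆ s ∧ Disjoint (bip {x, y} {x, y}ᶜ) s) ∧
          {s(z, w)} ⊆ s ∧ Disjoint (bip {z, w} {z, w}ᶜ) s) by
        rw [ex_congr (g := fun _ => 0) fun s _ => ind_false (hns s), ex_const]
        positivity
      rintro s ⟨⟨h3, h4⟩, h5, h6⟩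
      have nb : ∀ a b, a ∈ ({x, y} : Finset (Fin n)) → b ∉ ({x, y} : Finset (Fin n)) → s(a, b) ∉ s := fun a b ha hb h =>
        Finset.disjoint_left.1 h4 (mem_bip.2 ⟨a, ha, b, mem_compl.2 hb, rfl⟩) h
      rw [singleton_subset_iff] at h5
      have n1 := nb z w
      have n2 := nb w z
      rw [Sym2.eq_swap] at n2
      simp only [mem_insert, mem_singleton, ne_eq, Sym2.eq_iff] at n1 n2 hgk
      grind
    · push Not at hd
      have hcS : ({x, y, z, w} : Finset (Fin n)).card = 4 := by
        rw [card_insert_of_notMem, card_insert_of_notMem, card_pair hzw] <;> simp <;> tauto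
      refine (pr_mono hp hp1 (Q := fun s => {s(x, y), s(z, w)} ⊆ s ∧ Disjoint (bip {x, y, z, w} {x, y, z, w}ᶜ) s)
        fun s _ h => ⟨?_, ?_⟩).trans (le_of_eq ?_)
      · exact insert_subset (h.1.1 (by simp)) h.2.1
      · refine Finset.disjoint_left.2 fun g h3 h4 => ?_
        obtain ⟨a, ha, b, hb, rfl⟩ := mem_bip.1 h3
        simp only [mem_insert, mem_singleton, mem_compl, not_or] at ha hb
        rcases ha with ha | ha | ha | ha
        · exact Finset.disjoint_left.1 h.1.2 (mem_bip.2 ⟨a, by simp [ha], b, by simp [hb], rfl⟩) h4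
        · exact Finset.disjoint_left.1 h.1.2 (mem_bip.2 ⟨a, by simp [ha], b, by simp [hb], rfl⟩) h4
        · exact Finset.disjoint_left.1 h.2.2 (mem_bip.2 ⟨a, by simp [ha], b, by simp [hb], rfl⟩) h4
        · exact Finset.disjoint_left.1 h.2.2 (mem_bip.2 ⟨a, by simp [ha], b, by simp [hb], rfl⟩) h4
      · rw [pr_pat (by simp [insert_subset_iff, hg, hk]) (bip_EE disjoint_compl_right),
          bip_card disjoint_compl_right, card_compl, hcS, Fintype.card_fin, card_pair hgk]
        refine Finset.disjoint_left.2 fun g h3 h4 => ?_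
        obtain ⟨a, ha, b, hb, rfl⟩ := mem_bip.1 h4
        simp only [mem_insert, mem_singleton, mem_compl, Sym2.eq_iff] at h3 hb
        grind
  have hsm := second_moment hp hp1 (EE n) Y hne hm0 hA1 (by positivity) hA2
  refine (pr_mono hp hp1 fun s _ hs g hg hY' => ?_).trans (hsm.trans ?_)
  · induction g with
    | _ x y =>
    rw [hY, singleton_subset_iff] at hY'
    obtain ⟨K, hK, hgK, hKs⟩ := hs.1 _ hY'.1
    obtain ⟨u, v, w, huv, huw, hvw, rfl⟩ := (hP.2 n).2 K hK
    have e1 : s(u, v) ∈ s := hKs (by simp)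
    have e2 : s(u, w) ∈ s := hKs (by simp)
    have nb : ∀ a b, a ∈ ({x, y} : Finset (Fin n)) → b ∉ ({x, y} : Finset (Fin n)) → s(a, b) ∉ s := fun a b ha hb h =>
      Finset.disjoint_left.1 hY'.2 (mem_bip.2 ⟨a, ha, b, mem_compl.2 hb, rfl⟩) h
    simp only [mem_insert, mem_singleton, Sym2.eq_iff] at hgK nb
    have := nb u v
    have := nb u w
    grind
  · have hr : p ^ 2 * (1 - p) ^ (4 * (n - 4)) / m ^ 2 ≤ exp δ := by
      rw [div_le_iff₀ (by positivity), hm, mul_pow, ← pow_mul, show 2 * (n - 2) * 2 = 8 + 4 * (n - 4) by omega, pow_add]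
      have h8 : 1 ≤ exp δ * (1 - p) ^ 8 := by
        refine le_trans ?_ (mul_le_mul_of_nonneg_left (pow_le_pow_left₀ (exp_pos _).le hq1 8) (exp_pos _).le)
        rw [← exp_nat_mul, ← exp_add]
        refine Real.one_le_exp ?_
        push_cast; nlinarith
      have : 0 ≤ p ^ 2 * (1 - p) ^ (4 * (n - 4)) := by positivity
      nlinarith
    have hM : 2 / ζ ≤ (EE n).card * m := by
      refine le_trans ?_ (mul_le_mul hEE hme (by positivity) (by positivity))
      by_cases h1 : n * p ≤ 1
      · have e1 : exp (-3) ≤ exp (-(2 * (n * p)) - 1) := exp_le_exp.2 (by linarith)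
        have e2 : 2 / ζ * 4 ≤ (n:ℝ) ^ 2 * p * exp (-3) := by
          rw [exp_neg, ← div_eq_mul_inv, le_div_iff₀ (exp_pos _)]; linarith
        linarith [mul_le_mul_of_nonneg_left e1 (by positivity : 0 ≤ (n:ℝ) ^ 2 * p)]
      · push Not at h1
        have e1 : exp (-(9 / 10 * log n) - 1) ≤ exp (-(2 * (n * p)) - 1) := exp_le_exp.2 (by linarith)
        have e2 : 2 / ζ * 4 ≤ (n:ℝ) * exp (-(9 / 10 * log n) - 1) := by
          nth_rw 1 [← exp_log (by linarith : (0:ℝ) < n)]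
          rw [← exp_add, show log n + (-(9 / 10 * log n) - 1) = log n / 10 - 1 by ring, exp_sub,
            le_div_iff₀ (exp_pos _)]
          exact k2
        have e3 : (n:ℝ) ≤ n ^ 2 * p := by nlinarith
        have e4 := mul_le_mul e3 e1 (exp_pos _).le (by positivity)
        linarith
    have : 1 / ((EE n).card * m) ≤ ζ / 2 := by
      rw [one_div, ← inv_div]
      exact inv_anti₀ (by positivity) hM
    linarith [min_le_left (ζ / 2) 1]

lemma all_small (hH : Strictly2Balanced H) {ζ : ℝ} (hζ : 0 < ζ) :
    ∀ᶠ n : ℕ in atTop, ∀ p, 0 ≤ p → p ≤ 1 → pr (EE n) p (fun s => cQ H s ∧ ¬ cT H s) ≤ ζ := by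
  by_cases h3 : 3 ≤ (HE H).card
  · filter_upwards [rangeA hH h3 hζ, window hH h3 ζ hζ, rangeC hH h3 (window hH h3) hζ] with n h4 h5 h6 p hp hp1
    rcases le_total (LL H n p) (9 / 10 * ((2 - aH H) * log n)) with h | h
    · exact h4 p hp hp1 h
    · rcases le_total (LL H n p) (3 * log n) with h' | h'
      · exact h5 p hp hp1 h h'
      · exact h6 p hp hp1 h'
  · have h2 : (HE H).card = 2 := by have := sb_e2 hH; omega
    rcases two_cases hH h2 with h | h
    · filter_upwards [path_low hH h2 h hζ, path_high h2 h hζ] with n h4 h5 p hp hp1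
      exact (le_total _ _).elim (h4 p hp hp1) (h5 p hp hp1)
    · exact match_all h2 h hζ

end

theorem stmt2 {α : Type*} [Fintype α] (H : SimpleGraph α) (hH : Strictly2Balanced H)
    (p : ℕ → ℝ) (hp : ∀ n, p n ∈ Set.Icc (0 : ℝ) 1) :
    Filter.Tendsto (fun n => erProb n (p n) {G | memQ H G ∧ ¬ memT H G})
      Filter.atTop (nhds 0) := by
  rw [Metric.tendsto_nhds]
  intro ε hε
  filter_upwards [all_small hH (half_pos hε)] with n hn
  rw [Real.dist_0_eq_abs, abs_of_nonneg (erProb_nonneg (hp n).1 (hp n).2 _)]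
  linarith [(erProb_le (H := H) (hp n).1 (hp n).2).trans (hn (p n) (hp n).1 (hp n).2)]

end RG
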